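/- For any positive integer k there is a superalgebra homomorphism φ_k : BC^{aff}_{r,t} → BC_{2,r+k,t+k} sending ω_{2n+1} ↦ ξ_{2n+1,k+1}, ω̄_{2n+1} ↦ ξ̄_{2n+1,k+1} (and ω̄_{2n} ↦ 0), e_1 ↦ e_{k+1}, s_i ↦ s_{k+i}, s̄_j ↦ s̄_{k+j}, c_l ↦ c_{k+l}, c̄_m ↦ c̄_{k+m}, x_1 ↦ z_{k+1} and x̄_1 ↦ z̄_{k+1}, for all admissible i, j, l, m, n, where BC^{aff}_{r,t} is taken over ℂ with scalar parameter ω_1 = −2m(2p − 2m + 1). -/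

import Mathlib

open Polynomial

noncomputable section

/-- Transposition `(a b)` (0-based indices) in the symmetric group on `Fin n`;
it is `1` if an index is out of range. -/
def sw (n a b : ℕ) : Equiv.Perm (Fin n) :=
  if h : a < n ∧ b < n then Equiv.swap ⟨a, h.1⟩ ⟨b, h.2⟩ else 1

/-- The permutation word `s_{i,j}` of the paper (1-based indices):
`s_{i,j} = s_i s_{i+1,j}` for `i < j`, `s_{i,i} = 1`, `s_{i,j} = s_{i,j+1} s_j` for `i > j`. -/
def sIJ (n i j : ℕ) : Equiv.Perm (Fin n) :=
  if i < j then ((List.range' i (j - i)).map (fun k => sw n (k - 1) k)).prod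
  else ((List.range' j (i - j)).reverse.map (fun k => sw n (k - 1) k)).prod

/-- The coefficients `a_{2n+1,j}` of the paper: `acoef ω n j = a_{2n+1,j}`, defined by the
recursion `a_{1,0} = -1`, `a_{2n+1,j+1} = a_{2n-1,j}` and
`a_{2n+1,0} = ∑_{j=0}^{n-1} a_{2n-1,j} ω_{2j+1}`. -/
def acoef {A : Type} [Ring A] (ω : ℕ → A) : ℕ → ℕ → A
  | 0, _ => -1
  | n + 1, 0 => ∑ j ∈ Finset.range (n + 1), acoef ω n j * ω (2 * j + 1)
  | n + 1, j + 1 => acoef ω n j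

/-- The parameters `ω̄_k` determined by the parameters `ω` as in Corollary 3.5:
`ω̄_{2n} = 0` and `ω̄_{2n+1} = ∑_{j=0}^{n} a_{2n+1,j} ω_{2j+1}`. -/
def obar {R : Type} [CommRing R] (ω : ℕ → R) (k : ℕ) : R :=
  if k % 2 = 0 then 0
  else ∑ j ∈ Finset.range (k / 2 + 1), acoef ω (k / 2) j * ω (2 * j + 1)

/-- Data for the presentation of the walled Brauer–Clifford superalgebra `BC_{r,t}`
(Definition 2.1 together with relations (2.1)–(2.3)) on an `R`-algebra `A`.
The images of the two symmetric groups are recorded as monoid homomorphisms, so the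
symmetric group relations among the `s_i` (resp. `s̄_j`) hold automatically. -/
structure WBC (R A : Type) [CommRing R] [Ring A] [Algebra R A] (r t : ℕ) : Type where
  σ : Equiv.Perm (Fin r) →* A
  σb : Equiv.Perm (Fin t) →* A
  c : Fin r → A
  cb : Fin t → A
  e : A
  c_sq : ∀ i, c i * c i = -1
  c_anti : ∀ i j, i ≠ j → c i * c j = -(c j * c i)
  c_conj : ∀ w i, σ w * c i * σ (w⁻¹) = c (w i)
  cb_sq : ∀ i, cb i * cb i = 1
  cb_anti : ∀ i j, i ≠ j → cb i * cb j = -(cb j * cb i)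
  cb_conj : ∀ w i, σb w * cb i * σb (w⁻¹) = cb (w i)
  comm_σσb : ∀ w v, σ w * σb v = σb v * σ w
  comm_σcb : ∀ w j, σ w * cb j = cb j * σ w
  comm_σbc : ∀ v i, σb v * c i = c i * σb v
  anti_ccb : ∀ i j, c i * cb j = -(cb j * c i)
  e_c1 : ∀ (h1 : 0 < r) (h2 : 0 < t), e * c ⟨0, h1⟩ = e * cb ⟨0, h2⟩
  c1_e : ∀ (h1 : 0 < r) (h2 : 0 < t), c ⟨0, h1⟩ * e = cb ⟨0, h2⟩ * e
  e_sq : e * e = 0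
  e_s_e : 1 < r → e * σ (sw r 0 1) * e = e
  e_sb_e : 1 < t → e * σb (sw t 0 1) * e = e
  s_e_comm : ∀ i : ℕ, 0 < i → i + 1 < r → σ (sw r i (i + 1)) * e = e * σ (sw r i (i + 1))
  sb_e_comm : ∀ j : ℕ, 0 < j → j + 1 < t → σb (sw t j (j + 1)) * e = e * σb (sw t j (j + 1))
  braid1 : 1 < r → 1 < t →
    e * σ (sw r 0 1) * σb (sw t 0 1) * e * σ (sw r 0 1)
      = e * σ (sw r 0 1) * σb (sw t 0 1) * e * σb (sw t 0 1)
  braid2 : 1 < r → 1 < t →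
    σ (sw r 0 1) * e * σ (sw r 0 1) * σb (sw t 0 1) * e
      = σb (sw t 0 1) * e * σ (sw r 0 1) * σb (sw t 0 1) * e
  c_e_comm : ∀ i : Fin r, (i : ℕ) ≠ 0 → c i * e = e * c i
  cb_e_comm : ∀ j : Fin t, (j : ℕ) ≠ 0 → cb j * e = e * cb j
  e_c_e : ∀ h : 0 < r, e * c ⟨0, h⟩ * e = 0
  e_cb_e : ∀ h : 0 < t, e * cb ⟨0, h⟩ * e = 0

namespace WBC

variable {R A : Type} [CommRing R] [Ring A] [Algebra R A] {r t : ℕ}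

/-- The transposition `(i,j) ∈ Σ_r` (1-based indices). -/
def tr (d : WBC R A r t) (i j : ℕ) : A := d.σ (sw r (i - 1) (j - 1))

/-- The transposition `(ī,j̄) ∈ Σ_t` (1-based indices). -/
def trb (d : WBC R A r t) (i j : ℕ) : A := d.σb (sw t (i - 1) (j - 1))

/-- The generator `s_j = (j, j+1)` (1-based). -/
def s (d : WBC R A r t) (j : ℕ) : A := d.σ (sw r (j - 1) j)

/-- The generator `s̄_j` (1-based). -/
def sb (d : WBC R A r t) (j : ℕ) : A := d.σb (sw t (j - 1) j)

/-- The generator `c_i` (1-based). -/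
def cn (d : WBC R A r t) (i : ℕ) : A := if h : i - 1 < r then d.c ⟨i - 1, h⟩ else 0

/-- The generator `c̄_i` (1-based). -/
def cbn (d : WBC R A r t) (i : ℕ) : A := if h : i - 1 < t then d.cb ⟨i - 1, h⟩ else 0

/-- `e_{i,j} = (1̄,j̄)(1,i) e_1 (1,i)(1̄,j̄)` (1-based). -/
def E (d : WBC R A r t) (i j : ℕ) : A := d.trb 1 j * d.tr 1 i * d.e * d.tr 1 i * d.trb 1 j

/-- `ē_{i,j} = c_i e_{i,j} c_i`. -/
def Eb (d : WBC R A r t) (i j : ℕ) : A := d.cn i * d.E i j * d.cn i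

/-- `L'_i = ∑_{j=1}^{i-1} (j,i)`. -/
def LL (d : WBC R A r t) (i : ℕ) : A := ∑ j ∈ Finset.Ico 1 i, d.tr j i

/-- The Jucys–Murphy element `L_i = L'_i + c_i L'_i c_i`. -/
def L (d : WBC R A r t) (i : ℕ) : A := d.LL i + d.cn i * d.LL i * d.cn i

/-- `L̄'_i = ∑_{j=1}^{i-1} (j̄,ī)`. -/
def LLb (d : WBC R A r t) (i : ℕ) : A := ∑ j ∈ Finset.Ico 1 i, d.trb j i

/-- The Jucys–Murphy element `L̄_i = L̄'_i - c̄_i L̄'_i c̄_i`. -/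
def Lb (d : WBC R A r t) (i : ℕ) : A := d.LLb i - d.cbn i * d.LLb i * d.cbn i

/-- `y_i = ∑_{j=1}^{i-1} (e_{i,j} + ē_{i,j}) - L_i`. -/
def y (d : WBC R A r t) (i : ℕ) : A := (∑ j ∈ Finset.Ico 1 i, (d.E i j + d.Eb i j)) - d.L i

/-- `ȳ_i = ∑_{j=1}^{i-1} (e_{j,i} - ē_{j,i}) - L̄_i`. -/
def yb (d : WBC R A r t) (i : ℕ) : A := (∑ j ∈ Finset.Ico 1 i, (d.E j i - d.Eb j i)) - d.Lb i

/-- `c^α = c_1^{α_1} ⋯ c_r^{α_r}`. -/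
def cpow (d : WBC R A r t) (α : Fin r → Fin 2) : A :=
  ((List.finRange r).map (fun i => d.c i ^ (α i : ℕ))).prod

/-- `c̄^β = c̄_1^{β_1} ⋯ c̄_t^{β_t}`. -/
def cbpow (d : WBC R A r t) (β : Fin t → Fin 2) : A :=
  ((List.finRange t).map (fun j => d.cb j ^ (β j : ℕ))).prod

/-- `e^f = e_1 e_2 ⋯ e_f`. -/
def epow (d : WBC R A r t) (f : ℕ) : A :=
  ((List.range f).map (fun i => d.E (i + 1) (i + 1))).prod

/-- Generators of the subalgebra `BC_{m,m}`: the elements `e_1`, `s_1, …, s_{m-1}`,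
`s̄_1, …, s̄_{m-1}`, `c_1` and `c̄_1` (interpreted as `∅` when `m = 0`). -/
def lowerGens (d : WBC R A r t) (m : ℕ) : Set A :=
  {x | (1 ≤ m ∧ x = d.e) ∨ (∃ j : ℕ, 1 ≤ j ∧ j + 1 ≤ m ∧ x = d.s j)
    ∨ (∃ j : ℕ, 1 ≤ j ∧ j + 1 ≤ m ∧ x = d.sb j)
    ∨ (1 ≤ m ∧ x = d.cn 1) ∨ (1 ≤ m ∧ x = d.cbn 1)}

end WBC

/-- `φ` intertwines two sets of walled Brauer–Clifford data. -/
structure WBCHom {R A B : Type} [CommRing R] [Ring A] [Algebra R A] [Ring B] [Algebra R B]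
    {r t : ℕ} (d : WBC R A r t) (d' : WBC R B r t) (φ : A →ₐ[R] B) : Prop where
  map_σ : ∀ w, φ (d.σ w) = d'.σ w
  map_σb : ∀ w, φ (d.σb w) = d'.σb w
  map_c : ∀ i, φ (d.c i) = d'.c i
  map_cb : ∀ j, φ (d.cb j) = d'.cb j
  map_e : φ d.e = d'.e

/-- `A` (with the data `d`) *is* the walled Brauer–Clifford superalgebra `BC_{r,t}`:
it is initial among all algebras with such data. -/
def WBC.IsUniversal {R A : Type} [CommRing R] [Ring A] [Algebra R A] {r t : ℕ}
    (d : WBC R A r t) : Prop :=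
  ∀ (B : Type) [Ring B] [Algebra R B], ∀ d' : WBC R B r t, ∃! φ : A →ₐ[R] B, WBCHom d d' φ

/-- An element of `D^f_{r,t}`: data `1 ≤ i_1 < ⋯ < i_f ≤ r` and `k ≤ j_k ≤ t`
(all 1-based) describing `s_{f,i_f} s̄_{f,j_f} ⋯ s_{1,i_1} s̄_{1,j_1}`. -/
structure DElt (r t f : ℕ) : Type where
  a : Fin f → ℕ
  b : Fin f → ℕ
  ha_mono : StrictMono a
  ha_lb : ∀ k, 1 ≤ a k
  ha_ub : ∀ k, a k ≤ r
  hb_lb : ∀ k : Fin f, (k : ℕ) + 1 ≤ b k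
  hb_ub : ∀ k, b k ≤ t

/-- The `Σ_r`-component `s_{f,i_f} ⋯ s_{1,i_1}` of the element of `D^f_{r,t}`. -/
def DElt.pr {r t f : ℕ} (x : DElt r t f) : Equiv.Perm (Fin r) :=
  ((List.finRange f).reverse.map (fun (k : Fin f) => sIJ r ((k : ℕ) + 1) (x.a k))).prod

/-- The `Σ_t`-component `s̄_{f,j_f} ⋯ s̄_{1,j_1}` of the element of `D^f_{r,t}`. -/
def DElt.pt {r t f : ℕ} (x : DElt r t f) : Equiv.Perm (Fin t) :=
  ((List.finRange f).reverse.map (fun (k : Fin f) => sIJ t ((k : ℕ) + 1) (x.b k))).prod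

/-- Index for the basis `{c^α d_1⁻¹ e^f w d_2 c̄^β}` of `BC_{r,t}`; the component
`w ∈ Σ_{r-f} × Σ_{t-f}` is a pair of permutations fixing `1, …, f` pointwise. -/
structure BCIndex (r t : ℕ) : Type where
  α : Fin r → Fin 2
  β : Fin t → Fin 2
  f : ℕ
  hf : f ≤ min r t
  d1 : DElt r t f
  d2 : DElt r t f
  w : Equiv.Perm (Fin r)
  wb : Equiv.Perm (Fin t)
  hw : ∀ i : Fin r, (i : ℕ) < f → w i = i
  hwb : ∀ j : Fin t, (j : ℕ) < f → wb j = j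

/-- The basis element `c^α d_1⁻¹ e^f w d_2 c̄^β` of Theorem 2.4. -/
def WBC.basElt {R A : Type} [CommRing R] [Ring A] [Algebra R A] {r t : ℕ}
    (d : WBC R A r t) (x : BCIndex r t) : A :=
  d.cpow x.α * d.σ (x.d1.pr⁻¹) * d.σb (x.d1.pt⁻¹) * d.epow x.f *
    d.σ x.w * d.σb x.wb * d.σ x.d2.pr * d.σb x.d2.pt * d.cbpow x.β

/-- Data for the presentation of the affine walled Brauer–Clifford superalgebra
`BC^aff_{r,t}` (Definition 3.1) with distinguished parameter `ω_1 ∈ R`.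
`om k` is `ω_k` (with `ω_1` the scalar `ω1` and `ω_{2k} = 0`), `omb k` is `ω̄_k`. -/
structure AWBC (R A : Type) [CommRing R] [Ring A] [Algebra R A] (r t : ℕ) (ω1 : R)
    extends WBC R A r t : Type where
  x1 : A
  xb1 : A
  om : ℕ → A
  omb : ℕ → A
  om_one : om 1 = algebraMap R A ω1
  om_even : ∀ k, om (2 * k) = 0
  omb_zero : omb 0 = 0
  om_comm : ∀ k, (∀ w, om k * σ w = σ w * om k) ∧ (∀ w, om k * σb w = σb w * om k) ∧
    (∀ i, om k * c i = c i * om k) ∧ (∀ j, om k * cb j = cb j * om k) ∧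
    om k * e = e * om k ∧ om k * x1 = x1 * om k ∧ om k * xb1 = xb1 * om k ∧
    (∀ l, om k * om l = om l * om k) ∧ (∀ l, om k * omb l = omb l * om k)
  omb_comm : ∀ k, (∀ w, omb k * σ w = σ w * omb k) ∧ (∀ w, omb k * σb w = σb w * omb k) ∧
    (∀ i, omb k * c i = c i * omb k) ∧ (∀ j, omb k * cb j = cb j * omb k) ∧
    omb k * e = e * omb k ∧ omb k * x1 = x1 * omb k ∧ omb k * xb1 = xb1 * omb k ∧
    (∀ l, omb k * omb l = omb l * omb k)
  x_comm : ∀ h : 1 < r, x1 * (σ (sw r 0 1) * x1 * σ (sw r 0 1)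
      - (1 - c ⟨0, by omega⟩ * c ⟨1, h⟩) * σ (sw r 0 1))
    = (σ (sw r 0 1) * x1 * σ (sw r 0 1)
      - (1 - c ⟨0, by omega⟩ * c ⟨1, h⟩) * σ (sw r 0 1)) * x1
  x1_c1 : ∀ h : 0 < r, x1 * c ⟨0, h⟩ = -(c ⟨0, h⟩ * x1)
  x1_c : ∀ i : Fin r, (i : ℕ) ≠ 0 → x1 * c i = c i * x1
  s_x1 : ∀ i : ℕ, 0 < i → i + 1 < r → σ (sw r i (i + 1)) * x1 = x1 * σ (sw r i (i + 1))
  xb_comm : ∀ h : 1 < t, xb1 * (σb (sw t 0 1) * xb1 * σb (sw t 0 1)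
      - (1 + cb ⟨0, by omega⟩ * cb ⟨1, h⟩) * σb (sw t 0 1))
    = (σb (sw t 0 1) * xb1 * σb (sw t 0 1)
      - (1 + cb ⟨0, by omega⟩ * cb ⟨1, h⟩) * σb (sw t 0 1)) * xb1
  xb1_cb1 : ∀ h : 0 < t, xb1 * cb ⟨0, h⟩ = -(cb ⟨0, h⟩ * xb1)
  xb1_cb : ∀ j : Fin t, (j : ℕ) ≠ 0 → xb1 * cb j = cb j * xb1
  sb_xb1 : ∀ j : ℕ, 0 < j → j + 1 < t → σb (sw t j (j + 1)) * xb1 = xb1 * σb (sw t j (j + 1))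
  e_xsum : e * (x1 + xb1) = 0
  xsum_e : (x1 + xb1) * e = 0
  e_sxs : 1 < r → e * (σ (sw r 0 1) * x1 * σ (sw r 0 1)) = (σ (sw r 0 1) * x1 * σ (sw r 0 1)) * e
  x_mixed : ∀ h : 0 < r, x1 * (e + xb1 - c ⟨0, h⟩ * e * c ⟨0, h⟩)
      = (e - c ⟨0, h⟩ * e * c ⟨0, h⟩ + xb1) * x1
  e_sbxbsb : 1 < t →
    e * (σb (sw t 0 1) * xb1 * σb (sw t 0 1)) = (σb (sw t 0 1) * xb1 * σb (sw t 0 1)) * e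
  e_xodd : ∀ k : ℕ, e * x1 ^ (2 * k + 1) * e = om (2 * k + 1) * e
  e_xeven : ∀ k : ℕ, 1 ≤ k → e * x1 ^ (2 * k) * e = 0
  e_xb : ∀ k : ℕ, 1 ≤ k → e * xb1 ^ k * e = omb k * e
  x1_cb_comm : ∀ j, x1 * cb j = cb j * x1
  xb1_c_comm : ∀ i, xb1 * c i = c i * xb1
  x1_σb : ∀ w, σb w * x1 = x1 * σb w
  xb1_σ : ∀ w, σ w * xb1 = xb1 * σ w

namespace AWBC

variable {R A : Type} [CommRing R] [Ring A] [Algebra R A] {r t : ℕ} {ω1 : R}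

/-- `x'_i = s_{i-1} ⋯ s_1 x_1 s_1 ⋯ s_{i-1}` (1-based). -/
def xp (d : AWBC R A r t ω1) (i : ℕ) : A :=
  ((List.range (i - 1)).reverse.map (fun k => d.toWBC.s (k + 1))).prod * d.x1 *
    ((List.range (i - 1)).map (fun k => d.toWBC.s (k + 1))).prod

/-- `x̄'_j = s̄_{j-1} ⋯ s̄_1 x̄_1 s̄_1 ⋯ s̄_{j-1}` (1-based). -/
def xbp (d : AWBC R A r t ω1) (j : ℕ) : A :=
  ((List.range (j - 1)).reverse.map (fun k => d.toWBC.sb (k + 1))).prod * d.xb1 *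
    ((List.range (j - 1)).map (fun k => d.toWBC.sb (k + 1))).prod

/-- `x_i = x'_i - L_i`. -/
def xv (d : AWBC R A r t ω1) (i : ℕ) : A := d.xp i - d.toWBC.L i

/-- `x̄_j = x̄'_j - L̄_j`. -/
def xbv (d : AWBC R A r t ω1) (j : ℕ) : A := d.xbp j - d.toWBC.Lb j

/-- `x^α = x_1^{α_1} ⋯ x_r^{α_r}`. -/
def xpow (d : AWBC R A r t ω1) (α : Fin r → ℕ) : A :=
  ((List.finRange r).map (fun (i : Fin r) => d.xv ((i : ℕ) + 1) ^ α i)).prod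

/-- `x̄^β = x̄_1^{β_1} ⋯ x̄_t^{β_t}`. -/
def xbpow (d : AWBC R A r t ω1) (β : Fin t → ℕ) : A :=
  ((List.finRange t).map (fun (j : Fin t) => d.xbv ((j : ℕ) + 1) ^ β j)).prod

/-- `∏_{n ∈ ℤ^{>0}} ω_{2n+1}^{a_{2n+1}}`, where `g i` is the exponent of `ω_{2(i+1)+1}`. -/
def ompow (d : AWBC R A r t ω1) (g : ℕ →₀ ℕ) : A :=
  ((g.support.sort (· ≤ ·)).map (fun n => d.om (2 * n + 3) ^ g n)).prod

/-- `z_i = x'_i + y_i`. -/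
def z (d : AWBC R A r t ω1) (i : ℕ) : A := d.xp i + d.toWBC.y i

/-- `z̄_j = x̄'_j + ȳ_j`. -/
def zb (d : AWBC R A r t ω1) (j : ℕ) : A := d.xbp j + d.toWBC.yb j

/-- Generators of the subalgebra `BC_{2,m,m}`-type subalgebra:
`e_1, s_1, …, s_{m-1}, s̄_1, …, s̄_{m-1}, c_1, c̄_1, x_1, x̄_1`. -/
def lowerGensA (d : AWBC R A r t ω1) (m : ℕ) : Set A :=
  d.toWBC.lowerGens m ∪ {x | 1 ≤ m ∧ (x = d.x1 ∨ x = d.xb1)}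

end AWBC

/-- `φ` intertwines two sets of affine walled Brauer–Clifford data. -/
structure AWBCHom {R A B : Type} [CommRing R] [Ring A] [Algebra R A] [Ring B] [Algebra R B]
    {r t : ℕ} {ω1 : R} (d : AWBC R A r t ω1) (d' : AWBC R B r t ω1) (φ : A →ₐ[R] B) : Prop where
  map_σ : ∀ w, φ (d.σ w) = d'.σ w
  map_σb : ∀ w, φ (d.σb w) = d'.σb w
  map_c : ∀ i, φ (d.c i) = d'.c i
  map_cb : ∀ j, φ (d.cb j) = d'.cb j
  map_e : φ d.e = d'.e
  map_x1 : φ d.x1 = d'.x1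
  map_xb1 : φ d.xb1 = d'.xb1
  map_om : ∀ k, φ (d.om k) = d'.om k
  map_omb : ∀ k, φ (d.omb k) = d'.omb k

/-- `A` (with the data `d`) is the affine walled Brauer–Clifford superalgebra
`BC^aff_{r,t}` of Definition 3.1. -/
def AWBC.IsUniversal {R A : Type} [CommRing R] [Ring A] [Algebra R A] {r t : ℕ} {ω1 : R}
    (d : AWBC R A r t ω1) : Prop :=
  ∀ (B : Type) [Ring B] [Algebra R B], ∀ d' : AWBC R B r t ω1,
    ∃! φ : A →ₐ[R] B, AWBCHom d d' φ

/-- Assumption 3.6: the parameters `ω̄` are determined by the `ω`'s as in Corollary 3.5. -/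
def AWBC.Ass36 {R A : Type} [CommRing R] [Ring A] [Algebra R A] {r t : ℕ} {ω1 : R}
    (d : AWBC R A r t ω1) : Prop :=
  (∀ n, d.omb (2 * n) = 0) ∧
  (∀ n, d.omb (2 * n + 1) = ∑ j ∈ Finset.range (n + 1), acoef d.om n j * d.om (2 * j + 1))

/-- `A` (with the data `d`) is the affine walled Brauer–Clifford superalgebra
`BC^aff_{r,t}` subject to Assumption 3.6. -/
def AWBC.IsUniversal36 {R A : Type} [CommRing R] [Ring A] [Algebra R A] {r t : ℕ} {ω1 : R}
    (d : AWBC R A r t ω1) : Prop :=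
  d.Ass36 ∧ ∀ (B : Type) [Ring B] [Algebra R B], ∀ d' : AWBC R B r t ω1,
    d'.Ass36 → ∃! φ : A →ₐ[R] B, AWBCHom d d' φ

/-- The parameters `ω_k`, `ω̄_k` are the scalars `ω k`, `obar ω k` (specialization defining
the algebra `B̃C_{r,t}` of Definition 3.13). -/
def AWBC.IsSpec {R A : Type} [CommRing R] [Ring A] [Algebra R A] {r t : ℕ} {ω1 : R}
    (d : AWBC R A r t ω1) (ω : ℕ → R) : Prop :=
  (∀ k, d.om k = algebraMap R A (ω k)) ∧ (∀ k, 1 ≤ k → d.omb k = algebraMap R A (obar ω k))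

/-- `A` (with the data `d`) is the algebra `B̃C_{r,t}` of Definition 3.13 with parameters
`ω_{2n+1} ∈ R`. -/
def AWBC.IsSpecUniversal {R A : Type} [CommRing R] [Ring A] [Algebra R A] {r t : ℕ} {ω1 : R}
    (d : AWBC R A r t ω1) (ω : ℕ → R) : Prop :=
  d.IsSpec ω ∧ ∀ (B : Type) [Ring B] [Algebra R B], ∀ d' : AWBC R B r t ω1,
    d'.IsSpec ω → ∃! φ : A →ₐ[R] B, AWBCHom d d' φ

/-- The cyclotomic relations `f(x_1) = 0` and `g(x̄_1) = 0`. -/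
def AWBC.IsCyc {R A : Type} [CommRing R] [Ring A] [Algebra R A] {r t : ℕ} {ω1 : R}
    (d : AWBC R A r t ω1) (f g : Polynomial R) : Prop :=
  Polynomial.aeval d.x1 f = 0 ∧ Polynomial.aeval d.xb1 g = 0

/-- `A` (with the data `d`) is the cyclotomic walled Brauer–Clifford superalgebra
`BC_{ℓ,r,t}` of Definition 3.14 attached to `f`, `g` and the scalar parameters `ω`. -/
def AWBC.IsCycUniversal {R A : Type} [CommRing R] [Ring A] [Algebra R A] {r t : ℕ} {ω1 : R}
    (d : AWBC R A r t ω1) (ω : ℕ → R) (f g : Polynomial R) : Prop :=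
  d.IsSpec ω ∧ d.IsCyc f g ∧ ∀ (B : Type) [Ring B] [Algebra R B], ∀ d' : AWBC R B r t ω1,
    d'.IsSpec ω → d'.IsCyc f g → ∃! φ : A →ₐ[R] B, AWBCHom d d' φ

/-- Index of a regular monomial `x^α d x̄^β ∏_{n≥1} ω_{2n+1}^{a_{2n+1}}` of `BC^aff_{r,t}`. -/
structure ARIndex (r t : ℕ) : Type where
  α : Fin r → ℕ
  β : Fin t → ℕ
  dIdx : BCIndex r t
  g : ℕ →₀ ℕ

/-- The regular monomial `x^α d x̄^β ∏_{n≥1} ω_{2n+1}^{a_{2n+1}}` of Definition 3.11. -/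
def AWBC.regElt {R A : Type} [CommRing R] [Ring A] [Algebra R A] {r t : ℕ} {ω1 : R}
    (d : AWBC R A r t ω1) (x : ARIndex r t) : A :=
  d.xpow x.α * d.toWBC.basElt x.dIdx * d.xbpow x.β * d.ompow x.g

/-- Index of a regular monomial `x^α d x̄^β` of `B̃C_{r,t}`. -/
structure SIndex (r t : ℕ) : Type where
  α : Fin r → ℕ
  β : Fin t → ℕ
  dIdx : BCIndex r t

/-- The regular monomial `x^α d x̄^β` of `B̃C_{r,t}`. -/
def AWBC.sregElt {R A : Type} [CommRing R] [Ring A] [Algebra R A] {r t : ℕ} {ω1 : R}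
    (d : AWBC R A r t ω1) (x : SIndex r t) : A :=
  d.xpow x.α * d.toWBC.basElt x.dIdx * d.xbpow x.β

/-- Index of a regular monomial `x^α d x̄^β` of the level `ℓ` algebra `BC_{ℓ,r,t}`,
with exponents in `{0, 1, …, ℓ-1}`. -/
structure CIndex (r t ℓ : ℕ) : Type where
  α : Fin r → Fin ℓ
  β : Fin t → Fin ℓ
  dIdx : BCIndex r t

/-- The regular monomial `x^α d x̄^β` of `BC_{ℓ,r,t}`. -/
def AWBC.cregElt {R A : Type} [CommRing R] [Ring A] [Algebra R A] {r t ℓ : ℕ} {ω1 : R}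
    (d : AWBC R A r t ω1) (x : CIndex r t ℓ) : A :=
  d.xpow (fun i => (x.α i : ℕ)) * d.toWBC.basElt x.dIdx * d.xbpow (fun j => (x.β j : ℕ))

/-- Admissibility (Definition 6.4): writing `f(x) = x^{k+2m} + ∑_{i=1}^{2m} a_i x^{k+2m-i}`,
one has `ω_L = -(a_1 ω_{L-1} + ⋯ + a_{2m} ω_{L-2m})` for all `L ≥ k + 2m`. -/
def AdmissibleParam {R : Type} [CommRing R] (ω : ℕ → R) (f : Polynomial R) (k m : ℕ) : Prop :=
  ∀ L, k + 2 * m ≤ L →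
    ω L = -∑ i ∈ Finset.Icc 1 (2 * m), f.coeff (k + 2 * m - i) * ω (L - i)

/-- The parameters `ω_0 = 0`, `ω_1 = -2m(2p-2m+1)`, `ω_i = p(p+1) ω_{i-2}` of (4.16). -/
def omSeq (m : ℕ) (p : ℂ) : ℕ → ℂ
  | 0 => 0
  | 1 => -2 * (m : ℂ) * (2 * p - 2 * (m : ℂ) + 1)
  | n + 2 => p * (p + 1) * omSeq m p n

/-- Index of a monomial `d_1^{-1} c^α x'^β e^f x̄'^{β̄} c̄^{ᾱ} w d_2` of (4.20). -/
structure L2Index (r t : ℕ) : Type where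
  α : Fin r → Fin 2
  βx : Fin r → Fin 2
  αb : Fin t → Fin 2
  βxb : Fin t → Fin 2
  f : ℕ
  hf : f ≤ min r t
  d1 : DElt r t f
  d2 : DElt r t f
  w : Equiv.Perm (Fin r)
  wb : Equiv.Perm (Fin t)
  hw : ∀ i : Fin r, (i : ℕ) < f → w i = i
  hwb : ∀ j : Fin t, (j : ℕ) < f → wb j = j

/-- The monomial `d_1^{-1} c^α x'^β e^f x̄'^{β̄} c̄^{ᾱ} w d_2` of (4.20), where
`x'^β = x'_r{}^{β_r} ⋯ x'_1{}^{β_1}` and `x̄'^{β̄} = x̄'_t{}^{β̄_t} ⋯ x̄'_1{}^{β̄_1}`. -/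
def AWBC.l2Elt {R A : Type} [CommRing R] [Ring A] [Algebra R A] {r t : ℕ} {ω1 : R}
    (d : AWBC R A r t ω1) (x : L2Index r t) : A :=
  d.toWBC.σ (x.d1.pr⁻¹) * d.toWBC.σb (x.d1.pt⁻¹) * d.toWBC.cpow x.α *
    ((List.finRange r).reverse.map (fun (i : Fin r) => d.xp ((i : ℕ) + 1) ^ (x.βx i : ℕ))).prod *
    d.toWBC.epow x.f *
    ((List.finRange t).reverse.map (fun (j : Fin t) => d.xbp ((j : ℕ) + 1) ^ (x.βxb j : ℕ))).prod *
    d.toWBC.cbpow x.αb *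
    d.toWBC.σ x.w * d.toWBC.σb x.wb * d.toWBC.σ x.d2.pr * d.toWBC.σb x.d2.pt

section
/-- relations of the level two cyclotomic Sergeev algebra -/
structure HData (a : ℂ) (A : Type) [Ring A] [Algebra ℂ A] (n : ℕ) : Type where
  σ : Equiv.Perm (Fin n) →* A
  c : Fin n → A
  ξ : Fin n → A
  c_sq : ∀ i, c i * c i = -1
  c_anti : ∀ i j, i ≠ j → c i * c j = -(c j * c i)
  σ_c : ∀ w i, σ w * c i = c (w i) * σ w
  σ_ξ : ∀ w i, σ w * ξ i = ξ (w i) * σ w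
  ξ_sq : ∀ i, ξ i * ξ i = algebraMap ℂ A a
  ξ_c : ∀ i, ξ i * c i = -(c i * ξ i)
  ξ_c' : ∀ i j, i ≠ j → ξ i * c j = c j * ξ i
  ξ_ξ : ∀ i j, i ≠ j → ξ i * ξ j - ξ j * ξ i
    = ξ i * ((1 - c i * c j) * σ (Equiv.swap i j)) - (1 - c i * c j) * σ (Equiv.swap i j) * ξ i

namespace HData
variable {a : ℂ} {A : Type} [Ring A] [Algebra ℂ A] {n : ℕ}

/-- generators -/
def gens (D : HData a A n) : Set A := Set.range D.σ ∪ Set.range D.c ∪ Set.range D.ξ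

/-- generated subalgebra -/
def alg (D : HData a A n) : Subalgebra ℂ A := Algebra.adjoin ℂ D.gens

lemma σ_mem (D : HData a A n) (w) : D.σ w ∈ D.alg :=
  Algebra.subset_adjoin (Or.inl (Or.inl ⟨w, rfl⟩))
lemma c_mem (D : HData a A n) (i) : D.c i ∈ D.alg :=
  Algebra.subset_adjoin (Or.inl (Or.inr ⟨i, rfl⟩))
lemma ξ_mem (D : HData a A n) (i) : D.ξ i ∈ D.alg :=
  Algebra.subset_adjoin (Or.inr ⟨i, rfl⟩)

end HData

/-- generic: a submodule containing 1 and closed under left mult. by generators contains adjoin -/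
lemma adjoin_le_of_left {A : Type} [Ring A] [Algebra ℂ A] (s : Set A) (S : Submodule ℂ A)
    (h1 : (1 : A) ∈ S) (h : ∀ g ∈ s, ∀ x ∈ S, g * x ∈ S) :
    ∀ x ∈ Algebra.adjoin ℂ s, x ∈ S := by
  have key : ∀ x ∈ Algebra.adjoin ℂ s, ∀ y ∈ S, x * y ∈ S := by
    intro x hx
    induction hx using Algebra.adjoin_induction with
    | mem x hx => exact h x hx
    | algebraMap r => intro y hy; rw [← Algebra.smul_def]; exact S.smul_mem _ hy
    | add x y _ _ hx hy => intro z hz; rw [add_mul]; exact S.add_mem (hx z hz) (hy z hz)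
    | mul x y _ _ hx hy => intro z hz; rw [mul_assoc]; exact hx _ (hy z hz)
  intro x hx; simpa using key x hx 1 h1

/-- extension of a permutation by fixing 0 -/
def up {n : ℕ} : Equiv.Perm (Fin n) →* Equiv.Perm (Fin (n + 1)) :=
  Equiv.Perm.viaEmbeddingHom (Fin.succEmb n)

@[simp] lemma up_succ {n : ℕ} (u : Equiv.Perm (Fin n)) (i) : up u (Fin.succ i) = Fin.succ (u i) := by
  have := Equiv.Perm.viaEmbedding_apply u (Fin.succEmb n) i
  simpa [up, Equiv.Perm.viaEmbeddingHom_apply] using this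

@[simp] lemma up_zero {n : ℕ} (u : Equiv.Perm (Fin n)) : up u 0 = 0 := by
  have := Equiv.Perm.viaEmbedding_apply_of_notMem u (Fin.succEmb n) 0
    (by rintro ⟨x, hx⟩; exact Fin.succ_ne_zero x hx)
  simpa [up, Equiv.Perm.viaEmbeddingHom_apply] using this

/-- the component of `w` in the stabiliser of 0 -/
def dn {n : ℕ} (w : Equiv.Perm (Fin (n + 1))) : Equiv.Perm (Fin n) :=
  (Equiv.Perm.decomposeFin w).2

lemma dn_spec {n : ℕ} (w : Equiv.Perm (Fin (n + 1))) :
    w = Equiv.swap 0 (w 0) * up (dn w) := by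
  obtain ⟨⟨p, e⟩, rfl⟩ := Equiv.Perm.decomposeFin.symm.surjective w
  ext i
  refine Fin.cases ?_ (fun i => ?_) i
  · simp
  · simp [dn]

lemma up_inj {n : ℕ} : Function.Injective (up (n := n)) := by
  intro u v h
  ext i
  have := congrArg (fun f => f (Fin.succ i)) h
  simpa using congrArg Fin.val this

lemma perm_cases {n : ℕ} {C : Equiv.Perm (Fin (n+1)) → Prop}
    (h : ∀ j u, C (Equiv.swap 0 j * up u)) (w) : C w := by
  rw [dn_spec w]; exact h _ _

lemma dn_swap_up {n : ℕ} (j : Fin (n+1)) (u : Equiv.Perm (Fin n)) :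
    dn (Equiv.swap 0 j * up u) = u := by
  have := dn_spec (Equiv.swap 0 j * up u)
  simp at this
  exact (up_inj this).symm

lemma dn_mul_up {n : ℕ} (w : Equiv.Perm (Fin (n+1))) (u : Equiv.Perm (Fin n)) :
    dn (w * up u) = dn w * u := by
  conv_lhs => rw [dn_spec w, mul_assoc, ← map_mul]
  rw [dn_swap_up]

/-- conditional power -/
def pw {A : Type} [Monoid A] (x : A) (b : Bool) : A := if b then x else 1

@[simp] lemma pw_true {A : Type} [Monoid A] (x : A) : pw x true = x := rfl
@[simp] lemma pw_false {A : Type} [Monoid A] (x : A) : pw x false = 1 := rfl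

namespace HData
variable {a : ℂ} {A : Type} [Ring A] [Algebra ℂ A] {n : ℕ}

/-- restriction to indices `1..n` -/
@[simps] def res (D : HData a A (n+1)) : HData a A n where
  σ := D.σ.comp up
  c := fun i => D.c i.succ
  ξ := fun i => D.ξ i.succ
  c_sq := fun i => D.c_sq _
  c_anti := fun i j h => D.c_anti _ _ (by simpa using h)
  σ_c := fun w i => by simp [D.σ_c]
  σ_ξ := fun w i => by simp [D.σ_ξ]
  ξ_sq := fun i => D.ξ_sq _
  ξ_c := fun i => D.ξ_c _
  ξ_c' := fun i j h => D.ξ_c' _ _ (by simpa using h)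
  ξ_ξ := fun i j h => by
    have := D.ξ_ξ i.succ j.succ (by simpa using h)
    have h2 : up (Equiv.swap i j) = Equiv.swap i.succ j.succ := by
      ext x
      refine Fin.cases ?_ (fun x => ?_) x
      · rw [up_zero, Equiv.swap_apply_of_ne_of_ne (Fin.succ_ne_zero _).symm (Fin.succ_ne_zero _).symm]
      · rw [up_succ]
        by_cases h1 : x = i
        · subst h1; simp
        by_cases h2 : x = j
        · subst h2; simp
        rw [Equiv.swap_apply_of_ne_of_ne h1 h2, Equiv.swap_apply_of_ne_of_ne]
        · simpa using h1
        · simpa using h2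
    simpa [h2] using this

lemma c_σ (D : HData a A n) (w i) : D.c i * D.σ w = D.σ w * D.c (w⁻¹ i) := by simp [D.σ_c]
lemma ξ_σ (D : HData a A n) (w i) : D.ξ i * D.σ w = D.σ w * D.ξ (w⁻¹ i) := by simp [D.σ_ξ]

/-- convenient form of the commutation relation -/
lemma comm0 (D : HData a A n) (i l : Fin n) (h : l ≠ i) :
    D.ξ l * D.ξ i = D.ξ i * D.ξ l + D.σ (Equiv.swap i l) *
      (D.ξ i * (1 + D.c l * D.c i) - (1 + D.c l * D.c i) * D.ξ l) := by
  have h1 := D.ξ_ξ l i h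
  have e1 : (1 - D.c l * D.c i) * D.σ (Equiv.swap l i)
      = D.σ (Equiv.swap i l) * (1 + D.c l * D.c i) := by
    rw [Equiv.swap_comm, mul_add, ← mul_assoc, D.σ_c, mul_assoc, D.σ_c]
    simp only [Equiv.swap_apply_left, Equiv.swap_apply_right, sub_mul, one_mul, mul_one, ← mul_assoc]
    rw [D.c_anti _ _ h]; noncomm_ring
  rw [e1, ← mul_assoc, D.ξ_σ] at h1
  simp only [Equiv.swap_inv, Equiv.swap_apply_right] at h1
  rw [sub_eq_iff_eq_add] at h1
  rw [h1]; noncomm_ring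

/-- `Y + c₀ Y` -/
def VV (D : HData a A (n+1)) : Submodule ℂ A :=
  Submodule.span ℂ {x | ∃ b, ∃ y ∈ D.res.alg, x = pw (D.c 0) b * y}

lemma VV_mk (D : HData a A (n+1)) (b) {y} (hy : y ∈ D.res.alg) : pw (D.c 0) b * y ∈ D.VV :=
  Submodule.subset_span ⟨b, y, hy, rfl⟩

lemma span_left {S : Set A} {T : Submodule ℂ A} (g : A) (h : ∀ x ∈ S, g * x ∈ T) :
    ∀ x ∈ Submodule.span ℂ S, g * x ∈ T := by
  intro x hx
  have : Submodule.span ℂ S ≤ T.comap (LinearMap.mulLeft ℂ g) := by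
    rw [Submodule.span_le]; intro y hy; exact h y hy
  exact this hx

lemma VV_c0 (D : HData a A (n+1)) : ∀ x ∈ D.VV, D.c 0 * x ∈ D.VV := by
  apply span_left
  rintro _ ⟨b, y, hy, rfl⟩
  cases b
  · simpa using D.VV_mk true hy
  · have := D.VV_mk false hy
    simp only [pw_true, pw_false, ← mul_assoc, D.c_sq, one_mul] at *
    simpa using this

lemma VV_c (D : HData a A (n+1)) (l : Fin n) : ∀ x ∈ D.VV, D.c l.succ * x ∈ D.VV := by
  apply span_left
  rintro _ ⟨b, y, hy, rfl⟩
  have hy' : D.c l.succ * y ∈ D.res.alg := mul_mem (D.res.c_mem l) hy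
  cases b
  · simpa using D.VV_mk false hy'
  · have := D.VV_mk true hy'
    rw [pw_true, ← mul_assoc, D.c_anti _ _ (Fin.succ_ne_zero l), neg_mul, mul_assoc]
    exact neg_mem this

lemma VV_ξ (D : HData a A (n+1)) (l : Fin n) : ∀ x ∈ D.VV, D.ξ l.succ * x ∈ D.VV := by
  apply span_left
  rintro _ ⟨b, y, hy, rfl⟩
  have hy' : D.ξ l.succ * y ∈ D.res.alg := mul_mem (D.res.ξ_mem l) hy
  cases b
  · simpa using D.VV_mk false hy'
  · have := D.VV_mk true hy'
    rw [pw_true, ← mul_assoc, D.ξ_c' _ _ (Fin.succ_ne_zero l), mul_assoc]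
    exact this

/-- the spanning submodule -/
def SS (D : HData a A (n+1)) : Submodule ℂ A :=
  Submodule.span ℂ {x | ∃ w b, ∃ v ∈ D.VV, x = D.σ w * (pw (D.ξ 0) b * v)}

lemma SS_mk (D : HData a A (n+1)) (w b) {v} (hv : v ∈ D.VV) : D.σ w * (pw (D.ξ 0) b * v) ∈ D.SS :=
  Submodule.subset_span ⟨w, b, v, hv, rfl⟩

lemma SS_σ (D : HData a A (n+1)) (u) : ∀ x ∈ D.SS, D.σ u * x ∈ D.SS := by
  apply span_left
  rintro _ ⟨w, b, v, hv, rfl⟩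
  rw [← mul_assoc, ← map_mul]; exact D.SS_mk _ _ hv

lemma SS_c (D : HData a A (n+1)) (i) : ∀ x ∈ D.SS, D.c i * x ∈ D.SS := by
  apply span_left
  rintro _ ⟨w, b, v, hv, rfl⟩
  rw [← mul_assoc, D.c_σ, mul_assoc]
  apply D.SS_σ
  refine Fin.cases ?_ (fun l => ?_) (w⁻¹ i)
  · have hv' := D.VV_c0 v hv
    have := D.SS_mk 1 b hv'
    rw [map_one, one_mul] at this
    cases b
    · simpa using this
    · rw [pw_true] at *
      have h2 : D.c 0 * D.ξ 0 = -(D.ξ 0 * D.c 0) := by rw [D.ξ_c]; simp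
      rw [← mul_assoc, h2, neg_mul, mul_assoc]
      exact neg_mem this
  · have hv' := D.VV_c l v hv
    have := D.SS_mk 1 b hv'
    rw [map_one, one_mul] at this
    cases b
    · simpa using this
    · rw [pw_true] at *
      rw [← mul_assoc, ← D.ξ_c' _ _ (Fin.succ_ne_zero l).symm, mul_assoc]
      exact this

lemma SS_ξ (D : HData a A (n+1)) (i) : ∀ x ∈ D.SS, D.ξ i * x ∈ D.SS := by
  apply span_left
  rintro _ ⟨w, b, v, hv, rfl⟩
  rw [← mul_assoc, D.ξ_σ, mul_assoc]
  apply D.SS_σ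
  refine Fin.cases ?_ (fun l => ?_) (w⁻¹ i)
  · cases b
    · have := D.SS_mk 1 true hv
      simpa using this
    · have := D.SS_mk 1 false hv
      rw [pw_true, ← mul_assoc, D.ξ_sq, ← Algebra.smul_def]
      apply Submodule.smul_mem
      simpa using this
  · have h0 : ∀ b, ∀ v ∈ D.VV, pw (D.ξ 0) b * v ∈ D.SS := by
      intro b v hv; simpa using D.SS_mk 1 b hv
    cases b
    · simpa using h0 false _ (D.VV_ξ l v hv)
    · rw [pw_true, ← mul_assoc, D.comm0 _ _ (Fin.succ_ne_zero l), add_mul]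
      apply add_mem
      · rw [mul_assoc]; exact h0 true _ (D.VV_ξ l v hv)
      · rw [mul_assoc]
        apply D.SS_σ
        rw [sub_mul, mul_assoc, mul_assoc]
        have hG : ∀ v ∈ D.VV, (1 + D.c l.succ * D.c 0) * v ∈ D.VV := by
          intro v hv
          rw [add_mul, one_mul, mul_assoc]
          exact add_mem hv (D.VV_c l _ (D.VV_c0 _ hv))
        apply sub_mem
        · exact h0 true _ (hG _ hv)
        · have := h0 false _ (hG _ (D.VV_ξ l _ hv))
          simpa using this

lemma one_mem_VV (D : HData a A (n+1)) : (1 : A) ∈ D.VV := by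
  simpa using D.VV_mk false (one_mem _)

lemma spanStep (D : HData a A (n+1)) : ∀ x ∈ D.alg, x ∈ D.SS := by
  apply adjoin_le_of_left
  · simpa using D.SS_mk 1 false D.one_mem_VV
  · rintro _ ((⟨w, rfl⟩ | ⟨i, rfl⟩) | ⟨i, rfl⟩)
    · exact D.SS_σ w
    · exact D.SS_c i
    · exact D.SS_ξ i

lemma spanStep' (D : HData a A (n+1)) : ∀ x ∈ D.alg, x ∈ Submodule.span ℂ
    {x | ∃ w b b', ∃ y ∈ D.res.alg, x = D.σ w * (pw (D.ξ 0) b * (pw (D.c 0) b' * y))} := by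
  intro x hx
  have := D.spanStep x hx
  refine (Submodule.span_le.2 ?_ : D.SS ≤ _) this
  rintro _ ⟨w, b, v, hv, rfl⟩
  rw [← mul_assoc]
  refine span_left _ ?_ v hv
  rintro _ ⟨b', y, hy, rfl⟩
  exact Submodule.subset_span ⟨w, b, b', y, hy, by rw [mul_assoc]⟩

/-- increasing monomial -/
def mon (D : HData a A n) (α β : Fin n → Bool) : A :=
  (List.ofFn (fun i => pw (D.ξ i) (α i) * pw (D.c i) (β i))).prod

lemma mon_succ (D : HData a A (n+1)) (α β : Fin (n+1) → Bool) :
    D.mon α β = pw (D.ξ 0) (α 0) * pw (D.c 0) (β 0) *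
      D.res.mon (fun i => α i.succ) (fun i => β i.succ) := by
  simp [mon, List.ofFn_succ]

lemma spanL : ∀ (n : ℕ) (D : HData a A n), ∀ x ∈ D.alg, x ∈ Submodule.span ℂ
    {x | ∃ w α β, x = D.σ w * D.mon α β} := by
  intro n
  induction n with
  | zero =>
    intro D
    apply adjoin_le_of_left
    · exact Submodule.subset_span ⟨1, Fin.elim0, Fin.elim0, by simp [mon]⟩
    · rintro _ ((⟨w, rfl⟩ | ⟨i, rfl⟩) | ⟨i, rfl⟩)
      · apply span_left
        rintro _ ⟨w', α, β, rfl⟩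
        exact Submodule.subset_span ⟨w * w', α, β, by rw [map_mul, mul_assoc]⟩
      · exact i.elim0
      · exact i.elim0
  | succ n ih =>
    intro D x hx
    refine (Submodule.span_le.2 ?_) (D.spanStep' x hx)
    rintro _ ⟨w, b, b', y, hy, rfl⟩
    rw [← mul_assoc, ← mul_assoc]
    refine span_left _ ?_ y (ih D.res y hy)
    rintro _ ⟨u, α, β, rfl⟩
    refine Submodule.subset_span ⟨w * up u, Fin.cons b α, Fin.cons b' β, ?_⟩
    rw [mon_succ]
    simp only [Fin.cons_zero, Fin.cons_succ, map_mul]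
    have h1 : pw (D.c 0) b' * D.σ (up u) = D.σ (up u) * pw (D.c 0) b' := by
      cases b' <;> simp [D.σ_c]
    have h2 : pw (D.ξ 0) b * D.σ (up u) = D.σ (up u) * pw (D.ξ 0) b := by
      cases b <;> simp [D.σ_ξ]
    simp only [res_σ, MonoidHom.comp_apply]
    calc D.σ w * pw (D.ξ 0) b * pw (D.c 0) b' * (D.σ (up u) * D.res.mon α β)
        = D.σ w * pw (D.ξ 0) b * (pw (D.c 0) b' * D.σ (up u)) * D.res.mon α β := by
          simp only [mul_assoc]
      _ = D.σ w * (pw (D.ξ 0) b * D.σ (up u)) * pw (D.c 0) b' * D.res.mon α β := by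
          rw [h1]; simp only [mul_assoc]
      _ = _ := by rw [h2]; simp only [mul_assoc]

/-- reversed opposite data -/
def opData (D : HData a A n) : HData a Aᵐᵒᵖ n where
  σ := { toFun := fun w => MulOpposite.op (D.σ (Fin.revPerm * w⁻¹ * Fin.revPerm))
         map_one' := by
          have : (Fin.revPerm * Fin.revPerm : Equiv.Perm (Fin n)) = 1 := by ext; simp
          simp [this]
         map_mul' := fun u v => by
          rw [← MulOpposite.op_mul, ← map_mul]
          congr 2
          ext; simp }
  c := fun i => MulOpposite.op (D.c i.rev)
  ξ := fun i => MulOpposite.op (D.ξ i.rev)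
  c_sq := fun i => by rw [← MulOpposite.op_mul, D.c_sq]; rfl
  c_anti := fun i j h => by
    rw [← MulOpposite.op_mul, D.c_anti _ _ (by simpa using h.symm)]; rfl
  σ_c := fun w i => by
    simp only [MonoidHom.coe_mk, OneHom.coe_mk, ← MulOpposite.op_mul, D.σ_c]
    simp
  σ_ξ := fun w i => by
    simp only [MonoidHom.coe_mk, OneHom.coe_mk, ← MulOpposite.op_mul, D.σ_ξ]
    simp
  ξ_sq := fun i => by rw [← MulOpposite.op_mul, D.ξ_sq]; rfl
  ξ_c := fun i => by
    rw [← MulOpposite.op_mul, ← MulOpposite.op_mul, D.ξ_c]; simp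
  ξ_c' := fun i j h => by
    rw [← MulOpposite.op_mul, ← MulOpposite.op_mul, D.ξ_c' _ _ (by simpa using h)]
  ξ_ξ := fun i j h => by
    have h' : i.rev ≠ j.rev := by simpa using h
    have e : Fin.revPerm * (Equiv.swap i j)⁻¹ * Fin.revPerm = Equiv.swap i.rev j.rev := by
      ext x
      have := Equiv.swap_apply_apply Fin.revPerm i j
      simp only [Fin.revPerm_apply] at this
      rw [this]; simp
    simp only [MonoidHom.coe_mk, OneHom.coe_mk, e]
    have h3 := D.comm0 i.rev j.rev h'.symm
    apply MulOpposite.unop_injective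
    simp only [MulOpposite.unop_sub, MulOpposite.unop_mul, MulOpposite.unop_op, MulOpposite.unop_one]
    rw [h3]
    have h4 := D.c_anti _ _ h'
    have h5 := D.ξ_c i.rev
    have h6 := D.ξ_c' _ _ h'
    have h7 : D.ξ i.rev * D.σ (Equiv.swap i.rev j.rev) = D.σ (Equiv.swap i.rev j.rev) * D.ξ j.rev := by
      rw [D.ξ_σ]; simp
    rw [← mul_assoc, h7]
    have h8 : D.ξ i.rev * (D.c j.rev * D.c i.rev) = - (D.c j.rev * D.c i.rev * D.ξ i.rev) := by
      rw [← mul_assoc, h6, mul_assoc, h5]; noncomm_ring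
    have h9 : D.ξ j.rev * (D.c j.rev * D.c i.rev) = - (D.c j.rev * D.c i.rev * D.ξ j.rev) := by
      rw [← mul_assoc, D.ξ_c, neg_mul, mul_assoc, D.ξ_c' _ _ h'.symm]; noncomm_ring
    simp only [mul_add, mul_sub, mul_one, one_mul, add_mul, sub_mul, h8]
    simp only [mul_assoc, h9]
    noncomm_ring

end HData
namespace HData
variable {a : ℂ} {A : Type} [Ring A] [Algebra ℂ A] {n : ℕ}
/-- increasing monomial, other order -/
def monr (D : HData a A n) (α β : Fin n → Bool) : A :=
  (List.ofFn (fun i => pw (D.c i) (β i) * pw (D.ξ i) (α i))).prod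

lemma unop_mon (D : HData a A n) (α β : Fin n → Bool) :
    MulOpposite.unop (D.opData.mon α β) = D.monr (fun i => α i.rev) (fun i => β i.rev) := by
  rw [mon, monr, MulOpposite.unop_list_prod, List.map_ofFn]
  have hrev : ∀ f : Fin n → A, (List.ofFn f).reverse = List.ofFn (fun i => f i.rev) := by
    intro f
    apply List.ext_getElem
    · simp
    · intro i h1 h2
      simp only [List.getElem_reverse, List.getElem_ofFn, List.length_ofFn]
      congr 1
      ext
      simp [Fin.rev]
      omega
  rw [hrev]
  congr 2
  funext i
  simp only [Function.comp, MulOpposite.unop_mul]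
  congr 1
  · cases β i.rev <;> simp [opData]
  · cases α i.rev <;> simp [opData]

lemma op_mem (D : HData a A n) : ∀ x ∈ D.alg, MulOpposite.op x ∈ D.opData.alg := by
  intro x hx
  induction hx using Algebra.adjoin_induction with
  | mem x hx =>
    obtain ((⟨w, rfl⟩ | ⟨i, rfl⟩) | ⟨i, rfl⟩) := hx
    · have := D.opData.σ_mem (Fin.revPerm * w⁻¹ * Fin.revPerm)
      have e : Fin.revPerm * (Fin.revPerm * w⁻¹ * Fin.revPerm)⁻¹ * Fin.revPerm = w := by
        ext; simp
      have e2 : D.opData.σ (Fin.revPerm * w⁻¹ * Fin.revPerm) = MulOpposite.op (D.σ w) := by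
        conv_rhs => rw [← e]
        rfl
      rwa [e2] at this
    · simpa [opData] using D.opData.c_mem i.rev
    · simpa [opData] using D.opData.ξ_mem i.rev
  | algebraMap r => exact algebraMap_mem _ r
  | add x y _ _ hx hy => exact add_mem hx hy
  | mul x y _ _ hx hy => exact mul_mem hy hx

lemma spanR (D : HData a A n) : ∀ x ∈ D.alg, x ∈ Submodule.span ℂ
    {x | ∃ w α β, x = D.monr α β * D.σ w} := by
  intro x hx
  have h1 := spanL n D.opData _ (D.op_mem x hx)
  set S := Submodule.span ℂ {x | ∃ w α β, x = D.monr α β * D.σ w}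
  have : Submodule.span ℂ {x | ∃ w α β, x = D.opData.σ w * D.opData.mon α β}
      ≤ S.comap (MulOpposite.opLinearEquiv ℂ).symm.toLinearMap := by
    rw [Submodule.span_le]
    rintro _ ⟨w, α, β, rfl⟩
    apply Submodule.subset_span
    refine ⟨Fin.revPerm * w⁻¹ * Fin.revPerm, fun i => α i.rev, fun i => β i.rev, ?_⟩
    · simp only [LinearEquiv.coe_coe, MulOpposite.coe_opLinearEquiv_symm, MulOpposite.unop_mul, unop_mon]
      rfl
  exact this h1

/-- the opposite data multiplies -/
lemma mon_mem (D : HData a A n) (α β) : D.mon α β ∈ D.alg := by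
  apply list_prod_mem
  intro x hx
  rw [List.mem_ofFn] at hx
  obtain ⟨i, rfl⟩ := hx
  apply mul_mem
  · cases α i
    · exact one_mem _
    · exact D.ξ_mem i
  · cases β i
    · exact one_mem _
    · exact D.c_mem i

end HData
end

section
/-- generators of the presented algebra -/
inductive HGen (n : ℕ) : Type
  | s : Equiv.Perm (Fin n) → HGen n
  | c : Fin n → HGen n
  | x : Fin n → HGen n

namespace HGen
variable {n : ℕ}
/-- free generator -/
abbrev fs (w : Equiv.Perm (Fin n)) : FreeAlgebra ℂ (HGen n) := FreeAlgebra.ι ℂ (HGen.s w)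
/-- free generator -/
abbrev fc (i : Fin n) : FreeAlgebra ℂ (HGen n) := FreeAlgebra.ι ℂ (HGen.c i)
/-- free generator -/
abbrev fx (i : Fin n) : FreeAlgebra ℂ (HGen n) := FreeAlgebra.ι ℂ (HGen.x i)
end HGen
open HGen in
/-- defining relations -/
inductive HRel (a : ℂ) (n : ℕ) : FreeAlgebra ℂ (HGen n) → FreeAlgebra ℂ (HGen n) → Prop
  | one : HRel a n (fs 1) 1
  | mul (u v) : HRel a n (fs (u * v)) (fs u * fs v)
  | c_sq (i) : HRel a n (fc i * fc i) (-1)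
  | c_anti (i j) (h : i ≠ j) : HRel a n (fc i * fc j) (-(fc j * fc i))
  | σ_c (w i) : HRel a n (fs w * fc i) (fc (w i) * fs w)
  | σ_ξ (w i) : HRel a n (fs w * fx i) (fx (w i) * fs w)
  | ξ_sq (i) : HRel a n (fx i * fx i) (algebraMap ℂ _ a)
  | ξ_c (i) : HRel a n (fx i * fc i) (-(fc i * fx i))
  | ξ_c' (i j) (h : i ≠ j) : HRel a n (fx i * fc j) (fc j * fx i)
  | ξ_ξ (i j) (h : i ≠ j) : HRel a n (fx i * fx j - fx j * fx i)
      (fx i * ((1 - fc i * fc j) * fs (Equiv.swap i j)) - (1 - fc i * fc j) * fs (Equiv.swap i j) * fx i)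

/-- presented algebra -/
def HH (a : ℂ) (n : ℕ) : Type := RingQuot (HRel a n)

instance (a n) : Ring (HH a n) := inferInstanceAs (Ring (RingQuot (HRel a n)))
instance (a n) : Algebra ℂ (HH a n) := inferInstanceAs (Algebra ℂ (RingQuot (HRel a n)))

namespace HH
/-- quotient map -/
def mk (a n) : FreeAlgebra ℂ (HGen n) →ₐ[ℂ] HH a n := RingQuot.mkAlgHom ℂ (HRel a n)

lemma mk_rel {a n x y} (h : HRel a n x y) : mk a n x = mk a n y := RingQuot.mkAlgHom_rel ℂ h

/-- the universal data -/
def D (a : ℂ) (n : ℕ) : HData a (HH a n) n where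
  σ := { toFun := fun w => mk a n (HGen.fs w)
         map_one' := by simpa using mk_rel (HRel.one (a := a) (n := n))
         map_mul' := fun u v => by simpa using mk_rel (HRel.mul (a := a) u v) }
  c := fun i => mk a n (HGen.fc i)
  ξ := fun i => mk a n (HGen.fx i)
  c_sq := fun i => by simpa using mk_rel (HRel.c_sq (a := a) i)
  c_anti := fun i j h => by simpa using mk_rel (HRel.c_anti (a := a) i j h)
  σ_c := fun w i => by simpa using mk_rel (HRel.σ_c (a := a) w i)
  σ_ξ := fun w i => by simpa using mk_rel (HRel.σ_ξ (a := a) w i)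
  ξ_sq := fun i => by simpa using mk_rel (HRel.ξ_sq (a := a) i)
  ξ_c := fun i => by simpa using mk_rel (HRel.ξ_c (a := a) i)
  ξ_c' := fun i j h => by simpa using mk_rel (HRel.ξ_c' (a := a) i j h)
  ξ_ξ := fun i j h => by simpa using mk_rel (HRel.ξ_ξ (a := a) i j h)

variable {a : ℂ} {n : ℕ} {A : Type} [Ring A] [Algebra ℂ A]

/-- value on generators -/
def genVal (E : HData a A n) : HGen n → A
  | .s w => E.σ w
  | .c i => E.c i
  | .x i => E.ξ i

/-- universal property -/
def lift (E : HData a A n) : HH a n →ₐ[ℂ] A :=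
  RingQuot.liftAlgHom ℂ ⟨FreeAlgebra.lift ℂ (genVal E), by
    intro x y h
    cases h with
    | one => simp [genVal]
    | mul u v => simp [genVal]
    | c_sq i => simp [genVal, E.c_sq]
    | c_anti i j h => simp [genVal, E.c_anti _ _ h]
    | σ_c w i => simp [genVal, E.σ_c]
    | σ_ξ w i => simp [genVal, E.σ_ξ]
    | ξ_sq i => simp [genVal, E.ξ_sq]
    | ξ_c i => simp [genVal, E.ξ_c]
    | ξ_c' i j h => simp [genVal, E.ξ_c' _ _ h]
    | ξ_ξ i j h => simpa [genVal] using E.ξ_ξ _ _ h⟩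

@[simp] lemma lift_mk (E : HData a A n) (x) : lift E (mk a n x) = FreeAlgebra.lift ℂ (genVal E) x := by
  unfold lift mk
  exact RingQuot.liftAlgHom_mkAlgHom_apply ..
@[simp] lemma lift_σ (E : HData a A n) (w) : lift E ((D a n).σ w) = E.σ w := by
  simp [D, genVal]
@[simp] lemma lift_c (E : HData a A n) (i) : lift E ((D a n).c i) = E.c i := by
  simp [D, genVal]
@[simp] lemma lift_ξ (E : HData a A n) (i) : lift E ((D a n).ξ i) = E.ξ i := by
  simp [D, genVal]

lemma alg_top : (D a n).alg = ⊤ := by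
  rw [eq_top_iff]
  rintro x -
  obtain ⟨y, rfl⟩ : ∃ y, mk a n y = x := RingQuot.mkAlgHom_surjective ℂ (HRel a n) x
  induction y using FreeAlgebra.induction with
  | grade0 r => rw [AlgHom.commutes]; exact algebraMap_mem _ r
  | grade1 g =>
    cases g with
    | s w => exact (D a n).σ_mem w
    | c w => exact (D a n).c_mem w
    | x w => exact (D a n).ξ_mem w
  | mul x y hx hy => rw [map_mul]; exact mul_mem hx hy
  | add x y hx hy => rw [map_add]; exact add_mem hx hy

lemma mem_alg (x : HH a n) : x ∈ (D a n).alg := by rw [alg_top]; trivial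

/-- induction by left multiplication on a submodule-like property -/
lemma ind {C : HH a n → Prop} (σ : ∀ w, C ((D a n).σ w)) (c : ∀ i, C ((D a n).c i))
    (ξ : ∀ i, C ((D a n).ξ i)) (sc : ∀ r, C (algebraMap ℂ _ r)) (add : ∀ x y, C x → C y → C (x + y))
    (mul : ∀ x y, C x → C y → C (x * y)) (x) : C x := by
  have := mem_alg x
  induction this using Algebra.adjoin_induction with
  | mem x hx =>
    obtain ((⟨w, rfl⟩ | ⟨i, rfl⟩) | ⟨i, rfl⟩) := hx
    · exact σ w
    · exact c i
    · exact ξ i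
  | algebraMap r => exact sc r
  | add x y _ _ hx hy => exact add x y hx hy
  | mul x y _ _ hx hy => exact mul x y hx hy

/-- data with negated Clifford generators -/
def negData (E : HData a A n) : HData a A n where
  σ := E.σ
  c := fun i => - E.c i
  ξ := E.ξ
  c_sq := by simp [E.c_sq]
  c_anti := fun i j h => by simp [E.c_anti i j h]
  σ_c := by simp [E.σ_c]
  σ_ξ := E.σ_ξ
  ξ_sq := E.ξ_sq
  ξ_c := by simp [E.ξ_c]
  ξ_c' := fun i j h => by simp [E.ξ_c' i j h]
  ξ_ξ := fun i j h => by simpa using E.ξ_ξ i j h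

/-- parity automorphism -/
def γ : HH a n →ₐ[ℂ] HH a n := lift (negData (D a n))
@[simp] lemma γ_σ (w) : γ ((D a n).σ w) = (D a n).σ w := lift_σ _ _
@[simp] lemma γ_c (w) : γ ((D a n).c w) = - (D a n).c w := lift_c _ _
@[simp] lemma γ_ξ (w) : γ ((D a n).ξ w) = (D a n).ξ w := lift_ξ _ _
@[simp] lemma γ_γ (x : HH a n) : γ (γ x) = x := by
  induction x using ind with
  | σ w => simp
  | c i => simp
  | ξ i => simp
  | sc r => simp
  | add x y hx hy => simp [hx, hy]
  | mul x y hx hy => simp [hx, hy]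

/-- inclusion on the last strands -/
def inc : HH a n →ₐ[ℂ] HH a (n+1) := lift (D a (n+1)).res
@[simp] lemma inc_σ (w) : inc ((D a n).σ w) = (D a (n+1)).σ (up w) := by simp [inc]
@[simp] lemma inc_c (i) : inc ((D a n).c i) = (D a (n+1)).c i.succ := by simp [inc]
@[simp] lemma inc_ξ (i) : inc ((D a n).ξ i) = (D a (n+1)).ξ i.succ := by simp [inc]

lemma inc_γ (x : HH a n) : γ (inc x) = inc (γ x) := by
  induction x using ind with
  | σ w => simp
  | c i => simp
  | ξ i => simp
  | sc r => simp
  | add x y hx hy => simp [hx, hy]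
  | mul x y hx hy => simp [hx, hy]

/-- `c₀` supercommutes with the image of `inc` -/
lemma c0_inc (x : HH a n) : (D a (n+1)).c 0 * inc x = inc (γ x) * (D a (n+1)).c 0 := by
  induction x using ind with
  | σ w => simp [(D a (n+1)).σ_c]
  | c i => simp [(D a (n+1)).c_anti 0 i.succ (Fin.succ_ne_zero i).symm]
  | ξ i => simp [(D a (n+1)).ξ_c' i.succ 0 (Fin.succ_ne_zero i)]
  | sc r => simp [Algebra.commutes]
  | add x y hx hy => simp [hx, hy, mul_add, add_mul]
  | mul x y hx hy => simp only [map_mul]; rw [← mul_assoc, hx, mul_assoc, hy, mul_assoc]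

lemma res_alg (x : HH a n) : inc x ∈ (D a (n+1)).res.alg := by
  induction x using ind with
  | σ w => simpa using (D a (n+1)).res.σ_mem w
  | c i => simpa using (D a (n+1)).res.c_mem i
  | ξ i => simpa using (D a (n+1)).res.ξ_mem i
  | sc r => simp
  | add x y hx hy => rw [map_add]; exact add_mem hx hy
  | mul x y hx hy => rw [map_mul]; exact mul_mem hx hy

lemma res_alg' (x) (hx : x ∈ (D a (n+1)).res.alg) : ∃ y : HH a n, inc y = x := by
  induction hx using Algebra.adjoin_induction with
  | mem x hx =>
    obtain ((⟨w, rfl⟩ | ⟨i, rfl⟩) | ⟨i, rfl⟩) := hx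
    · exact ⟨(D a n).σ w, by simp⟩
    · exact ⟨(D a n).c i, by simp⟩
    · exact ⟨(D a n).ξ i, by simp⟩
  | algebraMap r => exact ⟨algebraMap _ _ r, by simp⟩
  | add x y _ _ hx hy =>
    obtain ⟨x', rfl⟩ := hx
    obtain ⟨y', rfl⟩ := hy
    exact ⟨x' + y', by simp⟩
  | mul x y _ _ hx hy =>
    obtain ⟨x', rfl⟩ := hx
    obtain ⟨y', rfl⟩ := hy
    exact ⟨x' * y', by simp⟩

lemma span_succ (x : HH a (n+1)) : x ∈ Submodule.span ℂ
    {x | ∃ w b b', ∃ y : HH a n, x = (D a (n+1)).σ w * (pw ((D a (n+1)).ξ 0) b *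
      (pw ((D a (n+1)).c 0) b' * inc y))} := by
  have := (D a (n+1)).spanStep' x (mem_alg x)
  refine Submodule.span_mono ?_ this
  rintro _ ⟨w, b, b', y, hy, rfl⟩
  obtain ⟨y', rfl⟩ := res_alg' y hy
  exact ⟨w, b, b', y', rfl⟩

end HH
end

section
namespace HH
variable {a : ℂ} {n : ℕ}

/-- `H ⊕ c₀ H` -/
abbrev VM (a : ℂ) (n : ℕ) : Type := HH a n × HH a n

/-- left mult -/
abbrev ml (y : HH a n) : HH a n →ₗ[ℂ] HH a n := LinearMap.mulLeft ℂ y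

/-- operators on V -/
def vU (u : Equiv.Perm (Fin n)) : VM a n →ₗ[ℂ] VM a n :=
  (ml ((D a n).σ u)).prodMap (ml ((D a n).σ u))
/-- operators on V -/
def vX (i : Fin n) : VM a n →ₗ[ℂ] VM a n :=
  (ml ((D a n).ξ i)).prodMap (ml ((D a n).ξ i))
/-- operators on V -/
def vC (i : Fin n) : VM a n →ₗ[ℂ] VM a n :=
  (ml ((D a n).c i)).prodMap (-(ml ((D a n).c i)))
/-- operators on V -/
def vC0 : VM a n →ₗ[ℂ] VM a n :=
  LinearMap.prod (-LinearMap.snd ℂ _ _) (LinearMap.fst ℂ _ _)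

@[simp] lemma vU_mk (u) (y z : HH a n) : vU u (y, z) = ((D a n).σ u * y, (D a n).σ u * z) := rfl
@[simp] lemma vX_mk (u) (y z : HH a n) : vX u (y, z) = ((D a n).ξ u * y, (D a n).ξ u * z) := rfl
@[simp] lemma vC_mk (u) (y z : HH a n) : vC u (y, z) = ((D a n).c u * y, -((D a n).c u * z)) := rfl
@[simp] lemma vC0_mk (y z : HH a n) : vC0 (y, z) = (-z, y) := rfl

lemma vU_one (x : VM a n) : vU 1 x = x := by obtain ⟨y, z⟩ := x; simp
lemma vU_vU (u v) (x : VM a n) : vU u (vU v x) = vU (u * v) x := by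
  obtain ⟨y, z⟩ := x; simp [mul_assoc]
lemma vU_vX (u i) (x : VM a n) : vU u (vX i x) = vX (u i) (vU u x) := by
  obtain ⟨y, z⟩ := x; simp [← mul_assoc, (D a n).σ_ξ]
lemma vU_vC (u i) (x : VM a n) : vU u (vC i x) = vC (u i) (vU u x) := by
  obtain ⟨y, z⟩ := x; simp [← mul_assoc, (D a n).σ_c]
lemma vU_vC0 (u) (x : VM a n) : vU u (vC0 x) = vC0 (vU u x) := by
  obtain ⟨y, z⟩ := x; simp
lemma vX_vC0 (u) (x : VM a n) : vX u (vC0 x) = vC0 (vX u x) := by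
  obtain ⟨y, z⟩ := x; simp
lemma vC_vC0 (u) (x : VM a n) : vC u (vC0 x) = -vC0 (vC u x) := by
  obtain ⟨y, z⟩ := x; simp
lemma vC0_vC0 (x : VM a n) : vC0 (vC0 x) = - x := by
  obtain ⟨y, z⟩ := x; simp
lemma vC_vC (i) (x : VM a n) : vC i (vC i x) = - x := by
  obtain ⟨y, z⟩ := x; simp [← mul_assoc, (D a n).c_sq]
lemma vX_vX (i) (x : VM a n) : vX i (vX i x) = a • x := by
  obtain ⟨y, z⟩ := x; simp [← mul_assoc, (D a n).ξ_sq, Algebra.smul_def]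
lemma vC_vC' (i j) (h : i ≠ j) (x : VM a n) : vC i (vC j x) = - vC j (vC i x) := by
  obtain ⟨y, z⟩ := x; simp [← mul_assoc, (D a n).c_anti i j h]
lemma vX_vC (i) (x : VM a n) : vX i (vC i x) = - vC i (vX i x) := by
  obtain ⟨y, z⟩ := x; simp [← mul_assoc, (D a n).ξ_c i]
lemma vX_vC' (i j) (h : i ≠ j) (x : VM a n) : vX i (vC j x) = vC j (vX i x) := by
  obtain ⟨y, z⟩ := x; simp [← mul_assoc, (D a n).ξ_c' i j h]
lemma vX_comm (i j) (h : i ≠ j) (x : VM a n) :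
    vX i (vX j x) = vX j (vX i x) + (vX i (vU (Equiv.swap i j) x) + vC i (vC j (vX i (vU (Equiv.swap i j) x)))
      - vX j (vU (Equiv.swap i j) x) + vC i (vC j (vX j (vU (Equiv.swap i j) x)))) := by
  obtain ⟨y, z⟩ := x
  have h1 := (D a n).ξ_ξ i j h
  have h2 : (D a n).ξ i * ((D a n).c i * (D a n).c j) = -((D a n).c i * ((D a n).c j * (D a n).ξ i)) := by
    rw [← mul_assoc, (D a n).ξ_c, neg_mul, mul_assoc, (D a n).ξ_c' _ _ h]
  have h3 : (D a n).σ (Equiv.swap i j) * (D a n).ξ i = (D a n).ξ j * (D a n).σ (Equiv.swap i j) := by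
    rw [(D a n).σ_ξ]; simp
  have h4 : (D a n).ξ i * (D a n).ξ j = (D a n).ξ j * (D a n).ξ i + ((D a n).ξ i * (D a n).σ (Equiv.swap i j)
    + (D a n).c i * ((D a n).c j * ((D a n).ξ i * (D a n).σ (Equiv.swap i j)))
    - (D a n).ξ j * (D a n).σ (Equiv.swap i j) + (D a n).c i * ((D a n).c j * ((D a n).ξ j * (D a n).σ (Equiv.swap i j)))) := by
    rw [sub_eq_iff_eq_add] at h1
    rw [h1, mul_assoc (1 - _), h3, sub_mul, one_mul, sub_mul, one_mul, mul_sub, ← mul_assoc ((D a n).ξ i), h2]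
    noncomm_ring
  ext
  · simp only [vX_mk, vU_mk, vC_mk, Prod.fst_add, Prod.fst_sub, ← mul_assoc, h4]
    noncomm_ring
  · simp only [vX_mk, vU_mk, vC_mk, Prod.snd_add, Prod.snd_sub, ← mul_assoc, h4]
    noncomm_ring

/-- `1 + c_l c_0` -/
def vG (i : Fin n) : VM a n →ₗ[ℂ] VM a n := LinearMap.id + vC i ∘ₗ vC0
lemma vG_apply (i) (x : VM a n) : vG i x = x + vC i (vC0 x) := rfl
lemma vU_vG (u i) (x : VM a n) : vU u (vG i x) = vG (u i) (vU u x) := by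
  simp [vG_apply, vU_vC, vU_vC0]

/-- induced module -/
abbrev PM (a : ℂ) (n : ℕ) : Type := Fin (n+1) × Bool → VM a n

/-- basis-type vectors -/
def vec (w : Equiv.Perm (Fin (n+1))) (b : Bool) : VM a n →ₗ[ℂ] PM a n :=
  LinearMap.single ℂ (fun _ => VM a n) (w 0, b) ∘ₗ vU (dn w)

lemma vec_up (w : Equiv.Perm (Fin (n+1))) (u) (b) (x : VM a n) :
    vec (w * up u) b x = vec w b (vU u x) := by
  simp [vec, dn_mul_up, vU_vU]

lemma dn_swap (j : Fin (n+1)) : dn (Equiv.swap 0 j) = 1 := by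
  simpa using dn_swap_up j 1

lemma vec_swap (j b) (x : VM a n) :
    vec (Equiv.swap 0 j) b x = Pi.single (j, b) x := by
  simp [vec, dn_swap, vU_one]

lemma PM_ext {M : Type} [AddCommGroup M] [Module ℂ M] {f g : PM a n →ₗ[ℂ] M}
    (h : ∀ w b x, f (vec w b x) = g (vec w b x)) : f = g := by
  apply LinearMap.pi_ext
  rintro ⟨j, b⟩ x
  rw [← vec_swap]; exact h _ _ _

/-- lifting -/
def lf {M : Type} [AddCommGroup M] [Module ℂ M] (f : Equiv.Perm (Fin (n+1)) → Bool → (VM a n →ₗ[ℂ] M)) :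
    PM a n →ₗ[ℂ] M :=
  ∑ jb : Fin (n+1) × Bool, f (Equiv.swap 0 jb.1) jb.2 ∘ₗ LinearMap.proj jb

lemma lf_vec {M : Type} [AddCommGroup M] [Module ℂ M] (f : Equiv.Perm (Fin (n+1)) → Bool → (VM a n →ₗ[ℂ] M))
    (hf : ∀ w u b x, f (w * up u) b x = f w b (vU u x)) (w b x) : lf f (vec w b x) = f w b x := by
  have h1 : ∀ j b x, lf f (Pi.single (j, b) x) = f (Equiv.swap 0 j) b x := by
    intro j b x
    simp only [lf, LinearMap.sum_apply, LinearMap.comp_apply, LinearMap.proj_apply]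
    rw [Finset.sum_eq_single (j, b)]
    · simp
    · intro jb _ hne; rw [Pi.single_eq_of_ne hne]; simp
    · simp
  conv_rhs => rw [dn_spec w]
  rw [hf, ← h1]
  rfl

/-- action of permutations -/
def pS (v : Equiv.Perm (Fin (n+1))) : PM a n →ₗ[ℂ] PM a n := lf (fun w b => vec (v * w) b)
lemma pS_vec (v w b) (x : VM a n) : pS v (vec w b x) = vec (v * w) b x := by
  apply lf_vec; intro w u b x; rw [← mul_assoc, vec_up]

/-- sign -/
def sg (b : Bool) : ℂ := if b then -1 else 1
@[simp] lemma sg_t : sg true = -1 := rfl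
@[simp] lemma sg_f : sg false = 1 := rfl

/-- action of Clifford generators -/
def pCf (w : Equiv.Perm (Fin (n+1))) (b : Bool) (i : Fin (n+1)) : VM a n →ₗ[ℂ] PM a n :=
  Fin.cases (motive := fun _ => VM a n →ₗ[ℂ] PM a n) (sg b • vec w b ∘ₗ vC0) (fun l => vec w b ∘ₗ vC l) i
/-- action of Clifford generators -/
def pC (i : Fin (n+1)) : PM a n →ₗ[ℂ] PM a n := lf (fun w b => pCf w b (w⁻¹ i))

lemma pCf_zero (w b) (x : VM a n) : pCf w b 0 x = sg b • vec w b (vC0 x) := rfl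
lemma pCf_succ (w b l) (x : VM a n) : pCf w b (Fin.succ l) x = vec w b (vC l x) := rfl

lemma pC_vec (i w b) (x : VM a n) : pC i (vec w b x) = pCf w b (w⁻¹ i) x := by
  apply lf_vec
  intro w u b x
  have : (w * up u)⁻¹ i = up u⁻¹ (w⁻¹ i) := by simp
  rw [this]
  refine Fin.cases ?_ (fun l => ?_) (w⁻¹ i)
  · rw [up_zero, pCf_zero, pCf_zero, vec_up, vU_vC0]
  · rw [up_succ, pCf_succ, pCf_succ, vec_up, vU_vC]; simp

/-- action of ξ -/
def pXf (w : Equiv.Perm (Fin (n+1))) (b : Bool) (i : Fin (n+1)) : VM a n →ₗ[ℂ] PM a n :=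
  Fin.cases (motive := fun _ => VM a n →ₗ[ℂ] PM a n)
    (if b then a • vec w false else vec w true)
    (fun l => if b then vec w true ∘ₗ vX l + vec (w * Equiv.swap 0 l.succ) true ∘ₗ vG l
        - vec (w * Equiv.swap 0 l.succ) false ∘ₗ vG l ∘ₗ vX l else vec w false ∘ₗ vX l) i
/-- action of ξ -/
def pX (i : Fin (n+1)) : PM a n →ₗ[ℂ] PM a n := lf (fun w b => pXf w b (w⁻¹ i))

lemma pXf_zf (w) (x : VM a n) : pXf w false 0 x = vec w true x := rfl
lemma pXf_zt (w) (x : VM a n) : pXf w true 0 x = a • vec w false x := rfl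
lemma pXf_sf (w l) (x : VM a n) : pXf w false (Fin.succ l) x = vec w false (vX l x) := rfl
lemma pXf_st (w l) (x : VM a n) : pXf w true (Fin.succ l) x = vec w true (vX l x)
  + vec (w * Equiv.swap 0 l.succ) true (vG l x) - vec (w * Equiv.swap 0 l.succ) false (vG l (vX l x)) := rfl

lemma up_mul_swap (u : Equiv.Perm (Fin n)) (l : Fin n) :
    up u * Equiv.swap 0 l.succ = Equiv.swap 0 (u l).succ * up u := by
  rw [Equiv.mul_swap_eq_swap_mul]; simp

lemma pX_vec (i w b) (x : VM a n) : pX i (vec w b x) = pXf w b (w⁻¹ i) x := by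
  apply lf_vec
  intro w u b x
  have : (w * up u)⁻¹ i = up u⁻¹ (w⁻¹ i) := by simp
  rw [this]
  refine Fin.cases ?_ (fun l => ?_) (w⁻¹ i)
  · rw [up_zero]
    cases b
    · rw [pXf_zf, pXf_zf, vec_up]
    · rw [pXf_zt, pXf_zt, vec_up]
  · rw [up_succ]
    cases b
    · rw [pXf_sf, pXf_sf, vec_up, vU_vX]; simp
    · rw [pXf_st, pXf_st, vec_up, vU_vX, mul_assoc w, up_mul_swap, ← mul_assoc w, vec_up, vec_up]
      simp [vU_vG, vU_vX]

lemma up_swap (i j : Fin n) : up (Equiv.swap i j) = Equiv.swap i.succ j.succ := by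
  ext x
  refine Fin.cases ?_ (fun x => ?_) x
  · rw [up_zero, Equiv.swap_apply_of_ne_of_ne (Fin.succ_ne_zero _).symm (Fin.succ_ne_zero _).symm]
  · rw [up_succ]
    by_cases h1 : x = i
    · subst h1; simp
    by_cases h2 : x = j
    · subst h2; simp
    rw [Equiv.swap_apply_of_ne_of_ne h1 h2, Equiv.swap_apply_of_ne_of_ne]
    · simpa using h1
    · simpa using h2

lemma vec_sw_sw (w : Equiv.Perm (Fin (n+1))) {l m : Fin n} (h : l ≠ m) (b) (x : VM a n) :
    vec (w * Equiv.swap 0 m.succ * Equiv.swap 0 l.succ) b x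
      = vec (w * Equiv.swap 0 l.succ) b (vU (Equiv.swap l m) x) := by
  rw [← vec_up, mul_assoc, mul_assoc, up_swap, Equiv.mul_swap_eq_swap_mul (Equiv.swap 0 l.succ)]
  rw [Equiv.swap_apply_right, Equiv.swap_apply_of_ne_of_ne (Fin.succ_ne_zero _) (by simpa using h.symm)]

lemma vec_swsw (w : Equiv.Perm (Fin (n+1))) (l m : Fin n) (b) (x : VM a n) :
    vec (w * Equiv.swap l.succ m.succ) b x = vec w b (vU (Equiv.swap l m) x) := by
  rw [← vec_up, up_swap]

lemma pS_sw (w : Equiv.Perm (Fin (n+1))) (i j b) (x : VM a n) :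
    pS (Equiv.swap (w i) (w j)) (vec w b x) = vec (w * Equiv.swap i j) b x := by
  rw [pS_vec, Equiv.mul_swap_eq_swap_mul]

end HH
namespace HH
variable {a : ℂ} {n : ℕ}

lemma pC_w (w b) (i) (x : VM a n) : pC (w i) (vec w b x) = pCf w b i x := by rw [pC_vec]; simp
lemma pX_w (w b) (i) (x : VM a n) : pX (w i) (vec w b x) = pXf w b i x := by rw [pX_vec]; simp
lemma pC_w' (w v b) (i) (x : VM a n) : pC (w i) (vec (w * v) b x) = pCf (w * v) b (v⁻¹ i) x := by
  rw [pC_vec]; simp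
lemma pX_w' (w v b) (i) (x : VM a n) : pX (w i) (vec (w * v) b x) = pXf (w * v) b (v⁻¹ i) x := by
  rw [pX_vec]; simp

lemma swap_succ_ne {l m : Fin n} (h : l ≠ m) : Equiv.swap 0 m.succ l.succ = l.succ :=
  Equiv.swap_apply_of_ne_of_ne (Fin.succ_ne_zero _) (by simpa using h)

lemma pX_pX (i j : Fin (n+1)) (h : i ≠ j) (x : PM a n) :
    pX i (pX j x) - pX j (pX i x) =
    pX i (pS (Equiv.swap i j) x) + pC i (pC j (pX i (pS (Equiv.swap i j) x)))
      - pX j (pS (Equiv.swap i j) x) + pC i (pC j (pX j (pS (Equiv.swap i j) x))) := by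
  have : pX i ∘ₗ pX j - pX j ∘ₗ pX i =
    pX i ∘ₗ pS (Equiv.swap i j) + pC i ∘ₗ pC j ∘ₗ pX i ∘ₗ pS (Equiv.swap i j)
      - pX j ∘ₗ pS (Equiv.swap i j) + (pC i ∘ₗ pC j ∘ₗ pX j ∘ₗ pS (Equiv.swap i j) : PM a n →ₗ[ℂ] PM a n) := by
    refine PM_ext (fun w b x => ?_)
    obtain ⟨i, rfl⟩ := w.surjective i
    obtain ⟨j, rfl⟩ := w.surjective j
    simp only [LinearMap.sub_apply, LinearMap.add_apply, LinearMap.comp_apply, pX_w, pS_sw]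
    have h' : i ≠ j := fun e => h (by rw [e])
    revert h'
    refine Fin.cases ?_ (fun l => ?_) i
    · refine Fin.cases (fun h' => absurd rfl h') (fun l _ => ?_) j
      cases b
      · simp [pXf_zf, pXf_sf, pXf_zt, pXf_st, pX_w, pX_w', pC_w, pC_w', pCf_zero, pCf_succ, vG_apply, vX_vC0, vC_vC0, vX_vC, vC_vC, vC0_vC0,
          mul_assoc w, swap_succ_ne]
        try abel
        done
      · simp [pXf_zf, pXf_sf, pXf_zt, pXf_st, pX_w, pX_w', pC_w, pC_w', pCf_zero, pCf_succ, vG_apply, vX_vC0, vC_vC0, vX_vC, vC_vC, vC0_vC0,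
          mul_assoc w, vX_vX]
        try abel
        done
    · refine Fin.cases (fun _ => ?_) (fun m h' => ?_) j
      · cases b
        · simp [pXf_zf, pXf_sf, pXf_zt, pXf_st, pX_w, pX_w', pC_w, pC_w', pCf_zero, pCf_succ, vG_apply, vX_vC0, vC_vC0, vX_vC, vC_vC, vC0_vC0,
            mul_assoc w, Equiv.swap_comm _ (0:Fin (n+1))]
          try abel
          done
        · simp [pXf_zf, pXf_sf, pXf_zt, pXf_st, pX_w, pX_w', pC_w, pC_w', pCf_zero, pCf_succ, vG_apply, vX_vC0, vC_vC0, vX_vC, vC_vC, vC0_vC0,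
            mul_assoc w, vX_vX, Equiv.swap_comm _ (0:Fin (n+1))]
          try abel
          done
      · have hlm : l ≠ m := fun e => h' (by rw [e])
        cases b
        · simp [pXf_zf, pXf_sf, pXf_zt, pXf_st, pX_w, pX_w', pC_w, pC_w', pCf_zero, pCf_succ, vec_swsw, vX_comm l m hlm]
          done
        · simp [pXf_zf, pXf_sf, pXf_zt, pXf_st, pX_w, pX_w', pC_w, pC_w', pCf_zero, pCf_succ, vec_swsw, swap_succ_ne hlm,
            swap_succ_ne hlm.symm, vec_sw_sw w hlm, vec_sw_sw w hlm.symm, vG_apply, vU_vC, vU_vX, vX_comm l m hlm, vU_vC0,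
            vX_vC0, vC_vC0, vX_vC, vC_vC, vC0_vC0, vX_vC' _ _ hlm, vX_vC' _ _ hlm.symm, vC_vC' _ _ hlm, Equiv.swap_comm m l]
          try abel
          done
  have := LinearMap.congr_fun this x
  simpa using this

end HH
end

section
namespace HH
variable {a : ℂ} {n : ℕ}

lemma fin_ne_cases {C : (i j : Fin (n+1)) → i ≠ j → Prop}
    (h1 : ∀ l : Fin n, C 0 l.succ (Fin.succ_ne_zero l).symm) (h2 : ∀ l : Fin n, C l.succ 0 (Fin.succ_ne_zero l))
    (h3 : ∀ (l m : Fin n) (h : l ≠ m), C l.succ m.succ (by simpa using h)) (i j) (h : i ≠ j) : C i j h := by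
  revert h
  refine Fin.cases ?_ (fun l => ?_) i
  · refine Fin.cases (fun h' => absurd rfl h') (fun l _ => h1 l) j
  · refine Fin.cases (fun _ => h2 l) (fun m h' => h3 l m (fun e => h' (by rw [e]))) j

lemma pC_sq (i : Fin (n+1)) : (pC i * pC i : Module.End ℂ (PM a n)) = -1 := by
  refine PM_ext (fun w b x => ?_)
  obtain ⟨i, rfl⟩ := w.surjective i
  refine Fin.cases ?_ (fun l => ?_) i
  · cases b <;> simp [pC_w, pCf_zero, vC0_vC0]
  · simp [pC_w, pCf_succ, vC_vC]

lemma pC_anti (i j : Fin (n+1)) (h : i ≠ j) : (pC i * pC j : Module.End ℂ (PM a n)) = -(pC j * pC i) := by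
  refine PM_ext (fun w b x => ?_)
  obtain ⟨i, rfl⟩ := w.surjective i
  obtain ⟨j, rfl⟩ := w.surjective j
  have h' : i ≠ j := fun e => h (by rw [e])
  clear h
  induction i, j, h' using fin_ne_cases with
  | h1 l => cases b <;> simp [pC_w, pCf_zero, pCf_succ, vC_vC0]
  | h2 l => cases b <;> simp [pC_w, pCf_zero, pCf_succ, vC_vC0]
  | h3 l m hlm => simp [pC_w, pCf_zero, pCf_succ, vC_vC' _ _ hlm]

lemma pS_pC (v) (i : Fin (n+1)) : (pS v * pC i : Module.End ℂ (PM a n)) = pC (v i) * pS v := by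
  refine PM_ext (fun w b x => ?_)
  obtain ⟨i, rfl⟩ := w.surjective i
  simp only [Module.End.mul_apply, pC_w, pS_vec]
  rw [pC_vec, show (v * w)⁻¹ (v (w i)) = i by simp]
  refine Fin.cases ?_ (fun l => ?_) i
  · simp [pCf_zero, pS_vec]
  · simp [pCf_succ, pS_vec]

lemma pS_pX (v) (i : Fin (n+1)) : (pS v * pX i : Module.End ℂ (PM a n)) = pX (v i) * pS v := by
  refine PM_ext (fun w b x => ?_)
  obtain ⟨i, rfl⟩ := w.surjective i
  simp only [Module.End.mul_apply, pX_w, pS_vec]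
  rw [pX_vec, show (v * w)⁻¹ (v (w i)) = i by simp]
  refine Fin.cases ?_ (fun l => ?_) i
  · cases b <;> simp [pXf_zf, pXf_zt, pS_vec]
  · cases b <;> simp [pXf_sf, pXf_st, pS_vec, mul_assoc]

lemma pX_sq (i : Fin (n+1)) : (pX i * pX i : Module.End ℂ (PM a n)) = algebraMap ℂ _ a := by
  refine PM_ext (fun w b x => ?_)
  obtain ⟨i, rfl⟩ := w.surjective i
  rw [Module.algebraMap_end_eq_smul_id]
  simp only [Module.End.mul_apply, LinearMap.smul_apply, LinearMap.id_apply, pX_w]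
  refine Fin.cases ?_ (fun l => ?_) i
  · cases b <;> simp [pXf_zf, pXf_zt, pX_w]
  · cases b
    · simp [pXf_sf, pX_w, vX_vX]
    · simp [pXf_st, pXf_zf, pXf_zt, pXf_sf, pX_w, pX_w', vX_vX, mul_assoc w, vG_apply]

lemma pX_pC (i : Fin (n+1)) : (pX i * pC i : Module.End ℂ (PM a n)) = - (pC i * pX i) := by
  refine PM_ext (fun w b x => ?_)
  obtain ⟨i, rfl⟩ := w.surjective i
  refine Fin.cases ?_ (fun l => ?_) i
  · cases b <;> simp [pC_w, pX_w, pCf_zero, pXf_zf, pXf_zt]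
  · cases b
    · simp [pC_w, pX_w, pCf_succ, pXf_sf, vX_vC]
    · simp [pC_w, pX_w, pCf_succ, pXf_st, vX_vC, pC_w', pCf_zero, vG_apply, vC_vC0, vC_vC, vC0_vC0, vX_vC0]
      try abel

lemma pX_pC' (i j : Fin (n+1)) (h : i ≠ j) : (pX i * pC j : Module.End ℂ (PM a n)) = pC j * pX i := by
  refine PM_ext (fun w b x => ?_)
  obtain ⟨i, rfl⟩ := w.surjective i
  obtain ⟨j, rfl⟩ := w.surjective j
  have h' : i ≠ j := fun e => h (by rw [e])
  clear h
  induction i, j, h' using fin_ne_cases with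
  | h1 l => cases b <;> simp [pC_w, pX_w, pCf_zero, pCf_succ, pXf_zf, pXf_zt]
  | h2 l =>
    cases b
    · simp [pC_w, pX_w, pCf_zero, pCf_succ, pXf_sf, vX_vC0]
    · simp [pC_w, pX_w, pC_w', pCf_zero, pCf_succ, pXf_st, vX_vC0, vG_apply, vC_vC0, vC_vC, vC0_vC0]
      try abel
  | h3 l m hlm =>
    cases b
    · simp [pC_w, pX_w, pCf_zero, pCf_succ, pXf_sf, vX_vC' _ _ hlm]
    · simp [pC_w, pX_w, pC_w', pCf_zero, pCf_succ, pXf_st, vX_vC' _ _ hlm, vG_apply, vC_vC0, swap_succ_ne hlm.symm, vC_vC' _ _ hlm, vX_vC0]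
      try abel

/-- the data on `End P` -/
def pData (a : ℂ) (n : ℕ) : HData a (Module.End ℂ (PM a n)) (n+1) where
  σ := { toFun := fun v => pS v
         map_one' := by
          refine PM_ext (fun w b x => ?_)
          simp [pS_vec]
         map_mul' := fun u v => by
          refine PM_ext (fun w b x => ?_)
          simp [pS_vec, mul_assoc] }
  c := fun i => pC i
  ξ := fun i => pX i
  c_sq := pC_sq
  c_anti := pC_anti
  σ_c := pS_pC
  σ_ξ := pS_pX
  ξ_sq := pX_sq
  ξ_c := pX_pC
  ξ_c' := pX_pC'
  ξ_ξ := fun i j h => by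
    have e : ∀ p : PM a n, _ := pX_pX i j h
    have c1 : ∀ p : PM a n, pX i (pC i p) = - pC i (pX i p) := fun p => by
      simpa using LinearMap.congr_fun (pX_pC (a := a) i) p
    have c2 : ∀ p : PM a n, pX i (pC j p) = pC j (pX i p) := fun p => by
      simpa using LinearMap.congr_fun (pX_pC' (a := a) i j h) p
    have c3 : ∀ p : PM a n, pS (Equiv.swap i j) (pX i p) = pX j (pS (Equiv.swap i j) p) := fun p => by
      simpa using LinearMap.congr_fun (pS_pX (a := a) (Equiv.swap i j) i) p
    refine LinearMap.ext fun p => ?_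
    refine (e p).trans ?_
    simp only [MonoidHom.coe_mk, OneHom.coe_mk, Module.End.mul_apply, LinearMap.sub_apply, Module.End.one_apply, map_sub, c1, c2, c3]
    abel

/-- representation on `P` -/
def act : HH a (n+1) →ₐ[ℂ] Module.End ℂ (PM a n) := lift (pData a n)

lemma act_σ (v) : act ((D a (n+1)).σ v) = pS v := lift_σ _ _
lemma act_c (v) : act ((D a (n+1)).c v) = pC v := lift_c _ _
lemma act_ξ (v) : act ((D a (n+1)).ξ v) = pX v := lift_ξ _ _

/-- the map Ψ -/
def Psi : HH a (n+1) →ₗ[ℂ] PM a n :=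
  (LinearMap.applyₗ (R := ℂ) (vec 1 false (1, 0) : PM a n)) ∘ₗ act.toLinearMap

lemma Psi_apply (h : HH a (n+1)) : Psi h = act h (vec 1 false (1, 0)) := rfl
lemma Psi_mul (h k : HH a (n+1)) : Psi (h * k) = act h (Psi k) := by
  simp [Psi_apply]

lemma act_inc (y z : HH a n) : act (inc y) (vec 1 false (z, 0)) = vec 1 false (y * z, 0) := by
  induction y using ind generalizing z with
  | σ w => simp [act_σ, pS_vec]; simpa using vec_up 1 w false (z, 0)
  | c i =>
    rw [inc_c, act_c]
    simpa [pCf_succ] using pC_w 1 false i.succ (z, 0)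
  | ξ i =>
    rw [inc_ξ, act_ξ]
    simpa [pXf_sf] using pX_w 1 false i.succ (z, 0)
  | sc r =>
    simp [Module.algebraMap_end_eq_smul_id, ← Algebra.smul_def, ← map_smul]
  | add x y hx hy => rw [map_add, map_add, LinearMap.add_apply, hx, hy, ← map_add, add_mul]; simp
  | mul x y hx hy => simp [hx, hy, mul_assoc]

lemma Psi_inc (y : HH a n) : Psi (inc y) = vec 1 false (y, 0) := by
  rw [Psi_apply, act_inc, mul_one]

/-- the summand map -/
def thf (w : Equiv.Perm (Fin (n+1))) (b : Bool) : VM a n →ₗ[ℂ] HH a (n+1) :=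
  LinearMap.mulLeft ℂ ((D a (n+1)).σ w * pw ((D a (n+1)).ξ 0) b) ∘ₗ
    (inc.toLinearMap ∘ₗ LinearMap.fst ℂ _ _ + LinearMap.mulLeft ℂ ((D a (n+1)).c 0) ∘ₗ inc.toLinearMap ∘ₗ LinearMap.snd ℂ _ _)

lemma thf_apply (w : Equiv.Perm (Fin (n+1))) (b) (y z : HH a n) :
    thf w b (y, z) = (D a (n+1)).σ w * (pw ((D a (n+1)).ξ 0) b * (inc y + (D a (n+1)).c 0 * inc z)) := by
  simp [thf, mul_assoc]

/-- inverse of Ψ -/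
def theta : PM a n →ₗ[ℂ] HH a (n+1) := lf thf

lemma theta_vec (w b) (x : VM a n) : theta (vec w b x) = thf w b x := by
  apply lf_vec
  intro w u b x
  obtain ⟨y, z⟩ := x
  rw [vU_mk, thf_apply, thf_apply, map_mul, map_mul, map_mul, inc_σ]
  have h1 : (D a (n+1)).c 0 * (D a (n+1)).σ (up u) = (D a (n+1)).σ (up u) * (D a (n+1)).c 0 := by
    simp [(D a (n+1)).σ_c]
  have h2 : pw ((D a (n+1)).ξ 0) b * (D a (n+1)).σ (up u) = (D a (n+1)).σ (up u) * pw ((D a (n+1)).ξ 0) b := by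
    cases b <;> simp [(D a (n+1)).σ_ξ]
  rw [← mul_assoc ((D a (n+1)).c 0), h1, mul_assoc ((D a (n+1)).σ (up u)), ← mul_add, ← mul_assoc (pw _ _), h2]
  simp only [mul_assoc]

lemma Psi_std (w b) (x : VM a n) : Psi (thf w b x) = vec w b x := by
  obtain ⟨y, z⟩ := x
  rw [thf_apply, Psi_mul, Psi_mul, map_add, Psi_mul, Psi_inc, Psi_inc, act_σ, act_c]
  have h1 := pC_w 1 false 0 (z, (0 : HH a n))
  rw [Equiv.Perm.one_apply] at h1
  rw [h1, pCf_zero, sg_f, one_smul, vC0_mk, ← map_add]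
  have h2 := pX_w 1 false 0 (y, z)
  rw [Equiv.Perm.one_apply, pXf_zf] at h2
  cases b
  · simp [pS_vec]
  · simp [act_ξ, pS_vec, h2]

lemma Psi_theta (p : PM a n) : Psi (theta p) = p := by
  have : Psi ∘ₗ theta = (LinearMap.id : PM a n →ₗ[ℂ] PM a n) := by
    refine PM_ext (fun w b x => ?_)
    simp [theta_vec, Psi_std]
  exact LinearMap.congr_fun this p

lemma theta_Psi (h : HH a (n+1)) : theta (Psi h) = h := by
  have : Submodule.span ℂ {x | ∃ w b b', ∃ y : HH a n, x = (D a (n+1)).σ w * (pw ((D a (n+1)).ξ 0) b *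
      (pw ((D a (n+1)).c 0) b' * inc y))} ≤ LinearMap.eqLocus (theta ∘ₗ Psi) LinearMap.id := by
    rw [Submodule.span_le]
    rintro _ ⟨w, b, b', y, rfl⟩
    have : (D a (n+1)).σ w * (pw ((D a (n+1)).ξ 0) b * (pw ((D a (n+1)).c 0) b' * inc y))
      = thf w b (if b' then (0, y) else (y, 0)) := by
      cases b' <;> simp [thf_apply]
    rw [this]
    simp [Psi_std, theta_vec]
  exact this (span_succ h)

/-- freeness -/
def PhiE : HH a (n+1) ≃ₗ[ℂ] PM a n := LinearEquiv.ofLinearMap Psi theta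
  (LinearMap.ext Psi_theta) (LinearMap.ext theta_Psi)

end HH
end

section
namespace HH
variable {a : ℂ} {n : ℕ}

lemma inc_mon (α β : Fin n → Bool) : inc ((D a n).mon α β) = (D a (n+1)).res.mon α β := by
  rw [HData.mon, HData.mon, map_list_prod, List.map_ofFn]
  congr 2
  funext i
  have : ∀ (x : HH a n) b, inc (pw x b) = pw (inc x) b := by intro x b; cases b <;> simp
  simp [this, HData.res]

lemma vec_at (w b) (x : VM a n) (jb) : vec w b x jb = if jb = (w 0, b) then vU (dn w) x else 0 := by
  simp only [vec, LinearMap.comp_apply, LinearMap.single_apply]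
  split_ifs with h
  · subst h; simp
  · exact Pi.single_eq_of_ne h _

lemma dn_eq {w w' : Equiv.Perm (Fin (n+1))} : w = w' ↔ w 0 = w' 0 ∧ dn w = dn w' := by
  constructor
  · rintro rfl; simp
  · rintro ⟨h1, h2⟩; rw [dn_spec w, dn_spec w', h1, h2]

/-- trivial data -/
def E0 (a : ℂ) : HData a ℂ 0 where
  σ := 1
  c := fun i => i.elim0
  ξ := fun i => i.elim0
  c_sq := fun i => i.elim0
  c_anti := fun i => i.elim0
  σ_c := fun _ i => i.elim0
  σ_ξ := fun _ i => i.elim0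
  ξ_sq := fun i => i.elim0
  ξ_c := fun i => i.elim0
  ξ_c' := fun i => i.elim0
  ξ_ξ := fun i => i.elim0

lemma dn_one : dn (1 : Equiv.Perm (Fin (n+1))) = 1 := by
  have := dn_swap (0 : Fin (n+1))
  rwa [Equiv.swap_self] at this

lemma dualF : ∀ (n : ℕ) (w : Equiv.Perm (Fin n)) (α β : Fin n → Bool), ∃ δ : HH a n →ₗ[ℂ] ℂ,
    ∀ w' α' β', δ ((D a n).σ w' * (D a n).mon α' β') = if w' = w ∧ α' = α ∧ β' = β then 1 else 0 := by
  intro n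
  induction n with
  | zero =>
    intro w α β
    refine ⟨(lift (E0 a)).toLinearMap, fun w' α' β' => ?_⟩
    have h1 : w' = w := Subsingleton.elim _ _
    have h2 : α' = α := Subsingleton.elim _ _
    have h3 : β' = β := Subsingleton.elim _ _
    simp [HData.mon, h1, h2, h3, E0]
  | succ n ih =>
    intro w α β
    obtain ⟨δ, hδ⟩ := ih (dn w) (fun i => α i.succ) (fun i => β i.succ)
    let q : VM a n →ₗ[ℂ] HH a n := if β 0 then LinearMap.snd ℂ _ _ else LinearMap.fst ℂ _ _
    refine ⟨δ ∘ₗ q ∘ₗ LinearMap.proj (w 0, α 0) ∘ₗ Psi, fun w' α' β' => ?_⟩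
    have : (D a (n+1)).σ w' * (D a (n+1)).mon α' β' = thf w' (α' 0)
       (if β' 0 then (0, (D a n).mon (fun i => α' i.succ) (fun i => β' i.succ))
         else ((D a n).mon (fun i => α' i.succ) (fun i => β' i.succ), 0)) := by
      rw [HData.mon_succ, ← inc_mon]
      cases β' 0 <;> simp [thf_apply, mul_assoc]
    rw [this]
    simp only [LinearMap.comp_apply, Psi_std, LinearMap.proj_apply, vec_at]
    have e1 : ∀ f g : Fin (n+1) → Bool, f = g ↔ f 0 = g 0 ∧ (fun i : Fin n => f i.succ) = (fun i => g i.succ) := by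
      intro f g
      constructor
      · rintro rfl; simp
      · rintro ⟨h1, h2⟩; funext i; exact Fin.cases h1 (fun i => congrFun h2 i) i
    have E : (w' = w ∧ α' = α ∧ β' = β) ↔ ((w' 0 = w 0 ∧ dn w' = dn w) ∧ (α' 0 = α 0 ∧ (fun i : Fin n => α' i.succ) = (fun i => α i.succ))
       ∧ (β' 0 = β 0 ∧ (fun i : Fin n => β' i.succ) = (fun i => β i.succ))) := by
      rw [dn_eq, e1 α', e1 β']
    rw [if_congr E rfl rfl]
    by_cases h1 : w' 0 = w 0
    · by_cases h2 : α' 0 = α 0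
      · rw [if_pos (by rw [h1, h2])]
        by_cases h3 : β' 0 = β 0
        · rw [h3]
          cases hb : β 0 <;> simp [q, hb, hδ, h1, h2]
        · cases hb : β 0 <;> cases hb' : β' 0 <;> simp [q, hb, hb'] <;> simp [hb, hb'] at h3
      · rw [if_neg (by simp [Ne.symm h2]), if_neg (by tauto)]; simp
    · rw [if_neg (by simp [Ne.symm h1]), if_neg (by tauto)]; simp

/-- PBW independence -/
lemma pbw_indep (n : ℕ) : LinearIndependent ℂ
    (fun x : Equiv.Perm (Fin n) × (Fin n → Bool) × (Fin n → Bool) => (D a n).σ x.1 * (D a n).mon x.2.1 x.2.2) := by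
  rw [linearIndependent_iff']
  intro s g hg i hi
  obtain ⟨δ, hδ⟩ := dualF (a := a) n i.1 i.2.1 i.2.2
  have := congrArg δ hg
  simp only [map_sum, map_smul, hδ, map_zero] at this
  rw [Finset.sum_eq_single i] at this
  · simpa using this
  · intro j _ hj
    rw [if_neg]; · simp
    rintro ⟨h1, h2, h3⟩; exact hj (Prod.ext h1 (Prod.ext h2 h3))
  · intro h; exact absurd hi h

/-- induction on spanning vectors -/
lemma lin_ext {M : Type} [AddCommGroup M] [Module ℂ M] {f g : HH a (n+1) →ₗ[ℂ] M}
    (h : ∀ w b x, f (thf w b x) = g (thf w b x)) : f = g := by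
  have : f ∘ₗ theta = g ∘ₗ theta := PM_ext (fun w b x => by simp [theta_vec, h])
  ext x
  have := LinearMap.congr_fun this (Psi x)
  simpa [theta_Psi] using this

lemma PM_ext' {M : Type} [AddCommGroup M] [Module ℂ M] {f g : PM a n →ₗ[ℂ] M}
    (h0 : ∀ b x, f (vec 1 b x) = g (vec 1 b x))
    (h1 : ∀ (j : Fin n) b x, f (vec (Equiv.swap 0 j.succ) b x) = g (vec (Equiv.swap 0 j.succ) b x)) : f = g := by
  refine PM_ext (fun w b x => ?_)
  rw [dn_spec w]
  refine Fin.cases ?_ (fun j => ?_) (w 0)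
  · rw [Equiv.swap_self, vec_up]; exact h0 _ _
  · rw [vec_up]; exact h1 _ _ _

/-- π_j -/
def vP (j : Fin n) : VM a n →ₗ[ℂ] HH a n :=
  LinearMap.fst ℂ _ _ + ml ((D a n).c j) ∘ₗ LinearMap.snd ℂ _ _
@[simp] lemma vP_mk (j : Fin n) (y z : HH a n) : vP j (y, z) = y + (D a n).c j * z := rfl

/-- τ -/
def tau (ω : ℂ) : PM a n →ₗ[ℂ] HH a n :=
  ω • (LinearMap.fst ℂ _ _ ∘ₗ LinearMap.proj (0, true)) +
  ∑ j : Fin n, (vP j ∘ₗ LinearMap.proj (j.succ, false) + ml ((D a n).ξ j) ∘ₗ vP j ∘ₗ LinearMap.proj (j.succ, true))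

lemma tau_z (ω : ℂ) (b) (x : VM a n) : tau ω (vec 1 b x) = if b then ω • x.1 else 0 := by
  cases b <;> simp [tau, vec_at, dn_one, vU_one]
lemma tau_s (ω : ℂ) (j : Fin n) (b) (x : VM a n) :
    tau ω (vec (Equiv.swap 0 j.succ) b x) = pw ((D a n).ξ j) b * vP j x := by
  simp only [tau, LinearMap.add_apply, LinearMap.sum_apply, LinearMap.smul_apply, LinearMap.comp_apply, LinearMap.proj_apply, vec_at,
    Equiv.swap_apply_left, dn_swap, vU_one]
  rw [Finset.sum_eq_single j]
  · cases b <;> simp [(Fin.succ_ne_zero j).symm]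
  · intro l _ hl
    rw [if_neg, if_neg] <;> simp [hl]
  · simp

/-- trace -/
def tr (ω : ℂ) : HH a (n+1) →ₗ[ℂ] HH a n := tau ω ∘ₗ Psi
lemma tr_apply (ω : ℂ) (h : HH a (n+1)) : tr ω h = tau ω (Psi h) := rfl

lemma tr_act (ω : ℂ) (g : HH a (n+1)) (g' : HH a n) (H : ∀ p : PM a n, tau ω (act g p) = g' * tau ω p) (h : HH a (n+1)) :
  tr ω (g * h) = g' * tr ω h := by rw [tr_apply, Psi_mul, H, tr_apply]

lemma vP_vG (l : Fin n) (x : VM a n) : vP l (vG l x) = (2:ℂ) • x.1 := by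
  obtain ⟨y, z⟩ := x
  simp [vG_apply, mul_add, ← mul_assoc, (D a n).c_sq, two_smul]
lemma vP_vX (l : Fin n) (x : VM a n) : (vX l x).1 = (D a n).ξ l * x.1 := by
  obtain ⟨y, z⟩ := x
  simp
lemma vP_vX' (j l : Fin n) (h : j ≠ l) (x : VM a n) : vP j (vX l x) = (D a n).ξ l * vP j x := by
  obtain ⟨y, z⟩ := x
  simp [mul_add, ← mul_assoc, (D a n).ξ_c' _ _ h.symm]
lemma vP_vU (u) (j : Fin n) (x : VM a n) : vP (u j) (vU u x) = (D a n).σ u * vP j x := by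
  obtain ⟨y, z⟩ := x
  simp [mul_add, ← mul_assoc, (D a n).σ_c]
lemma vP_vC (j l : Fin n) (h : j ≠ l) (x : VM a n) : vP j (vC l x) = (D a n).c l * vP j x := by
  obtain ⟨y, z⟩ := x
  simp [mul_add, ← mul_assoc, (D a n).c_anti _ _ h]
lemma vP_vC0 (l : Fin n) (x : VM a n) : vP l (vC0 x) = (D a n).c l * vP l x := by
  obtain ⟨y, z⟩ := x
  simp [mul_add, ← mul_assoc, (D a n).c_sq]; abel
lemma vP_vG' (j l : Fin n) (h : j ≠ l) (x : VM a n) : vP l (vG j x) = (1 - (D a n).c l * (D a n).c j) * vP l x := by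
  obtain ⟨y, z⟩ := x
  have := (D a n).c_anti _ _ h
  have h2 : (D a n).c l * (D a n).c j * (D a n).c l = (D a n).c j := by
    rw [mul_assoc, this, mul_neg, ← mul_assoc, (D a n).c_sq]; simp
  simp [vG_apply, mul_add, ← mul_assoc, sub_mul, h2]; abel

lemma tau_inc (ω : ℂ) (y : HH a n) : ∀ p : PM a n, tau ω (act (inc y) p) = y * tau ω p := by
  suffices H : tau ω ∘ₗ act (inc y) = ml y ∘ₗ tau ω from fun p => LinearMap.congr_fun H p
  induction y using ind with
  | σ u =>
    refine PM_ext' (fun b x => ?_) (fun j b x => ?_)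
    · have := vec_up 1 u b x
      rw [one_mul] at this
      cases b <;> simp [act_σ, pS_vec, this, tau_z]
      obtain ⟨y, z⟩ := x
      rfl
    · simp only [LinearMap.comp_apply, inc_σ, act_σ, pS_vec, up_mul_swap, vec_up, tau_s, vP_vU, ml, LinearMap.mulLeft_apply]
      rw [← mul_assoc, ← mul_assoc]
      congr 1
      cases b <;> simp [(D a n).σ_ξ]
  | c l =>
    refine PM_ext' (fun b x => ?_) (fun j b x => ?_)
    · have := pC_w 1 b l.succ x
      rw [Equiv.Perm.one_apply, pCf_succ] at this
      cases b <;> simp [act_c, this, tau_z]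
      obtain ⟨y, z⟩ := x
      rfl
    · simp only [LinearMap.comp_apply, inc_c, act_c, pC_vec, ml, LinearMap.mulLeft_apply, Equiv.swap_inv]
      by_cases h : j = l
      · subst h
        rw [Equiv.swap_apply_right, pCf_zero, map_smul, tau_s, tau_s, vP_vC0]
        cases b
        · simp
        · simp [← mul_assoc, (D a n).ξ_c]
      · rw [swap_succ_ne (Ne.symm h), pCf_succ, tau_s, tau_s, vP_vC _ _ h]
        cases b
        · simp
        · simp [← mul_assoc, (D a n).ξ_c' _ _ h]
  | ξ l =>
    refine PM_ext' (fun b x => ?_) (fun j b x => ?_)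
    · have := pX_w 1 b l.succ x
      rw [Equiv.Perm.one_apply] at this
      simp only [LinearMap.comp_apply, inc_ξ, act_ξ, ml, LinearMap.mulLeft_apply, this]
      cases b
      · rw [pXf_sf, tau_z, tau_z]; simp
      · rw [pXf_st, map_sub, map_add, one_mul, tau_s, tau_s, tau_z, tau_z, vP_vG, vP_vG, vP_vX]
        simp
    · simp only [LinearMap.comp_apply, inc_ξ, act_ξ, pX_vec, ml, LinearMap.mulLeft_apply, Equiv.swap_inv]
      by_cases h : j = l
      · subst h
        rw [Equiv.swap_apply_right]
        cases b
        · rw [pXf_zf, tau_s, tau_s]; simp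
        · rw [pXf_zt, map_smul, tau_s, tau_s]; simp [← mul_assoc, (D a n).ξ_sq, Algebra.smul_def]
      · rw [swap_succ_ne (Ne.symm h)]
        cases b
        · rw [pXf_sf, tau_s, tau_s, vP_vX' _ _ h]; simp
        · have e := vec_sw_sw (a := a) 1 (Ne.symm h)
          simp only [one_mul] at e
          have e2 : ∀ x : VM a n, vP l (vU (Equiv.swap l j) (vG l x)) = (1 - (D a n).c l * (D a n).c j) *
              ((D a n).σ (Equiv.swap l j) * vP j x) := by
            intro x
            rw [vU_vG, Equiv.swap_apply_left, vP_vG' _ _ h]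
            have := vP_vU (a := a) (Equiv.swap l j) j x
            rw [Equiv.swap_apply_right] at this
            rw [this]
          rw [pXf_st, map_sub, map_add, e, e, tau_s, tau_s, tau_s, tau_s, e2, e2, vP_vX' _ _ h]
          have := (D a n).ξ_ξ l j (Ne.symm h)
          simp only [pw_true, pw_false, ← mul_assoc, ← sub_mul, ← add_mul, one_mul] at *
          congr 1
          rw [← sub_eq_zero] at this ⊢
          rw [← neg_eq_zero, ← this]
          abel
  | sc r =>
    refine LinearMap.ext fun p => ?_
    simp [Module.algebraMap_end_eq_smul_id, ← Algebra.smul_def]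
  | add x y hx hy =>
    rw [map_add, map_add, LinearMap.comp_add, hx, hy]
    refine LinearMap.ext fun p => ?_
    simp [add_mul]
  | mul x y hx hy =>
    refine LinearMap.ext fun p => ?_
    have hx' := fun p => LinearMap.congr_fun hx p
    have hy' := fun p => LinearMap.congr_fun hy p
    simp only [LinearMap.comp_apply, ml, LinearMap.mulLeft_apply] at hx' hy' ⊢
    rw [map_mul, map_mul, Module.End.mul_apply, hx', hy', mul_assoc]

lemma tr_left (ω : ℂ) (y : HH a n) (h : HH a (n+1)) : tr ω (inc y * h) = y * tr ω h :=
  tr_act ω _ _ (tau_inc ω y) h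

lemma thf_inc (w b) (x : VM a n) (y : HH a n) : thf w b x * inc y = thf w b (x.1 * y, x.2 * y) := by
  obtain ⟨u, v⟩ := x
  simp [thf_apply, mul_assoc, mul_add, add_mul]

lemma tau_vec_right (ω : ℂ) (w b) (x : VM a n) (y : HH a n) :
    tau ω (vec w b (x.1 * y, x.2 * y)) = tau ω (vec w b x) * y := by
  have H : ∀ u, (vU u (x.1 * y, x.2 * y)) = ((vU u x).1 * y, (vU u x).2 * y) := by
    intro u; obtain ⟨s, t⟩ := x; simp [mul_assoc]
  rw [dn_spec w]
  generalize dn w = u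
  refine Fin.cases ?_ (fun j => ?_) (w 0)
  · rw [Equiv.swap_self, vec_up, vec_up, H]
    erw [tau_z, tau_z]
    cases b <;> simp
  · rw [vec_up, vec_up, H, tau_s, tau_s]
    obtain ⟨s, t⟩ := vU u x
    simp [mul_assoc, add_mul]

lemma tr_right (ω : ℂ) (y : HH a n) (h : HH a (n+1)) : tr ω (h * inc y) = tr ω h * y := by
  suffices H : tr ω ∘ₗ LinearMap.mulRight ℂ (inc y) = LinearMap.mulRight ℂ y ∘ₗ tr ω (a := a) from
    LinearMap.congr_fun H h
  refine lin_ext (fun w b x => ?_)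
  simp only [LinearMap.comp_apply, LinearMap.mulRight_apply, thf_inc, tr_apply, Psi_std]
  exact tau_vec_right ω w b x y

lemma tr_thf_z (ω : ℂ) (b) (x : VM a n) : tr ω (thf 1 b x) = if b then ω • x.1 else 0 := by
  rw [tr_apply, Psi_std, tau_z]
lemma tr_thf_s (ω : ℂ) (j : Fin n) (b) (x : VM a n) :
    tr ω (thf (Equiv.swap 0 j.succ) b x) = pw ((D a n).ξ j) b * vP j x := by
  rw [tr_apply, Psi_std, tau_s]

end HH
end

section
namespace HH
variable {a : ℂ} {n : ℕ}

/-- the element ξ_i^b c_i^β -/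
def qq (i : Fin n) (b β : Bool) : HH a n := pw ((D a n).ξ i) b * pw ((D a n).c i) β

lemma σ_qq (w : Equiv.Perm (Fin n)) (i : Fin n) (b β) :
    (D a n).σ w * qq i b β = qq (w i) b β * (D a n).σ w := by
  have h1 : (D a n).σ w * pw ((D a n).ξ i) b = pw ((D a n).ξ (w i)) b * (D a n).σ w := by
    cases b <;> simp [(D a n).σ_ξ]
  have h2 : (D a n).σ w * pw ((D a n).c i) β = pw ((D a n).c (w i)) β * (D a n).σ w := by
    cases β <;> simp [(D a n).σ_c]
  rw [qq, qq, ← mul_assoc, h1, mul_assoc, h2, mul_assoc]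

lemma qq_σ (w : Equiv.Perm (Fin n)) (i : Fin n) (b β) :
    qq i b β * (D a n).σ w = (D a n).σ w * qq (w⁻¹ i) b β := by
  rw [σ_qq]; simp

@[simp] lemma inc_qq (i : Fin n) (b β) : inc (qq i b β : HH a n) = qq i.succ b β := by
  cases b <;> cases β <;> simp [qq]

lemma thf_q (w b) (y : HH a n) : thf w b (y, 0) = (D a (n+1)).σ w * qq 0 b false * inc y := by
  simp [thf_apply, qq, mul_assoc]
lemma thf_q' (w b) (y : HH a n) : thf w b (0, y) = (D a (n+1)).σ w * qq 0 b true * inc y := by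
  simp [thf_apply, qq, mul_assoc]

/-- enough to check on `σ w q_0 y` -/
lemma lin_ext2 {M : Type} [AddCommGroup M] [Module ℂ M] {f g : HH a (n+1) →ₗ[ℂ] M}
    (h : ∀ w b β y, f ((D a (n+1)).σ w * qq 0 b β * inc y) = g ((D a (n+1)).σ w * qq 0 b β * inc y)) : f = g := by
  refine lin_ext fun w b x => ?_
  obtain ⟨y, z⟩ := x
  have : ((y, z) : VM a n) = (y, 0) + (0, z) := by simp
  rw [this, map_add, map_add, map_add, thf_q, thf_q', h, h]

lemma lin_ext3 {M : Type} [AddCommGroup M] [Module ℂ M] {f g : HH a (n+1) →ₗ[ℂ] M}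
    (h0 : ∀ b β y, f (qq 0 b β * inc y) = g (qq 0 b β * inc y))
    (h1 : ∀ (j : Fin n) b β y, f ((D a (n+1)).σ (Equiv.swap 0 j.succ) * qq 0 b β * inc y) =
      g ((D a (n+1)).σ (Equiv.swap 0 j.succ) * qq 0 b β * inc y)) : f = g := by
  refine lin_ext2 fun w b β y => ?_
  have e : (D a (n+1)).σ (up (dn w)) * qq 0 b β * inc y = qq 0 b β * inc ((D a n).σ (dn w) * y) := by
    rw [σ_qq, up_zero, map_mul, inc_σ, mul_assoc]
  have e2 : (D a (n+1)).σ w * qq 0 b β * inc y = (D a (n+1)).σ (Equiv.swap 0 (w 0)) * (qq 0 b β * inc ((D a n).σ (dn w) * y)) := by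
    rw [← e, ← mul_assoc, ← mul_assoc, ← map_mul, ← dn_spec w]
  rw [e2]
  refine Fin.cases ?_ (fun j => ?_) (w 0)
  · rw [Equiv.swap_self]
    have : (D a (n+1)).σ (Equiv.refl _) = 1 := map_one _
    rw [this, one_mul]; exact h0 _ _ _
  · rw [← mul_assoc]; exact h1 _ _ _ _

variable (ω : ℂ)
lemma tr_q (b β) (y : HH a n) : tr ω (qq 0 b β * inc y) = if b = true ∧ β = false then ω • y else 0 := by
  have h1 := tr_thf_z ω b ((y, 0) : VM a n)
  have h2 := tr_thf_z ω b ((0, y) : VM a n)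
  rw [thf_q, map_one, one_mul] at h1
  rw [thf_q', map_one, one_mul] at h2
  cases β
  · rw [h1]; cases b <;> simp
  · rw [h2]; cases b <;> simp
lemma tr_sq (j : Fin n) (b β) (y : HH a n) : tr ω ((D a (n+1)).σ (Equiv.swap 0 j.succ) * qq 0 b β * inc y) =
    qq j b β * y := by
  have h1 := tr_thf_s ω j b ((y, 0) : VM a n)
  have h2 := tr_thf_s ω j b ((0, y) : VM a n)
  rw [thf_q] at h1
  rw [thf_q'] at h2
  cases β
  · rw [h1]; simp [qq]
  · rw [h2]; simp [qq, mul_assoc]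
lemma tr_q1 (b β) : tr ω (qq 0 b β : HH a (n+1)) = if b = true ∧ β = false then algebraMap ℂ _ ω else 0 := by
  have := tr_q (a := a) (n := n) ω b β 1
  rw [map_one, mul_one] at this
  rw [this, Algebra.algebraMap_eq_smul_one]
lemma tr_sq1 (j : Fin n) (b β) : tr ω ((D a (n+1)).σ (Equiv.swap 0 j.succ) * qq 0 b β) = qq j b β := by
  have := tr_sq (a := a) (n := n) ω j b β 1
  rwa [map_one, mul_one, mul_one] at this

lemma γ_qq (i : Fin n) (b β) : γ (qq i b β : HH a n) = if β then - qq i b β else qq i b β := by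
  cases b <;> cases β <;> simp [qq]

lemma tr_γ (h : HH a (n+1)) : tr ω (γ h) = γ (tr ω h) := by
  suffices H : tr ω ∘ₗ (γ (a := a)).toLinearMap = γ.toLinearMap ∘ₗ tr ω from LinearMap.congr_fun H h
  refine lin_ext3 (fun b β y => ?_) (fun j b β y => ?_)
  · simp only [LinearMap.comp_apply, AlgHom.toLinearMap_apply, map_mul, γ_qq, inc_γ, tr_q]
    cases b <;> cases β <;> simp [tr_q]
  · simp only [LinearMap.comp_apply, AlgHom.toLinearMap_apply, map_mul, γ_qq, inc_γ, tr_sq, γ_σ]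
    cases β <;> simp [tr_sq]

lemma c0_qq (b β) : ∃ ε : ℂ, (ε = 1 ∨ ε = -1) ∧ (D a (n+1)).c 0 * qq 0 b β = ε • qq 0 b (!β) := by
  cases b <;> cases β <;> simp only [qq, pw_true, pw_false, Bool.not_true, Bool.not_false, mul_one, one_mul]
  · exact ⟨1, by simp⟩
  · exact ⟨-1, by simp [(D a (n+1)).c_sq]⟩
  · exact ⟨-1, by simp [(D a (n+1)).ξ_c]⟩
  · refine ⟨1, by simp, ?_⟩
    have := (D a (n+1)).ξ_c 0
    rw [this, mul_neg, ← mul_assoc, (D a (n+1)).c_sq]; simp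

lemma qq_c0 (b β) : (qq 0 b β : HH a (n+1)) * (D a (n+1)).c 0 = if β then - qq 0 b (!β) else qq 0 b (!β) := by
  cases b <;> cases β <;> simp [qq, mul_assoc, (D a (n+1)).c_sq]

lemma tr_c0 (h : HH a (n+1)) : tr ω ((D a (n+1)).c 0 * h) = tr ω (γ h * (D a (n+1)).c 0) := by
  suffices H : tr ω ∘ₗ LinearMap.mulLeft ℂ ((D a (n+1)).c 0) = tr ω ∘ₗ LinearMap.mulRight ℂ ((D a (n+1)).c 0) ∘ₗ (γ (a := a)).toLinearMap from LinearMap.congr_fun H h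
  have hy : ∀ y : HH a n, γ (inc y) * (D a (n+1)).c 0 = (D a (n+1)).c 0 * inc y := by
    intro y; rw [c0_inc, inc_γ]
  refine lin_ext3 (fun b β y => ?_) (fun j b β y => ?_)
  · simp only [LinearMap.comp_apply, AlgHom.toLinearMap_apply, map_mul, LinearMap.mulLeft_apply, LinearMap.mulRight_apply]
    rw [mul_assoc (γ (qq _ _ _)), hy, ← mul_assoc, ← mul_assoc, γ_qq]
    have h2 : ∀ b β, tr ω ((qq 0 b β : HH a (n+1)) * (D a (n+1)).c 0 * inc y) = if b = true ∧ β = true then - ω • y else 0 := by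
      intro b β
      rw [qq_c0]
      cases b <;> cases β <;> simp [tr_q]
    have h1 : ∀ b β, tr ω ((D a (n+1)).c 0 * (qq 0 b β : HH a (n+1)) * inc y) = if b = true ∧ β = true then ω • y else 0 := by
      intro b β
      have : (D a (n+1)).c 0 * qq 0 b β = (if b then -1 else 1 : ℂ) • (qq 0 b β * (D a (n+1)).c 0) := by
        cases b <;> cases β <;> simp [qq, (D a (n+1)).ξ_c]
        rw [mul_assoc, (D a (n+1)).ξ_c]; simp
      rw [this, smul_mul_assoc, map_smul, h2]
      cases b <;> cases β <;> simp
    rw [h1]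
    cases b <;> cases β <;> simp [h2]
  · have hc : (D a (n+1)).c 0 * (D a (n+1)).σ (Equiv.swap 0 j.succ) = (D a (n+1)).σ (Equiv.swap 0 j.succ) * (D a (n+1)).c j.succ := by
      simp [(D a (n+1)).σ_c]
    have hcq : (D a (n+1)).c j.succ * qq 0 b β = γ (qq 0 b β) * (D a (n+1)).c j.succ := by
      have h0 : j.succ ≠ 0 := Fin.succ_ne_zero j
      have := inc_c (a := a) j
      cases b <;> cases β <;> simp [qq, (D a (n+1)).ξ_c' _ _ h0.symm, (D a (n+1)).c_anti _ _ h0, mul_assoc]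
      · rw [← mul_assoc, ← (D a (n+1)).ξ_c' _ _ h0.symm, mul_assoc, (D a (n+1)).c_anti _ _ h0]; simp
    simp only [LinearMap.comp_apply, AlgHom.toLinearMap_apply, map_mul, LinearMap.mulLeft_apply, LinearMap.mulRight_apply, γ_σ]
    rw [mul_assoc (_ * _), hy, ← mul_assoc, ← mul_assoc, hc]
    rw [mul_assoc ((D a (n+1)).σ _), hcq, ← mul_assoc, mul_assoc _ _ (inc y), ← inc_c, ← map_mul, γ_qq, ← mul_assoc _ ((D a (n+1)).c 0), mul_assoc _ _ ((D a (n+1)).c 0)]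
    cases β <;> simp only [if_true, if_false, neg_mul, mul_neg, map_neg, Bool.false_eq_true, qq_c0, tr_sq]
    · simp [qq, mul_assoc]
    · simp [qq, mul_assoc, ← mul_assoc ((D a n).c j), (D a n).c_sq]
end HH
namespace HH
variable {a : ℂ} {n : ℕ}

/-- ε -/
def vE : VM a n →ₗ[ℂ] VM a n := LinearMap.prod (LinearMap.fst ℂ _ _) (- LinearMap.snd ℂ _ _)
lemma vE_mk (y z : HH a n) : vE (y, z) = (y, -z) := rfl

/-- x̄ on PM -/
def pB (κ : ℂ) : PM a n →ₗ[ℂ] PM a n :=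
  LinearMap.pi fun jb => if jb.2 then - (vE ∘ₗ LinearMap.proj (jb.1, false)) else (-κ) • (vE ∘ₗ LinearMap.proj (jb.1, true))

lemma pB_f (κ : ℂ) (w) (x : VM a n) : pB κ (vec w false x) = - vec w true (vE x) := by
  funext jb
  obtain ⟨j, b⟩ := jb
  have : vE (vU (dn w) x) = vU (dn w) (vE x) := by obtain ⟨y, z⟩ := x; simp [vE_mk]
  cases b <;> simp [pB, vec_at]
  split_ifs <;> simp [this]
lemma pB_t (κ : ℂ) (w) (x : VM a n) : pB κ (vec w true x) = (-κ) • vec w false (vE x) := by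
  funext jb
  obtain ⟨j, b⟩ := jb
  have : vE (vU (dn w) x) = vU (dn w) (vE x) := by obtain ⟨y, z⟩ := x; simp [vE_mk]
  cases b <;> simp [pB, vec_at]
  split_ifs <;> simp [this]

/-- x̄ -/
def xB (κ : ℂ) : HH a (n+1) →ₗ[ℂ] HH a (n+1) := theta ∘ₗ pB κ ∘ₗ Psi
/-- sign -/
def sgn (β : Bool) : ℂ := if β then -1 else 1
lemma xB_f (κ : ℂ) (w β) (y : HH a n) : xB κ ((D a (n+1)).σ w * qq 0 false β * inc y) =
    (- sgn β) • ((D a (n+1)).σ w * qq 0 true β * inc y) := by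
  cases β
  · rw [← thf_q, xB, LinearMap.comp_apply, LinearMap.comp_apply, Psi_std, pB_f, map_neg, theta_vec, vE_mk, neg_zero, thf_q]; simp [sgn]
  · rw [← thf_q', xB, LinearMap.comp_apply, LinearMap.comp_apply, Psi_std, pB_f, map_neg, theta_vec, vE_mk, thf_q']; simp [sgn]
lemma xB_t (κ : ℂ) (w β) (y : HH a n) : xB κ ((D a (n+1)).σ w * qq 0 true β * inc y) =
    (- κ * sgn β) • ((D a (n+1)).σ w * qq 0 false β * inc y) := by
  cases β
  · rw [← thf_q, xB, LinearMap.comp_apply, LinearMap.comp_apply, Psi_std, pB_t, map_smul, theta_vec, vE_mk, neg_zero, thf_q]; simp [sgn]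
  · rw [← thf_q', xB, LinearMap.comp_apply, LinearMap.comp_apply, Psi_std, pB_t, map_smul, theta_vec, vE_mk, thf_q']; simp [sgn]
lemma xB_q (κ : ℂ) (w b β) (y : HH a n) : xB κ ((D a (n+1)).σ w * qq 0 b β * inc y) =
    (- (if b then κ else 1) * sgn β) • ((D a (n+1)).σ w * qq 0 (!b) β * inc y) := by
  cases b
  · rw [xB_f]; simp
  · rw [xB_t]; simp

lemma xB_σ (κ : ℂ) (w) (h : HH a (n+1)) : xB κ ((D a (n+1)).σ w * h) = (D a (n+1)).σ w * xB κ h := by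
  suffices H : xB κ ∘ₗ LinearMap.mulLeft ℂ ((D a (n+1)).σ w) = LinearMap.mulLeft ℂ ((D a (n+1)).σ w) ∘ₗ xB κ from LinearMap.congr_fun H h
  refine lin_ext2 fun w' b β y => ?_
  simp only [LinearMap.comp_apply, LinearMap.mulLeft_apply, ← mul_assoc, ← map_mul, xB_q, mul_smul_comm]
lemma xB_inc (κ : ℂ) (y : HH a n) (h : HH a (n+1)) : xB κ (h * inc y) = xB κ h * inc y := by
  suffices H : xB κ ∘ₗ LinearMap.mulRight ℂ (inc y) = LinearMap.mulRight ℂ (inc y) ∘ₗ xB κ from LinearMap.congr_fun H h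
  refine lin_ext2 fun w' b β y' => ?_
  simp only [LinearMap.comp_apply, LinearMap.mulRight_apply, mul_assoc _ (inc _) (inc _), ← map_mul, xB_q, smul_mul_assoc]
lemma xB_γ (κ : ℂ) (h : HH a (n+1)) : xB κ (γ h) = γ (xB κ h) := by
  suffices H : xB κ ∘ₗ (γ (a := a)).toLinearMap = (γ (a := a)).toLinearMap ∘ₗ xB κ from LinearMap.congr_fun H h
  refine lin_ext2 fun w' b β y' => ?_
  simp only [LinearMap.comp_apply, AlgHom.toLinearMap_apply, xB_q, map_smul, map_mul, γ_σ, inc_γ, γ_qq]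
  cases β <;> simp [xB_q]
lemma xB_rc (κ : ℂ) (h : HH a (n+1)) : xB κ (h * (D a (n+1)).c 0) = - (xB κ h * (D a (n+1)).c 0) := by
  suffices H : xB κ ∘ₗ LinearMap.mulRight ℂ ((D a (n+1)).c 0) = - (LinearMap.mulRight ℂ ((D a (n+1)).c 0) ∘ₗ xB κ) from LinearMap.congr_fun H h
  refine lin_ext2 fun w' b β y' => ?_
  have e : ∀ b β, (D a (n+1)).σ w' * qq 0 b β * inc y' * (D a (n+1)).c 0 =
      sgn β • ((D a (n+1)).σ w' * qq 0 b (!β) * inc (γ y')) := by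
    intro b β
    have := c0_inc (γ y')
    rw [γ_γ] at this
    rw [mul_assoc, ← this, ← mul_assoc, mul_assoc _ _ ((D a (n+1)).c 0), qq_c0]
    cases β <;> simp [sgn]
  simp only [LinearMap.comp_apply, LinearMap.mulRight_apply, LinearMap.neg_apply, e, xB_q, map_smul, smul_mul_assoc]
  cases b <;> cases β <;> simp [sgn]
lemma xB_c (κ : ℂ) (i) (h : HH a (n+1)) : xB κ ((D a (n+1)).c i * h) = (D a (n+1)).c i * xB κ h := by
  suffices H : xB κ ∘ₗ LinearMap.mulLeft ℂ ((D a (n+1)).c i) = LinearMap.mulLeft ℂ ((D a (n+1)).c i) ∘ₗ xB κ from LinearMap.congr_fun H h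
  refine lin_ext2 fun w b β y => ?_
  simp only [LinearMap.comp_apply, LinearMap.mulLeft_apply, xB_q, mul_smul_comm]
  generalize hj : w⁻¹ i = j
  have hij : (D a (n+1)).c i * (D a (n+1)).σ w = (D a (n+1)).σ w * (D a (n+1)).c j := by rw [← hj, HData.c_σ]
  simp only [← mul_assoc, hij]
  revert hj hij
  refine Fin.cases ?_ (fun j => ?_) j
  · intro _ _
    have : ∀ b β, (D a (n+1)).c 0 * qq 0 b β = (sgn b * sgn β) • qq 0 b (!β) := by
      intro b β
      cases b <;> cases β <;> simp [sgn, qq, (D a (n+1)).ξ_c, (D a (n+1)).c_sq]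
      rw [← mul_assoc, (D a (n+1)).c_sq]; simp
    simp only [mul_assoc _ _ (qq _ _ _), this, mul_smul_comm, smul_mul_assoc, map_smul, xB_q, smul_smul]
    congr 1
    cases b <;> cases β <;> simp [sgn]
  · intro _ _
    have h0 : j.succ ≠ 0 := Fin.succ_ne_zero j
    have hcq : ∀ b β, (D a (n+1)).c j.succ * qq 0 b β = sgn β • (qq 0 b β * (D a (n+1)).c j.succ) := by
      intro b β
      cases b <;> cases β <;> simp [sgn, qq, (D a (n+1)).ξ_c' _ _ h0.symm, (D a (n+1)).c_anti _ _ h0, mul_assoc]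
      · rw [← mul_assoc, ← (D a (n+1)).ξ_c' _ _ h0.symm, mul_assoc, (D a (n+1)).c_anti _ _ h0]; simp
    simp only [← inc_c] at hcq ⊢
    simp only [mul_assoc _ _ (qq _ _ _), hcq, mul_smul_comm, smul_mul_assoc, map_smul, smul_smul]
    have e : ∀ b β, (D a (n+1)).σ w * (qq 0 b β * inc ((D a n).c j)) * inc y = (D a (n+1)).σ w * qq 0 b β * inc ((D a n).c j * y) := by
      intro b β; rw [map_mul]; simp only [mul_assoc]
    simp only [e, xB_q, smul_smul]
    congr 1; ring
lemma xB_1 (κ : ℂ) : xB κ (1 : HH a (n+1)) = - (D a (n+1)).ξ 0 := by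
  have := xB_q (a := a) (n := n) κ 1 false false 1
  simpa [qq, sgn] using this
lemma xB_ξ (κ : ℂ) : xB κ ((D a (n+1)).ξ 0) = - algebraMap ℂ _ κ := by
  have := xB_q (a := a) (n := n) κ 1 true false 1
  simpa [qq, sgn, Algebra.algebraMap_eq_smul_one] using this
lemma xB_sq (κ : ℂ) (h : HH a (n+1)) : xB κ (xB κ h) = κ • h := by
  suffices H : xB κ ∘ₗ xB κ = κ • (LinearMap.id : HH a (n+1) →ₗ[ℂ] HH a (n+1)) from LinearMap.congr_fun H h
  refine lin_ext2 fun w b β y => ?_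
  simp only [LinearMap.comp_apply, LinearMap.smul_apply, LinearMap.id_apply, xB_q, map_smul, smul_smul, Bool.not_not]
  congr 1
  cases b <;> cases β <;> simp [sgn]
end HH
end

section
namespace HH
variable {a : ℂ} {n : ℕ}

/-- the simple transposition (0 1) -/
def s1 : HH a (n+2) := (D a (n+2)).σ (Equiv.swap 0 1)
lemma s1_s1 : (s1 : HH a (n+2)) * s1 = 1 := by rw [s1, ← map_mul]; simp
lemma s1_s1' (h : HH a (n+2)) : h * s1 * s1 = h := by rw [mul_assoc, s1_s1, mul_one]
lemma s1_ξ0 : (s1 : HH a (n+2)) * (D a (n+2)).ξ 0 = (D a (n+2)).ξ 1 * s1 := by simp [s1, (D a (n+2)).σ_ξ]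
lemma s1_ξ1 : (s1 : HH a (n+2)) * (D a (n+2)).ξ 1 = (D a (n+2)).ξ 0 * s1 := by simp [s1, (D a (n+2)).σ_ξ]
lemma s1_c0 : (s1 : HH a (n+2)) * (D a (n+2)).c 0 = (D a (n+2)).c 1 * s1 := by simp [s1, (D a (n+2)).σ_c]
lemma s1_c1 : (s1 : HH a (n+2)) * (D a (n+2)).c 1 = (D a (n+2)).c 0 * s1 := by simp [s1, (D a (n+2)).σ_c]
lemma up_up_swap (u : Equiv.Perm (Fin n)) : up (up u) * Equiv.swap 0 1 = Equiv.swap 0 1 * up (up u) := by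
  rw [Equiv.mul_swap_eq_swap_mul]
  have : up (up u) 1 = 1 := by
    have h := up_succ (up u) 0
    rwa [up_zero] at h
  rw [this, up_zero]
lemma s1_inc2 (y : HH a n) : s1 * inc (inc y) = inc (inc y) * s1 := by
  induction y using ind with
  | σ w => simp only [inc_σ, s1, ← map_mul, up_up_swap]
  | c i =>
    have : (Equiv.swap 0 1 : Equiv.Perm (Fin (n+2))) i.succ.succ = i.succ.succ :=
      Equiv.swap_apply_of_ne_of_ne (Fin.succ_ne_zero _) (by rw [← Fin.succ_zero_eq_one, Ne, Fin.succ_inj]; exact Fin.succ_ne_zero _)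
    simp [s1, (D a (n+2)).σ_c, this]
  | ξ i =>
    have : (Equiv.swap 0 1 : Equiv.Perm (Fin (n+2))) i.succ.succ = i.succ.succ :=
      Equiv.swap_apply_of_ne_of_ne (Fin.succ_ne_zero _) (by rw [← Fin.succ_zero_eq_one, Ne, Fin.succ_inj]; exact Fin.succ_ne_zero _)
    simp [s1, (D a (n+2)).σ_ξ, this]
  | sc r => simp [Algebra.commutes]
  | add x y hx hy => simp [mul_add, add_mul, hx, hy]
  | mul x y hx hy => rw [map_mul, map_mul, ← mul_assoc, hx, mul_assoc, hy, mul_assoc]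

lemma comm10 : (D a (n+2)).ξ 1 * (D a (n+2)).ξ 0 = (D a (n+2)).ξ 0 * (D a (n+2)).ξ 1 + s1 * ((D a (n+2)).ξ 0 * (1 + (D a (n+2)).c 1 * (D a (n+2)).c 0)
   - (1 + (D a (n+2)).c 1 * (D a (n+2)).c 0) * (D a (n+2)).ξ 1) := HData.comm0 _ 0 1 (by simp)

lemma c10 : (D a (n+2)).c 1 * (D a (n+2)).c 0 = - ((D a (n+2)).c 0 * (D a (n+2)).c 1) := (D a (n+2)).c_anti _ _ (by simp)
lemma ξ0c1 : (D a (n+2)).ξ 0 * (D a (n+2)).c 1 = (D a (n+2)).c 1 * (D a (n+2)).ξ 0 := (D a (n+2)).ξ_c' _ _ (by simp)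
lemma ξ1c0 : (D a (n+2)).ξ 1 * (D a (n+2)).c 0 = (D a (n+2)).c 0 * (D a (n+2)).ξ 1 := (D a (n+2)).ξ_c' _ _ (by simp)
lemma inc_ξ0 : inc ((D a (n+1)).ξ 0) = (D a (n+2)).ξ 1 := inc_ξ _
lemma inc_c0 : inc ((D a (n+1)).c 0) = (D a (n+2)).c 1 := inc_c _

lemma lin_ext4 {M : Type} [AddCommGroup M] [Module ℂ M] {f g : HH a (n+2) →ₗ[ℂ] M}
    (h : ∀ w b b' β β' y, f ((D a (n+2)).σ w * (pw ((D a (n+2)).ξ 0) b * pw ((D a (n+2)).ξ 1) b') * pw ((D a (n+2)).c 0) β * pw ((D a (n+2)).c 1) β' * inc (inc y)) =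
      g ((D a (n+2)).σ w * (pw ((D a (n+2)).ξ 0) b * pw ((D a (n+2)).ξ 1) b') * pw ((D a (n+2)).c 0) β * pw ((D a (n+2)).c 1) β' * inc (inc y))) : f = g := by
  refine lin_ext2 fun w b β y => ?_
  suffices H : f ∘ₗ LinearMap.mulLeft ℂ ((D a (n+2)).σ w * qq 0 b β) ∘ₗ (inc (a := a)).toLinearMap =
     g ∘ₗ LinearMap.mulLeft ℂ ((D a (n+2)).σ w * qq 0 b β) ∘ₗ (inc (a := a)).toLinearMap from LinearMap.congr_fun H y
  refine lin_ext2 fun u b' β' z => ?_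
  simp only [LinearMap.comp_apply, LinearMap.mulLeft_apply, AlgHom.toLinearMap_apply]
  have e : (D a (n+2)).σ w * qq 0 b β * inc ((D a (n+1)).σ u * qq 0 b' β' * inc z) =
     (D a (n+2)).σ (w * up u) * (pw ((D a (n+2)).ξ 0) b * pw ((D a (n+2)).ξ 1) b') * pw ((D a (n+2)).c 0) β * pw ((D a (n+2)).c 1) β' * inc (inc z) := by
    rw [map_mul inc, map_mul inc, inc_σ, inc_qq, ← mul_assoc, ← mul_assoc, mul_assoc _ (qq _ _ _) ((D a (n+2)).σ _), ← up_zero u, ← σ_qq, up_zero, map_mul]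
    congr 1
    simp only [mul_assoc]
    congr 2
    rw [qq, qq, mul_assoc]
    congr 1
    rw [← mul_assoc, ← mul_assoc]
    congr 1
    show _ * pw ((D a (n+2)).ξ 1) b' = _
    cases β <;> cases b' <;> simp [ξ1c0]
  rw [e]; exact h _ _ _ _ _ _

/-- the operator W -/
def opW (κ : ℂ) : HH a (n+2) →ₗ[ℂ] HH a (n+2) :=
  LinearMap.mulRight ℂ s1 ∘ₗ xB κ ∘ₗ LinearMap.mulRight ℂ s1 - LinearMap.mulRight ℂ s1
   + LinearMap.mulRight ℂ (s1 * (D a (n+2)).c 1 * (D a (n+2)).c 0)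
lemma opW_apply (κ : ℂ) (h : HH a (n+2)) : opW κ h = xB κ (h * s1) * s1 - h * s1 + h * (s1 * (D a (n+2)).c 1 * (D a (n+2)).c 0) := rfl
lemma opW_σ (κ : ℂ) (w) (h : HH a (n+2)) : opW κ ((D a (n+2)).σ w * h) = (D a (n+2)).σ w * opW κ h := by
  simp only [opW_apply, mul_assoc, xB_σ, mul_add, mul_sub]
lemma opW_inc2 (κ : ℂ) (y : HH a n) (h : HH a (n+2)) : opW κ (h * inc (inc y)) = opW κ h * inc (inc y) := by
  have e1 : ∀ x : HH a (n+2), x * inc (inc y) * s1 = x * s1 * inc (inc y) := by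
    intro x; rw [mul_assoc, mul_assoc, s1_inc2]
  have e2 : (D a (n+2)).c 1 * ((D a (n+2)).c 0 * inc (inc y)) = inc (inc y) * ((D a (n+2)).c 1 * (D a (n+2)).c 0) := by
    rw [c0_inc, ← mul_assoc, ← inc_c0, inc_γ, ← map_mul, c0_inc, γ_γ, map_mul, mul_assoc]
  simp only [opW_apply, e1, xB_inc, add_mul, sub_mul]
  simp only [mul_assoc, e2, s1_inc2]
  simp only [← mul_assoc, e1]
lemma opW_c0 (κ : ℂ) (h : HH a (n+2)) : opW κ (h * (D a (n+2)).c 0) = opW κ h * (D a (n+2)).c 0 := by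
  have e1 : ∀ x : HH a (n+2), x * (D a (n+2)).c 0 * s1 = x * s1 * (D a (n+2)).c 1 := by
    intro x; rw [mul_assoc, mul_assoc, s1_c1]
  have e2 : ∀ x : HH a (n+2), x * (D a (n+2)).c 1 * s1 = x * s1 * (D a (n+2)).c 0 := by
    intro x; rw [mul_assoc, mul_assoc, s1_c0]
  have e3 : ∀ x : HH a (n+2), x * (D a (n+2)).c 1 * (D a (n+2)).c 1 = -x := by
    intro x; rw [mul_assoc, (D a (n+2)).c_sq]; simp
  have e4 : ∀ x : HH a (n+2), x * (D a (n+2)).c 0 * (D a (n+2)).c 0 = -x := by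
    intro x; rw [mul_assoc, (D a (n+2)).c_sq]; simp
  simp only [opW_apply, ← mul_assoc, e1, add_mul, sub_mul, e3, e4]
  rw [← inc_c0, xB_inc, inc_c0, e2]
  simp only [neg_mul, e3]; abel
lemma opW_c1 (κ : ℂ) (h : HH a (n+2)) : opW κ (h * (D a (n+2)).c 1) = - (opW κ h * (D a (n+2)).c 1) := by
  have e1 : ∀ x : HH a (n+2), x * (D a (n+2)).c 0 * s1 = x * s1 * (D a (n+2)).c 1 := by
    intro x; rw [mul_assoc, mul_assoc, s1_c1]
  have e2 : ∀ x : HH a (n+2), x * (D a (n+2)).c 1 * s1 = x * s1 * (D a (n+2)).c 0 := by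
    intro x; rw [mul_assoc, mul_assoc, s1_c0]
  have e3 : ∀ x : HH a (n+2), x * (D a (n+2)).c 1 * (D a (n+2)).c 1 = -x := by
    intro x; rw [mul_assoc, (D a (n+2)).c_sq]; simp
  have e4 : ∀ x : HH a (n+2), x * (D a (n+2)).c 0 * (D a (n+2)).c 0 = -x := by
    intro x; rw [mul_assoc, (D a (n+2)).c_sq]; simp
  have e5 : ∀ x : HH a (n+2), x * (D a (n+2)).c 1 * (D a (n+2)).c 0 = - (x * (D a (n+2)).c 0 * (D a (n+2)).c 1) := by
    intro x; rw [mul_assoc, c10]; simp [mul_assoc]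
  simp only [opW_apply, ← mul_assoc]
  simp only [e1, e2, add_mul, sub_mul, e5, e4, xB_rc, neg_mul, mul_neg, e3, neg_neg]
  abel

lemma xB_ξ1 (κ : ℂ) : xB κ ((D a (n+2)).ξ 1) = - ((D a (n+2)).ξ 0 * (D a (n+2)).ξ 1) := by
  have := xB_inc κ ((D a (n+1)).ξ 0) (1 : HH a (n+2))
  rw [one_mul, inc_ξ0, xB_1] at this
  rw [this, neg_mul]
lemma xB_s1 (κ : ℂ) (h : HH a (n+2)) : xB κ (s1 * h) = s1 * xB κ h := xB_σ _ _ _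
lemma xB_ξ10 (κ : ℂ) : xB κ ((D a (n+2)).ξ 1 * (D a (n+2)).ξ 0) = - κ • (D a (n+2)).ξ 1 - κ • (s1 * (1 - (D a (n+2)).c 1 * (D a (n+2)).c 0))
   + s1 * (1 + (D a (n+2)).c 1 * (D a (n+2)).c 0) * ((D a (n+2)).ξ 0 * (D a (n+2)).ξ 1) := by
  rw [comm10, map_add, ← inc_ξ0, xB_inc, xB_s1, map_sub, inc_ξ0, xB_ξ, mul_add, map_add, mul_one, xB_ξ, add_mul, map_add, one_mul, xB_ξ1,
    mul_assoc ((D a (n+2)).c 1), xB_c, xB_c, xB_ξ1, ← mul_assoc ((D a (n+2)).ξ 0), xB_rc, ξ0c1, xB_c, xB_ξ]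
  simp only [Algebra.smul_def]
  have := Algebra.commutes (A := HH a (n+2)) κ s1
  have h2 := Algebra.commutes (A := HH a (n+2)) κ ((D a (n+2)).c 1)
  rw [map_neg]
  linear_combination (norm := noncomm_ring) this * (1- (D a (n+2)).c 1 * (D a (n+2)).c 0) - s1 * h2 * (D a (n+2)).c 0

section nf
variable (t : HH a (n+2))
local notation "X0" => HData.ξ (D a (n+2)) 0
local notation "X1" => HData.ξ (D a (n+2)) 1
local notation "C0" => HData.c (D a (n+2)) 0
local notation "C1" => HData.c (D a (n+2)) 1
lemma nf1 : X0 * s1 = s1 * X1 := s1_ξ1.symm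
lemma nf2 : X1 * s1 = s1 * X0 := s1_ξ0.symm
lemma nf3 : C0 * s1 = s1 * C1 := s1_c1.symm
lemma nf4 : C1 * s1 = s1 * C0 := s1_c0.symm
lemma nf5 : C0 * X0 = - (X0 * C0) := by rw [(D a (n+2)).ξ_c, neg_neg]
lemma nf6 : C1 * X1 = - (X1 * C1) := by rw [(D a (n+2)).ξ_c, neg_neg]
lemma nf7 : C0 * X1 = X1 * C0 := ξ1c0.symm
lemma nf8 : C1 * X0 = X0 * C1 := ξ0c1.symm
lemma nf9 : C0 * C0 = -1 := (D a (n+2)).c_sq _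
lemma nf10 : C1 * C1 = -1 := (D a (n+2)).c_sq _
lemma nf11 : X0 * X0 = a • 1 := by rw [(D a (n+2)).ξ_sq, Algebra.algebraMap_eq_smul_one]
lemma nf12 : X1 * X1 = a • 1 := by rw [(D a (n+2)).ξ_sq, Algebra.algebraMap_eq_smul_one]
lemma nf13 : X1 * X0 = X0 * X1 + s1 * X0 - s1 * (X0 * (C0 * C1)) - s1 * X1 - s1 * (X1 * (C0 * C1)) := by
  rw [comm10, c10]
  simp only [add_mul, mul_add, mul_sub, mul_one, one_mul, neg_mul, mul_neg, mul_assoc, nf6]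
  rw [← mul_assoc C0, nf7, mul_assoc]; abel
lemma nf1' : X0 * (s1 * t) = s1 * (X1 * t) := by rw [← mul_assoc, nf1, mul_assoc]
lemma nf2' : X1 * (s1 * t) = s1 * (X0 * t) := by rw [← mul_assoc, nf2, mul_assoc]
lemma nf3' : C0 * (s1 * t) = s1 * (C1 * t) := by rw [← mul_assoc, nf3, mul_assoc]
lemma nf4' : C1 * (s1 * t) = s1 * (C0 * t) := by rw [← mul_assoc, nf4, mul_assoc]
lemma nf5' : C0 * (X0 * t) = - (X0 * (C0 * t)) := by rw [← mul_assoc, nf5, neg_mul, mul_assoc]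
lemma nf6' : C1 * (X1 * t) = - (X1 * (C1 * t)) := by rw [← mul_assoc, nf6, neg_mul, mul_assoc]
lemma nf7' : C0 * (X1 * t) = X1 * (C0 * t) := by rw [← mul_assoc, nf7, mul_assoc]
lemma nf8' : C1 * (X0 * t) = X0 * (C1 * t) := by rw [← mul_assoc, nf8, mul_assoc]
lemma nf9' : C0 * (C0 * t) = -t := by rw [← mul_assoc, nf9, neg_one_mul]
lemma nf10' : C1 * (C1 * t) = -t := by rw [← mul_assoc, nf10, neg_one_mul]
lemma nf11' : X0 * (X0 * t) = a • t := by rw [← mul_assoc, nf11, smul_mul_assoc, one_mul]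
lemma nf12' : X1 * (X1 * t) = a • t := by rw [← mul_assoc, nf12, smul_mul_assoc, one_mul]
lemma nf13' : X1 * (X0 * t) = X0 * (X1 * t) + s1 * (X0 * t) - s1 * (X0 * (C0 * (C1 * t))) - s1 * (X1 * t) - s1 * (X1 * (C0 * (C1 * t))) := by
  rw [← mul_assoc, nf13]; simp only [add_mul, sub_mul, mul_assoc]
lemma nf14 : C1 * C0 = - (C0 * C1) := c10
lemma nf14' : C1 * (C0 * t) = - (C0 * (C1 * t)) := by rw [← mul_assoc, nf14, neg_mul, mul_assoc]
lemma nf15' : s1 * (s1 * t) = t := by rw [← mul_assoc, s1_s1, one_mul]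
lemma nf16 (κ : ℂ) : xB κ (1 : HH a (n+2)) = - X0 := xB_1 κ
lemma nf17 (κ : ℂ) : xB κ X0 = - κ • (1 : HH a (n+2)) := by rw [xB_ξ, Algebra.algebraMap_eq_smul_one, neg_smul]
lemma nf18 (κ : ℂ) : xB κ (t * C0) = - (xB κ t * C0) := xB_rc κ t
lemma nf19 (κ : ℂ) : xB κ (t * C1) = xB κ t * C1 := by rw [← inc_c0, xB_inc]
lemma nf20 (κ : ℂ) : xB κ (t * X1) = xB κ t * X1 := by rw [← inc_ξ0, xB_inc]
lemma nf21 (κ : ℂ) : xB κ (t * (C0 * C1)) = - (xB κ t * (C0 * C1)) := by rw [← mul_assoc, nf19, nf18, neg_mul, mul_assoc]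
lemma nf22 (κ : ℂ) : xB κ (s1 * t) = s1 * xB κ t := xB_s1 _ _
lemma nf23 (κ : ℂ) : xB κ (s1 : HH a (n+2)) = - (s1 * X0) := by
  have := xB_s1 κ (1 : HH a (n+2))
  rwa [mul_one, nf16, mul_neg] at this
lemma nf24 (κ : ℂ) : xB κ (C0 * t) = C0 * xB κ t := xB_c _ _ _
lemma nf25 (κ : ℂ) : xB κ (C1 * t) = C1 * xB κ t := xB_c _ _ _
lemma nf26 (κ : ℂ) : xB κ C0 = X0 * C0 := by
  have := nf18 (1 : HH a (n+2)) κ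
  rwa [one_mul, nf16, neg_mul, neg_neg] at this
lemma nf27 (κ : ℂ) : xB κ C1 = - (X0 * C1) := by
  have := nf19 (1 : HH a (n+2)) κ
  rwa [one_mul, nf16, neg_mul] at this
lemma nf28 (κ : ℂ) : xB κ (X0 * X1) = - κ • X1 := by rw [nf20, nf17, smul_mul_assoc, one_mul]
lemma nf29 (κ : ℂ) : xB κ X1 = - (X0 * X1) := xB_ξ1 κ
lemma nf30 (κ : ℂ) : xB κ (X0 * (X1 * (C0 * C1))) = κ • (X1 * (C0 * C1)) := by rw [← mul_assoc, nf21, nf28, smul_mul_assoc, ← smul_neg, neg_smul, smul_neg, neg_neg]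
end nf
lemma xB_opW (κ : ℂ) (h : HH a (n+2)) : xB κ (opW κ h) = opW κ (xB κ h) := by
  suffices H : xB κ ∘ₗ opW κ = opW κ ∘ₗ xB (a := a) (n := n+1) κ from LinearMap.congr_fun H h
  have h1 : xB κ (opW κ 1) = opW κ (xB κ (1 : HH a (n+2))) := by
    simp only [opW_apply, map_add, map_sub, map_neg, map_smul, neg_mul, mul_neg, mul_assoc, neg_neg, s1_s1, mul_one, one_mul, mul_add, mul_sub, smul_mul_assoc, mul_smul_comm,
      nf1, nf2, nf3, nf4, nf5, nf6, nf7, nf8, nf9, nf10, nf11, nf12, nf13, nf14, nf1', nf2', nf3', nf4', nf5', nf6', nf7', nf8', nf9', nf10', nf11', nf12', nf13', nf14', nf15',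
      nf16, nf17, nf21, nf22, nf23, nf24, nf25, nf26, nf27, nf28, nf29, nf30]
    module
  have h2 : xB κ (opW κ ((D a (n+2)).ξ 1)) = opW κ (xB κ ((D a (n+2)).ξ 1)) := by
    simp only [opW_apply, map_add, map_sub, map_neg, map_smul, neg_mul, mul_neg, mul_assoc, neg_neg, s1_s1, mul_one, one_mul, mul_add, mul_sub, add_mul, sub_mul, smul_mul_assoc, mul_smul_comm,
      nf1, nf2, nf3, nf4, nf5, nf6, nf7, nf8, nf9, nf10, nf11, nf12, nf13, nf14, nf1', nf2', nf3', nf4', nf5', nf6', nf7', nf8', nf9', nf10', nf11', nf12', nf13', nf14', nf15',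
      nf16, nf17, nf21, nf22, nf23, nf24, nf25, nf26, nf27, nf28, nf29, nf30]
    module
  have h3 : xB κ (opW κ ((D a (n+2)).ξ 0)) = opW κ (xB κ ((D a (n+2)).ξ 0)) := by
    have e : (D a (n+2)).ξ 0 = - xB κ (1 : HH a (n+2)) := by rw [nf16, neg_neg]
    rw [e]; simp only [map_neg]; rw [← h1, xB_sq, xB_sq, map_smul]
  have h4 : xB κ (opW κ ((D a (n+2)).ξ 0 * (D a (n+2)).ξ 1)) = opW κ (xB κ ((D a (n+2)).ξ 0 * (D a (n+2)).ξ 1)) := by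
    have e : (D a (n+2)).ξ 0 * (D a (n+2)).ξ 1 = - xB κ ((D a (n+2)).ξ 1) := by rw [nf29, neg_neg]
    rw [e]; simp only [map_neg]; rw [← h2, xB_sq, xB_sq, map_smul]
  refine lin_ext4 fun w b b' β β' y => ?_
  simp only [LinearMap.comp_apply]
  rw [opW_inc2, xB_inc, xB_inc, opW_inc2]
  congr 1
  have H1 : xB κ (opW κ (pw ((D a (n+2)).ξ 0) b * pw ((D a (n+2)).ξ 1) b')) = opW κ (xB κ (pw ((D a (n+2)).ξ 0) b * pw ((D a (n+2)).ξ 1) b')) := by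
    cases b <;> cases b' <;> simp [h1, h2, h3, h4]
  have H2 : xB κ (opW κ ((D a (n+2)).σ w * (pw ((D a (n+2)).ξ 0) b * pw ((D a (n+2)).ξ 1) b'))) =
      opW κ (xB κ ((D a (n+2)).σ w * (pw ((D a (n+2)).ξ 0) b * pw ((D a (n+2)).ξ 1) b'))) := by
    rw [opW_σ, xB_σ, xB_σ, opW_σ, H1]
  generalize (D a (n+2)).σ w * (pw ((D a (n+2)).ξ 0) b * pw ((D a (n+2)).ξ 1) b') = q at H2
  cases β <;> cases β' <;> simp [opW_c0, opW_c1, nf18, nf19, H2]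
end HH
end

section
namespace HH
variable {a : ℂ} {n : ℕ} (ω : ℂ)

lemma s1_qq1 (b β) : (s1 : HH a (n+2)) * qq 1 b β = qq 0 b β * s1 := by
  rw [s1, σ_qq, Equiv.swap_apply_right]
lemma s1_qq0 (b β) : (s1 : HH a (n+2)) * qq 0 b β = qq 1 b β * s1 := by
  rw [s1, σ_qq, Equiv.swap_apply_left]
lemma inc_qq0 (b β) : inc (qq 0 b β : HH a (n+1)) = qq 1 b β := inc_qq _ _ _
lemma s1_conj (j : Fin n) : (s1 : HH a (n+2)) * inc ((D a (n+1)).σ (Equiv.swap 0 j.succ)) * s1 = (D a (n+2)).σ (Equiv.swap 0 j.succ.succ) := by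
  rw [inc_σ, up_swap, s1, ← map_mul, ← map_mul]
  congr 1
  rw [Fin.succ_zero_eq_one, Equiv.swap_comm 1 j.succ.succ, Equiv.swap_comm 0 1, Equiv.swap_mul_swap_mul_swap, Equiv.swap_comm]
  · rw [← Fin.succ_zero_eq_one, Ne, Fin.succ_inj]; exact Fin.succ_ne_zero _
  · exact Fin.succ_ne_zero _

lemma tr_claim (y : HH a (n+1)) : tr ω (s1 * inc y * s1) = inc (tr ω y) := by
  suffices H : tr ω ∘ₗ LinearMap.mulRight ℂ s1 ∘ₗ LinearMap.mulLeft ℂ s1 ∘ₗ (inc (a := a) (n := n+1)).toLinearMap = (inc (a := a) (n := n)).toLinearMap ∘ₗ tr ω from LinearMap.congr_fun H y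
  refine lin_ext3 (fun b β z => ?_) (fun j b β z => ?_)
  · simp only [LinearMap.comp_apply, LinearMap.mulLeft_apply, LinearMap.mulRight_apply, AlgHom.toLinearMap_apply]
    rw [map_mul inc, inc_qq0, ← mul_assoc, mul_assoc _ _ s1, ← s1_inc2, ← mul_assoc, s1_qq1, s1_s1', tr_q, tr_q]
    split_ifs <;> simp
  · simp only [LinearMap.comp_apply, LinearMap.mulLeft_apply, LinearMap.mulRight_apply, AlgHom.toLinearMap_apply]
    have : s1 * inc ((D a (n+1)).σ (Equiv.swap 0 j.succ) * qq 0 b β * inc z) * s1 =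
       (s1 * inc ((D a (n+1)).σ (Equiv.swap 0 j.succ)) * s1) * qq 0 b β * inc (inc z) := by
      rw [map_mul inc, map_mul inc, inc_qq0, ← mul_assoc, mul_assoc _ _ s1, ← s1_inc2]
      simp only [mul_assoc]
      rw [← mul_assoc s1 (qq 0 _ _), s1_qq0, mul_assoc]
    rw [this, s1_conj, tr_sq, tr_sq, map_mul, inc_qq]

lemma tr_s1 (x y : HH a (n+1)) : tr ω (inc x * s1 * inc y) = x * y := by
  rw [tr_right, tr_left]
  have := tr_sq1 (a := a) (n := n+1) ω 0 false false
  simp [qq] at this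
  rw [s1, this, mul_one]

lemma lin_ext5 {M : Type} [AddCommGroup M] [Module ℂ M] {f g : HH a (n+2) →ₗ[ℂ] M}
    (h1 : ∀ b β y, f (qq 0 b β * inc y) = g (qq 0 b β * inc y))
    (h2 : ∀ x y, f (inc x * s1 * inc y) = g (inc x * s1 * inc y)) : f = g := by
  refine lin_ext3 h1 fun j b β y => ?_
  have : (D a (n+2)).σ (Equiv.swap 0 j.succ) * qq 0 b β * inc y = inc ((D a (n+1)).σ (Equiv.swap 0 j) * qq 0 b β) * s1 * inc ((D a (n+1)).σ (Equiv.swap 0 j) * y) := by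
    rw [map_mul inc, inc_qq0, mul_assoc (inc _) _ s1, ← s1_qq0, map_mul inc, inc_σ, ← mul_assoc, ← mul_assoc, mul_assoc _ (qq 0 b β) ((D a (n+2)).σ _)]
    rw [← up_zero (Equiv.swap 0 j), ← σ_qq, up_zero, ← mul_assoc, s1, ← map_mul, ← map_mul]
    have e : up (Equiv.swap 0 j) * Equiv.swap 0 1 * up (Equiv.swap 0 j) = Equiv.swap 0 j.succ := by
      rw [show (1 : Fin (n+2)) = Fin.succ 0 from rfl, up_mul_swap, mul_assoc, Equiv.swap_apply_left, ← map_mul]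
      simp
    rw [e]
  rw [this, h2]

lemma xiqq (i j : Fin n) (h : i ≠ j) (b β β') : qq i false β * qq j b β' = (sgn (β && β')) • (qq j b β' * qq i false β : HH a n) := by
  have h1 := (D a n).c_anti i j h
  have h2 := (D a n).ξ_c' j i h.symm
  cases b <;> cases β <;> cases β' <;> simp [qq, sgn, h1, h2, ← mul_assoc] <;> simp [mul_assoc, h1]
  rw [← mul_assoc, ← h2, mul_assoc, h1, mul_neg]

def lam (a ω : ℂ) (b β b' β' : Bool) : ℂ := if b then sgn β' * (if b' then a + ω else 1) else 1

lemma tr_qq2 (j : Fin n) (b β b' β') : tr ω ((D a (n+1)).σ (Equiv.swap 0 j.succ) * qq j.succ b β * qq 0 b' β') =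
    lam a ω b β b' β' • (qq j (xor b b') (xor β β') : HH a n) := by
  have hj : j.succ ≠ 0 := Fin.succ_ne_zero j
  have K : ∀ b β b' β', tr ω ((D a (n+1)).σ (Equiv.swap 0 j.succ) * (qq 0 b β * qq j.succ b' β')) = (qq j b β * qq j b' β' : HH a n) := by
    intro b β b' β'
    rw [← inc_qq, ← mul_assoc, tr_sq]
  have c2 := (D a n).c_sq j
  have ξc : (D a n).c j * (D a n).ξ j = - ((D a n).ξ j * (D a n).c j) := by rw [(D a n).ξ_c, neg_neg]
  rw [mul_assoc]
  cases b
  · rw [xiqq _ _ hj, mul_smul_comm, map_smul, K]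
    cases b' <;> cases β <;> cases β' <;> simp [lam, sgn, qq, c2, mul_assoc]
  cases b'
  · have := xiqq (a := a) 0 j.succ hj.symm true β' β
    have e : (qq j.succ true β * qq 0 false β' : HH a (n+1)) = sgn (β' && β) • (qq 0 false β' * qq j.succ true β) := by
      rw [this, smul_smul]
      cases β' <;> cases β <;> simp [sgn]
    rw [e, mul_smul_comm, map_smul, K]
    cases β <;> cases β' <;> simp [lam, sgn, qq, ξc, ← mul_assoc] <;> simp [mul_assoc, c2]
  · have e0 : ∀ β', (qq j.succ true β * qq 0 true β' : HH a (n+1)) = sgn (β && β') • (qq j.succ true false * qq 0 true β' * inc (qq j false β)) := by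
      intro β'
      rw [inc_qq, mul_assoc, show (qq j.succ true β : HH a (n+1)) = qq j.succ true false * qq j.succ false β by simp [qq], mul_assoc, xiqq _ _ hj, mul_smul_comm]
    rw [e0, mul_smul_comm, map_smul, ← mul_assoc, tr_right]
    have cm := (D a (n+1)).comm0 0 j.succ hj
    have key : tr ω ((D a (n+1)).σ (Equiv.swap 0 j.succ) * ((D a (n+1)).ξ j.succ * (D a (n+1)).ξ 0 * pw ((D a (n+1)).c 0) β')) = (sgn β' * (a+ω)) • (qq j false β' : HH a n) := by
      rw [cm, add_mul, mul_add, map_add]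
      have z1 : (D a (n+1)).ξ 0 * (D a (n+1)).ξ j.succ * pw ((D a (n+1)).c 0) β' = qq 0 true β' * qq j.succ true false := by
        have := (D a (n+1)).ξ_c' j.succ 0 hj
        cases β' <;> simp [qq, mul_assoc, this]
      rw [z1, K, ← mul_assoc, ← mul_assoc, ← map_mul, Equiv.swap_mul_self, map_one, one_mul]
      have z2 : ((D a (n+1)).ξ 0 * (1 + (D a (n+1)).c j.succ * (D a (n+1)).c 0) - (1 + (D a (n+1)).c j.succ * (D a (n+1)).c 0) * (D a (n+1)).ξ j.succ) * pw ((D a (n+1)).c 0) β'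
         = qq 0 true β' * inc 1 - (qq 0 true (!β') * inc ((D a n).c j)) - qq 0 false β' * inc ((D a n).ξ j) + (qq 0 false (!β') * inc ((D a n).c j * (D a n).ξ j)) := by
        have h1 := (D a (n+1)).c_anti j.succ 0 hj
        have h2 := (D a (n+1)).c_sq 0
        have h3 := (D a (n+1)).ξ_c' j.succ 0 hj
        rw [h1]
        cases β'
        · simp only [qq, sgn, pw, map_one, map_mul, inc_ξ, inc_c]
          simp
          noncomm_ring
        · simp only [qq, sgn, pw, map_one, map_mul, inc_ξ, inc_c]
          simp
          linear_combination (norm := noncomm_ring) -(D a (n+1)).ξ 0 * (D a (n+1)).c 0 * h1 + (D a (n+1)).ξ 0 * h2 * (D a (n+1)).c j.succ - h3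
            + h1 * (D a (n+1)).ξ j.succ * (D a (n+1)).c 0 + (D a (n+1)).c j.succ * h3 * (D a (n+1)).c 0 - (D a (n+1)).c j.succ * (D a (n+1)).ξ j.succ * h2
      rw [z2]
      simp only [map_add, map_sub, map_smul, tr_q]
      have : (D a n).ξ j * (D a n).ξ j = algebraMap ℂ _ a := (D a n).ξ_sq j
      cases β' <;> simp [qq, sgn, this, Algebra.algebraMap_eq_smul_one, add_smul]
      · rw [mul_assoc, ξc, mul_neg, ← mul_assoc, this, Algebra.algebraMap_eq_smul_one, smul_mul_assoc, one_mul]; module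
    have : (qq j.succ true false * qq 0 true β' : HH a (n+1)) = (D a (n+1)).ξ j.succ * (D a (n+1)).ξ 0 * pw ((D a (n+1)).c 0) β' := by
      simp [qq, mul_assoc]
    rw [this, key]
    cases β <;> cases β' <;> simp [lam, sgn, qq, c2]

lemma T2 (h : HH a (n+2)) : tr ω (tr ω (s1 * h)) = tr ω (tr ω (h * s1)) := by
  suffices H : tr ω ∘ₗ tr ω ∘ₗ LinearMap.mulLeft ℂ (s1 : HH a (n+2)) = tr ω ∘ₗ tr ω ∘ₗ LinearMap.mulRight ℂ s1 from LinearMap.congr_fun H h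
  refine lin_ext5 (fun b β z => ?_) (fun x y => ?_)
  · suffices H : tr ω ∘ₗ tr ω ∘ₗ LinearMap.mulLeft ℂ (s1 * qq 0 b β : HH a (n+2)) ∘ₗ (inc (a := a) (n := n+1)).toLinearMap
        = tr ω ∘ₗ tr ω ∘ₗ LinearMap.mulRight ℂ s1 ∘ₗ LinearMap.mulLeft ℂ (qq 0 b β) ∘ₗ (inc (a := a) (n := n+1)).toLinearMap by
      have := LinearMap.congr_fun H z
      simpa only [LinearMap.comp_apply, LinearMap.mulLeft_apply, LinearMap.mulRight_apply, AlgHom.toLinearMap_apply, mul_assoc] using this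
    have L : ∀ z : HH a (n+1), tr ω (s1 * qq 0 b β * inc z) = qq 0 b β * z := fun z => tr_sq ω 0 b β z
    have M : ∀ b' β', tr ω (qq 0 b β * qq 1 b' β' * s1) = lam a ω b β b' β' • (qq 0 (xor b b') (xor β β') : HH a (n+1)) := by
      intro b' β'
      rw [← tr_qq2]
      congr 1
      rw [mul_assoc, ← s1_qq0, ← mul_assoc, ← s1_qq1]; rfl
    refine lin_ext3 (fun b' β' z => ?_) (fun j b' β' z => ?_)
    · simp only [LinearMap.comp_apply, LinearMap.mulLeft_apply, LinearMap.mulRight_apply, AlgHom.toLinearMap_apply]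
      rw [L, map_mul inc, inc_qq0, ← mul_assoc, ← mul_assoc, mul_assoc _ (inc _) s1, ← s1_inc2, ← mul_assoc, tr_right, tr_right, M, tr_right]
      congr 1
      have c2 := (D a (n+1)).c_sq 0
      have ξc : (D a (n+1)).c 0 * (D a (n+1)).ξ 0 = - ((D a (n+1)).ξ 0 * (D a (n+1)).c 0) := by rw [(D a (n+1)).ξ_c, neg_neg]
      have e : ∃ ν : ℂ, (qq 0 b β * qq 0 b' β' : HH a (n+1)) = ν • qq 0 (xor b b') (xor β β') ∧ (xor b b' = true → xor β β' = false → ν = lam a ω b β b' β') := by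
        have ξ2 : (D a (n+1)).ξ 0 * (D a (n+1)).ξ 0 = a • 1 := by rw [(D a (n+1)).ξ_sq, Algebra.algebraMap_eq_smul_one]
        have ξ2' : ∀ t, (D a (n+1)).ξ 0 * ((D a (n+1)).ξ 0 * t) = a • t := by intro t; rw [← mul_assoc, ξ2, smul_mul_assoc, one_mul]
        have ξc' : ∀ t, (D a (n+1)).c 0 * ((D a (n+1)).ξ 0 * t) = - ((D a (n+1)).ξ 0 * ((D a (n+1)).c 0 * t)) := by intro t; rw [← mul_assoc, ξc, neg_mul, mul_assoc]
        refine ⟨sgn (β && b') * sgn (β && β') * (if b && b' then a else 1), ?_, ?_⟩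
        · cases b <;> cases b' <;> cases β <;> cases β' <;> simp [qq, sgn, c2, ξc, ξ2, ξ2', ξc', mul_assoc]
        · cases b <;> cases b' <;> cases β <;> cases β' <;> simp [sgn, lam]
      obtain ⟨ν, h1, h2⟩ := e
      rw [h1, map_smul, map_smul, tr_q1]
      split_ifs with h
      · rw [h2 h.1 h.2]
      · simp
    · simp only [LinearMap.comp_apply, LinearMap.mulLeft_apply, LinearMap.mulRight_apply, AlgHom.toLinearMap_apply]
      have e0 : qq 0 b β * inc ((D a (n+1)).σ (Equiv.swap 0 j.succ) * qq 0 b' β' * inc z) * s1 =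
        qq 0 b β * inc ((D a (n+1)).σ (Equiv.swap 0 j.succ)) * qq 1 b' β' * s1 * inc (inc z) := by
        rw [map_mul inc, map_mul inc, inc_qq0, mul_assoc _ s1, s1_inc2]; simp only [mul_assoc]
      rw [L, e0, tr_right, tr_right, ← mul_assoc, tr_right]
      congr 1
      rw [← mul_assoc, qq_σ, Equiv.swap_inv, Equiv.swap_apply_left, tr_qq2]
      have : qq 0 b β * inc ((D a (n+1)).σ (Equiv.swap 0 j.succ)) * qq 1 b' β' * s1 = inc ((D a (n+1)).σ (Equiv.swap 0 j.succ)) * (qq 0 b β * qq 1 b' β' * s1) := by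
        rw [inc_σ]
        conv_rhs => rw [← mul_assoc, ← mul_assoc, σ_qq, up_zero]
      rw [this, tr_left, M, mul_smul_comm, map_smul, tr_sq1]
  · simp only [LinearMap.comp_apply, LinearMap.mulLeft_apply, LinearMap.mulRight_apply]
    have e1 : s1 * (inc x * s1 * inc y) = (s1 * inc x * s1) * inc y := by simp only [mul_assoc]
    have e2 : (inc x * s1 * inc y) * s1 = inc x * (s1 * inc y * s1) := by simp only [mul_assoc]
    rw [e1, e2, tr_right, tr_left, tr_claim, tr_claim, tr_left, tr_right]
end HH
namespace HH
variable {a : ℂ} {n : ℕ} (ω : ℂ)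
lemma l_eq (j : Fin n) : (D a (n+2)).σ (Equiv.swap 0 j.succ.succ) = inc ((D a (n+1)).σ (Equiv.swap 0 j.succ)) * s1 * inc ((D a (n+1)).σ (Equiv.swap 0 j.succ)) := by
  rw [inc_σ, up_swap, s1, ← map_mul, ← map_mul]
  congr 1
  rw [Fin.succ_zero_eq_one, Equiv.swap_comm 0 j.succ.succ, Equiv.swap_comm 1 j.succ.succ, Equiv.swap_comm 0 1, Equiv.swap_comm j.succ.succ 1, Equiv.swap_comm 1 0,
    Equiv.swap_mul_swap_mul_swap]
  · exact Fin.zero_ne_one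
  · exact (Fin.succ_ne_zero _).symm
lemma Q_eq (j : Fin n) (y : HH a (n+1)) : tr ω ((D a (n+2)).σ (Equiv.swap 0 j.succ.succ) * inc y * s1) = (D a (n+1)).σ (Equiv.swap 0 j.succ) * inc (tr ω ((D a (n+1)).σ (Equiv.swap 0 j.succ) * y)) := by
  rw [l_eq, mul_assoc _ _ (inc y), ← map_mul, mul_assoc, mul_assoc, ← mul_assoc s1, tr_left, tr_claim]
lemma br1 (j : Fin n) (h : HH a (n+2)) : tr ω ((D a (n+2)).σ (Equiv.swap 0 j.succ.succ) * inc (tr ω ((D a (n+2)).σ (Equiv.swap 0 j.succ.succ) * h)) * s1) =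
    tr ω ((D a (n+2)).σ (Equiv.swap 0 j.succ.succ) * inc (tr ω (h * s1)) * s1) := by
  rw [Q_eq, Q_eq]
  congr 2
  rw [← tr_left, ← tr_left, l_eq, ← mul_assoc, ← mul_assoc, ← mul_assoc, ← map_mul, ← map_mul, Equiv.swap_mul_self, map_one, map_one, one_mul, mul_assoc, T2, mul_assoc (inc _)]
lemma br2 (j : Fin n) (y : HH a (n+1)) : (D a (n+2)).σ (Equiv.swap 0 j.succ.succ) * inc (tr ω ((D a (n+2)).σ (Equiv.swap 0 j.succ.succ) * inc y * s1)) =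
    inc (tr ω ((D a (n+2)).σ (Equiv.swap 0 j.succ.succ) * inc y * s1)) * s1 := by
  rw [Q_eq, l_eq, map_mul inc ((D a (n+1)).σ (Equiv.swap 0 j.succ)), ← mul_assoc, mul_assoc _ (inc ((D a (n+1)).σ _)) (inc ((D a (n+1)).σ _)), ← map_mul, ← map_mul, Equiv.swap_mul_self, map_one, map_one, mul_one, mul_assoc, s1_inc2, mul_assoc]
/-! e_sbxbsb -/
lemma xBs1 (κ : ℂ) (y : HH a (n+1)) : xB κ (inc y * s1) * s1 = inc (xB κ y) := by
  suffices H : LinearMap.mulRight ℂ s1 ∘ₗ xB κ ∘ₗ LinearMap.mulRight ℂ s1 ∘ₗ (inc (a := a) (n := n+1)).toLinearMap = (inc (a := a) (n := n+1)).toLinearMap ∘ₗ xB κ from LinearMap.congr_fun H y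
  refine lin_ext2 (fun w b β z => ?_)
  simp only [LinearMap.comp_apply, LinearMap.mulRight_apply, AlgHom.toLinearMap_apply]
  have e : inc ((D a (n+1)).σ w * qq 0 b β * inc z) * s1 = (D a (n+2)).σ (up w * Equiv.swap 0 1) * qq 0 b β * inc (inc z) := by
    rw [map_mul inc, map_mul inc, inc_qq0, mul_assoc _ _ s1, ← s1_inc2, ← mul_assoc, mul_assoc _ _ s1, ← s1_qq0, inc_σ, map_mul, ← mul_assoc]; rfl
  rw [e, xB_q, xB_q, map_smul, smul_mul_assoc]
  congr 1
  rw [map_mul, mul_assoc, ← s1_inc2, ← mul_assoc]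
  rw [mul_assoc (_ * _) (qq _ _ _) s1]
  change (_ * s1) * (_ * s1) * _ = _
  rw [← s1_qq1, ← mul_assoc, s1_s1', map_mul inc, map_mul inc, inc_σ, inc_qq0]
end HH
end

section
namespace HH
variable {a : ℂ} {n : ℕ} (ω : ℂ)
lemma xB_ξ' (κ : ℂ) (j : Fin n) : xB κ ((D a (n+1)).ξ j.succ) = - ((D a (n+1)).ξ 0 * (D a (n+1)).ξ j.succ) := by
  have := xB_inc κ ((D a n).ξ j) (1 : HH a (n+1))
  rw [one_mul, inc_ξ, xB_1] at this
  rw [this, neg_mul]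
lemma xB_ξj0 (κ : ℂ) (j : Fin n) : xB κ ((D a (n+1)).ξ j.succ * (D a (n+1)).ξ 0) = - κ • (D a (n+1)).ξ j.succ - κ • ((D a (n+1)).σ (Equiv.swap 0 j.succ) * (1 - (D a (n+1)).c j.succ * (D a (n+1)).c 0))
   + (D a (n+1)).σ (Equiv.swap 0 j.succ) * (1 + (D a (n+1)).c j.succ * (D a (n+1)).c 0) * ((D a (n+1)).ξ 0 * (D a (n+1)).ξ j.succ) := by
  have hj : j.succ ≠ 0 := Fin.succ_ne_zero j
  rw [(D a (n+1)).comm0 0 j.succ hj, map_add, ← inc_ξ, xB_inc, xB_σ, map_sub, inc_ξ, xB_ξ, mul_add, map_add, mul_one, xB_ξ, add_mul, map_add, one_mul, xB_ξ',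
    mul_assoc ((D a (n+1)).c j.succ), xB_c, xB_c, xB_ξ', ← mul_assoc ((D a (n+1)).ξ 0), xB_rc, (D a (n+1)).ξ_c' _ _ hj.symm, xB_c, xB_ξ]
  simp only [Algebra.smul_def]
  have := Algebra.commutes (A := HH a (n+1)) κ ((D a (n+1)).σ (Equiv.swap 0 j.succ))
  have h2 := Algebra.commutes (A := HH a (n+1)) κ ((D a (n+1)).c j.succ)
  rw [map_neg]
  linear_combination (norm := noncomm_ring) this * (1- (D a (n+1)).c j.succ * (D a (n+1)).c 0) - (D a (n+1)).σ (Equiv.swap 0 j.succ) * h2 * (D a (n+1)).c 0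

def GG (κ : ℂ) (h : HH a (n+2)) : HH a (n+2) := xB κ (h * s1) * s1
def PP (κ : ℂ) (h : HH a (n+2)) : Prop := tr ω (GG κ h) = xB κ (tr ω h)
variable {ω} {κ : ℂ} {h : HH a (n+2)}
lemma PP_up (u) (H : PP ω κ h) : PP ω κ ((D a (n+2)).σ (up u) * h) := by
  rw [PP, GG] at *
  rw [mul_assoc, xB_σ, mul_assoc, ← inc_σ, tr_left, H, tr_left, xB_σ]
lemma PP_inc2 (y) (H : PP ω κ h) : PP ω κ (h * inc (inc y)) := by
  rw [PP, GG] at *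
  rw [mul_assoc, ← s1_inc2, ← mul_assoc, xB_inc, mul_assoc, ← s1_inc2, ← mul_assoc, tr_right, H, tr_right, xB_inc]
lemma PP_c1 (H : PP ω κ h) : PP ω κ (h * (D a (n+2)).c 1) := by
  rw [PP, GG] at *
  rw [mul_assoc, ← s1_c0, ← mul_assoc, nf18, neg_mul, mul_assoc, ← s1_c1, ← mul_assoc, ← inc_c0, map_neg, tr_right, tr_right, H, xB_rc]
lemma GG_c0 : GG κ (h * (D a (n+2)).c 0) = GG κ h * (D a (n+2)).c 0 := by
  rw [GG, GG, mul_assoc, ← s1_c1, ← mul_assoc, nf19, mul_assoc, ← s1_c0, ← mul_assoc]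
lemma PP_c0 (H : PP ω κ ((D a (n+2)).c 0 * γ h)) : PP ω κ (h * (D a (n+2)).c 0) := by
  rw [PP] at *
  have e : tr ω (h * (D a (n+2)).c 0) = tr ω ((D a (n+2)).c 0 * γ h) := by rw [tr_c0, γ_γ]
  rw [GG_c0, e, ← H]
  have e2 : tr ω (GG κ h * (D a (n+2)).c 0) = tr ω ((D a (n+2)).c 0 * γ (GG κ h)) := by rw [tr_c0, γ_γ]
  rw [e2, GG, GG, mul_assoc _ (γ h), nf24, mul_assoc, map_mul γ, ← xB_γ, map_mul γ]
  have : γ (s1 : HH a (n+2)) = s1 := γ_σ _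
  rw [this]
end HH
namespace HH
variable {a : ℂ} {n : ℕ} {ω κ : ℂ}
section nfs
local notation "X0" => HData.ξ (D a (n+2)) 0
local notation "X1" => HData.ξ (D a (n+2)) 1
local notation "C0" => HData.c (D a (n+2)) 0
local notation "C1" => HData.c (D a (n+2)) 1
lemma GG_σ (w) (h : HH a (n+2)) : GG κ ((D a (n+2)).σ w * h) = (D a (n+2)).σ w * GG κ h := by
  rw [GG, mul_assoc, xB_σ, mul_assoc, ← GG]
lemma GG_1 : GG κ (1 : HH a (n+2)) = - X1 := by
  rw [GG, one_mul, nf23, neg_mul, s1_ξ0, s1_s1']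
lemma GG_X0 : GG κ X0 = - (X1 * X0) := by
  rw [GG, nf1, nf22, nf29, mul_neg, neg_mul, mul_assoc, mul_assoc, nf2, nf1', nf15']
lemma GG_X1 : GG κ X1 = - κ • 1 := by
  rw [GG, nf2, nf22, nf17, mul_smul_comm, smul_mul_assoc, mul_one, s1_s1]
lemma GG_X01 : GG κ (X0 * X1) = - κ • X0 - κ • ((1 - C1 * C0) * s1) + (1 + C1 * C0) * (s1 * (X1 * X0)) := by
  rw [GG, mul_assoc, nf2, nf1', nf22, xB_ξ10]
  simp only [mul_add, add_mul, mul_sub, sub_mul, smul_mul_assoc, mul_smul_comm, mul_one, one_mul, mul_assoc, nf15', nf2, nf1']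
lemma tr_l (k : Fin (n+1)) (b β) (y : HH a (n+1)) : tr ω ((D a (n+2)).σ (Equiv.swap 0 k.succ) * (qq 0 b β * inc y)) = qq k b β * y := by
  rw [← mul_assoc, tr_sq]

lemma PP_σ0 (hm : tr ω (GG κ h) = xB κ (tr ω h)) : PP ω κ h := hm
lemma PPs1_1 : PP ω κ (s1 : HH a (n+2)) := by
  have e := GG_σ (κ := κ) (Equiv.swap 0 1) (1 : HH a (n+2))
  have t := tr_s1 (a := a) (n := n) ω 1 1
  have t2 := tr_s1 (a := a) (n := n) ω 1 ((D a (n+1)).ξ 0)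
  simp only [map_one, mul_one, one_mul, inc_ξ0] at t t2
  rw [mul_one, ← s1, GG_1] at e
  rw [PP, e, mul_neg, map_neg, t, t2, xB_1]
lemma tr_s10 : tr ω (s1 * (X1 * X0)) = (a + ω) • (1 : HH a (n+1)) := by
  have := tr_qq2 (a := a) (n := n+1) ω 0 true false true false
  simp [qq, lam, sgn, mul_assoc] at this
  exact this
lemma tr_s10c : tr ω (s1 * (X1 * C1 * X0)) = (a + ω) • ((D a (n+1)).c 0) := by
  have := tr_qq2 (a := a) (n := n+1) ω 0 true true true false
  simp [qq, lam, sgn, mul_assoc] at this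
  rw [mul_assoc X1]; exact this
lemma tr_X10 : tr ω (X1 * X0) = ω • (D a (n+1)).ξ 0 := by
  rw [← inc_ξ0, tr_left]
  have := tr_q1 (a := a) (n := n+1) ω true false
  simp only [qq, pw, if_true, mul_one] at this
  simp at this
  rw [this, Algebra.algebraMap_eq_smul_one, mul_smul_comm, mul_one]
lemma C01X10 : C0 * (C1 * (X1 * X0)) = C1 * X1 * (X0 * C0) := by
  have h1 := nf14' (a := a) (n := n) (X1 * X0)
  rw [nf7', nf5, mul_neg, mul_neg, neg_inj] at h1
  rw [mul_assoc, h1]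
lemma tr_cX : tr ω (C0 * (C1 * (X1 * X0))) = 0 := by
  rw [C01X10, ← inc_ξ0, ← inc_c0, ← map_mul, tr_left]
  have := tr_q1 (a := a) (n := n+1) ω true true
  simp [qq, pw] at this
  rw [this, mul_zero]

lemma t_sX0 : tr ω (s1 * X0) = (D a (n+1)).ξ 0 := by
  have t2 := tr_sq1 (a := a) (n := n+1) ω 0 true false
  simp [qq, pw] at t2
  exact t2
lemma t_sX01 : tr ω (s1 * (X0 * X1)) = a • 1 := by
  have t0 := tr_sq (a := a) (n := n+1) ω 0 true false ((D a (n+1)).ξ 0)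
  simp [qq, pw, (D a (n+1)).ξ_sq, mul_assoc] at t0
  rw [← Algebra.algebraMap_eq_smul_one]
  exact t0
lemma t_1 : tr ω (1 : HH a (n+2)) = 0 := by
  have t2 := tr_q1 (a := a) (n := n+1) ω false false
  simp [qq, pw] at t2
  exact t2
lemma t_C01 : tr ω (C0 * C1) = 0 := by
  have t2 := tr_q (a := a) (n := n+1) ω false true ((D a (n+1)).c 0)
  simp [qq, pw] at t2
  exact t2
lemma PPs1_0 : PP ω (a+ω) (s1 * X0) := by
  have e := GG_σ (κ := (a+ω)) (Equiv.swap 0 1) (X0)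
  rw [← s1, GG_X0] at e
  rw [PP, e, mul_neg, map_neg, t_sX0, tr_s10, xB_ξ, Algebra.algebraMap_eq_smul_one]
lemma PPs1_X1 : PP ω κ (s1 * X1) := by
  have e := GG_σ (κ := κ) (Equiv.swap 0 1) (X1)
  have t := tr_s1 (a := a) (n := n) ω 1 1
  have t2 := tr_s1 (a := a) (n := n) ω 1 ((D a (n+1)).ξ 0)
  simp only [map_one, mul_one, one_mul, inc_ξ0] at t t2
  rw [← s1, GG_X1] at e
  rw [PP, e, t2, mul_smul_comm, mul_one, map_smul, t, xB_ξ, Algebra.algebraMap_eq_smul_one, neg_smul]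
lemma PPs1_X01 : PP ω (a+ω) (s1 * (X0 * X1)) := by
  have e := GG_σ (κ := (a+ω)) (Equiv.swap 0 1) (X0 * X1)
  rw [← s1, GG_X01] at e
  rw [PP, e, t_sX01]
  simp only [mul_add, add_mul, mul_sub, sub_mul, mul_smul_comm, mul_one, one_mul, mul_assoc, nf3, nf4', nf3', nf15', s1_s1, map_add, map_sub, map_smul, t_sX0, t_1, tr_X10, tr_cX, ← nf4, ← nf3, s1_c0, s1_c1]
  simp only [nf4', nf3', nf3, nf4, nf15', t_C01, tr_cX, xB_1]
  module
lemma t_qi (b β) (y : HH a (n+1)) : tr ω (pw X0 b * pw C0 β * inc y) = if b = true ∧ β = false then ω • y else 0 := tr_q (n := n+1) ω b β y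
lemma GG_pc (β) (h : HH a (n+2)) : GG κ (h * pw C0 β) = GG κ h * pw C0 β := by
  cases β
  · simp [pw]
  · simp [pw, GG_c0]
lemma t_X0c (β) : tr ω (X0 * pw C0 β) = if β then 0 else ω • 1 := by
  have h1 := t_qi (a := a) (n := n) (ω := ω) true β 1
  rw [map_one, mul_one] at h1
  cases β <;> simp [pw] at h1 ⊢ <;> exact h1
lemma t_c (β) : tr ω (pw C0 β) = 0 := by
  have h1 := t_qi (a := a) (n := n) (ω := ω) false β 1
  cases β <;> simp [pw] at h1 ⊢ <;> exact h1
lemma pc_X1 (β) : pw C0 β * X1 = X1 * pw C0 β := by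
  cases β <;> simp [pw, nf7]
lemma PP0_X0 (β) : PP ω κ (X0 * pw C0 β) := by
  rw [PP, GG_pc, GG_X0, neg_mul, map_neg, mul_assoc, ← inc_ξ0, tr_left, t_X0c]
  cases β <;> simp [xB_1]
lemma PP0_X1 (β) : PP ω κ (X1 * pw C0 β) := by
  rw [PP, GG_pc, GG_X1, smul_mul_assoc, one_mul, map_smul, ← inc_ξ0, tr_left, t_c]
  simp
lemma PP0_1 (β) : PP ω κ (pw C0 β) := by
  rw [PP, ← one_mul (pw C0 β), GG_pc, GG_1, neg_mul, map_neg, ← inc_ξ0, tr_left, one_mul, t_c]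
  simp
lemma tr_s10' (β') : tr ω (s1 * (X1 * (X0 * pw C0 β'))) = (sgn β' * (a + ω)) • (pw ((D a (n+1)).c 0) β') := by
  have := tr_qq2 (a := a) (n := n+1) ω 0 true false true β'
  cases β' <;> simp [qq, lam, sgn, mul_assoc] at this ⊢ <;> exact this
lemma tr_s10c' (β') : tr ω (s1 * (X1 * (C1 * (X0 * pw C0 β')))) = (sgn β' * (a + ω)) • (pw ((D a (n+1)).c 0) (!β')) := by
  have := tr_qq2 (a := a) (n := n+1) ω 0 true true true β'
  cases β' <;> simp [qq, lam, sgn, mul_assoc] at this ⊢ <;> exact this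
lemma t_s1 (β) : tr ω (s1 * pw C0 β) = pw ((D a (n+1)).c 0) β := by
  have t2 := tr_sq1 (a := a) (n := n+1) ω 0 false β
  cases β <;> simp [qq, pw] at t2 ⊢ <;> exact t2
lemma t_s1c (β) : tr ω (s1 * (C1 * pw C0 β)) = pw ((D a (n+1)).c 0) (!β) := by
  have t2 := tr_qq2 (a := a) (n := n+1) ω 0 false true false β
  have hc := (D a (n+1)).c_sq 0
  cases β <;> simp [qq, lam, sgn, mul_assoc] at t2 ⊢ <;> exact t2
lemma PP0_X01 (β) : PP ω (a+ω) (X0 * X1 * pw C0 β) := by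
  have h1 : X0 * X1 * pw C0 β = X0 * pw C0 β * inc ((D a (n+1)).ξ 0) := by rw [mul_assoc, ← pc_X1, ← mul_assoc, inc_ξ0]
  have h2 : GG (a+ω) (X0 * X1) * pw C0 β = - (a+ω) • (X0 * pw C0 β) - (a+ω) • (s1 * pw C0 β) + (a+ω) • (inc ((D a (n+1)).c 0) * (s1 * (C1 * pw C0 β)))
     + s1 * (X1 * (X0 * pw C0 β)) - inc ((D a (n+1)).c 0) * (s1 * (X1 * (C1 * (X0 * pw C0 β)))) := by
    rw [GG_X01, inc_c0]
    simp only [mul_add, add_mul, mul_sub, sub_mul, smul_mul_assoc, mul_smul_comm, mul_one, one_mul, mul_assoc, nf3', nf6', mul_neg, smul_sub, neg_mul]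
    abel
  have hc : (D a (n+1)).c 0 * (D a (n+1)).c 0 = -1 := (D a (n+1)).c_sq 0
  rw [PP, GG_pc, h2, h1, tr_right, t_X0c]
  simp only [map_add, map_sub, map_smul, tr_left, t_X0c, t_s1, t_s1c, tr_s10', tr_s10c']
  cases β <;> simp [pw, sgn, hc, xB_ξ, Algebra.algebraMap_eq_smul_one]
  all_goals module
end nfs
end HH
namespace HH
variable {a : ℂ} {n : ℕ} {ω κ : ℂ}
section nfs
local notation "X0" => HData.ξ (D a (n+2)) 0
local notation "X1" => HData.ξ (D a (n+2)) 1
local notation "C0" => HData.c (D a (n+2)) 0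
local notation "C1" => HData.c (D a (n+2)) 1
variable (k : Fin n)
def ll (k : Fin n) : HH a (n+2) := (D a (n+2)).σ (Equiv.swap 0 k.succ.succ)
def rr (k : Fin n) : HH a (n+1) := (D a (n+1)).σ (Equiv.swap 0 k.succ)
lemma ll_s1 : (ll k * s1 : HH a (n+2)) = inc (rr k) * ll k := by
  rw [rr, ll, inc_σ, s1, ← map_mul, ← map_mul, up_swap, Equiv.mul_swap_eq_swap_mul, Equiv.swap_apply_left, Equiv.swap_apply_of_ne_of_ne, Equiv.swap_comm]
  · rfl
  · simp
  · simp [Fin.ext_iff]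
lemma ll_X1 : ll k * X1 = X1 * ll k := by
  rw [ll, (D a (n+2)).σ_ξ, Equiv.swap_apply_of_ne_of_ne]
  · simp
  · simp [Fin.ext_iff]
lemma ll_C1 : ll k * C1 = C1 * ll k := by
  rw [ll, (D a (n+2)).σ_c, Equiv.swap_apply_of_ne_of_ne]
  · simp
  · simp [Fin.ext_iff]
lemma tr_ll (b β) (y : HH a (n+1)) : tr ω (ll k * (pw X0 b * pw C0 β * inc y)) = pw ((D a (n+1)).ξ k.succ) b * pw ((D a (n+1)).c k.succ) β * y :=
  tr_l _ _ _ _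
lemma GG_ll (h : HH a (n+2)) : GG κ (ll k * h) = ll k * GG κ h := GG_σ _ _
lemma PPl_1 : PP ω κ (ll k : HH a (n+2)) := by
  have h1 := GG_ll (κ := κ) k (1 : HH a (n+2))
  have h2 := tr_ll (a := a) (ω := ω) k false false 1
  have h3 := tr_ll (a := a) (ω := ω) k false false ((D a (n+1)).ξ 0)
  simp [pw, inc_ξ0] at h1 h2 h3
  rw [PP, h1, GG_1, mul_neg, map_neg, h2, h3, xB_1]
lemma PPl_X0 : PP ω κ (ll k * X0) := by
  have h2 := tr_ll (a := a) (ω := ω) k true false 1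
  simp [pw] at h2
  rw [PP, GG_ll, h2, GG_X0, mul_neg, map_neg, ← mul_assoc, ll_X1, mul_assoc, ← inc_ξ0, tr_left, h2, xB_ξ']
lemma PPl_X1 : PP ω κ (ll k * X1) := by
  have h2 := tr_ll (a := a) (ω := ω) k false false 1
  have h3 := tr_ll (a := a) (ω := ω) k false false ((D a (n+1)).ξ 0)
  simp [pw, inc_ξ0] at h2 h3
  rw [PP, GG_ll, h3, GG_X1, mul_smul_comm, mul_one, map_smul, h2, xB_ξ, Algebra.algebraMap_eq_smul_one, neg_smul]
lemma PPl_X01 : PP ω κ (ll k * (X0 * X1)) := by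
  have h1 := tr_ll (a := a) (ω := ω) k true false ((D a (n+1)).ξ 0)
  have h2 := tr_ll (a := a) (ω := ω) k true false 1
  have h3 := tr_ll (a := a) (ω := ω) k false false 1
  have h4 := tr_ll (a := a) (ω := ω) k false true ((D a (n+1)).c 0)
  have h5 := tr_ll (a := a) (ω := ω) k true true 1
  simp [pw, inc_ξ0, inc_c0] at h1 h2 h3 h4 h5
  have e : ll k * GG κ (X0 * X1) = - κ • (ll k * X0) - κ • (inc (rr k) * ll k) + κ • (inc (rr k) * (ll k * (C0 * C1)))
     + inc (rr k * (D a (n+1)).ξ 0) * (ll k * X0) + inc (rr k * (D a (n+1)).c 0 * (D a (n+1)).ξ 0) * (ll k * (X0 * C0)) := by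
    have q1 : C1 * C0 * s1 = s1 * (C0 * C1) := by rw [mul_assoc, nf3, nf4']
    rw [GG_X01, sub_mul, one_mul, q1, add_mul, one_mul, ← mul_assoc (C1 * C0), q1, mul_assoc s1, mul_assoc C0, C01X10]
    simp only [mul_add, mul_sub, mul_smul_comm, ← mul_assoc, ll_s1, map_mul, inc_ξ0, inc_c0, smul_sub]
    simp only [mul_assoc (inc (rr k)), ll_C1, ll_X1]
    simp only [mul_assoc, ll_X1]
    simp only [← mul_assoc _ (ll k), ll_X1]
    simp only [mul_assoc, ll_X1]
    simp only [← mul_assoc (ll k), ll_X1]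
    simp only [mul_assoc]
    abel
  rw [PP, GG_ll, e, h1, xB_ξj0]
  simp only [map_add, map_sub, map_smul, tr_left, h2, h3, h4, h5]
  have k1 := (D a (n+1)).c_anti k.succ 0 (Fin.succ_ne_zero k)
  have k2 := (D a (n+1)).ξ_c' 0 k.succ (Fin.succ_ne_zero k).symm
  have k3 := (D a (n+1)).ξ_c k.succ
  have : rr k * (D a (n+1)).c 0 * (D a (n+1)).ξ 0 * ((D a (n+1)).ξ k.succ * (D a (n+1)).c k.succ) = rr k * ((D a (n+1)).c k.succ * (D a (n+1)).c 0 * ((D a (n+1)).ξ 0 * (D a (n+1)).ξ k.succ)) := by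
    rw [k3, k1]
    linear_combination (norm := noncomm_ring) -rr k * (D a (n+1)).c 0 * k2 * (D a (n+1)).ξ k.succ
  rw [this, ← rr]
  simp only [mul_add, add_mul, mul_sub, smul_sub, mul_one, mul_assoc]
  abel
lemma PP_neg {h : HH a (n+2)} (H : PP ω κ h) : PP ω κ (-h) := by
  have e := neg_one_smul ℂ h
  rw [PP] at *
  rw [← e, GG, smul_mul_assoc, map_smul, smul_mul_assoc, map_smul, ← GG, H, map_smul, map_smul]
lemma PP_sgn {h : HH a (n+2)} (b) (H : PP ω κ h) : PP ω κ (sgn b • h) := by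
  cases b
  · simpa [sgn] using H
  · simpa [sgn] using PP_neg H
def mm (b b' : Bool) : HH a (n+2) := pw X0 b * pw X1 b'
lemma γ_mm (b b') : γ (mm b b' : HH a (n+2)) = mm b b' ∨ γ (mm b b' : HH a (n+2)) = - mm b b' := by
  rw [mm]
  cases b <;> cases b' <;> simp [pw, γ_ξ]
lemma PP_main (w : Equiv.Perm (Fin (n+2))) (b b' β) : PP ω (a+ω) ((D a (n+2)).σ w * mm b b' * pw C0 β) := by
  have hw : w = up (dn w⁻¹)⁻¹ * Equiv.swap 0 (w⁻¹ 0) := by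
    have := dn_spec w⁻¹
    apply_fun (·⁻¹) at this
    rwa [inv_inv, mul_inv_rev, Equiv.swap_inv, ← map_inv] at this
  have key : ∀ j, PP ω (a+ω) ((D a (n+2)).σ (Equiv.swap 0 j) * mm b b' * pw C0 β) := by
    intro j
    refine Fin.cases ?_ (fun j => Fin.cases ?_ (fun k => ?_) j) j
    · have := PP0_1 (a := a) (n := n) (ω := ω) (κ := a+ω) β
      have := PP0_X0 (a := a) (n := n) (ω := ω) (κ := a+ω) β
      have := PP0_X1 (a := a) (n := n) (ω := ω) (κ := a+ω) β
      have := PP0_X01 (a := a) (n := n) (ω := ω) β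
      rw [Equiv.swap_self, show Equiv.refl _ = (1 : Equiv.Perm (Fin (n+2))) from rfl, map_one, one_mul]
      cases b <;> cases b' <;> simpa only [mm, pw, if_true, Bool.false_eq_true, if_false, one_mul, mul_one]
    · have B : ∀ b b', PP ω (a+ω) (s1 * mm b b' : HH a (n+2)) := by
        intro b b'
        have := PPs1_1 (a := a) (n := n) (ω := ω) (κ := a+ω)
        have := PPs1_0 (a := a) (n := n) (ω := ω)
        have := PPs1_X1 (a := a) (n := n) (ω := ω) (κ := a+ω)
        have := PPs1_X01 (a := a) (n := n) (ω := ω)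
        cases b <;> cases b' <;> simpa only [mm, pw, if_true, Bool.false_eq_true, if_false, one_mul, mul_one]
      change PP ω (a+ω) (s1 * mm b b' * pw C0 β)
      cases β
      · simpa [pw] using B b b'
      · simp only [pw, if_true]
        apply PP_c0
        have e1 : C0 * γ (s1 * mm b b') = s1 * (C1 * γ (mm b b')) := by
          rw [map_mul γ, show γ (s1 : HH a (n+2)) = s1 from γ_σ _, nf3']
        have e2 : C1 * mm b b' = sgn b' • (mm b b' * C1) := by
          cases b <;> cases b' <;> simp [mm, pw, sgn, nf6, nf8, mul_assoc, nf8']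
        have B' := PP_sgn b' (PP_c1 (B b b'))
        rw [mul_assoc, ← mul_smul_comm, ← e2] at B'
        rw [e1]
        rcases γ_mm (a := a) (n := n) b b' with h | h <;> rw [h]
        · exact B'
        · rw [mul_neg, mul_neg]; exact PP_neg B'
    · have B : ∀ b b', PP ω (a+ω) (ll k * mm b b' : HH a (n+2)) := by
        intro b b'
        have := PPl_1 (a := a) (n := n) (ω := ω) (κ := a+ω) k
        have := PPl_X0 (a := a) (n := n) (ω := ω) (κ := a+ω) k
        have := PPl_X1 (a := a) (n := n) (ω := ω) (κ := a+ω) k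
        have := PPl_X01 (a := a) (n := n) (ω := ω) (κ := a+ω) k
        cases b <;> cases b' <;> simpa only [mm, pw, if_true, Bool.false_eq_true, if_false, one_mul, mul_one]
      change PP ω (a+ω) (ll k * mm b b' * pw C0 β)
      cases β
      · simpa [pw] using B b b'
      · simp only [pw, if_true]
        apply PP_c0
        have e1 : C0 * γ (ll k * mm b b') = ll k * ((D a (n+2)).c k.succ.succ * γ (mm b b')) := by
          rw [map_mul γ, show γ (ll k : HH a (n+2)) = ll k from γ_σ _, ← mul_assoc (ll k), ll, (D a (n+2)).σ_c, Equiv.swap_apply_right, mul_assoc]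
        have i1 : X0 * (D a (n+2)).c k.succ.succ = (D a (n+2)).c k.succ.succ * X0 := (D a (n+2)).ξ_c' _ _ (Fin.succ_ne_zero _).symm
        have i2 : X1 * (D a (n+2)).c k.succ.succ = (D a (n+2)).c k.succ.succ * X1 := (D a (n+2)).ξ_c' _ _ (by simp [Fin.ext_iff])
        have e2 : (D a (n+2)).c k.succ.succ * mm b b' = mm b b' * (D a (n+2)).c k.succ.succ := by
          cases b <;> cases b' <;> simp [mm, pw, i1, i2, mul_assoc]
          rw [← mul_assoc, ← i1, mul_assoc]
        have B' := (PP_inc2 ((D a n).c k) (B b b'))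
        rw [inc_c, inc_c, mul_assoc, ← e2] at B'
        rw [e1]
        rcases γ_mm (a := a) (n := n) b b' with h | h <;> rw [h]
        · exact B'
        · rw [mul_neg, mul_neg]; exact PP_neg B'
  rw [hw, map_mul]
  have := PP_up (dn w⁻¹)⁻¹ (key (w⁻¹ 0))
  simpa only [mul_assoc] using this
/-- the relation between the partial trace and the operator `xB`, after conjugation by `s1` -/
lemma tr_xB (h : HH a (n+2)) : tr ω (xB (a+ω) (h * s1) * s1) = xB (a+ω) (tr ω h) := by
  suffices H : tr ω ∘ₗ LinearMap.mulRight ℂ s1 ∘ₗ xB (a+ω) ∘ₗ LinearMap.mulRight ℂ s1 = xB (a+ω) ∘ₗ tr (a := a) (n := n+1) ω from LinearMap.congr_fun H h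
  refine lin_ext4 fun w b b' β β' y => ?_
  have h0 := PP_main (a := a) (n := n) (ω := ω) w b b' β
  have h1 : PP ω (a+ω) ((D a (n+2)).σ w * mm b b' * pw C0 β * pw C1 β') := by
    cases β'
    · simpa [pw] using h0
    · simpa [pw] using PP_c1 h0
  exact PP_inc2 y h1
end nfs
end HH
end

section
namespace HH
variable {a : ℂ} {n : ℕ} {ω κ : ℂ}
section mix
/-- the operator `x̄₁ + e₁ - c₁ e₁ c₁` -/
def MM (ω : ℂ) (h : HH a (n+1)) : HH a (n+1) := xB (a+ω) h + inc (tr ω h) - (D a (n+1)).c 0 * inc (tr ω ((D a (n+1)).c 0 * h))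
lemma MM_inc (h : HH a (n+1)) (y) : MM ω (h * inc y) = MM ω h * inc y := by
  rw [MM, MM, xB_inc, tr_right, map_mul inc, ← mul_assoc, tr_right, map_mul inc]
  noncomm_ring
lemma MM_add (h h' : HH a (n+1)) : MM ω (h + h') = MM ω h + MM ω h' := by
  simp only [MM, map_add, mul_add]; abel
lemma MM_smul (z : ℂ) (h : HH a (n+1)) : MM ω (z • h) = z • MM ω h := by
  simp only [MM, map_smul, mul_smul_comm, smul_add, smul_sub]
lemma MM_sub (h h' : HH a (n+1)) : MM ω (h - h') = MM ω h - MM ω h' := by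
  simp only [MM, map_sub, mul_sub]; abel
lemma MM_c (h : HH a (n+1)) : MM ω (h * (D a (n+1)).c 0) = - (MM ω h * (D a (n+1)).c 0) := by
  have h0 : (D a (n+1)).c 0 * (D a (n+1)).c 0 = -1 := (D a (n+1)).c_sq 0
  have h1 : tr ω (h * (D a (n+1)).c 0) = - γ (tr ω ((D a (n+1)).c 0 * h)) := by
    rw [← tr_γ, map_mul γ, γ_c, neg_mul, map_neg, tr_c0, γ_γ, neg_neg]
  have h2 : tr ω ((D a (n+1)).c 0 * (h * (D a (n+1)).c 0)) = γ (tr ω h) := by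
    rw [tr_c0, map_mul γ, γ_c, mul_neg, neg_mul, mul_assoc, h0, mul_neg_one, neg_neg, tr_γ]
  have h3 := c0_inc (tr ω h)
  have h4 := c0_inc (tr ω ((D a (n+1)).c 0 * h))
  have h5 := c0_inc (γ (tr ω h))
  rw [γ_γ] at h5
  rw [MM, MM, xB_rc, h1, h2, h5, h4, map_neg]
  linear_combination (norm := noncomm_ring) -inc (γ (tr ω ((D a (n+1)).c 0 * h))) * h0
lemma tr_one0 : tr ω (1 : HH a (n+1)) = 0 := by
  have := tr_q1 (a := a) (n := n) ω false false
  simpa [qq, pw] using this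
lemma tr_ξ0 : tr ω ((D a (n+1)).ξ 0) = algebraMap ℂ _ ω := by
  have := tr_q1 (a := a) (n := n) ω true false
  simpa [qq, pw] using this
lemma tr_cc0 : tr ω ((D a (n+1)).c 0) = 0 := by
  have := tr_q1 (a := a) (n := n) ω false true
  simpa [qq, pw] using this
lemma tr_ξc0 : tr ω ((D a (n+1)).ξ 0 * (D a (n+1)).c 0) = 0 := by
  have := tr_q1 (a := a) (n := n) ω true true
  simpa [qq, pw] using this
lemma MM_1 : MM ω (1 : HH a (n+1)) = - (D a (n+1)).ξ 0 := by
  rw [MM, xB_1, tr_one0, mul_one, tr_cc0]; simp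
lemma MM_ξ : MM ω ((D a (n+1)).ξ 0) = algebraMap ℂ _ (-a) := by
  have h : (D a (n+1)).c 0 * (D a (n+1)).ξ 0 = - ((D a (n+1)).ξ 0 * (D a (n+1)).c 0) := by rw [(D a (n+1)).ξ_c, neg_neg]
  rw [MM, xB_ξ, tr_ξ0, h, map_neg, tr_ξc0]; simp
variable (j : Fin n)
local notation "l" => HData.σ (D a (n+1)) (Equiv.swap 0 j.succ)
lemma tr_lq (b β) (y : HH a n) : tr ω (l * (pw ((D a (n+1)).ξ 0) b * pw ((D a (n+1)).c 0) β * inc y)) = pw ((D a n).ξ j) b * pw ((D a n).c j) β * y := by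
  rw [← mul_assoc]; exact tr_sq _ _ _ _ _
lemma c0_l : (D a (n+1)).c 0 * l = l * inc ((D a n).c j) := by
  rw [inc_c, (D a (n+1)).σ_c, Equiv.swap_apply_right]
lemma ξ0_l : (D a (n+1)).ξ 0 * l = l * inc ((D a n).ξ j) := by
  rw [inc_ξ, (D a (n+1)).σ_ξ, Equiv.swap_apply_right]
lemma MM_l : MM ω l = 1 - l * (D a (n+1)).ξ 0 - (D a (n+1)).c 0 * inc ((D a n).c j) := by
  have h1 := tr_lq (a := a) (ω := ω) j false false 1
  have h2 := tr_lq (a := a) (ω := ω) j false false ((D a n).c j)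
  have h3 := xB_σ (a+ω) (Equiv.swap 0 j.succ) (1 : HH a (n+1))
  rw [mul_one, xB_1] at h3
  simp only [pw, Bool.false_eq_true, if_false, one_mul, mul_one, map_one] at h1 h2
  rw [MM, h3, c0_l, h1, h2, map_one]; noncomm_ring
lemma MM_lξ : MM ω (l * (D a (n+1)).ξ 0) = - (a + ω) • l + inc ((D a n).ξ j) - (D a (n+1)).c 0 * inc ((D a n).ξ j * (D a n).c j) := by
  have h1 := tr_lq (a := a) (ω := ω) j true false 1
  have h2 := tr_lq (a := a) (ω := ω) j true false ((D a n).c j)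
  have h3 := xB_σ (a+ω) (Equiv.swap 0 j.succ) ((D a (n+1)).ξ 0)
  have h4 := (D a (n+1)).ξ_c' 0 j.succ (Fin.succ_ne_zero j).symm
  rw [xB_ξ, Algebra.algebraMap_eq_smul_one, mul_neg, mul_smul_comm, mul_one] at h3
  simp only [pw, Bool.false_eq_true, if_false, one_mul, mul_one, map_one, if_true, inc_c] at h1 h2
  rw [MM, h3, ← mul_assoc, c0_l, inc_c, mul_assoc, ← h4, h1, h2, neg_smul]
lemma MM_comm (h : HH a (n+1)) : MM ω ((D a (n+1)).ξ 0 * h) = (D a (n+1)).ξ 0 * MM ω h := by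
  let F : HH a (n+1) →ₗ[ℂ] HH a (n+1) := { toFun := MM ω, map_add' := MM_add, map_smul' := MM_smul }
  suffices H : F ∘ₗ LinearMap.mulLeft ℂ ((D a (n+1)).ξ 0) = LinearMap.mulLeft ℂ ((D a (n+1)).ξ 0) ∘ₗ F from LinearMap.congr_fun H h
  have S : ∀ h : HH a (n+1), MM ω ((D a (n+1)).ξ 0 * h) = (D a (n+1)).ξ 0 * MM ω h → ∀ β y,
     MM ω ((D a (n+1)).ξ 0 * (h * pw ((D a (n+1)).c 0) β * inc y)) = (D a (n+1)).ξ 0 * MM ω (h * pw ((D a (n+1)).c 0) β * inc y) := by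
    intro h H β y
    rw [← mul_assoc, MM_inc, MM_inc, ← mul_assoc, ← mul_assoc]
    congr 1
    cases β
    · simpa [pw] using H
    · simp only [pw, if_true]; rw [MM_c, MM_c, H, mul_neg]; noncomm_ring
  have x2 : (D a (n+1)).ξ 0 * (D a (n+1)).ξ 0 = algebraMap ℂ _ a := (D a (n+1)).ξ_sq 0
  refine lin_ext3 (fun b β y => ?_) (fun j b β y => ?_)
  · have H : MM ω ((D a (n+1)).ξ 0 * (pw ((D a (n+1)).ξ 0) b)) = (D a (n+1)).ξ 0 * MM ω (pw ((D a (n+1)).ξ 0) b) := by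
      cases b
      · simp [pw, MM_ξ, MM_1, x2]
      · simp only [pw, if_true, MM_ξ]
        rw [x2, Algebra.algebraMap_eq_smul_one, Algebra.algebraMap_eq_smul_one, MM_smul, MM_1]; simp
    exact S _ H β y
  · have H : MM ω ((D a (n+1)).ξ 0 * ((D a (n+1)).σ (Equiv.swap 0 j.succ) * pw ((D a (n+1)).ξ 0) b)) = (D a (n+1)).ξ 0 * MM ω ((D a (n+1)).σ (Equiv.swap 0 j.succ) * pw ((D a (n+1)).ξ 0) b) := by
      have hj : j.succ ≠ 0 := Fin.succ_ne_zero j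
      have cm := (D a (n+1)).comm0 0 j.succ hj
      have a1 := (D a (n+1)).c_anti j.succ 0 hj
      have a2 := (D a (n+1)).ξ_c' j.succ 0 hj
      have a3 := (D a (n+1)).ξ_c' 0 j.succ hj.symm
      have a4 := (D a (n+1)).ξ_c j.succ
      have xj : (D a (n+1)).ξ j.succ * (D a (n+1)).ξ j.succ = algebraMap ℂ _ a := (D a (n+1)).ξ_sq j.succ
      have ll : (D a (n+1)).σ (Equiv.swap 0 j.succ) * (D a (n+1)).σ (Equiv.swap 0 j.succ) = 1 := by rw [← map_mul]; simp
      cases b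
      · simp only [pw, Bool.false_eq_true, if_false, mul_one]
        rw [ξ0_l, MM_inc, MM_l, mul_sub, mul_sub, ← mul_assoc, ξ0_l, inc_ξ, inc_c, mul_assoc ((D a (n+1)).σ (Equiv.swap 0 j.succ)), cm, sub_mul, sub_mul]
        linear_combination (norm := noncomm_ring) ll * (- (D a (n+1)).ξ j.succ+ (D a (n+1)).ξ 0 * (1 + (D a (n+1)).c j.succ * (D a (n+1)).c 0) - (D a (n+1)).c j.succ * (D a (n+1)).c 0 * (D a (n+1)).ξ j.succ) + (D a (n+1)).ξ 0 * a1 - a1 * (D a (n+1)).ξ j.succ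
      · simp only [pw, if_true]
        have e : (D a (n+1)).ξ 0 * ((D a (n+1)).σ (Equiv.swap 0 j.succ) * (D a (n+1)).ξ 0) = (D a (n+1)).σ (Equiv.swap 0 j.succ) * (D a (n+1)).ξ 0 * inc ((D a n).ξ j) + ((D a (n+1)).ξ 0 + (D a (n+1)).ξ 0 * inc ((D a n).c j) * (D a (n+1)).c 0 - 1 * inc ((D a n).ξ j) - 1 * inc ((D a n).c j) * (D a (n+1)).c 0 * inc ((D a n).ξ j)) := by
          rw [← mul_assoc, ξ0_l, inc_ξ, inc_c, mul_assoc, cm]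
          linear_combination (norm := noncomm_ring) ll * ((D a (n+1)).ξ 0 * (1 + (D a (n+1)).c j.succ * (D a (n+1)).c 0) - (1 + (D a (n+1)).c j.succ * (D a (n+1)).c 0) * (D a (n+1)).ξ j.succ)
        rw [e]
        simp only [MM_add, MM_sub, MM_inc, MM_c]
        rw [MM_lξ, MM_ξ, MM_1, map_mul inc, inc_ξ, inc_c, Algebra.algebraMap_eq_smul_one]
        have k1 : (D a (n+1)).ξ 0 * (D a (n+1)).σ (Equiv.swap 0 j.succ) = (D a (n+1)).σ (Equiv.swap 0 j.succ) * (D a (n+1)).ξ j.succ := by rw [ξ0_l, inc_ξ]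
        rw [Algebra.algebraMap_eq_smul_one] at xj
        simp only [neg_smul, add_smul, mul_add, mul_sub, add_mul, sub_mul, smul_mul_assoc, mul_smul_comm, neg_mul, mul_neg, k1, one_mul]
        linear_combination (norm := skip) xj - (D a (n+1)).c 0 * (D a (n+1)).ξ j.succ * a4 + a • a1 - (D a (n+1)).ξ 0 * a1 * (D a (n+1)).ξ j.succ  + (D a (n+1)).c 0 * xj * (D a (n+1)).c j.succ - (D a (n+1)).ξ 0 * (D a (n+1)).c 0 * a4
        simp only [neg_smul, mul_add, mul_sub, add_mul, sub_mul, smul_mul_assoc, mul_smul_comm, neg_mul, mul_neg, one_mul, mul_one, mul_assoc, smul_sub, smul_neg, smul_add]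
        rw [a4]
        simp only [mul_neg]
        abel
    have := S _ H β y
    rw [mul_assoc ((D a (n+1)).σ (Equiv.swap 0 j.succ))] at this
    exact this
end mix
end HH
end

section
/-- shorthand for extension of permutations along an embedding -/
abbrev via {α β : Type} (f : α ↪ β) : Equiv.Perm α →* Equiv.Perm β := Equiv.Perm.viaEmbeddingHom f

lemma via_apply {α β : Type} (f : α ↪ β) (w : Equiv.Perm α) (x : α) : via f w (f x) = f (w x) := by
  rw [Equiv.Perm.viaEmbeddingHom_apply, Equiv.Perm.viaEmbedding_apply]
lemma via_not {α β : Type} (f : α ↪ β) (w : Equiv.Perm α) (x : β) (h : ∀ y, f y ≠ x) : via f w x = x := by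
  simp only [via, Equiv.Perm.viaEmbeddingHom_apply]
  exact Equiv.Perm.viaEmbedding_apply_of_notMem _ _ _ (by rintro ⟨y, rfl⟩; exact h y rfl)
lemma via_swap {α β : Type} [DecidableEq α] [DecidableEq β] (f : α ↪ β) (x y : α) :
    via f (Equiv.swap x y) = Equiv.swap (f x) (f y) := by
  ext z
  by_cases h : ∃ u, f u = z
  · obtain ⟨u, rfl⟩ := h
    rw [via_apply]
    simp only [Equiv.swap_apply_def, f.injective.eq_iff]
    split_ifs <;> rfl
  · push Not at h
    rw [via_not _ _ _ h, Equiv.swap_apply_of_ne_of_ne (h x).symm (h y).symm]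

namespace HH
variable {a : ℂ} {n : ℕ} {ω : ℂ}
lemma tr_xB0 (h : HH a (n+1)) : tr ω (xB (a+ω) h) = - tr ω ((D a (n+1)).ξ 0 * h) := by
  suffices H : tr ω ∘ₗ xB (a+ω) = - (tr ω ∘ₗ LinearMap.mulLeft ℂ ((D a (n+1)).ξ 0)) from LinearMap.congr_fun H h
  refine lin_ext3 (fun b β y => ?_) (fun j b β y => ?_)
  · have h1 := xB_q (a := a) (n := n) (a+ω) 1 b β y
    rw [map_one, one_mul, one_mul] at h1
    rw [LinearMap.comp_apply, h1, map_smul, tr_q]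
    simp only [LinearMap.neg_apply, LinearMap.comp_apply, LinearMap.mulLeft_apply]
    cases b
    · have h2 : (D a (n+1)).ξ 0 * (qq 0 false β * inc y) = qq 0 true β * inc y := by simp [qq, mul_assoc]
      rw [h2, tr_q]
      cases β <;> simp [sgn]
    · have h2 : (D a (n+1)).ξ 0 * (qq 0 true β * inc y) = a • (qq 0 false β * inc y) := by
        simp only [qq, pw_true, pw_false, ← mul_assoc, (D a (n+1)).ξ_sq, one_mul]
        rw [mul_assoc, ← Algebra.smul_def]
      rw [h2, map_smul, tr_q]; simp
  · rw [LinearMap.comp_apply, xB_q, map_smul, tr_sq]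
    simp only [LinearMap.neg_apply, LinearMap.comp_apply, LinearMap.mulLeft_apply]
    have h2 : (D a (n+1)).ξ 0 * ((D a (n+1)).σ (Equiv.swap 0 j.succ) * qq 0 b β * inc y)
      = (D a (n+1)).σ (Equiv.swap 0 j.succ) * qq j.succ true false * qq 0 b β * inc y := by
      rw [← mul_assoc, ← mul_assoc, (D a (n+1)).ξ_σ]; simp [qq]
    rw [h2, tr_right, tr_qq2]
    cases b <;> cases β <;> simp [lam, sgn, qq] <;> module
end HH
end

section
lemma sw_eq {n a b : ℕ} (h : a < n) (h' : b < n) : sw n a b = Equiv.swap ⟨a, h⟩ ⟨b, h'⟩ := by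
  rw [sw, dif_pos ⟨h, h'⟩]

/-- labels of upper strands -/
def lab (T R : ℕ) : Fin (R+1) ↪ Fin (T+R+1+1) where
  toFun i := if h : (i : ℕ) = 0 then 0 else ⟨T + 1 + i, by omega⟩
  inj' i j h := by
    simp only at h
    split_ifs at h with h1 h2 h2
    · exact Fin.ext (by omega)
    · have := congrArg Fin.val h; simp at this; omega
    · have := congrArg Fin.val h; simp at this
    · have := congrArg Fin.val h; simp at this; exact Fin.ext (by omega)
/-- labels of lower strands -/
def labb (T R : ℕ) : Fin (T+1) ↪ Fin (T+R+1+1) := Fin.castLEEmb (by omega)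

lemma lab_zero {T R : ℕ} (h) : lab T R ⟨0, h⟩ = 0 := rfl
lemma labb_zero {T R : ℕ} (h) : labb T R ⟨0, h⟩ = 0 := rfl
lemma lab_pos {T R : ℕ} (i : Fin (R+1)) (h : (i : ℕ) ≠ 0) : lab T R i = Fin.succ (⟨T + i, by omega⟩ : Fin (T+R+1)) := by
  refine Fin.ext ?_
  show Fin.val (if h : (i : ℕ) = 0 then (0 : Fin (T+R+1+1)) else ⟨T + 1 + i, by omega⟩) = _
  rw [dif_neg h]; simp; omega
lemma labb_pos {T R : ℕ} (i : Fin (T+1)) (h : (i : ℕ) ≠ 0) : labb T R i = Fin.succ (⟨i - 1, by omega⟩ : Fin (T+R+1)) := by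
  simp [labb, Fin.ext_iff]; omega
lemma lab_one {T R : ℕ} (h : 1 < R + 1) : lab T R ⟨1, h⟩ = Fin.succ (Fin.succ (⟨T, by omega⟩ : Fin (T+R))) := by
  rw [lab_pos _ (by simp)]; rfl
lemma labb_one {T R : ℕ} (h : 1 < T + 1) : labb T R ⟨1, h⟩ = 1 := by
  simp [labb, Fin.ext_iff]

namespace HH
variable {a : ℂ} {ω : ℂ}

/-- `e` as an operator -/
def opE (ω : ℂ) {n : ℕ} : Module.End ℂ (HH a (n+1)) := (inc (a := a)).toLinearMap ∘ₗ tr ω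
lemma opE_apply {n : ℕ} (h : HH a (n+1)) : opE ω h = inc (tr ω h) := rfl

/-- `σ` as operators -/
def opσ (a : ℂ) (T R : ℕ) : Equiv.Perm (Fin (R+1)) →* Module.End ℂ (HH a (T+R+1+1)) where
  toFun w := LinearMap.mulLeft ℂ ((D a _).σ (via (lab T R) w))
  map_one' := by rw [map_one, map_one]; exact LinearMap.mulLeft_one _ _
  map_mul' u v := by rw [map_mul, map_mul]; exact LinearMap.mulLeft_mul _ _ _ _
lemma opσ_apply {T R : ℕ} (w) (h : HH a (T+R+1+1)) : opσ a T R w h = (D a _).σ (via (lab T R) w) * h := rfl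
/-- `σ̄` as operators -/
def opσb (a : ℂ) (T R : ℕ) : Equiv.Perm (Fin (T+1)) →* Module.End ℂ (HH a (T+R+1+1)) where
  toFun w := LinearMap.mulRight ℂ ((D a _).σ (via (labb T R) w⁻¹))
  map_one' := by rw [inv_one, map_one, map_one]; exact LinearMap.mulRight_one _ _
  map_mul' u v := by rw [mul_inv_rev, map_mul, map_mul]; exact LinearMap.mulRight_mul _ _ _ _
lemma opσb_apply {T R : ℕ} (w) (h : HH a (T+R+1+1)) : opσb a T R w h = h * (D a _).σ (via (labb T R) w⁻¹) := rfl
/-- `c` as operators -/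
def opc (a : ℂ) (T R : ℕ) (i : Fin (R+1)) : Module.End ℂ (HH a (T+R+1+1)) := LinearMap.mulLeft ℂ ((D a _).c (lab T R i))
lemma opc_apply {T R : ℕ} (i) (h : HH a (T+R+1+1)) : opc a T R i h = (D a _).c (lab T R i) * h := rfl
/-- `c̄` as operators -/
def opcb (a : ℂ) (T R : ℕ) (i : Fin (T+1)) : Module.End ℂ (HH a (T+R+1+1)) :=
  LinearMap.mulRight ℂ ((D a _).c (labb T R i)) ∘ₗ (γ (a := a)).toLinearMap
lemma opcb_apply {T R : ℕ} (i) (h : HH a (T+R+1+1)) : opcb a T R i h = γ h * (D a _).c (labb T R i) := rfl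

lemma opσ_sw {T R : ℕ} (h1 : 1 < R+1) (h : HH a (T+R+1+1)) : opσ a T R (sw (R+1) 0 1) h =
    (D a (T+R+2)).σ (Equiv.swap 0 (Fin.succ (Fin.succ (⟨T, by omega⟩ : Fin (T+R))))) * h := by
  rw [opσ_apply, sw_eq (by omega) h1, via_swap, lab_one, lab_zero]
lemma opσb_sw {T R : ℕ} (h1 : 1 < T+1) (h : HH a (T+R+1+1)) : opσb a T R (sw (T+1) 0 1) h = h * s1 := by
  rw [opσb_apply, sw_eq (by omega) h1, Equiv.swap_inv, via_swap, labb_one, labb_zero]; rfl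
lemma opσ_sw' {T R : ℕ} (i : ℕ) (hi : 0 < i) (h1 : i+1 < R+1) (h : HH a (T+R+1+1)) : ∃ w, opσ a T R (sw (R+1) i (i+1)) =
    LinearMap.mulLeft ℂ (inc ((D a (T+R+1)).σ w)) := by
  refine ⟨Equiv.swap ⟨T+i, by omega⟩ ⟨T+(i+1), by omega⟩, LinearMap.ext fun h => ?_⟩
  rw [opσ_apply, sw_eq (by omega) h1, via_swap, lab_pos _ (by simp; omega), lab_pos _ (by simp), inc_σ, up_swap]; rfl
lemma opσb_sw' {T R : ℕ} (i : ℕ) (hi : 0 < i) (h1 : i+1 < T+1) (h : HH a (T+R+1+1)) : ∃ w, opσb a T R (sw (T+1) i (i+1)) =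
    LinearMap.mulRight ℂ (inc ((D a (T+R+1)).σ w)) := by
  refine ⟨Equiv.swap ⟨i-1, by omega⟩ ⟨i, by omega⟩, LinearMap.ext fun h => ?_⟩
  rw [opσb_apply, sw_eq (by omega) h1, Equiv.swap_inv, via_swap, labb_pos _ (by simp; omega), labb_pos _ (by simp), inc_σ, up_swap]; rfl

/-- the walled Brauer-Clifford structure on `HH` -/
def wbc (a ω : ℂ) (T R : ℕ) : WBC ℂ (Module.End ℂ (HH a (T+R+1+1))) (R+1) (T+1) where
  σ := opσ a T R
  σb := opσb a T R
  c := opc a T R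
  cb := opcb a T R
  e := opE ω
  c_sq i := LinearMap.ext fun h => by
    simp only [Module.End.mul_apply, opc_apply, ← mul_assoc, (D a _).c_sq]; simp
  c_anti i j hij := LinearMap.ext fun h => by
    simp only [Module.End.mul_apply, opc_apply, ← mul_assoc, LinearMap.neg_apply]
    rw [(D a _).c_anti _ _ (fun h => hij ((lab T R).injective h)), neg_mul]
  c_conj w i := LinearMap.ext fun h => by
    simp only [Module.End.mul_apply, opc_apply, opσ_apply, ← mul_assoc, (D a _).σ_c, via_apply]
    rw [mul_assoc _ (HData.σ _ _) (HData.σ _ _), ← map_mul, ← map_mul]; simp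
  cb_sq i := LinearMap.ext fun h => by
    simp only [Module.End.mul_apply, opcb_apply, map_mul, γ_c, γ_γ, mul_neg, neg_mul, mul_assoc, (D a _).c_sq]; simp
  cb_anti i j hij := LinearMap.ext fun h => by
    simp only [Module.End.mul_apply, opcb_apply, map_mul, γ_c, γ_γ, mul_neg, neg_mul, mul_assoc, LinearMap.neg_apply]
    rw [(D a _).c_anti _ _ (fun h => hij ((labb T R).injective h)), mul_neg, neg_neg]
  cb_conj w i := LinearMap.ext fun h => by
    simp only [Module.End.mul_apply, opcb_apply, opσb_apply, map_mul, γ_σ, mul_assoc]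
    rw [← mul_assoc ((D a _).σ _), (D a _).σ_c, mul_assoc, ← map_mul, ← map_mul]
    simp [via_apply]
  comm_σσb w v := LinearMap.ext fun h => by
    simp only [Module.End.mul_apply, opσ_apply, opσb_apply, mul_assoc]
  comm_σcb w v := LinearMap.ext fun h => by
    simp only [Module.End.mul_apply, opσ_apply, opcb_apply, mul_assoc, map_mul, γ_σ]
  comm_σbc w v := LinearMap.ext fun h => by
    simp only [Module.End.mul_apply, opσb_apply, opc_apply, mul_assoc]
  anti_ccb w v := LinearMap.ext fun h => by
    simp only [Module.End.mul_apply, opcb_apply, opc_apply, mul_assoc, map_mul, γ_c, LinearMap.neg_apply, neg_mul, neg_neg]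
  e_c1 h1 h2 := LinearMap.ext fun h => by
    simp only [Module.End.mul_apply, opcb_apply, opc_apply, opE_apply, lab_zero, labb_zero, tr_c0]
  c1_e h1 h2 := LinearMap.ext fun h => by
    simp only [Module.End.mul_apply, opcb_apply, opc_apply, opE_apply, lab_zero, labb_zero, c0_inc, inc_γ]
  e_sq := LinearMap.ext fun h => by
    have := tr_left ω (tr ω h) 1
    rw [mul_one, tr_one0, mul_zero] at this
    simp only [Module.End.mul_apply, opE_apply, this, map_zero, LinearMap.zero_apply]
  e_s_e h1 := LinearMap.ext fun h => by
    have h2 := tr_sq1 (a := a) (n := T+R+1) ω (Fin.succ (⟨T, by omega⟩ : Fin (T+R))) false false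
    simp only [qq, pw_false, mul_one] at h2
    simp only [Module.End.mul_apply, opE_apply, opσ_sw h1, tr_right, h2, one_mul]
  e_sb_e h1 := LinearMap.ext fun h => by
    have h2 := tr_s1 (a := a) (n := T+R) (ω := ω) (tr ω h) 1
    rw [map_one, mul_one, mul_one] at h2
    simp only [Module.End.mul_apply, opE_apply, opσb_sw h1, h2]
  s_e_comm i hi h1 := by
    obtain ⟨w, hw⟩ := opσ_sw' (a := a) (T := T) i hi h1 0
    rw [hw]
    refine LinearMap.ext fun h => ?_
    simp only [Module.End.mul_apply, opE_apply, LinearMap.mulLeft_apply, tr_left, map_mul inc]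
  sb_e_comm i hi h1 := by
    obtain ⟨w, hw⟩ := opσb_sw' (a := a) (R := R) i hi h1 0
    rw [hw]
    refine LinearMap.ext fun h => ?_
    simp only [Module.End.mul_apply, opE_apply, LinearMap.mulRight_apply, tr_right, map_mul inc]
  braid1 h1 h2 := LinearMap.ext fun h => by
    simp only [Module.End.mul_apply, opE_apply, opσ_sw h1, opσb_sw h2, ← mul_assoc]
    exact congrArg inc (br1 _ _ _)
  braid2 h1 h2 := LinearMap.ext fun h => by
    simp only [Module.End.mul_apply, opE_apply, opσ_sw h1, opσb_sw h2, ← mul_assoc]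
    exact br2 _ _ _
  c_e_comm i hi := LinearMap.ext fun h => by
    simp only [Module.End.mul_apply, opE_apply, opc_apply, lab_pos _ hi, ← inc_c, tr_left, map_mul inc]
  cb_e_comm i hi := LinearMap.ext fun h => by
    simp only [Module.End.mul_apply, opE_apply, opcb_apply, labb_pos _ hi, ← inc_c, tr_right, map_mul inc, inc_γ, tr_γ]
  e_c_e h1 := LinearMap.ext fun h => by
    have h2 := tr_right ω (tr ω h) ((D a (T+R+1+1)).c 0)
    rw [tr_cc0, zero_mul] at h2
    simp only [Module.End.mul_apply, opE_apply, opc_apply, lab_zero, h2, map_zero, LinearMap.zero_apply]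
  e_cb_e h1 := LinearMap.ext fun h => by
    have h2 := tr_left ω (γ (tr ω h)) ((D a (T+R+1+1)).c 0)
    rw [tr_cc0, mul_zero] at h2
    simp only [Module.End.mul_apply, opE_apply, opcb_apply, labb_zero, inc_γ, h2, map_zero, LinearMap.zero_apply]

lemma opE_alg (z : ℂ) {n : ℕ} : algebraMap ℂ (Module.End ℂ (HH a (n+1))) z * opE ω = opE ω * algebraMap ℂ _ z := Algebra.commutes _ _
/-- `x₁` as operator -/
def opx (a : ℂ) (n : ℕ) : Module.End ℂ (HH a (n+1)) := LinearMap.mulLeft ℂ ((D a (n+1)).ξ 0)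
lemma opx_apply {n : ℕ} (h : HH a (n+1)) : opx a n h = (D a (n+1)).ξ 0 * h := rfl
lemma opx_sq {n : ℕ} : opx a n ^ 2 = algebraMap ℂ _ a := LinearMap.ext fun h => by
  rw [pow_two]
  simp only [Module.End.mul_apply, opx_apply, ← mul_assoc, (D a _).ξ_sq, Module.algebraMap_end_apply]
  rw [← Algebra.smul_def]
/-- `x̄₁` as operator -/
def opxB (a : ℂ) (n : ℕ) (κ : ℂ) : Module.End ℂ (HH a (n+1)) := xB κ
lemma opxB_apply {n : ℕ} (κ : ℂ) (h : HH a (n+1)) : opxB a n κ h = xB κ h := rfl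
lemma xB_sq' {n : ℕ} (κ : ℂ) : opxB a n κ ^ 2 = algebraMap ℂ _ κ := LinearMap.ext fun h => by
  rw [pow_two]
  simp only [Module.End.mul_apply, opxB_apply, xB_sq, Module.algebraMap_end_apply]
lemma opE_x_opE {n : ℕ} : opE ω * opx a n * opE ω = algebraMap ℂ _ ω * opE ω := LinearMap.ext fun h => by
  simp only [Module.End.mul_apply, opx_apply, opE_apply, tr_right, tr_ξ0, map_mul inc, AlgHom.commutes, Module.algebraMap_end_apply]
  rw [← Algebra.smul_def]
lemma opE_opE {n : ℕ} : opE ω * opE ω = (0 : Module.End ℂ (HH a (n+1))) := LinearMap.ext fun h => by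
    have := tr_left ω (tr ω h) 1
    rw [mul_one, tr_one0, mul_zero] at this
    simp only [Module.End.mul_apply, opE_apply, this, map_zero, LinearMap.zero_apply]
lemma xB_opE {n : ℕ} (κ : ℂ) : opxB a n κ * opE ω = - (opx a n * opE ω) := LinearMap.ext fun h => by
  simp only [Module.End.mul_apply, LinearMap.neg_apply, opx_apply, opE_apply, opxB_apply]
  have := xB_inc (a := a) κ (tr ω h) 1
  rwa [one_mul, xB_1, neg_mul] at this

lemma opE_xB_opE {n : ℕ} (κ : ℂ) : opE ω * (opxB a n κ * opE ω) = algebraMap ℂ _ (-ω) * opE ω := by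
  rw [xB_opE]
  refine LinearMap.ext fun h => ?_
  have := LinearMap.congr_fun (opE_x_opE (a := a) (ω := ω) (n := n)) h
  simp only [Module.End.mul_apply, LinearMap.neg_apply, map_neg, Module.algebraMap_end_apply, neg_smul] at this ⊢
  rw [this]

/-- the affine walled Brauer-Clifford structure on `HH` -/
def awbc (a ω : ℂ) (T R : ℕ) (f g : ℕ → ℂ) (hf0 : ∀ k, f (2*k) = 0) (hf1 : ∀ k, f (2*k+1) = a^k * ω)
   (hg0 : ∀ k, g (2*k) = 0) (hg1 : ∀ k, g (2*k+1) = - ((a+ω)^k * ω)) :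
   AWBC ℂ (Module.End ℂ (HH a (T+R+1+1))) (R+1) (T+1) ω where
  toWBC := wbc a ω T R
  x1 := opx a _
  xb1 := opxB a _ (a+ω)
  om k := algebraMap ℂ _ (f k)
  omb k := algebraMap ℂ _ (g k)
  om_one := by have := hf1 0; simp at this; rw [this]
  om_even k := by rw [hf0, map_zero]
  omb_zero := by have := hg0 0; simp at this; rw [this, map_zero]
  om_comm k := ⟨fun _ => Algebra.commutes _ _, fun _ => Algebra.commutes _ _, fun _ => Algebra.commutes _ _,
    fun _ => Algebra.commutes _ _, Algebra.commutes _ _, Algebra.commutes _ _, Algebra.commutes _ _,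
    fun _ => Algebra.commutes _ _, fun _ => Algebra.commutes _ _⟩
  omb_comm k := ⟨fun _ => Algebra.commutes _ _, fun _ => Algebra.commutes _ _, fun _ => Algebra.commutes _ _,
    fun _ => Algebra.commutes _ _, Algebra.commutes _ _, Algebra.commutes _ _, Algebra.commutes _ _,
    fun _ => Algebra.commutes _ _⟩
  x_comm h1 := LinearMap.ext fun h => by
    show opx a _ (opσ a T R _ (opx a _ (opσ a T R _ h)) - (opσ a T R _ h - opc a T R _ (opc a T R _ (opσ a T R _ h)))) =
      opσ a T R _ (opx a _ (opσ a T R _ (opx a _ h))) - (opσ a T R _ (opx a _ h) - opc a T R _ (opc a T R _ (opσ a T R _ (opx a _ h))))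
    simp only [opσ_sw h1, opx_apply, opc_apply, lab_zero, lab_one]
    generalize hj : Fin.succ (Fin.succ (⟨T, by omega⟩ : Fin (T+R))) = j
    have hne : (0 : Fin (T+R+1+1)) ≠ j := by rw [← hj]; exact (Fin.succ_ne_zero _).symm
    have h3 := (D a (T+R+1+1)).ξ_ξ 0 j hne
    have h4 : (D a (T+R+1+1)).σ (Equiv.swap 0 j) * ((D a (T+R+1+1)).ξ 0 * (D a (T+R+1+1)).σ (Equiv.swap 0 j)) = (D a (T+R+1+1)).ξ j := by
      rw [← mul_assoc, (D a _).σ_ξ, Equiv.swap_apply_left, mul_assoc, ← map_mul, Equiv.swap_mul_self, map_one, mul_one]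
    have h5 : ∀ y, (D a (T+R+1+1)).σ (Equiv.swap 0 j) * ((D a (T+R+1+1)).ξ 0 * ((D a (T+R+1+1)).σ (Equiv.swap 0 j) * y)) = (D a (T+R+1+1)).ξ j * y := by
      intro y; rw [← h4]; simp only [mul_assoc]
    simp only [show T + R + 2 = T + R + 1 + 1 from rfl, h5]
    linear_combination (norm := noncomm_ring) h3 * h
  x1_c1 h1 := LinearMap.ext fun h => by
    show opx a _ (opc a T R _ h) = - opc a T R _ (opx a _ h)
    simp only [opx_apply, opc_apply, lab_zero, ← mul_assoc, (D a _).ξ_c, neg_mul]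
  x1_c i hi := LinearMap.ext fun h => by
    show opx a _ (opc a T R _ h) = opc a T R _ (opx a _ h)
    simp only [opx_apply, opc_apply, ← mul_assoc]
    rw [(D a _).ξ_c']
    rw [lab_pos _ hi]; exact (Fin.succ_ne_zero _).symm
  s_x1 i hi h1 := by
    refine LinearMap.ext fun h => ?_
    show opσ a T R _ (opx a _ h) = opx a _ (opσ a T R _ h)
    rw [opx_apply, opx_apply, opσ_apply, opσ_apply, ← mul_assoc, ← mul_assoc, (D a _).σ_ξ, sw_eq (by omega) h1, via_swap, Equiv.swap_apply_of_ne_of_ne]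
    · rw [lab_pos _ (by simp; omega)]; exact (Fin.succ_ne_zero _).symm
    · rw [lab_pos _ (by simp)]; exact (Fin.succ_ne_zero _).symm
  xb_comm h1 := LinearMap.ext fun h => by
    show xB (a+ω) (opσb a T R _ (xB (a+ω) (opσb a T R _ h)) - (opσb a T R _ h + opcb a T R _ (opcb a T R _ (opσb a T R _ h)))) =
      opσb a T R _ (xB (a+ω) (opσb a T R _ (xB (a+ω) h))) - (opσb a T R _ (xB (a+ω) h) + opcb a T R _ (opcb a T R _ (opσb a T R _ (xB (a+ω) h))))
    have key : ∀ h : HH a (T+R+1+1), opσb a T R (sw (T+1) 0 1) (xB (a+ω) (opσb a T R (sw (T+1) 0 1) h)) - (opσb a T R (sw (T+1) 0 1) h +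
       opcb a T R ⟨0, by omega⟩ (opcb a T R ⟨1, h1⟩ (opσb a T R (sw (T+1) 0 1) h))) = opW (a+ω) h := by
      intro h
      simp only [opσb_sw h1, opcb_apply, labb_zero, labb_one, opW_apply, map_mul γ, γ_γ, γ_c]
      noncomm_ring
    rw [key, key, xB_opW]
  xb1_cb1 h1 := LinearMap.ext fun h => by
    show xB (a+ω) (opcb a T R _ h) = - opcb a T R _ (xB (a+ω) h)
    simp only [opcb_apply, labb_zero, ← xB_γ, xB_rc]
  xb1_cb i hi := LinearMap.ext fun h => by
    show xB (a+ω) (opcb a T R _ h) = opcb a T R _ (xB (a+ω) h)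
    simp only [opcb_apply, labb_pos _ hi, ← xB_γ, ← inc_c, xB_inc]
  sb_xb1 i hi h1 := by
    obtain ⟨w, hw⟩ := opσb_sw' (a := a) (R := R) i hi h1 0
    show opσb a T R _ * _ = _ * opσb a T R _
    rw [hw]
    refine LinearMap.ext fun h => ?_
    simp only [Module.End.mul_apply, LinearMap.mulRight_apply, opxB_apply, xB_inc]
  e_xsum := LinearMap.ext fun h => by
    show opE ω (opx a _ h + xB (a+ω) h) = 0
    rw [opE_apply, map_add, tr_xB0, opx_apply, add_neg_cancel, map_zero]
  xsum_e := by
    show (opx a _ + opxB a _ (a+ω)) * opE ω = 0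
    rw [add_mul, xB_opE, add_neg_cancel]
  e_sxs h1 := LinearMap.ext fun h => by
    show opE ω (opσ a T R _ (opx a _ (opσ a T R _ h))) = opσ a T R _ (opx a _ (opσ a T R _ (opE ω h)))
    simp only [opσ_sw h1, opx_apply, opE_apply]
    generalize hj : (Fin.succ (⟨T, by omega⟩ : Fin (T+R))) = j
    have h5 : ∀ y, (D a (T+R+1+1)).σ (Equiv.swap 0 j.succ) * ((D a (T+R+1+1)).ξ 0 * ((D a (T+R+1+1)).σ (Equiv.swap 0 j.succ) * y)) = (D a (T+R+1+1)).ξ j.succ * y := by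
      intro y
      rw [← mul_assoc, (D a _).σ_ξ, Equiv.swap_apply_left, mul_assoc, ← mul_assoc _ _ y, ← map_mul, Equiv.swap_mul_self, map_one, one_mul]
    rw [h5, h5, ← inc_ξ, tr_left, map_mul inc]
  x_mixed h1 := LinearMap.ext fun h => by
    show opx a _ (opE ω h + xB (a+ω) h - opc a T R _ (opE ω (opc a T R _ h))) = opE ω (opx a _ h) - opc a T R _ (opE ω (opc a T R _ (opx a _ h))) + xB (a+ω) (opx a _ h)
    simp only [opx_apply, opc_apply, lab_zero, opE_apply]
    have := MM_comm (ω := ω) h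
    rw [MM, MM] at this
    rw [add_comm (inc (tr ω h)), ← this]; abel
  e_sbxbsb h1 := LinearMap.ext fun h => by
    show opE ω (opσb a T R _ (xB (a+ω) (opσb a T R _ h))) = opσb a T R _ (xB (a+ω) (opσb a T R _ (opE ω h)))
    simp only [opσb_sw h1, opE_apply]
    rw [tr_xB, xBs1]
  e_xodd k := by
    show opE ω * opx a _ ^ (2*k+1) * opE ω = _ * opE ω
    rw [hf1, pow_succ, pow_mul, opx_sq, ← map_pow, ← mul_assoc, ← Algebra.commutes (a^k), mul_assoc, mul_assoc, ← mul_assoc (opE ω), opE_x_opE, map_mul, mul_assoc]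
  e_xeven k hk := by
    show opE ω * opx a _ ^ (2*k) * opE ω = 0
    rw [pow_mul, opx_sq, ← map_pow, ← Algebra.commutes, mul_assoc, opE_opE, mul_zero]
  e_xb k hk := by
    show opE ω * opxB a _ (a+ω) ^ k * opE ω = algebraMap ℂ _ (g k) * opE ω
    obtain ⟨l, rfl | rfl⟩ := k.even_or_odd'
    · rw [hg0, map_zero, zero_mul, pow_mul, xB_sq', ← map_pow, ← Algebra.commutes, mul_assoc, opE_opE, mul_zero]
    · rw [hg1, pow_succ, pow_mul, xB_sq', ← map_pow, ← mul_assoc, ← Algebra.commutes ((a+ω)^l), mul_assoc, mul_assoc, opE_xB_opE, ← mul_assoc, ← map_mul, mul_neg]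
  x1_cb_comm i := LinearMap.ext fun h => by
    show opx a _ (opcb a T R _ h) = opcb a T R _ (opx a _ h)
    simp only [opx_apply, opcb_apply, map_mul γ, γ_ξ, mul_assoc]
  xb1_c_comm i := LinearMap.ext fun h => by
    show xB (a+ω) (opc a T R _ h) = opc a T R _ (xB (a+ω) h)
    simp only [opc_apply, xB_c]
  x1_σb w := LinearMap.ext fun h => by
    show opσb a T R w (opx a _ h) = opx a _ (opσb a T R w h)
    simp only [opx_apply, opσb_apply, mul_assoc]
  xb1_σ w := LinearMap.ext fun h => by
    show opσ a T R w (xB (a+ω) h) = xB (a+ω) (opσ a T R w h)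
    simp only [opσ_apply, xB_σ]
end HH
end

section
/-- Index form of the (level two) affine walled Brauer-Clifford relations -/
structure Idx (a κ ω : ℂ) (B : Type) [Ring B] [Algebra ℂ B] (r t : ℕ) : Type where
  σ : Equiv.Perm (Fin r) →* B
  σb : Equiv.Perm (Fin t) →* B
  c : Fin r → B
  cb : Fin t → B
  ξ : Fin r → B
  ξb : Fin t → B
  ε : Fin r → Fin t → B
  c_sq : ∀ i, c i * c i = -1
  c_anti : ∀ i j, i ≠ j → c i * c j = -(c j * c i)
  σ_c : ∀ w i, σ w * c i = c (w i) * σ w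
  cb_sq : ∀ i, cb i * cb i = 1
  cb_anti : ∀ i j, i ≠ j → cb i * cb j = -(cb j * cb i)
  σb_cb : ∀ w i, σb w * cb i = cb (w i) * σb w
  σσb : ∀ w v, σ w * σb v = σb v * σ w
  σcb : ∀ w j, σ w * cb j = cb j * σ w
  σbc : ∀ v i, σb v * c i = c i * σb v
  ccb : ∀ i j, c i * cb j = -(cb j * c i)
  σ_ξ : ∀ w i, σ w * ξ i = ξ (w i) * σ w
  ξ_sq : ∀ i, ξ i * ξ i = algebraMap ℂ B a
  ξ_c : ∀ i, ξ i * c i = -(c i * ξ i)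
  ξ_c' : ∀ i j, i ≠ j → ξ i * c j = c j * ξ i
  ξ_ξ : ∀ i j, i ≠ j → ξ i * ξ j - ξ j * ξ i
    = ξ i * ((1 - c i * c j) * σ (Equiv.swap i j)) - (1 - c i * c j) * σ (Equiv.swap i j) * ξ i
  σbξ : ∀ v i, σb v * ξ i = ξ i * σb v
  ξcb : ∀ i j, ξ i * cb j = cb j * ξ i
  σb_ξb : ∀ w i, σb w * ξb i = ξb (w i) * σb w
  ξb_sq : ∀ i, ξb i * ξb i = algebraMap ℂ B κ
  ξb_cb : ∀ i, ξb i * cb i = -(cb i * ξb i)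
  ξb_cb' : ∀ i j, i ≠ j → ξb i * cb j = cb j * ξb i
  ξb_ξb : ∀ i j, i ≠ j → ξb i * ξb j - ξb j * ξb i
    = ξb i * ((1 + cb i * cb j) * σb (Equiv.swap i j)) - (1 + cb i * cb j) * σb (Equiv.swap i j) * ξb i
  σξb : ∀ w j, σ w * ξb j = ξb j * σ w
  ξbc : ∀ i j, ξb j * c i = c i * ξb j
  σ_ε : ∀ w i j, σ w * ε i j = ε (w i) j * σ w
  σb_ε : ∀ w i j, σb w * ε i j = ε i (w j) * σb w
  ε_c : ∀ i j, ε i j * c i = ε i j * cb j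
  c_ε : ∀ i j, c i * ε i j = cb j * ε i j
  ε_c' : ∀ i j l, l ≠ i → c l * ε i j = ε i j * c l
  ε_cb' : ∀ i j l, l ≠ j → cb l * ε i j = ε i j * cb l
  ε_sq : ∀ i j, ε i j * ε i j = 0
  εcε : ∀ i j, ε i j * c i * ε i j = 0
  εξε : ∀ i j, ε i j * ξ i * ε i j = algebraMap ℂ B ω * ε i j
  ε_ξ : ∀ i j, ε i j * ξ i = - (ε i j * ξb j)
  ξ_ε : ∀ i j, ξ i * ε i j = - (ξb j * ε i j)
  ε_ξ' : ∀ i j l, l ≠ i → ξ l * ε i j = ε i j * ξ l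
  ε_ξb' : ∀ i j l, l ≠ j → ξb l * ε i j = ε i j * ξb l
  ε_row : ∀ i j l, j ≠ l → ε i j * ε i l = σb (Equiv.swap j l) * ε i l
  ε_col : ∀ i k j, i ≠ k → ε i j * ε k j = σ (Equiv.swap i k) * ε k j
  εε_sw : ∀ i k j l, i ≠ k → j ≠ l → σ (Equiv.swap i k) * (σb (Equiv.swap j l) * (ε i j * ε k l)) = ε i j * ε k l
  εε_comm : ∀ i k j l, i ≠ k → j ≠ l → ε i j * ε k l = ε k l * ε i j
  mixed : ∀ i j, ξ i * (ξb j + ε i j - c i * ε i j * c i) = (ξb j + ε i j - c i * ε i j * c i) * ξ i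

namespace Idx
variable {a κ ω : ℂ} {B : Type} [Ring B] [Algebra ℂ B] {r t : ℕ} (d : Idx a κ ω B r t)


/-- exchange of the two sides of the wall -/
def swap : Idx κ a (-ω) B t r where
  σ := d.σb
  σb := d.σ
  c j := Complex.I • d.cb j
  cb i := Complex.I • d.c i
  ξ := d.ξb
  ξb := d.ξ
  ε i j := d.ε j i
  c_sq i := by simp [smul_smul, d.cb_sq]
  c_anti i j h := by simp [smul_smul, d.cb_anti i j h]
  σ_c w i := by simp [d.σb_cb]
  cb_sq i := by simp [smul_smul, d.c_sq]
  cb_anti i j h := by simp [smul_smul, d.c_anti i j h]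
  σb_cb w i := by simp [d.σ_c]
  σσb w v := (d.σσb v w).symm
  σcb w j := by simp [d.σbc]
  σbc w j := by simp [d.σcb]
  ccb i j := by simp [smul_smul, d.ccb]
  σ_ξ := d.σb_ξb
  ξ_sq := d.ξb_sq
  ξ_c i := by simp [d.ξb_cb]
  ξ_c' i j h := by simp [d.ξb_cb' i j h]
  ξ_ξ i j h := by
    rw [d.ξb_ξb i j h]
    simp only [smul_mul_smul, Complex.I_mul_I, neg_smul, one_smul, sub_neg_eq_add]
  σbξ := d.σξb
  ξcb i j := by simp [d.ξbc]
  σb_ξb := d.σ_ξ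
  ξb_sq := d.ξ_sq
  ξb_cb i := by simp [d.ξ_c]
  ξb_cb' i j h := by simp [d.ξ_c' i j h]
  ξb_ξb i j h := by
    rw [d.ξ_ξ i j h]
    simp only [smul_mul_smul, Complex.I_mul_I, neg_smul, one_smul, sub_eq_add_neg]
  σξb := d.σbξ
  ξbc i j := by simp [d.ξcb]
  σ_ε w i j := d.σb_ε w j i
  σb_ε w i j := d.σ_ε w j i
  ε_c i j := by simp [d.ε_c]
  c_ε i j := by simp [d.c_ε]
  ε_c' i j l h := by simp [d.ε_cb' _ _ _ h]
  ε_cb' i j l h := by simp [d.ε_c' _ _ _ h]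
  ε_sq i j := d.ε_sq j i
  εcε i j := by simp [← d.ε_c, d.εcε]
  εξε i j := by
    have := d.εξε j i
    rw [d.ε_ξ, neg_mul] at this
    rw [map_neg, neg_mul, ← this, neg_neg]
  ε_ξ i j := by rw [d.ε_ξ, neg_neg]
  ξ_ε i j := by rw [d.ξ_ε, neg_neg]
  ε_ξ' i j l h := d.ε_ξb' j i l h
  ε_ξb' i j l h := d.ε_ξ' j i l h
  ε_row i j l h := d.ε_col j l i h
  ε_col i k j h := d.ε_row j i k h
  εε_sw i k j l h1 h2 := by
    rw [← mul_assoc, ← d.σσb, mul_assoc]; exact d.εε_sw j l i k h2 h1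
  εε_comm i k j l h1 h2 := d.εε_comm _ _ _ _ h2 h1
  mixed i j := by
    have h := d.mixed j i
    have h1 := d.ε_ξ j i
    have h2 := d.ξ_ε j i
    have h3 := d.ξ_c j
    have h4 := d.ξbc j i
    have h5 : Complex.I • d.cb i * d.ε j i * Complex.I • d.cb i = - (d.c j * d.ε j i * d.c j) := by
      simp only [smul_mul_assoc, mul_smul_comm, smul_smul, Complex.I_mul_I, neg_smul, one_smul]
      rw [d.c_ε, mul_assoc _ _ (d.c j), d.ε_c, mul_assoc]
    rw [h5]
    generalize d.c j = c at *
    generalize d.ξ j = x at *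
    generalize d.ξb i = y at *
    generalize d.ε j i = e at *
    have h6 : x * c * e * c = y * c * e * c := by
      linear_combination (norm := noncomm_ring) h3 * e * c - c * h2 * c - h4 * e * c
    have h7 : c * e * c * x = c * e * c * y := by
      linear_combination (norm := noncomm_ring) c * e * h3 - c * h1 * c + c * e * h4
    linear_combination (norm := noncomm_ring) - h + h2 - h1 - h6 + h7

end Idx
end

section
lemma up_gen {n : ℕ} {M : Type} [Monoid M] (σ : Equiv.Perm (Fin (n+1)) →* M) (x : M)
    (h : ∀ i : ℕ, 0 < i → i + 1 < n+1 → σ (sw (n+1) i (i + 1)) * x = x * σ (sw (n+1) i (i + 1)))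
    (w : Equiv.Perm (Fin (n+1))) (hw : w 0 = 0) : σ w * x = x * σ w := by
  have hw' : w = up (dn w) := by
    have := dn_spec w
    rwa [hw, Equiv.swap_self, ← Equiv.Perm.one_def, one_mul] at this
  rw [hw']
  generalize dn w = u
  cases n with
  | zero => rw [Subsingleton.elim u 1, map_one, map_one, one_mul, mul_one]
  | succ n =>
    have hu : u ∈ Submonoid.closure (Set.range fun i : Fin n ↦ Equiv.swap i.castSucc i.succ) := by
      rw [Equiv.Perm.mclosure_swap_castSucc_succ]; trivial
    induction hu using Submonoid.closure_induction with
    | mem u hu =>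
      obtain ⟨i, rfl⟩ := hu
      have := h (i+1) (by omega) (by omega)
      rw [sw_eq (by omega) (by omega)] at this
      simp only
      rw [HH.up_swap]
      exact this
    | one => rw [map_one, map_one, one_mul, mul_one]
    | mul u v _ _ hu hv => rw [map_mul, map_mul, mul_assoc, hv, ← mul_assoc, hu, mul_assoc]

lemma equi {n : ℕ} {M : Type} [Monoid M] (σ : Equiv.Perm (Fin (n+1)) →* M) (x : M)
    (h : ∀ w : Equiv.Perm (Fin (n+1)), w 0 = 0 → σ w * x = x * σ w) (w : Equiv.Perm (Fin (n+1))) (i) :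
    σ w * (σ (Equiv.swap 0 i) * x * σ (Equiv.swap 0 i)) =
      σ (Equiv.swap 0 (w i)) * x * σ (Equiv.swap 0 (w i)) * σ w := by
  have e1 : w = Equiv.swap 0 (w i) * (Equiv.swap 0 (w i) * w * Equiv.swap 0 i) * Equiv.swap 0 i := by
    rw [← mul_assoc, ← mul_assoc, Equiv.swap_mul_self, one_mul, mul_assoc, Equiv.swap_mul_self, mul_one]
  have h2 := h (Equiv.swap 0 (w i) * w * Equiv.swap 0 i) (by simp)
  have e2 : Equiv.swap 0 (w i) * w = (Equiv.swap 0 (w i) * w * Equiv.swap 0 i) * Equiv.swap 0 i := by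
    rw [mul_assoc _ _ (Equiv.swap 0 i), Equiv.swap_mul_self, mul_one]
  generalize Equiv.swap 0 (w i) * w * Equiv.swap 0 i = v at e1 e2 h2
  generalize Equiv.swap 0 (w i) = s' at *
  have hs : σ (Equiv.swap 0 i) * σ (Equiv.swap 0 i) = 1 := by rw [← map_mul, Equiv.swap_mul_self, map_one]
  have hs' : σ w = σ s' * σ v * σ (Equiv.swap 0 i) := by rw [← map_mul, ← map_mul, ← e1]
  have h3 : σ s' * σ w = σ v * σ (Equiv.swap 0 i) := by rw [← map_mul, e2, map_mul]
  rw [mul_assoc (σ s' * x), h3, hs', mul_assoc (σ s' * σ v), ← mul_assoc (σ _) (σ _ * x), ← mul_assoc (σ _) (σ _) x, hs, one_mul,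
    mul_assoc (σ s'), ← mul_assoc (σ v), h2]
  simp only [mul_assoc]

lemma exists_perm2 {n : ℕ} (i l : Fin (n+1)) (h : i ≠ l) : ∃ (h1 : 1 < n+1) (w : Equiv.Perm (Fin (n+1))), w 0 = i ∧ w ⟨1, h1⟩ = l := by
  have h1 : 1 < n + 1 := by
    have := i.2; have := l.2; by_contra hh; exact h (Fin.ext (by omega))
  refine ⟨h1, Equiv.swap 0 i * Equiv.swap ⟨1, h1⟩ (Equiv.swap 0 i l), ?_, ?_⟩
  · have h0 : Equiv.swap ⟨1, h1⟩ (Equiv.swap 0 i l) 0 = 0 := by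
      refine Equiv.swap_apply_of_ne_of_ne (fun hh => absurd (congrArg Fin.val hh) (by simp)) (fun hh => ?_)
      have := congrArg (Equiv.swap 0 i) hh
      rw [Equiv.swap_apply_left, Equiv.swap_apply_self] at this
      exact h this
    rw [Equiv.Perm.mul_apply, h0, Equiv.swap_apply_left]
  · rw [Equiv.Perm.mul_apply, Equiv.swap_apply_left, Equiv.swap_apply_self]

lemma exists_perm1 {n : ℕ} (i : Fin (n+1)) : ∃ w : Equiv.Perm (Fin (n+1)), w 0 = i := ⟨Equiv.swap 0 i, by simp⟩

/-- conjugation by `σ w σ̄ v` -/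
def adj {B : Type} [Ring B] {r t : ℕ} (σ : Equiv.Perm (Fin r) →* B) (σb : Equiv.Perm (Fin t) →* B) (w : Equiv.Perm (Fin r)) (v : Equiv.Perm (Fin t)) : B →+* B where
  toFun x := σ w * σb v * x * (σb v⁻¹ * σ w⁻¹)
  map_one' := by
    rw [mul_one, mul_assoc, ← mul_assoc (σb v), ← map_mul, mul_inv_cancel, map_one, one_mul, ← map_mul, mul_inv_cancel, map_one]
  map_mul' x y := by
    have : (σb v⁻¹ * σ w⁻¹) * (σ w * σb v) = 1 := by
      rw [mul_assoc, ← mul_assoc (σ _), ← map_mul, inv_mul_cancel, map_one, one_mul, ← map_mul, inv_mul_cancel, map_one]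
    calc _ = σ w * σb v * x * 1 * y * (σb v⁻¹ * σ w⁻¹) := by noncomm_ring
      _ = _ := by rw [← this]; noncomm_ring
  map_zero' := by simp
  map_add' x y := by noncomm_ring

lemma adj_eq {B : Type} [Ring B] {r t : ℕ} (σ : Equiv.Perm (Fin r) →* B) (σb : Equiv.Perm (Fin t) →* B) (w : Equiv.Perm (Fin r)) (v : Equiv.Perm (Fin t)) (x y z : B)
    (h1 : σb v * x = y * σb v) (h2 : σ w * y = z * σ w) : adj σ σb w v x = z := by
  show σ w * σb v * x * (σb v⁻¹ * σ w⁻¹) = z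
  rw [mul_assoc (σ w), h1, ← mul_assoc (σ w), h2, mul_assoc, ← mul_assoc (σb v), ← map_mul, mul_inv_cancel, map_one, one_mul,
    mul_assoc, ← map_mul, mul_inv_cancel, map_one, mul_one]

namespace AWBC
variable {B : Type} [Ring B] [Algebra ℂ B] {R T : ℕ} {ω a κ : ℂ} (d : AWBC ℂ B (R+1) (T+1) ω)
/-- `ξ_i` -/
def X (i : Fin (R+1)) : B := d.σ (Equiv.swap 0 i) * d.x1 * d.σ (Equiv.swap 0 i)
/-- `ξ̄_j` -/
def Xb (i : Fin (T+1)) : B := d.σb (Equiv.swap 0 i) * d.xb1 * d.σb (Equiv.swap 0 i)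
/-- `ε_{ij}` -/
def EE (i : Fin (R+1)) (j : Fin (T+1)) : B := d.σb (Equiv.swap 0 j) * (d.σ (Equiv.swap 0 i) * d.e * d.σ (Equiv.swap 0 i)) * d.σb (Equiv.swap 0 j)

lemma X_zero : d.X 0 = d.x1 := by simp [X, ← Equiv.Perm.one_def]
lemma Xb_zero : d.Xb 0 = d.xb1 := by simp [Xb, ← Equiv.Perm.one_def]
lemma EE_zero : d.EE 0 0 = d.e := by simp [EE, ← Equiv.Perm.one_def]
lemma X_one (h : 1 < R+1) : d.X ⟨1, h⟩ = d.σ (sw (R+1) 0 1) * d.x1 * d.σ (sw (R+1) 0 1) := by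
  rw [sw_eq (by omega) h]; rfl
lemma Xb_one (h : 1 < T+1) : d.Xb ⟨1, h⟩ = d.σb (sw (T+1) 0 1) * d.xb1 * d.σb (sw (T+1) 0 1) := by
  rw [sw_eq (by omega) h]; rfl
lemma σ_X (w i) : d.σ w * d.X i = d.X (w i) * d.σ w := equi d.σ d.x1 (up_gen d.σ d.x1 d.s_x1) w i
lemma σb_Xb (w i) : d.σb w * d.Xb i = d.Xb (w i) * d.σb w := equi d.σb d.xb1 (up_gen d.σb d.xb1 d.sb_xb1) w i
lemma σb_X (v i) : d.σb v * d.X i = d.X i * d.σb v := by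
  have h := d.comm_σσb
  rw [X, ← mul_assoc, ← mul_assoc, ← h, mul_assoc (d.σ _) (d.σb _), d.x1_σb]
  simp only [mul_assoc, h]
lemma σ_Xb (v i) : d.σ v * d.Xb i = d.Xb i * d.σ v := by
  have h := d.comm_σσb
  rw [Xb, ← mul_assoc, ← mul_assoc, h, mul_assoc (d.σb _) (d.σ _), d.xb1_σ]
  simp only [mul_assoc, h]
lemma σb_EE (v i j) : d.σb v * d.EE i j = d.EE i (v j) * d.σb v := by
  refine equi d.σb _ ?_ v j
  intro w hw
  have h := d.comm_σσb
  rw [← mul_assoc, ← mul_assoc, ← h, mul_assoc (d.σ _) (d.σb _), up_gen d.σb d.e d.sb_e_comm w hw]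
  simp only [mul_assoc, h]
lemma EE' (i j) : d.EE i j = d.σ (Equiv.swap 0 i) * (d.σb (Equiv.swap 0 j) * d.e * d.σb (Equiv.swap 0 j)) * d.σ (Equiv.swap 0 i) := by
  have h := d.comm_σσb
  simp only [EE, mul_assoc, h]
  simp only [← mul_assoc, h]
lemma σ_EE (v i j) : d.σ v * d.EE i j = d.EE (v i) j * d.σ v := by
  rw [EE', EE']
  refine equi d.σ _ ?_ v i
  intro w hw
  have h := d.comm_σσb
  rw [← mul_assoc, ← mul_assoc, h, mul_assoc (d.σb _) (d.σ _), up_gen d.σ d.e d.s_e_comm w hw]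
  simp only [mul_assoc, h]
lemma σ_c (w i) : d.σ w * d.c i = d.c (w i) * d.σ w := by
  rw [← d.c_conj, mul_assoc _ _ (d.σ w), ← map_mul]; simp
lemma σb_cb (w i) : d.σb w * d.cb i = d.cb (w i) * d.σb w := by
  rw [← d.cb_conj, mul_assoc _ _ (d.σb w), ← map_mul]; simp

variable (w : Equiv.Perm (Fin (R+1))) (v : Equiv.Perm (Fin (T+1)))
local notation "Ad" => adj d.σ d.σb w v
lemma Ad_X (i) : Ad (d.X i) = d.X (w i) := adj_eq _ _ _ _ _ _ _ (d.σb_X _ _) (d.σ_X _ _)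
lemma Ad_Xb (i) : Ad (d.Xb i) = d.Xb (v i) := adj_eq _ _ _ _ _ _ _ (d.σb_Xb _ _) (d.σ_Xb _ _)
lemma Ad_EE (i j) : Ad (d.EE i j) = d.EE (w i) (v j) := adj_eq _ _ _ _ _ _ _ (d.σb_EE _ _ _) (d.σ_EE _ _ _)
lemma Ad_c (i) : Ad (d.c i) = d.c (w i) := adj_eq _ _ _ _ _ _ _ (d.comm_σbc _ _) (d.σ_c _ _)
lemma Ad_cb (i) : Ad (d.cb i) = d.cb (v i) := adj_eq _ _ _ _ _ _ _ (d.σb_cb _ _) (d.comm_σcb _ _)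
lemma Ad_σ (u) : Ad (d.σ u) = d.σ (w * u * w⁻¹) := adj_eq _ _ _ _ _ _ _ (d.comm_σσb _ _).symm (by rw [← map_mul, ← map_mul]; simp)
lemma Ad_σb (u) : Ad (d.σb u) = d.σb (v * u * v⁻¹) := adj_eq _ _ _ _ _ (d.σb (v * u * v⁻¹)) _ (by rw [← map_mul, ← map_mul]; simp) (d.comm_σσb _ _)
lemma Ad_alg (z : ℂ) : Ad (algebraMap ℂ B z) = algebraMap ℂ B z :=
  adj_eq _ _ _ _ _ _ _ (Algebra.commutes _ _).symm (Algebra.commutes _ _).symm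
end AWBC
end

section
namespace AWBC
variable {B : Type} [Ring B] [Algebra ℂ B] {R T : ℕ} {ω a κ : ℂ} (d : AWBC ℂ B (R+1) (T+1) ω)
lemma Ad_σs (w v i j) : adj d.σ d.σb w v (d.σ (Equiv.swap i j)) = d.σ (Equiv.swap (w i) (w j)) := by
  rw [Ad_σ, Equiv.mul_swap_eq_swap_mul, mul_assoc, mul_inv_cancel, mul_one]
lemma Ad_σbs (w v i j) : adj d.σ d.σb w v (d.σb (Equiv.swap i j)) = d.σb (Equiv.swap (v i) (v j)) := by
  rw [Ad_σb, Equiv.mul_swap_eq_swap_mul, mul_assoc, mul_inv_cancel, mul_one]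

lemma one_ne {n : ℕ} (h1 : 1 < n+1) : (⟨1, h1⟩ : Fin (n+1)) ≠ 0 := fun h => by simpa using congrArg Fin.val h

lemma base_s (h1 : 1 < R+1) : d.σ (sw (R+1) 0 1) = d.σ (Equiv.swap 0 ⟨1, h1⟩) := by
  rw [sw_eq (by omega) h1]; rfl
lemma base_sb (h1 : 1 < T+1) : d.σb (sw (T+1) 0 1) = d.σb (Equiv.swap 0 ⟨1, h1⟩) := by
  rw [sw_eq (by omega) h1]; rfl
lemma ss (i j) : d.σ (Equiv.swap i j) * d.σ (Equiv.swap i j) = 1 := by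
  rw [← map_mul, Equiv.swap_mul_self, map_one]
lemma ssb (i j) : d.σb (Equiv.swap i j) * d.σb (Equiv.swap i j) = 1 := by
  rw [← map_mul, Equiv.swap_mul_self, map_one]

lemma base_col (h1 : 1 < R+1) : d.EE 0 0 * d.EE ⟨1,h1⟩ 0 = d.σ (Equiv.swap 0 ⟨1,h1⟩) * d.EE ⟨1,h1⟩ 0 := by
  have h := d.e_s_e h1
  rw [d.base_s h1, ← d.EE_zero] at h
  have h2 := d.σ_EE (Equiv.swap 0 ⟨1,h1⟩) ⟨1, h1⟩ 0
  rw [Equiv.swap_apply_right] at h2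
  have h3 := d.ss 0 ⟨1,h1⟩
  generalize d.σ _ = s at *
  linear_combination (norm := noncomm_ring) h * s - d.EE 0 0 * h3 * d.EE ⟨1,h1⟩ 0 + d.EE 0 0 * s * h2 - h2

lemma base_row (h1 : 1 < T+1) : d.EE 0 0 * d.EE 0 ⟨1,h1⟩ = d.σb (Equiv.swap 0 ⟨1,h1⟩) * d.EE 0 ⟨1,h1⟩ := by
  have h := d.e_sb_e h1
  rw [d.base_sb h1, ← d.EE_zero] at h
  have h2 := d.σb_EE (Equiv.swap 0 ⟨1,h1⟩) 0 ⟨1, h1⟩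
  rw [Equiv.swap_apply_right] at h2
  have h3 := d.ssb 0 ⟨1,h1⟩
  generalize d.σb _ = s at *
  linear_combination (norm := noncomm_ring) h * s - d.EE 0 0 * h3 * d.EE 0 ⟨1,h1⟩ + d.EE 0 0 * s * h2 - h2

lemma base_b1 (h1 : 1 < R+1) (h2 : 1 < T+1) : d.EE 0 0 * d.EE ⟨1,h1⟩ ⟨1,h2⟩ * d.σ (Equiv.swap 0 ⟨1,h1⟩) * d.σb (Equiv.swap 0 ⟨1,h2⟩)
    = d.EE 0 0 * d.EE ⟨1,h1⟩ ⟨1,h2⟩ := by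
  have h := d.braid1 h1 h2
  rw [d.base_s h1, d.base_sb h2, ← d.EE_zero] at h
  have e1 := d.σ_EE (Equiv.swap 0 ⟨1,h1⟩) 0 ⟨1, h2⟩
  rw [Equiv.swap_apply_left] at e1
  have e2 := d.σb_EE (Equiv.swap 0 ⟨1,h2⟩) 0 0
  rw [Equiv.swap_apply_left] at e2
  have e3 := d.ss 0 ⟨1,h1⟩
  have e4 := d.ssb 0 ⟨1,h2⟩
  have e5 := d.comm_σσb (Equiv.swap 0 ⟨1,h1⟩) (Equiv.swap 0 ⟨1,h2⟩)
  generalize d.σ _ = s at *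
  generalize d.σb _ = u at *
  generalize d.EE 0 0 = P at *
  generalize d.EE 0 ⟨1,h2⟩ = Q at *
  generalize d.EE ⟨1,h1⟩ ⟨1,h2⟩ = N at *
  have k1 : s * u * P = N * s * u := by
    linear_combination (norm := noncomm_ring) s * e2 + e1 * u
  have k2 : P * N * s * u * s = P * N * s * u * u := by
    linear_combination (norm := noncomm_ring) h - P * k1 * s + P * k1 * u
  have k3 : P * N * u = P * N * s := by
    linear_combination (norm := noncomm_ring) k2 + P * N * s * e5  + P * N * s * e4 - P * N * e3 * u
  calc P * N * s * u = P * N * u * u := by rw [k3]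
    _ = P * N := by rw [mul_assoc, e4, mul_one]

lemma base_b2 (h1 : 1 < R+1) (h2 : 1 < T+1) : d.σ (Equiv.swap 0 ⟨1,h1⟩) * (d.σb (Equiv.swap 0 ⟨1,h2⟩) * (d.EE 0 0 * d.EE ⟨1,h1⟩ ⟨1,h2⟩))
    = d.EE 0 0 * d.EE ⟨1,h1⟩ ⟨1,h2⟩ := by
  have h := d.braid2 h1 h2
  rw [d.base_s h1, d.base_sb h2, ← d.EE_zero] at h
  have e1 := d.σ_EE (Equiv.swap 0 ⟨1,h1⟩) 0 ⟨1, h2⟩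
  rw [Equiv.swap_apply_left] at e1
  have e2 := d.σb_EE (Equiv.swap 0 ⟨1,h2⟩) 0 0
  rw [Equiv.swap_apply_left] at e2
  have e3 := d.ss 0 ⟨1,h1⟩
  have e4 := d.ssb 0 ⟨1,h2⟩
  have e5 := d.comm_σσb (Equiv.swap 0 ⟨1,h1⟩) (Equiv.swap 0 ⟨1,h2⟩)
  generalize d.σ _ = s at *
  generalize d.σb _ = u at *
  generalize d.EE 0 0 = P at *
  generalize d.EE 0 ⟨1,h2⟩ = Q at *
  generalize d.EE ⟨1,h1⟩ ⟨1,h2⟩ = N at *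
  have k1 : s * u * P = N * s * u := by
    linear_combination (norm := noncomm_ring) s * e2 + e1 * u
  have k2 : s * P * N * s * u = u * P * N * s * u := by
    linear_combination (norm := noncomm_ring) h - s * P * k1 + u * P * k1
  have k3 : s * P * N = u * P * N := by
    linear_combination (norm := noncomm_ring) k2 * u * s - (s * P * N - u * P * N) * (s * e4 * s + e3)
  linear_combination (norm := noncomm_ring) e3 * P * N - s * k3

lemma base_comm (h1 : 1 < R+1) (h2 : 1 < T+1) : d.EE 0 0 * d.EE ⟨1,h1⟩ ⟨1,h2⟩ = d.EE ⟨1,h1⟩ ⟨1,h2⟩ * d.EE 0 0 := by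
  have b1 := d.base_b1 h1 h2
  have b2 := d.base_b2 h1 h2
  have e1 := d.σ_EE (Equiv.swap 0 ⟨1,h1⟩) 0 ⟨1, h2⟩
  rw [Equiv.swap_apply_left] at e1
  have e2 := d.σb_EE (Equiv.swap 0 ⟨1,h2⟩) 0 0
  rw [Equiv.swap_apply_left] at e2
  have f1 := d.σ_EE (Equiv.swap 0 ⟨1,h1⟩) ⟨1,h1⟩ 0
  rw [Equiv.swap_apply_right] at f1
  have f2 := d.σb_EE (Equiv.swap 0 ⟨1,h2⟩) ⟨1,h1⟩ ⟨1,h2⟩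
  rw [Equiv.swap_apply_right] at f2
  have e3 := d.ss 0 ⟨1,h1⟩
  have e4 := d.ssb 0 ⟨1,h2⟩
  have e5 := d.comm_σσb (Equiv.swap 0 ⟨1,h1⟩) (Equiv.swap 0 ⟨1,h2⟩)
  generalize d.σ _ = s at *
  generalize d.σb _ = u at *
  generalize d.EE 0 0 = P at *
  generalize d.EE 0 ⟨1,h2⟩ = Q at *
  generalize d.EE ⟨1,h1⟩ ⟨1,h2⟩ = N at *
  generalize d.EE ⟨1,h1⟩ 0 = M at *
  have k1 : s * u * P = N * s * u := by
    linear_combination (norm := noncomm_ring) s * e2 + e1 * u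
  have k2 : s * u * N = P * s * u := by
    linear_combination (norm := noncomm_ring) s * f2 + f1 * u
  have k3 : s * u * s * u = 1 := by
    linear_combination (norm := noncomm_ring) -s * e5 * u + e3 * u * u + e4
  calc P * N = s * u * (P * N * s * u) := by rw [b1, mul_assoc, b2]
    _ = (s * u * P) * N * s * u := by noncomm_ring
    _ = N * (s * u * N) * s * u := by rw [k1]; noncomm_ring
    _ = N * P * (s * u * s * u) := by rw [k2]; noncomm_ring
    _ = N * P := by rw [k3, mul_one]

/-- from the presentation to the index form -/
def idx (hx : d.x1 * d.x1 = algebraMap ℂ B a) (hxb : d.xb1 * d.xb1 = algebraMap ℂ B κ) :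
    Idx a κ ω B (R+1) (T+1) where
  σ := d.σ
  σb := d.σb
  c := d.c
  cb := d.cb
  ξ := d.X
  ξb := d.Xb
  ε := d.EE
  c_sq := d.c_sq
  c_anti := d.c_anti
  σ_c := d.σ_c
  cb_sq := d.cb_sq
  cb_anti := d.cb_anti
  σb_cb := d.σb_cb
  σσb := d.comm_σσb
  σcb := d.comm_σcb
  σbc := d.comm_σbc
  ccb := d.anti_ccb
  σ_ξ := d.σ_X
  σbξ := d.σb_X
  σb_ξb := d.σb_Xb
  σξb := d.σ_Xb
  σ_ε := d.σ_EE
  σb_ε := d.σb_EE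
  ξ_sq i := by
    obtain ⟨w, rfl⟩ := exists_perm1 i
    have := congrArg (adj d.σ d.σb w 1) hx
    simpa only [← X_zero, map_mul, Ad_X, Ad_alg] using this
  ξb_sq i := by
    obtain ⟨w, rfl⟩ := exists_perm1 i
    have := congrArg (adj d.σ d.σb 1 w) hxb
    simpa only [← Xb_zero, map_mul, Ad_Xb, Ad_alg] using this
  ξ_c i := by
    obtain ⟨w, rfl⟩ := exists_perm1 i
    have := congrArg (adj d.σ d.σb w 1) (d.x1_c1 (by omega))
    simp only [← X_zero, map_mul, map_neg, Ad_X, Ad_c] at this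
    exact this
  ξ_c' i j h := by
    obtain ⟨h1, w, rfl, rfl⟩ := exists_perm2 i j h
    have := congrArg (adj d.σ d.σb w 1) (d.x1_c ⟨1,h1⟩ (by simp))
    simp only [← X_zero, map_mul, map_neg, Ad_X, Ad_c] at this
    exact this
  ξ_ξ i j h := by
    obtain ⟨h1, w, rfl, rfl⟩ := exists_perm2 i j h
    have h0 := d.x_comm h1
    rw [← X_one _ h1, base_s _ h1] at h0
    have := congrArg (adj d.σ d.σb w 1) h0
    simp only [← X_zero, map_mul, map_neg, map_sub, map_one, Ad_X, Ad_c, Ad_σs] at this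
    change d.X (w 0) * (_ - (1 - d.c (w 0) * _) * _) = (_ - (1 - d.c (w 0) * _) * _) * _ at this
    linear_combination (norm := noncomm_ring) this
  ξb_cb i := by
    obtain ⟨w, rfl⟩ := exists_perm1 i
    have := congrArg (adj d.σ d.σb 1 w) (d.xb1_cb1 (by omega))
    simp only [← Xb_zero, map_mul, map_neg, Ad_Xb, Ad_cb] at this
    exact this
  ξb_cb' i j h := by
    obtain ⟨h1, w, rfl, rfl⟩ := exists_perm2 i j h
    have := congrArg (adj d.σ d.σb 1 w) (d.xb1_cb ⟨1,h1⟩ (by simp))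
    simp only [← Xb_zero, map_mul, map_neg, Ad_Xb, Ad_cb] at this
    exact this
  ξb_ξb i j h := by
    obtain ⟨h1, w, rfl, rfl⟩ := exists_perm2 i j h
    have h0 := d.xb_comm h1
    rw [← Xb_one _ h1, base_sb _ h1] at h0
    have := congrArg (adj d.σ d.σb 1 w) h0
    simp only [← Xb_zero, map_mul, map_neg, map_sub, map_add, map_one, Ad_Xb, Ad_cb, Ad_σbs] at this
    change d.Xb (w 0) * (_ - (1 + d.cb (w 0) * _) * _) = (_ - (1 + d.cb (w 0) * _) * _) * _ at this
    linear_combination (norm := noncomm_ring) this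
  ξcb i j := by
    obtain ⟨w, rfl⟩ := exists_perm1 i
    have := congrArg (adj d.σ d.σb w 1) (d.x1_cb_comm j)
    simpa only [← X_zero, map_mul, map_neg, Ad_X, Ad_cb, Equiv.Perm.one_apply] using this
  ξbc i j := by
    obtain ⟨w, rfl⟩ := exists_perm1 j
    have := congrArg (adj d.σ d.σb 1 w) (d.xb1_c_comm i)
    simpa only [← Xb_zero, map_mul, map_neg, Ad_Xb, Ad_c, Equiv.Perm.one_apply] using this
  ε_c i j := by
    obtain ⟨w, rfl⟩ := exists_perm1 i
    obtain ⟨v, rfl⟩ := exists_perm1 j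
    have := congrArg (adj d.σ d.σb w v) (d.e_c1 (by omega) (by omega))
    simp only [← EE_zero, map_mul, Ad_EE, Ad_c, Ad_cb] at this
    exact this
  c_ε i j := by
    obtain ⟨w, rfl⟩ := exists_perm1 i
    obtain ⟨v, rfl⟩ := exists_perm1 j
    have := congrArg (adj d.σ d.σb w v) (d.c1_e (by omega) (by omega))
    simp only [← EE_zero, map_mul, Ad_EE, Ad_c, Ad_cb] at this
    exact this
  ε_c' i j l h := by
    obtain ⟨h1, w, rfl, rfl⟩ := exists_perm2 i l h.symm
    obtain ⟨v, rfl⟩ := exists_perm1 j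
    have := congrArg (adj d.σ d.σb w v) (d.c_e_comm ⟨1,h1⟩ (by simp))
    simpa only [← EE_zero, map_mul, Ad_EE, Ad_c, Ad_cb] using this
  ε_cb' i j l h := by
    obtain ⟨h1, v, rfl, rfl⟩ := exists_perm2 j l h.symm
    obtain ⟨w, rfl⟩ := exists_perm1 i
    have := congrArg (adj d.σ d.σb w v) (d.cb_e_comm ⟨1,h1⟩ (by simp))
    simpa only [← EE_zero, map_mul, Ad_EE, Ad_c, Ad_cb] using this
  ε_sq i j := by
    obtain ⟨w, rfl⟩ := exists_perm1 i
    obtain ⟨v, rfl⟩ := exists_perm1 j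
    have := congrArg (adj d.σ d.σb w v) d.e_sq
    simpa only [← EE_zero, map_mul, map_zero, Ad_EE, Ad_c, Ad_cb] using this
  εcε i j := by
    obtain ⟨w, rfl⟩ := exists_perm1 i
    obtain ⟨v, rfl⟩ := exists_perm1 j
    have := congrArg (adj d.σ d.σb w v) (d.e_c_e (by omega))
    simp only [← EE_zero, map_mul, map_zero, Ad_EE, Ad_c, Ad_cb] at this
    exact this
  εξε i j := by
    obtain ⟨w, rfl⟩ := exists_perm1 i
    obtain ⟨v, rfl⟩ := exists_perm1 j
    have h0 := d.e_xodd 0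
    rw [mul_zero, zero_add, pow_one, d.om_one] at h0
    have := congrArg (adj d.σ d.σb w v) h0
    simpa only [← EE_zero, ← X_zero, map_mul, Ad_EE, Ad_X, Ad_alg] using this
  ε_ξ i j := by
    obtain ⟨w, rfl⟩ := exists_perm1 i
    obtain ⟨v, rfl⟩ := exists_perm1 j
    have := congrArg (adj d.σ d.σb w v) d.e_xsum
    simp only [← EE_zero, ← X_zero, ← Xb_zero, map_mul, map_add, map_zero, Ad_EE, Ad_X, Ad_Xb, mul_add] at this
    exact eq_neg_of_add_eq_zero_left this
  ξ_ε i j := by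
    obtain ⟨w, rfl⟩ := exists_perm1 i
    obtain ⟨v, rfl⟩ := exists_perm1 j
    have := congrArg (adj d.σ d.σb w v) d.xsum_e
    simp only [← EE_zero, ← X_zero, ← Xb_zero, map_mul, map_add, map_zero, Ad_EE, Ad_X, Ad_Xb, add_mul] at this
    exact eq_neg_of_add_eq_zero_left this
  ε_ξ' i j l h := by
    obtain ⟨h1, w, rfl, rfl⟩ := exists_perm2 i l h.symm
    obtain ⟨v, rfl⟩ := exists_perm1 j
    have h0 := d.e_sxs h1
    rw [← X_one _ h1] at h0
    have := congrArg (adj d.σ d.σb w v) h0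
    simpa only [← EE_zero, map_mul, Ad_EE, Ad_X] using this.symm
  ε_ξb' i j l h := by
    obtain ⟨h1, v, rfl, rfl⟩ := exists_perm2 j l h.symm
    obtain ⟨w, rfl⟩ := exists_perm1 i
    have h0 := d.e_sbxbsb h1
    rw [← Xb_one _ h1] at h0
    have := congrArg (adj d.σ d.σb w v) h0
    simpa only [← EE_zero, map_mul, Ad_EE, Ad_Xb] using this.symm
  ε_row i j l h := by
    obtain ⟨h1, v, rfl, rfl⟩ := exists_perm2 j l h
    obtain ⟨w, rfl⟩ := exists_perm1 i
    have := congrArg (adj d.σ d.σb w v) (d.base_row h1)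
    simpa only [map_mul, Ad_EE, Ad_σbs] using this
  ε_col i k j h := by
    obtain ⟨h1, w, rfl, rfl⟩ := exists_perm2 i k h
    obtain ⟨v, rfl⟩ := exists_perm1 j
    have := congrArg (adj d.σ d.σb w v) (d.base_col h1)
    simpa only [map_mul, Ad_EE, Ad_σs] using this
  εε_sw i k j l h h' := by
    obtain ⟨h1, w, rfl, rfl⟩ := exists_perm2 i k h
    obtain ⟨h2, v, rfl, rfl⟩ := exists_perm2 j l h'
    have := congrArg (adj d.σ d.σb w v) (d.base_b2 h1 h2)
    simpa only [map_mul, Ad_EE, Ad_σs, Ad_σbs] using this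
  εε_comm i k j l h h' := by
    obtain ⟨h1, w, rfl, rfl⟩ := exists_perm2 i k h
    obtain ⟨h2, v, rfl, rfl⟩ := exists_perm2 j l h'
    have := congrArg (adj d.σ d.σb w v) (d.base_comm h1 h2)
    simpa only [map_mul, Ad_EE, Ad_σs, Ad_σbs] using this
  mixed i j := by
    obtain ⟨w, rfl⟩ := exists_perm1 i
    obtain ⟨v, rfl⟩ := exists_perm1 j
    have := congrArg (adj d.σ d.σb w v) (d.x_mixed (by omega))
    simp only [← EE_zero, ← X_zero, ← Xb_zero, map_mul, map_add, map_sub, Ad_EE, Ad_X, Ad_Xb, Ad_c] at this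
    change d.X (w 0) * (d.EE (w 0) (v 0) + _ - d.c (w 0) * _ * d.c (w 0)) = (_ - d.c (w 0) * _ * d.c (w 0) + _) * _ at this
    linear_combination (norm := noncomm_ring) this
end AWBC
end

section
namespace Idx
variable {a κ ω : ℂ} {B : Type} [Ring B] [Algebra ℂ B] {r t : ℕ} (d : Idx a κ ω B r t)

/-- product of cups/caps -/
def εL (L : List (Fin r × Fin t)) : B := (L.map (fun q => d.ε q.1 q.2)).prod
/-- the list is a partial matching -/
def OK (L : List (Fin r × Fin t)) : Prop := (L.map Prod.fst).Nodup ∧ (L.map Prod.snd).Nodup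

@[simp] lemma εL_nil : d.εL [] = 1 := rfl
@[simp] lemma εL_cons (q L) : d.εL (q :: L) = d.ε q.1 q.2 * d.εL L := by simp [εL]
lemma OK_cons (q : Fin r × Fin t) (L) : OK (q :: L) ↔ (q.1 ∉ L.map Prod.fst ∧ q.2 ∉ L.map Prod.snd) ∧ OK L := by
  simp only [OK, List.map_cons, List.nodup_cons]; tauto
lemma OK.perm {L L' : List (Fin r × Fin t)} (h : L.Perm L') (hL : OK L) : OK L' :=
  ⟨(h.map _).nodup_iff.1 hL.1, (h.map _).nodup_iff.1 hL.2⟩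
lemma εL_perm {L L' : List (Fin r × Fin t)} (h : L.Perm L') (hL : OK L) : d.εL L = d.εL L' := by
  induction h with
  | nil => rfl
  | cons q h ih => rw [εL_cons, εL_cons, ih ((OK_cons _ _).1 hL).2]
  | swap p q l =>
    rw [εL_cons, εL_cons, εL_cons, εL_cons, ← mul_assoc, ← mul_assoc]
    obtain ⟨⟨h1, h2⟩, -⟩ := (OK_cons _ _).1 hL
    simp only [List.map_cons, List.mem_cons, not_or] at h1 h2
    rw [d.εε_comm _ _ _ _ h1.1 h2.1]
  | trans h1 h2 ih1 ih2 => rw [ih1 hL, ih2 (hL.perm h1)]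
lemma front {L : List (Fin r × Fin t)} (hL : OK L) {q} (hq : q ∈ L) : ∃ L', L.Perm (q :: L') ∧ OK (q :: L') ∧ d.εL L = d.ε q.1 q.2 * d.εL L' :=
  ⟨L.erase q, List.perm_cons_erase hq, hL.perm (List.perm_cons_erase hq), by rw [d.εL_perm (List.perm_cons_erase hq) hL, εL_cons]⟩

/-- relabelling -/
def mp (w : Equiv.Perm (Fin r)) (v : Equiv.Perm (Fin t)) (L : List (Fin r × Fin t)) : List (Fin r × Fin t) :=
  L.map (fun q => (w q.1, v q.2))
lemma mp_OK (w v) {L : List (Fin r × Fin t)} (hL : OK L) : OK (mp w v L) := by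
  constructor
  · have : (mp w v L).map Prod.fst = (L.map Prod.fst).map w := by simp [mp, Function.comp_def]
    rw [this]; exact hL.1.map w.injective
  · have : (mp w v L).map Prod.snd = (L.map Prod.snd).map v := by simp [mp, Function.comp_def]
    rw [this]; exact hL.2.map v.injective
lemma ad_εL (w v L) : d.σ w * (d.σb v * d.εL L) = d.εL (mp w v L) * (d.σ w * d.σb v) := by
  induction L with
  | nil => simp [mp]
  | cons q L ih =>
    have e : mp w v (q :: L) = (w q.1, v q.2) :: mp w v L := rfl
    rw [e, εL_cons, εL_cons, ← mul_assoc (d.σb v), d.σb_ε, mul_assoc, ← mul_assoc, d.σ_ε, mul_assoc, ih, mul_assoc]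

/-- walled Brauer diagrams -/
def Br : Set B := {x | ∃ u v L, OK L ∧ x = d.σ u * (d.σb v * d.εL L)}
lemma Br_σ (w) {x} (hx : x ∈ d.Br) : d.σ w * x ∈ d.Br := by
  obtain ⟨u, v, L, hL, rfl⟩ := hx
  exact ⟨w * u, v, L, hL, by rw [map_mul, mul_assoc]⟩
lemma Br_σb (w) {x} (hx : x ∈ d.Br) : d.σb w * x ∈ d.Br := by
  obtain ⟨u, v, L, hL, rfl⟩ := hx
  exact ⟨u, w * v, L, hL, by rw [map_mul, ← mul_assoc, ← d.σσb, mul_assoc, mul_assoc]⟩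
lemma Br_rσ (w) {x} (hx : x ∈ d.Br) : x * d.σ w ∈ d.Br := by
  obtain ⟨u, v, L, hL, rfl⟩ := hx
  refine ⟨u * w, v, mp w⁻¹ 1 L, mp_OK _ _ hL, ?_⟩
  have h := d.ad_εL w 1 (mp w⁻¹ 1 L)
  have e : mp w 1 (mp w⁻¹ 1 L) = L := by simp [mp, Function.comp_def]
  rw [e, map_one, mul_one, one_mul] at h
  rw [map_mul, mul_assoc, mul_assoc (d.σ u), mul_assoc (d.σb v), ← h, ← mul_assoc (d.σb v), ← d.σσb, mul_assoc]
lemma Br_one : (1 : B) ∈ d.Br := ⟨1, 1, [], ⟨List.nodup_nil, List.nodup_nil⟩, by simp⟩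
lemma ε_σσb (i j u v) : d.ε i j * (d.σ u * d.σb v) = d.σ u * d.σb v * d.ε (u⁻¹ i) (v⁻¹ j) := by
  rw [mul_assoc (d.σ u), d.σb_ε, ← mul_assoc (d.σ u), d.σ_ε]
  simp [mul_assoc]
lemma mem_fst {L : List (Fin r × Fin t)} {i} (h : i ∈ L.map Prod.fst) : ∃ j, (i, j) ∈ L := by simpa using h
lemma mem_snd {L : List (Fin r × Fin t)} {j} (h : j ∈ L.map Prod.snd) : ∃ i, (i, j) ∈ L := by simpa using h

lemma ε_εL (i j) {L} (hL : OK L) : d.ε i j * d.εL L ∈ d.Br ∨ d.ε i j * d.εL L = 0 := by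
  by_cases hi : i ∈ L.map Prod.fst
  · obtain ⟨l, hl⟩ := mem_fst hi
    obtain ⟨L', hp, hL', e⟩ := d.front hL hl
    by_cases hj : j = l
    · right; rw [e, hj, ← mul_assoc, d.ε_sq, zero_mul]
    · left
      have := d.Br_σb (Equiv.swap j l) (x := d.εL L) ⟨1, 1, L, hL, by simp⟩
      rwa [e, ← mul_assoc, ← d.ε_row _ _ _ hj, mul_assoc, ← e] at this
  · by_cases hj : j ∈ L.map Prod.snd
    · obtain ⟨l, hl⟩ := mem_snd hj
      obtain ⟨L', hp, hL', e⟩ := d.front hL hl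
      have hil : i ≠ l := by
        rintro rfl; exact hi (List.mem_map.2 ⟨_, hl, rfl⟩)
      left
      have := d.Br_σ (Equiv.swap i l) (x := d.εL L) ⟨1, 1, L, hL, by simp⟩
      rwa [e, ← mul_assoc, ← d.ε_col _ _ _ hil, mul_assoc, ← e] at this
    · left
      exact ⟨1, 1, (i,j) :: L, (OK_cons _ _).2 ⟨⟨hi, hj⟩, hL⟩, by simp⟩

lemma Br_ε (i j) {x} (hx : x ∈ d.Br) : d.ε i j * x ∈ d.Br ∨ d.ε i j * x = 0 := by
  obtain ⟨u, v, L, hL, rfl⟩ := hx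
  rw [← mul_assoc (d.σ u), ← mul_assoc (d.ε i j), d.ε_σσb, mul_assoc, mul_assoc]
  rcases d.ε_εL (u⁻¹ i) (v⁻¹ j) hL with h | h
  · left; exact d.Br_σ _ (d.Br_σb _ h)
  · right; rw [h, mul_zero, mul_zero]

/-- dichotomy: the top point `i` is on a vertical strand, or on a cup -/
lemma Br_cases (i) {x} (hx : x ∈ d.Br) : (∃ l, d.c i * x = x * d.c l ∧ d.ξ i * x = x * d.ξ l) ∨
    (∃ j y, x = d.ε i j * y) := by
  obtain ⟨u, v, L, hL, rfl⟩ := hx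
  by_cases h : u⁻¹ i ∈ L.map Prod.fst
  · right
    obtain ⟨l, hl⟩ := mem_fst h
    obtain ⟨L', hp, hL', e⟩ := d.front hL hl
    refine ⟨v l, d.σ u * d.σb v * d.εL L', ?_⟩
    rw [e, ← mul_assoc, ← mul_assoc, ← mul_assoc, d.ε_σσb]
    simp
  · left
    refine ⟨u⁻¹ i, ?_, ?_⟩
    · have e : d.c (u⁻¹ i) * d.εL L = d.εL L * d.c (u⁻¹ i) := by
        generalize u⁻¹ i = l at h
        clear hL
        induction L with
        | nil => simp
        | cons q L ih =>
          simp only [List.map_cons, List.mem_cons, not_or] at h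
          rw [εL_cons, ← mul_assoc, d.ε_c' _ _ _ h.1, mul_assoc, ih h.2, mul_assoc]
      rw [mul_assoc (d.σ u), mul_assoc (d.σb v), ← e, ← mul_assoc (d.σb v), d.σbc, mul_assoc, ← mul_assoc (d.σ u) (d.c (u⁻¹ i)), d.σ_c, mul_assoc]
      simp
    · have e : d.ξ (u⁻¹ i) * d.εL L = d.εL L * d.ξ (u⁻¹ i) := by
        generalize u⁻¹ i = l at h
        clear hL
        induction L with
        | nil => simp
        | cons q L ih =>
          simp only [List.map_cons, List.mem_cons, not_or] at h
          rw [εL_cons, ← mul_assoc, d.ε_ξ' _ _ _ h.1, mul_assoc, ih h.2, mul_assoc]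
      rw [mul_assoc (d.σ u), mul_assoc (d.σb v), ← e, ← mul_assoc (d.σb v), d.σbξ, mul_assoc, ← mul_assoc (d.σ u) (d.ξ (u⁻¹ i)), d.σ_ξ, mul_assoc]
      simp
end Idx
end

section
namespace Idx
variable {a κ ω : ℂ} {B : Type} [Ring B] [Algebra ℂ B] {r t : ℕ} (d : Idx a κ ω B r t)

/-- the unbarred Sergeev part -/
@[simps] def hd : HData a B r where
  σ := d.σ
  c := d.c
  ξ := d.ξ
  c_sq := d.c_sq
  c_anti := d.c_anti
  σ_c := d.σ_c
  σ_ξ := d.σ_ξ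
  ξ_sq := d.ξ_sq
  ξ_c := d.ξ_c
  ξ_c' := d.ξ_c'
  ξ_ξ := d.ξ_ξ

/-- Brauer diagrams times the right algebra -/
def YY : Set B := {y | ∃ x ∈ d.Br, ∃ k ∈ d.hd.alg, y = x * k}
/-- the spanning set -/
def Z : Submodule ℂ B := Submodule.span ℂ {z | ∃ q ∈ d.swap.hd.alg, ∃ y ∈ d.YY, z = q * y}
lemma Z_of_YY {y} (hy : y ∈ d.YY) : y ∈ d.Z := Submodule.subset_span ⟨1, one_mem _, y, hy, by simp⟩
lemma Z_mul {q} (hq : q ∈ d.swap.hd.alg) {z} (hz : z ∈ d.Z) : q * z ∈ d.Z := by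
  refine HData.span_left q ?_ z hz
  rintro _ ⟨q', hq', y, hy, rfl⟩
  exact Submodule.subset_span ⟨q * q', mul_mem hq hq', y, hy, by rw [mul_assoc]⟩
lemma Z_σb (w) {z} (hz : z ∈ d.Z) : d.σb w * z ∈ d.Z := d.Z_mul (d.swap.hd.σ_mem w) hz
lemma Z_ξb (j) {z} (hz : z ∈ d.Z) : d.ξb j * z ∈ d.Z := d.Z_mul (d.swap.hd.ξ_mem j) hz
lemma cb_eq (j) : d.cb j = (-Complex.I) • d.swap.hd.c j := by
  simp [swap, hd, smul_smul]
lemma Z_cb (j) {z} (hz : z ∈ d.Z) : d.cb j * z ∈ d.Z :=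
  d.Z_mul (by rw [d.cb_eq]; exact Subalgebra.smul_mem _ (d.swap.hd.c_mem j) _) hz
lemma Z_ind (S : Submodule ℂ B) (h0 : ∀ y ∈ d.YY, y ∈ S) (h1 : ∀ w, ∀ z ∈ S, d.σb w * z ∈ S)
    (h2 : ∀ w, ∀ z ∈ S, d.cb w * z ∈ S) (h3 : ∀ w, ∀ z ∈ S, d.ξb w * z ∈ S) : ∀ z ∈ d.Z, z ∈ S := by
  have key : ∀ q ∈ d.swap.hd.alg, ∀ z ∈ S, q * z ∈ S := by
    intro q hq
    induction hq using Algebra.adjoin_induction with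
    | mem x hx =>
      intro z hz
      rcases hx with (⟨w, rfl⟩ | ⟨j, rfl⟩) | ⟨j, rfl⟩
      · exact h1 w z hz
      · have : d.swap.hd.c j = Complex.I • d.cb j := rfl
        rw [this, smul_mul_assoc]; exact S.smul_mem _ (h2 j z hz)
      · exact h3 j z hz
    | algebraMap c => intro z hz; rw [← Algebra.smul_def]; exact S.smul_mem _ hz
    | add x y _ _ h1 h2 => intro z hz; rw [add_mul]; exact S.add_mem (h1 z hz) (h2 z hz)
    | mul x y _ _ h1 h2 => intro z hz; rw [mul_assoc]; exact h1 _ (h2 z hz)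
  have : d.Z ≤ S := by
    refine Submodule.span_le.2 ?_
    rintro _ ⟨q, hq, y, hy, rfl⟩
    exact key q hq y (h0 y hy)
  exact this
/-- a family version -/
lemma Z_ind' {ι : Type} (m : ι → B) (h0 : ∀ y ∈ d.YY, ∀ i, m i * y ∈ d.Z)
    (h1 : ∀ w, ∀ z ∈ d.Z, (∀ i, m i * z ∈ d.Z) → ∀ i, m i * (d.σb w * z) ∈ d.Z)
    (h2 : ∀ w, ∀ z ∈ d.Z, (∀ i, m i * z ∈ d.Z) → ∀ i, m i * (d.cb w * z) ∈ d.Z)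
    (h3 : ∀ w, ∀ z ∈ d.Z, (∀ i, m i * z ∈ d.Z) → ∀ i, m i * (d.ξb w * z) ∈ d.Z) :
    ∀ z ∈ d.Z, ∀ i, m i * z ∈ d.Z := by
  have hS : ∀ z, z ∈ d.Z ⊓ ⨅ i, d.Z.comap (LinearMap.mulLeft ℂ (m i)) ↔ z ∈ d.Z ∧ ∀ i, m i * z ∈ d.Z := by
    intro z; simp [Submodule.mem_iInf]
  have := d.Z_ind (d.Z ⊓ ⨅ i, d.Z.comap (LinearMap.mulLeft ℂ (m i)))
    (fun y hy => (hS _).2 ⟨d.Z_of_YY hy, h0 y hy⟩)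
    (fun w z hz => (hS _).2 ⟨d.Z_σb _ ((hS z).1 hz).1, h1 w z ((hS z).1 hz).1 ((hS z).1 hz).2⟩)
    (fun w z hz => (hS _).2 ⟨d.Z_cb _ ((hS z).1 hz).1, h2 w z ((hS z).1 hz).1 ((hS z).1 hz).2⟩)
    (fun w z hz => (hS _).2 ⟨d.Z_ξb _ ((hS z).1 hz).1, h3 w z ((hS z).1 hz).1 ((hS z).1 hz).2⟩)
  exact fun z hz => ((hS z).1 (this z hz)).2

lemma YY_mk {x k} (hx : x ∈ d.Br) (hk : k ∈ d.hd.alg) : x * k ∈ d.Z := d.Z_of_YY ⟨x, hx, k, hk, rfl⟩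
lemma YY_c (i) {x k} (hx : x ∈ d.Br) (hk : k ∈ d.hd.alg) : d.c i * (x * k) ∈ d.Z := by
  rcases d.Br_cases i hx with ⟨l, h, -⟩ | ⟨j, y, h⟩
  · rw [← mul_assoc, h, mul_assoc]; exact d.YY_mk hx (mul_mem (d.hd.c_mem l) hk)
  · have : d.c i * (x * k) = d.cb j * (x * k) := by rw [h]; simp only [← mul_assoc, d.c_ε]
    rw [this]; exact d.Z_cb _ (d.YY_mk hx hk)
lemma YY_ξ (i) {x k} (hx : x ∈ d.Br) (hk : k ∈ d.hd.alg) : d.ξ i * (x * k) ∈ d.Z := by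
  rcases d.Br_cases i hx with ⟨l, -, h⟩ | ⟨j, y, h⟩
  · rw [← mul_assoc, h, mul_assoc]; exact d.YY_mk hx (mul_mem (d.hd.ξ_mem l) hk)
  · have : d.ξ i * (x * k) = - (d.ξb j * (x * k)) := by
      rw [h]; simp only [← mul_assoc, d.ξ_ε, neg_mul]
    rw [this]; exact neg_mem (d.Z_ξb _ (d.YY_mk hx hk))
lemma YY_ε (i j) {x k} (hx : x ∈ d.Br) (hk : k ∈ d.hd.alg) : d.ε i j * (x * k) ∈ d.Z := by
  rcases d.Br_ε i j hx with h | h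
  · rw [← mul_assoc]; exact d.YY_mk h hk
  · rw [← mul_assoc, h, zero_mul]; exact zero_mem _
lemma YY_εc (i j) {x k} (hx : x ∈ d.Br) (hk : k ∈ d.hd.alg) : d.ε i j * (d.c i * (x * k)) ∈ d.Z := by
  rcases d.Br_cases i hx with ⟨l, h, -⟩ | ⟨l, y, h⟩
  · rw [← mul_assoc _ x, h, mul_assoc x]; exact d.YY_ε i j hx (mul_mem (d.hd.c_mem l) hk)
  · by_cases hl : l = j
    · have : d.ε i j * (d.c i * (x * k)) = 0 := by
        rw [h, hl]; simp only [← mul_assoc, d.εcε, zero_mul]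
      rw [this]; exact zero_mem _
    · have : d.ε i j * (d.c i * (x * k)) = d.cb l * (d.ε i j * (x * k)) := by
        rw [← mul_assoc (d.cb l), d.ε_cb' _ _ _ hl, mul_assoc, ← mul_assoc (d.c i), ← mul_assoc (d.cb l)]
        rw [h, ← mul_assoc (d.c i), ← mul_assoc (d.cb l), d.c_ε]
      rw [this]; exact d.Z_cb _ (d.YY_ε i j hx hk)
lemma YY_εξ (i j) {x k} (hx : x ∈ d.Br) (hk : k ∈ d.hd.alg) : d.ε i j * (d.ξ i * (x * k)) ∈ d.Z := by
  rcases d.Br_cases i hx with ⟨l, -, h⟩ | ⟨l, y, h⟩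
  · rw [← mul_assoc _ x, h, mul_assoc x]; exact d.YY_ε i j hx (mul_mem (d.hd.ξ_mem l) hk)
  · by_cases hl : l = j
    · have : d.ε i j * (d.ξ i * (x * k)) = ω • (x * k) := by
        rw [h, hl, Algebra.smul_def]; simp only [← mul_assoc, d.εξε]
      rw [this]; exact Submodule.smul_mem _ _ (d.YY_mk hx hk)
    · have : d.ε i j * (d.ξ i * (x * k)) = - (d.ξb l * (d.ε i j * (x * k))) := by
        rw [← mul_assoc (d.ξb l), d.ε_ξb' _ _ _ hl, mul_assoc, ← mul_assoc (d.ξ i), ← mul_assoc (d.ξb l)]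
        rw [h, ← mul_assoc (d.ξ i), ← mul_assoc (d.ξb l), d.ξ_ε]; simp
      rw [this]; exact neg_mem (d.Z_ξb _ (d.YY_ε i j hx hk))
lemma εcξε (i j) : d.ε i j * d.c i * d.ξ i * d.ε i j = 0 := by
  have h1 := d.ε_c i j
  have h2 := d.c_ε i j
  have h3 := d.ξ_c i
  have h4 := d.ξcb i j
  have : (2:ℂ) • (d.ε i j * d.c i * d.ξ i * d.ε i j) = 0 := by
    rw [two_smul]
    linear_combination (norm := noncomm_ring) h1 * d.ξ i * d.ε i j - d.ε i j * h4 * d.ε i j - d.ε i j * d.ξ i * h2 + d.ε i j * h3 * d.ε i j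
  exact (smul_eq_zero.1 this).resolve_left (by norm_num)
lemma YY_εcξ (i j) {x k} (hx : x ∈ d.Br) (hk : k ∈ d.hd.alg) : d.ε i j * (d.c i * (d.ξ i * (x * k))) ∈ d.Z := by
  rcases d.Br_cases i hx with ⟨l, h', h⟩ | ⟨l, y, h⟩
  · rw [← mul_assoc _ x, h, mul_assoc x, ← mul_assoc _ x, h', mul_assoc x]
    exact d.YY_ε i j hx (mul_mem (d.hd.c_mem l) (mul_mem (d.hd.ξ_mem l) hk))
  · by_cases hl : l = j
    · have : d.ε i j * (d.c i * (d.ξ i * (x * k))) = 0 := by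
        rw [h, hl]; simp only [← mul_assoc, d.εcξε, zero_mul]
      rw [this]; exact zero_mem _
    · have : d.ε i j * (d.c i * (d.ξ i * (x * k))) = - (d.ξb l * (d.cb l * (d.ε i j * (x * k)))) := by
        rw [← mul_assoc (d.cb l), d.ε_cb' _ _ _ hl, ← mul_assoc (d.ξb l), ← mul_assoc (d.ξb l), d.ε_ξb' _ _ _ hl, mul_assoc, mul_assoc, h]
        rw [← mul_neg]
        congr 1
        have h1 := d.c_ε i l
        have h2 := d.ξ_ε i l
        have h3 := d.ξbc i l
        generalize d.c i = c at *
        generalize d.cb l = c' at *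
        generalize d.ξ i = x at *
        generalize d.ξb l = x' at *
        linear_combination (norm := noncomm_ring) c * h2 * y * k + h3 * d.ε i l * y * k - x' * h1 * y * k
      rw [this]; exact neg_mem (d.Z_ξb _ (d.Z_cb _ (d.YY_ε i j hx hk)))
lemma Z_c : ∀ z ∈ d.Z, ∀ i, d.c i * z ∈ d.Z := by
  refine d.Z_ind' d.c ?_ ?_ ?_ ?_
  · rintro _ ⟨x, hx, k, hk, rfl⟩ i; exact d.YY_c i hx hk
  · intro w z hz h i
    rw [← mul_assoc, ← d.σbc, mul_assoc]; exact d.Z_σb _ (h i)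
  · intro w z hz h i
    rw [← mul_assoc, d.ccb, neg_mul, mul_assoc]; exact neg_mem (d.Z_cb _ (h i))
  · intro w z hz h i
    rw [← mul_assoc, ← d.ξbc, mul_assoc]; exact d.Z_ξb _ (h i)
lemma Z_σ : ∀ z ∈ d.Z, ∀ w, d.σ w * z ∈ d.Z := by
  refine d.Z_ind' d.σ ?_ ?_ ?_ ?_
  · rintro _ ⟨x, hx, k, hk, rfl⟩ i; rw [← mul_assoc]; exact d.YY_mk (d.Br_σ i hx) hk
  · intro w z hz h i
    rw [← mul_assoc, d.σσb, mul_assoc]; exact d.Z_σb _ (h i)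
  · intro w z hz h i
    rw [← mul_assoc, d.σcb, mul_assoc]; exact d.Z_cb _ (h i)
  · intro w z hz h i
    rw [← mul_assoc, d.σξb, mul_assoc]; exact d.Z_ξb _ (h i)
end Idx
end

section
namespace Idx
variable {a κ ω : ℂ} {B : Type} [Ring B] [Algebra ℂ B] {r t : ℕ} (d : Idx a κ ω B r t)

/-- auxiliary predicate: everything reachable by `ε` from the left -/
def PE (z : B) : Prop := ∀ i j, d.ε i j * z ∈ d.Z ∧ d.ε i j * (d.cb j * z) ∈ d.Z ∧
  d.ε i j * (d.ξb j * z) ∈ d.Z ∧ d.ε i j * (d.cb j * (d.ξb j * z)) ∈ d.Z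
variable {d}
lemma PE.add {x y} (hx : d.PE x) (hy : d.PE y) : d.PE (x + y) := by
  intro i j
  obtain ⟨h1, h2, h3, h4⟩ := hx i j
  obtain ⟨g1, g2, g3, g4⟩ := hy i j
  simp only [mul_add]
  exact ⟨add_mem h1 g1, add_mem h2 g2, add_mem h3 g3, add_mem h4 g4⟩
lemma PE.smul (s : ℂ) {y} (hy : d.PE y) : d.PE (s • y) := by
  intro i j
  obtain ⟨g1, g2, g3, g4⟩ := hy i j
  simp only [mul_smul_comm]
  exact ⟨d.Z.smul_mem _ g1, d.Z.smul_mem _ g2, d.Z.smul_mem _ g3, d.Z.smul_mem _ g4⟩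
lemma PE.σb {z} (h : d.PE z) (w) : d.PE (d.σb w * z) := by
  intro i j
  have e1 : d.ε i j * d.σb w = d.σb w * d.ε i (w⁻¹ j) := by simp [d.σb_ε]
  have e2 : d.cb j * d.σb w = d.σb w * d.cb (w⁻¹ j) := by simp [d.σb_cb]
  have e3 : d.ξb j * d.σb w = d.σb w * d.ξb (w⁻¹ j) := by simp [d.σb_ξb]
  obtain ⟨h1, h2, h3, h4⟩ := h i (w⁻¹ j)
  refine ⟨?_, ?_, ?_, ?_⟩
  · rw [← mul_assoc, e1, mul_assoc]; exact d.Z_σb _ h1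
  · rw [← mul_assoc, ← mul_assoc, mul_assoc (d.ε i j), e2, ← mul_assoc, e1, mul_assoc, mul_assoc]; exact d.Z_σb _ h2
  · rw [← mul_assoc, ← mul_assoc, mul_assoc (d.ε i j), e3, ← mul_assoc, e1, mul_assoc, mul_assoc]; exact d.Z_σb _ h3
  · rw [← mul_assoc (d.ξb j), e3, mul_assoc (d.σb w), ← mul_assoc (d.cb j), e2, mul_assoc (d.σb w), ← mul_assoc, e1, mul_assoc]; exact d.Z_σb _ h4
lemma PE.cb {z} (h : d.PE z) (l) : d.PE (d.cb l * z) := by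
  intro i j
  obtain ⟨h1, h2, h3, h4⟩ := h i j
  have q1 := d.Z_cb l h1
  have q2 := d.Z_cb l h2
  have q3 := d.Z_cb l h3
  have q4 := d.Z_cb l h4
  by_cases hl : l = j
  · subst hl
    have e1 := d.cb_sq l
    have e2 := d.ξb_cb l
    refine ⟨h2, ?_, ?_, ?_⟩
    · rw [← mul_assoc (d.cb l), e1, one_mul]; exact h1
    · rw [← mul_assoc (d.ξb l), e2, neg_mul, mul_neg, mul_assoc]; exact neg_mem h4
    · rw [← mul_assoc (d.ξb l), e2, neg_mul, mul_neg, mul_neg, mul_assoc, ← mul_assoc (d.cb l), e1, one_mul]; exact neg_mem h3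
  · have e0 := d.ε_cb' i j l hl
    have e1 := d.cb_anti l j hl
    have e2 := d.ξb_cb' j l (Ne.symm hl)
    generalize d.ε i j = ε at *
    generalize d.cb j = c at *
    generalize d.cb l = c' at *
    generalize d.ξb j = x at *
    refine ⟨?_, ?_, ?_, ?_⟩
    · convert q1 using 1
      linear_combination (norm := noncomm_ring) - e0 * z
    · convert neg_mem q2 using 1
      linear_combination (norm := noncomm_ring) ε * e1 * z + e0 * c * z
    · convert q3 using 1
      linear_combination (norm := noncomm_ring) - e0 * x * z + ε * e2 * z
    · convert neg_mem q4 using 1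
      linear_combination (norm := noncomm_ring) e0 * c * x * z + ε * c * e2 * z + ε * e1 * x * z
variable (d) in
lemma cmb (j l) (h : j ≠ l) : d.ξb j * d.ξb l = d.ξb l * d.ξb j + d.σb (Equiv.swap j l) * (d.ξb l * (1 + d.cb l * d.cb j) - (1 + d.cb l * d.cb j) * d.ξb j) := by
  have h0 := d.ξb_ξb j l h
  have h1 := d.σb_ξb (Equiv.swap j l) l
  have h2 := d.σb_cb (Equiv.swap j l) l
  have h3 := d.σb_cb (Equiv.swap j l) j
  rw [Equiv.swap_apply_right] at h1 h2
  rw [Equiv.swap_apply_left] at h3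
  generalize d.σb (Equiv.swap j l) = s at *
  generalize d.cb j = c at *
  generalize d.cb l = c' at *
  generalize d.ξb j = x at *
  generalize d.ξb l = x' at *
  linear_combination (norm := noncomm_ring) h0 - h1 - h1 * c' * c - x * h2 * c - x * c * h3 + h2 * c * x + c * h3 * x
lemma PE.ξb {z} (hz : z ∈ d.Z) (h : d.PE z) (l) : d.PE (d.ξb l * z) := by
  intro i j
  obtain ⟨h1, h2, h3, h4⟩ := h i j
  by_cases hl : l = j
  · subst hl
    have e1 := d.ξb_sq l
    refine ⟨h3, h4, ?_, ?_⟩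
    · rw [← mul_assoc (d.ξb l), e1, ← Algebra.smul_def, mul_smul_comm]; exact d.Z.smul_mem _ h1
    · rw [← mul_assoc (d.ξb l), e1, ← Algebra.smul_def, mul_smul_comm, mul_smul_comm]; exact d.Z.smul_mem _ h2
  · have q1 := d.Z_ξb l h1
    have q2 := d.Z_ξb l h2
    have q3 := d.Z_ξb l h3
    have q4 := d.Z_ξb l h4
    -- the element `(1 + c̄_l c̄_j) z`
    have hw : d.PE ((1 + d.cb l * d.cb j) * z) := by
      rw [add_mul, one_mul, mul_assoc]; exact h.add ((h.cb j).cb l)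
    obtain ⟨-, -, w3, w4⟩ := hw i l
    obtain ⟨g1, g2, -, -⟩ := h i l
    obtain ⟨k1, k2, -, -⟩ := (h.cb j) i l
    have p1 := d.Z_ξb j g1
    have p2 := d.Z_ξb j g2
    have p3 := d.Z_cb j p1
    have p4 := d.Z_cb j p2
    have r0 := d.Z_σb (Equiv.swap j l) w3
    have r1 := d.Z_σb (Equiv.swap j l) w4
    have r2 := d.Z_σb (Equiv.swap j l) p1
    have r3 := d.Z_σb (Equiv.swap j l) p2
    have r4 := d.Z_σb (Equiv.swap j l) p3
    have r5 := d.Z_σb (Equiv.swap j l) p4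
    have e0 := d.ε_ξb' i j l hl
    have e0' := d.ε_ξb' i l j (Ne.symm hl)
    have e1 := d.ξb_cb' l j hl
    have e1' := d.ξb_cb' j l (Ne.symm hl)
    have e2 := d.cmb j l (Ne.symm hl)
    have e3 := d.σb_ε (Equiv.swap j l) i l
    have e4 := d.σb_cb (Equiv.swap j l) l
    rw [Equiv.swap_apply_right] at e3 e4
    have e5 := d.ε_cb' i l j (Ne.symm hl)
    have e6 := d.cb_anti l j hl
    have e7 := d.cb_sq l
    have e8 := d.ξb_cb j
    generalize d.ε i j = ε at *
    generalize d.ε i l = ε' at *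
    generalize d.cb j = c at *
    generalize d.cb l = c' at *
    generalize d.ξb j = x at *
    generalize d.ξb l = x' at *
    generalize d.σb (Equiv.swap j l) = s at *
    refine ⟨?_, ?_, ?_, ?_⟩
    · convert q1 using 1
      linear_combination (norm := noncomm_ring) - e0 * z
    · convert q2 using 1
      linear_combination (norm := noncomm_ring) - e0 * c * z - ε * e1 * z
    · -- ε x x' z = ε x' x z + s ε' (x' (1+c'c) z - (1 + c'c) x z)
      have f1 : ε' * (c' * c) * x = - (c * x * ε' * c') := by
        linear_combination (norm := noncomm_ring) ε' * e6 * x + e5 * c' * x + c * ε' * e1' + c * e0' * c'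
      convert add_mem q3 (sub_mem r0 (sub_mem r2 r5)) using 1
      linear_combination (norm := noncomm_ring) ε * e2 * z - e0 * x * z - e3 * (x' * (1 + c' * c) - (1 + c' * c) * x) * z + s * e0' * z - s * f1 * z
    · have f1 : ε' * c' * x = x * ε' * c' := by
        linear_combination (norm := noncomm_ring) - ε' * e1' - e0' * c'
      have f2 : ε' * c' * c' * c * x = c * x * ε' := by
        linear_combination (norm := noncomm_ring) ε' * e7 * c * x - e5 * x - c * e0'
      convert add_mem q4 (sub_mem r1 (add_mem r3 r4)) using 1
      linear_combination (norm := noncomm_ring) ε * c * e2 * z - e0 * c * x * z - ε * e1 * x * z - (ε * e4 + e3 * c') * (x' * (1 + c' * c) - (1 + c' * c) * x) * z - s * f1 * z - s * f2 * z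
lemma PE_all (z) (hz : z ∈ d.Z) : d.PE z := by
  let S : Submodule ℂ B :=
    { carrier := {z | z ∈ d.Z ∧ d.PE z}
      add_mem' := fun h1 h2 => ⟨add_mem h1.1 h2.1, h1.2.add h2.2⟩
      zero_mem' := ⟨zero_mem _, by intro i j; simp⟩
      smul_mem' := fun c x h => ⟨d.Z.smul_mem c h.1, h.2.smul c⟩ }
  have := d.Z_ind S ?_ ?_ ?_ ?_ z hz
  · exact this.2
  · rintro _ ⟨x, hx, k, hk, rfl⟩
    refine ⟨d.YY_mk hx hk, fun i j => ⟨d.YY_ε i j hx hk, ?_, ?_, ?_⟩⟩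
    · rw [← mul_assoc, ← d.ε_c, mul_assoc]; exact d.YY_εc i j hx hk
    · have := neg_mem (d.YY_εξ i j hx hk)
      rwa [← mul_assoc, d.ε_ξ, neg_mul, neg_neg, mul_assoc] at this
    · have := d.YY_εcξ i j hx hk
      have e1 := d.ε_ξ i j
      have e2 := d.ε_c i j
      have e3 := d.ξb_cb j
      have e4 := d.ξcb i j
      convert this using 1
      linear_combination (norm := noncomm_ring) d.ε i j * e3 * x * k - e1 * d.cb j * x * k + d.ε i j * e4 * x * k - e2 * d.ξ i * x * k
  · rintro w z ⟨h1, h2⟩; exact ⟨d.Z_σb w h1, h2.σb w⟩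
  · rintro w z ⟨h1, h2⟩; exact ⟨d.Z_cb w h1, h2.cb w⟩
  · rintro w z ⟨h1, h2⟩; exact ⟨d.Z_ξb w h1, h2.ξb h1 w⟩
lemma Z_ε (z) (hz : z ∈ d.Z) (i j) : d.ε i j * z ∈ d.Z := (PE_all z hz i j).1
lemma Z_ξ : ∀ z ∈ d.Z, ∀ i, d.ξ i * z ∈ d.Z := by
  refine d.Z_ind' d.ξ ?_ ?_ ?_ ?_
  · rintro _ ⟨x, hx, k, hk, rfl⟩ i; exact d.YY_ξ i hx hk
  · intro w z hz h i
    rw [← mul_assoc, ← d.σbξ, mul_assoc]; exact d.Z_σb _ (h i)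
  · intro w z hz h i
    rw [← mul_assoc, d.ξcb, mul_assoc]; exact d.Z_cb _ (h i)
  · intro j z hz h i
    have g1 := d.Z_ξb j (h i)
    have g2 := d.Z_ξb j (Z_ε z hz i j)
    have g3 := d.Z_c _ (d.Z_ξb j (Z_ε _ (d.Z_c z hz i) i j)) i
    have g4 := Z_ε _ (h i) i j
    have g5 := d.Z_c _ (Z_ε _ (d.Z_c _ (h i) i) i j) i
    have e1 := d.mixed i j
    have e2 := d.ξ_ε i j
    have e3 := d.ξ_c i
    convert add_mem (sub_mem (add_mem g4 (add_mem g1 g2)) g5) g3 using 1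
    linear_combination (norm := noncomm_ring) e1 * z - e2 * z + e3 * d.ε i j * d.c i * z - d.c i * e2 * d.c i * z
variable (d) in
/-- all generators -/
def allg : Set B := d.hd.gens ∪ (d.swap.hd.gens ∪ Set.range (fun q : Fin r × Fin t => d.ε q.1 q.2))
lemma all_Z : ∀ z ∈ Algebra.adjoin ℂ d.allg, z ∈ d.Z := by
  refine adjoin_le_of_left _ _ ?_ ?_
  · simpa using d.YY_mk d.Br_one (one_mem _)
  · rintro g (((⟨w, rfl⟩ | ⟨j, rfl⟩) | ⟨j, rfl⟩) | (hg | ⟨q, rfl⟩)) z hz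
    · exact d.Z_σ z hz w
    · exact d.Z_c z hz j
    · exact Z_ξ z hz j
    · exact d.Z_mul (Algebra.subset_adjoin hg) hz
    · exact Z_ε z hz _ _
end Idx
end

section
namespace Idx
variable {a κ ω : ℂ} {B : Type} [Ring B] [Algebra ℂ B] {r t : ℕ} (d : Idx a κ ω B r t)

/-- the final spanning set -/
def FF : Set B := {f | ∃ α' β' α β, ∃ x ∈ d.Br, f = d.swap.hd.monr α' β' * (x * d.hd.mon α β)}
lemma Z_FF : ∀ z ∈ d.Z, z ∈ Submodule.span ℂ d.FF := by
  have h : d.Z ≤ Submodule.span ℂ d.FF := by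
    refine Submodule.span_le.2 ?_
    rintro _ ⟨q, hq, y, ⟨x, hx, k, hk, rfl⟩, rfl⟩
    have h1 := HData.spanL _ d.hd k hk
    have h2 := d.swap.hd.spanR q hq
    have h3 : ∀ (f : B →ₗ[ℂ] B) (s : Set B) (v : B), v ∈ Submodule.span ℂ s → (∀ u ∈ s, f u ∈ Submodule.span ℂ d.FF) →
        f v ∈ Submodule.span ℂ d.FF := by
      intro f s v hv hs
      have : Submodule.span ℂ s ≤ (Submodule.span ℂ d.FF).comap f := Submodule.span_le.2 hs
      exact this hv
    refine h3 (LinearMap.mulRight ℂ (x * k)) _ q h2 ?_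
    rintro _ ⟨w, α', β', rfl⟩
    have h := h3 (LinearMap.mulLeft ℂ (d.swap.hd.monr α' β' * d.swap.hd.σ w * x)) _ k h1 ?_
    swap
    · rintro _ ⟨u, α, β, rfl⟩
      refine Submodule.subset_span ⟨α', β', α, β, _, d.Br_rσ u (d.Br_σb w hx), ?_⟩
      simp only [LinearMap.mulLeft_apply, mul_assoc]; rfl
    · simpa only [LinearMap.mulLeft_apply, LinearMap.mulRight_apply, mul_assoc] using h
  exact h
end Idx
lemma inj_of_basis {B V P Q : Type} [AddCommGroup B] [Module ℂ B] [AddCommGroup V] [Module ℂ V]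
    (g : B →ₗ[ℂ] V) (S : Set B) (v : P → V) (hv : LinearIndependent ℂ v)
    (q : Q → B) (hS : ∀ f ∈ S, ∃ x, f = q x) (R : Q → P) (s : Q → ℂ) (hs : ∀ x, s x ≠ 0)
    (hg : ∀ x, g (q x) = s x • v (R x)) (hR : ∀ x y, R x = R y → q x = q y)
    (b : B) (hb : b ∈ Submodule.span ℂ S) (h0 : g b = 0) : b = 0 := by
  classical
  -- choose for each value of `R` a representative
  have hS' : S ⊆ Set.range q := fun f hf => by obtain ⟨x, rfl⟩ := hS f hf; exact ⟨x, rfl⟩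
  have hb' : b ∈ Submodule.span ℂ (Set.range q) := Submodule.span_mono hS' hb
  let w : Set.range R → B := fun p => q p.2.choose
  have hw : Set.range q = Set.range w := by
    ext f; constructor
    · rintro ⟨x, rfl⟩
      refine ⟨⟨R x, x, rfl⟩, hR _ _ (Exists.choose_spec (p := fun y => R y = R x) ⟨x, rfl⟩)⟩
    · rintro ⟨p, rfl⟩; exact ⟨_, rfl⟩
  have hwi : LinearIndependent ℂ (fun p => g (w p)) := by
    have e : (fun p => g (w p)) = fun p : Set.range R => Units.mk0 (s p.2.choose) (hs _) • v p.1 := by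
      funext p
      have := p.2.choose_spec
      change g (q _) = _
      rw [hg, this]; rfl
    rw [e]
    exact (hv.comp (fun p : Set.range R => p.1) Subtype.val_injective).units_smul _
  rw [hw] at hb'
  obtain ⟨l, rfl⟩ := (Finsupp.mem_span_range_iff_exists_finsupp).1 hb'
  have : l = 0 := by
    refine linearIndependent_iff.1 hwi l ?_
    rw [Finsupp.linearCombination_apply, ← h0, map_finsuppSum]
    simp
  subst this; simp
end

section
namespace Idx
variable {a κ ω : ℂ} {B : Type} [Ring B] [Algebra ℂ B] {r t : ℕ} (d : Idx a κ ω B r t)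

lemma OK.fst_inj {L : List (Fin r × Fin t)} (h : OK L) {i j j'} (h1 : (i, j) ∈ L) (h2 : (i, j') ∈ L) : j = j' := by
  have := List.inj_on_of_nodup_map h.1 h1 h2 rfl
  simpa using this
lemma OK.snd_inj {L : List (Fin r × Fin t)} (h : OK L) {i i' j} (h1 : (i, j) ∈ L) (h2 : (i', j) ∈ L) : i = i' := by
  have := List.inj_on_of_nodup_map h.2 h1 h2 rfl
  simpa using this

lemma sw_εL {L : List (Fin r × Fin t)} (hL : OK L) {i j i' j'} (h1 : (i, j) ∈ L) (h2 : (i', j') ∈ L) (hi : i ≠ i') (hj : j ≠ j') :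
    d.σ (Equiv.swap i i') * (d.σb (Equiv.swap j j') * d.εL L) = d.εL L := by
  obtain ⟨L1, p1, o1, e1⟩ := d.front hL h1
  have h3 : (i', j') ∈ L1 := by
    have := (p1.mem_iff).1 h2
    rcases List.mem_cons.1 this with h | h
    · exact absurd (congrArg Prod.fst h).symm hi
    · exact h
  obtain ⟨L2, p2, o2, e2⟩ := d.front ((OK_cons _ _).1 o1).2 h3
  rw [e1, e2]
  have := d.εε_sw i i' j j' hi hj
  calc _ = d.σ (Equiv.swap i i') * (d.σb (Equiv.swap j j') * (d.ε i j * d.ε i' j')) * d.εL L2 := by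
        simp only [mul_assoc]
    _ = _ := by rw [this]; simp only [mul_assoc]

/-- stabilizer condition -/
def Stab (L : List (Fin r × Fin t)) (u : Equiv.Perm (Fin r)) (v : Equiv.Perm (Fin t)) : Prop :=
  (∀ i j, (i, j) ∈ L → (u i, v j) ∈ L) ∧ (∀ i, i ∉ L.map Prod.fst → u i = i) ∧ (∀ j, j ∉ L.map Prod.snd → v j = j)

lemma stab_fix {i j} {L : List (Fin r × Fin t)} (hL : OK ((i, j) :: L)) {u v} (h : Stab ((i, j) :: L) u v) (hi : u i = i) :
    v j = j ∧ Stab L u v := by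
  obtain ⟨h1, h2, h3⟩ := h
  have e : v j = j := by
    have := h1 i j (by simp)
    rw [hi] at this
    exact hL.fst_inj this (by simp)
  refine ⟨e, ?_, ?_, ?_⟩
  · intro x y hxy
    have := h1 x y (List.mem_cons_of_mem _ hxy)
    rcases List.mem_cons.1 this with h | h
    · exfalso
      have hx : x = i := u.injective ((congrArg Prod.fst h).trans hi.symm)
      exact ((OK_cons _ _).1 hL).1.1 (List.mem_map.2 ⟨_, hxy, hx⟩)
    · exact h
  · intro x hx
    by_cases hxi : x = i
    · rw [hxi, hi]
    · refine h2 x ?_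
      simp only [List.map_cons, List.mem_cons, not_or]
      exact ⟨hxi, hx⟩
  · intro x hx
    by_cases hxi : x = j
    · rw [hxi, e]
    · refine h3 x ?_
      simp only [List.map_cons, List.mem_cons, not_or]
      exact ⟨hxi, hx⟩

lemma stab_sw {L : List (Fin r × Fin t)} (hL : OK L) {u v} (h : Stab L u v) {i j i' j'} (h1 : (i, j) ∈ L) (h2 : (i', j') ∈ L) :
    Stab L (Equiv.swap i i' * u) (Equiv.swap j j' * v) := by
  obtain ⟨g1, g2, g3⟩ := h
  refine ⟨?_, ?_, ?_⟩
  · intro x y hxy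
    have hq := g1 x y hxy
    simp only [Equiv.Perm.mul_apply]
    generalize u x = x at *
    generalize v y = y at *
    by_cases e1 : x = i
    · subst e1; obtain rfl := hL.fst_inj hq h1; simpa using h2
    by_cases e2 : x = i'
    · subst e2; obtain rfl := hL.fst_inj hq h2; simpa using h1
    have e3 : y ≠ j := by rintro rfl; exact e1 (hL.snd_inj hq h1)
    have e4 : y ≠ j' := by rintro rfl; exact e2 (hL.snd_inj hq h2)
    rwa [Equiv.swap_apply_of_ne_of_ne e1 e2, Equiv.swap_apply_of_ne_of_ne e3 e4]
  · intro x hx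
    rw [Equiv.Perm.mul_apply, g2 x hx, Equiv.swap_apply_of_ne_of_ne]
    · rintro rfl; exact hx (List.mem_map.2 ⟨_, h1, rfl⟩)
    · rintro rfl; exact hx (List.mem_map.2 ⟨_, h2, rfl⟩)
  · intro x hx
    rw [Equiv.Perm.mul_apply, g3 x hx, Equiv.swap_apply_of_ne_of_ne]
    · rintro rfl; exact hx (List.mem_map.2 ⟨_, h1, rfl⟩)
    · rintro rfl; exact hx (List.mem_map.2 ⟨_, h2, rfl⟩)

lemma stab_εL : ∀ {L : List (Fin r × Fin t)} (hL : OK L) {u v} (h : Stab L u v), d.σ u * (d.σb v * d.εL L) = d.εL L := by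
  intro L
  induction L with
  | nil =>
    intro hL u v h
    have h1 : u = 1 := Equiv.ext fun i => h.2.1 i (by simp)
    have h2 : v = 1 := Equiv.ext fun i => h.2.2 i (by simp)
    simp [h1, h2]
  | cons q L ih =>
    obtain ⟨i, j⟩ := q
    intro hL
    have A : ∀ {u v}, Stab ((i, j) :: L) u v → u i = i → d.σ u * (d.σb v * d.εL ((i, j) :: L)) = d.εL ((i, j) :: L) := by
      intro u v h hi
      obtain ⟨hj, hs⟩ := stab_fix hL h hi
      have := ih ((OK_cons _ _).1 hL).2 hs
      rw [εL_cons, ← mul_assoc (d.σb v), d.σb_ε, hj, mul_assoc, ← mul_assoc (d.σ u), d.σ_ε, hi, mul_assoc, this]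
    intro u v h
    by_cases hi : u i = i
    · exact A h hi
    · have h0 : (i, j) ∈ (i, j) :: L := by simp
      have h1 := h.1 i j h0
      have hj : v j ≠ j := by
        intro hj; rw [hj] at h1; exact hi (hL.snd_inj h1 h0)
      have := A (stab_sw hL h h0 h1) (by simp)
      have e1 : u = Equiv.swap i (u i) * (Equiv.swap i (u i) * u) := by rw [← mul_assoc, Equiv.swap_mul_self, one_mul]
      have e2 : v = Equiv.swap j (v j) * (Equiv.swap j (v j) * v) := by rw [← mul_assoc, Equiv.swap_mul_self, one_mul]
      have e3 := d.sw_εL hL h0 h1 (Ne.symm hi) (Ne.symm hj)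
      generalize Equiv.swap i (u i) * u = u' at *
      generalize Equiv.swap j (v j) * v = v' at *
      rw [e1, e2, map_mul, map_mul, mul_assoc, mul_assoc, ← mul_assoc (d.σ u'), d.σσb, mul_assoc, this, e3]

/-- the permutation of a matching -/
def tau {X : Type} [DecidableEq X] (α : Fin r ↪ X) (β : Fin t ↪ X) (L : List (Fin r × Fin t)) : Equiv.Perm X :=
  (L.map (fun q => Equiv.swap (α q.1) (β q.2))).prod
@[simp] lemma tau_cons {X : Type} [DecidableEq X] (α : Fin r ↪ X) (β : Fin t ↪ X) (q L) :
    tau α β (q :: L) = Equiv.swap (α q.1) (β q.2) * tau α β L := by simp [tau]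
@[simp] lemma tau_nil {X : Type} [DecidableEq X] (α : Fin r ↪ X) (β : Fin t ↪ X)  :
    tau α β [] = 1 := rfl
section
variable {X : Type} [DecidableEq X] (α : Fin r ↪ X) (β : Fin t ↪ X)
lemma tau_not (L : List (Fin r × Fin t)) (x : X) (h1 : ∀ i ∈ L.map Prod.fst, x ≠ α i) (h2 : ∀ i ∈ L.map Prod.snd, x ≠ β i) :
    tau α β L x = x := by
  induction L with
  | nil => rfl
  | cons q L ih =>
    simp only [List.map_cons, List.mem_cons, forall_eq_or_imp] at h1 h2
    rw [tau_cons, Equiv.Perm.mul_apply, ih h1.2 h2.2, Equiv.swap_apply_of_ne_of_ne h1.1 h2.1]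
lemma tau_mem (hαβ : ∀ i j, α i ≠ β j) (L : List (Fin r × Fin t)) (hL : OK L) {i j} (h : (i, j) ∈ L) :
    tau α β L (α i) = β j ∧ tau α β L (β j) = α i := by
  induction L with
  | nil => simp at h
  | cons q L ih =>
    obtain ⟨⟨n1, n2⟩, o⟩ := (OK_cons _ _).1 hL
    rw [tau_cons, Equiv.Perm.mul_apply, Equiv.Perm.mul_apply]
    rcases List.mem_cons.1 h with rfl | h
    · rw [tau_not, tau_not]
      · simp
      · intro x hx; exact (hαβ _ _).symm
      · intro x hx e; rw [β.injective e] at n2; exact n2 hx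
      · intro x hx e; rw [α.injective e] at n1; exact n1 hx
      · intro x hx; exact (hαβ _ _)
    · obtain ⟨e1, e2⟩ := ih o h
      have f1 : i ≠ q.1 := by rintro rfl; exact n1 (List.mem_map.2 ⟨_, h, rfl⟩)
      have f2 : j ≠ q.2 := by rintro rfl; exact n2 (List.mem_map.2 ⟨_, h, rfl⟩)
      rw [e1, e2, Equiv.swap_apply_of_ne_of_ne, Equiv.swap_apply_of_ne_of_ne]
      · exact ⟨rfl, rfl⟩
      · exact fun e => f1 (α.injective e)
      · exact hαβ _ _
      · exact (hαβ _ _).symm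
      · exact fun e => f2 (β.injective e)
end
end Idx
end

section
namespace Idx
variable {a κ ω : ℂ} {B : Type} [Ring B] [Algebra ℂ B] {r t : ℕ} (d : Idx a κ ω B r t)

section
variable {X : Type} [DecidableEq X] (α : Fin r ↪ X) (β : Fin t ↪ X)
/-- the permutation of a walled Brauer diagram -/
def WW (u : Equiv.Perm (Fin r)) (v : Equiv.Perm (Fin t)) (L : List (Fin r × Fin t)) : Equiv.Perm X :=
  via α u * (tau α β L * via β v⁻¹)
variable {α β}
lemma WW_α (hαβ : ∀ i j, α i ≠ β j) (u v) {L : List (Fin r × Fin t)} (hL : OK L) (i) :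
    (∀ j, (i, j) ∈ L → WW α β u v L (α i) = β j) ∧ (i ∉ L.map Prod.fst → WW α β u v L (α i) = α (u i)) := by
  have e : via β v⁻¹ (α i) = α i := via_not _ _ _ (fun j h => hαβ i j h.symm)
  simp only [WW, Equiv.Perm.mul_apply, e]
  constructor
  · intro j h
    rw [(tau_mem α β hαβ L hL h).1]
    exact via_not _ _ _ (fun j h => hαβ _ _ h)
  · intro h
    rw [tau_not, via_apply]
    · intro x hx e; rw [α.injective e] at h; exact h hx
    · intro x hx; exact (hαβ _ _)
lemma WW_β (hαβ : ∀ i j, α i ≠ β j) (u v) {L : List (Fin r × Fin t)} (hL : OK L) (j) :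
    (∀ i, (i, j) ∈ L → WW α β u v L (β (v j)) = α (u i)) ∧ (j ∉ L.map Prod.snd → WW α β u v L (β (v j)) = β j) := by
  have e : via β v⁻¹ (β (v j)) = β j := by rw [via_apply]; simp
  simp only [WW, Equiv.Perm.mul_apply, e]
  constructor
  · intro i h
    rw [(tau_mem α β hαβ L hL h).2, via_apply]
  · intro h
    rw [tau_not]
    · exact via_not _ _ _ (fun j h => hαβ _ _ h)
    · intro x hx; exact (hαβ _ _).symm
    · intro x hx e; rw [β.injective e] at h; exact h hx
lemma WW_mem (hαβ : ∀ i j, α i ≠ β j) (u v) {L : List (Fin r × Fin t)} (hL : OK L) (i j) :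
    (i, j) ∈ L ↔ WW α β u v L (α i) = β j := by
  constructor
  · exact (WW_α hαβ u v hL i).1 j
  · intro h
    by_cases hi : i ∈ L.map Prod.fst
    · obtain ⟨j', hj⟩ := mem_fst hi
      have := (WW_α hαβ u v hL i).1 _ hj
      rw [h] at this
      rwa [β.injective this]
    · have := (WW_α hαβ u v hL i).2 hi
      rw [h] at this
      exact absurd this.symm (hαβ _ _)
/-- the permutation determines the diagram -/
lemma WW_inj (hαβ : ∀ i j, α i ≠ β j) {u v u' v'} {L L' : List (Fin r × Fin t)} (hL : OK L) (hL' : OK L')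
    (h : WW α β u v L = WW α β u' v' L') : d.σ u * (d.σb v * d.εL L) = d.σ u' * (d.σb v' * d.εL L') := by
  have hm : ∀ i j, (i, j) ∈ L ↔ (i, j) ∈ L' := fun i j => by
    rw [WW_mem hαβ u v hL, WW_mem hαβ u' v' hL', h]
  have hp : L.Perm L' := (List.perm_ext_iff_of_nodup hL.1.of_map hL'.1.of_map).2 (fun q => hm q.1 q.2)
  have hn1 : ∀ i, i ∉ L.map Prod.fst ↔ i ∉ L'.map Prod.fst := fun i => not_congr (hp.map _).mem_iff
  have hn2 : ∀ i, i ∉ L.map Prod.snd ↔ i ∉ L'.map Prod.snd := fun i => not_congr (hp.map _).mem_iff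
  rw [← d.εL_perm hp hL]
  have key : Stab L (u'⁻¹ * u) (v'⁻¹ * v) := by
    refine ⟨?_, ?_, ?_⟩
    · intro i j hij
      have e1 := (WW_β hαβ u v hL j).1 i hij
      set j1 := v'⁻¹ (v j) with hj1
      have hv : v j = v' j1 := by simp [hj1]
      rw [h, hv] at e1
      by_cases hjm : j1 ∈ L'.map Prod.snd
      · obtain ⟨i1, hi1⟩ := mem_snd hjm
        rw [(WW_β hαβ u' v' hL' j1).1 i1 hi1] at e1
        have : u i = u' i1 := (α.injective e1).symm
        rw [Equiv.Perm.mul_apply, Equiv.Perm.mul_apply, this, ← hj1]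
        simpa [hm] using hi1
      · rw [(WW_β hαβ u' v' hL' j1).2 hjm] at e1
        exact absurd e1.symm (hαβ _ _)
    · intro i hi
      have e1 := (WW_α hαβ u v hL i).2 hi
      rw [h, (WW_α hαβ u' v' hL' i).2 ((hn1 i).1 hi)] at e1
      rw [Equiv.Perm.mul_apply, ← α.injective e1]; simp
    · intro j hj
      have e1 := (WW_β hαβ u v hL j).2 hj
      have e2 := (WW_β hαβ u' v' hL' j).2 ((hn2 j).1 hj)
      rw [← h, ← e1] at e2
      have := β.injective ((WW α β u v L).injective e2)
      rw [Equiv.Perm.mul_apply, ← this]; simp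
  have := d.stab_εL hL key
  calc _ = d.σ u' * d.σb v' * (d.σ (u'⁻¹ * u) * (d.σb (v'⁻¹ * v) * d.εL L)) := by
        rw [mul_assoc (d.σ u'), ← mul_assoc (d.σb v'), ← d.σσb, mul_assoc, ← mul_assoc (d.σ u'), ← map_mul, ← mul_assoc (d.σb v'), ← map_mul]
        simp
    _ = _ := by rw [this, mul_assoc]
end
end Idx
end

section
open HH

/-- `ρ` realises the index data on `HH` -/
structure HRep {a κ ω : ℂ} {B : Type} [Ring B] [Algebra ℂ B] {T R : ℕ} (d : Idx a κ ω B (R+1) (T+1))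
    (ρ : B →ₐ[ℂ] Module.End ℂ (HH a (T+R+1+1))) : Prop where
  σ : ∀ w h, ρ (d.σ w) h = (D a _).σ (via (lab T R) w) * h
  σb : ∀ w h, ρ (d.σb w) h = h * (D a _).σ (via (labb T R) w⁻¹)
  c : ∀ i h, ρ (d.c i) h = (D a _).c (lab T R i) * h
  cb : ∀ i h, ρ (d.cb i) h = γ h * (D a _).c (labb T R i)
  ξ : ∀ i h, ρ (d.ξ i) h = (D a _).ξ (lab T R i) * h
  ξb : ∀ i h, ρ (d.ξb i) h = xB κ (h * (D a _).σ (Equiv.swap 0 (labb T R i))) * (D a _).σ (Equiv.swap 0 (labb T R i))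
  ε : ∀ i j h, ρ (d.ε i j) h = (D a _).σ (Equiv.swap 0 (lab T R i)) *
    inc (tr ω ((D a _).σ (Equiv.swap 0 (lab T R i)) * (h * (D a _).σ (Equiv.swap 0 (labb T R j))))) * (D a _).σ (Equiv.swap 0 (labb T R j))

/-- κ0 -/
def kap (T R : ℕ) : Equiv.Perm (Fin (T+R+1+1)) := Equiv.swap 0 ⟨T+1, by omega⟩
/-- labels b' -/
def labc (T R : ℕ) : Fin (T+1) ↪ Fin (T+R+1+1) := (labb T R).trans (kap T R).toEmbedding

lemma labc_apply (T R j) : labc T R j = kap T R (labb T R j) := rfl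

lemma lab_val {T R : ℕ} (i : Fin (R+1)) : (lab T R i : ℕ) = if (i : ℕ) = 0 then 0 else T + 1 + i := by
  split_ifs with h
  · obtain ⟨i, hi⟩ := i; have h' : i = 0 := h
    subst h'; rw [lab_zero]; rfl
  · rw [lab_pos i h]; simp; omega
lemma labb_val {T R : ℕ} (i : Fin (T+1)) : (labb T R i : ℕ) = i := rfl
lemma kap_val {T R : ℕ} (x) : (kap T R x : ℕ) = if (x : ℕ) = 0 then T+1 else if (x : ℕ) = T+1 then 0 else x := by
  unfold kap
  by_cases h : x = 0
  · subst h; rw [Equiv.swap_apply_left]; simp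
  · have h1 : (x : ℕ) ≠ 0 := fun h' => h (Fin.ext h')
    rw [if_neg h1]
    by_cases h2 : x = ⟨T+1, by omega⟩
    · rw [h2, Equiv.swap_apply_right, if_pos rfl]; rfl
    · have h3 : (x : ℕ) ≠ T+1 := fun h' => h2 (Fin.ext h')
      rw [if_neg h3, Equiv.swap_apply_of_ne_of_ne h h2]
lemma lab_labc {T R : ℕ} (i j) : lab T R i ≠ labc T R j := fun h => by
  have := congrArg Fin.val h
  rw [labc_apply, kap_val, lab_val, labb_val] at this
  split_ifs at this <;> omega
lemma kap_lab {T R : ℕ} (i : Fin (R+1)) : (kap T R (lab T R i) : ℕ) = T+1+i := by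
  rw [kap_val, lab_val]
  split_ifs <;> omega

lemma HH.incE_σ {a ω : ℂ} {n : ℕ} (w : Equiv.Perm (Fin (n+1))) (h : w 0 ≠ 0) :
    (inc (tr ω ((D a (n+1)).σ w)) : HH a (n+1)) = (D a (n+1)).σ (Equiv.swap 0 (w 0) * w) := by
  obtain ⟨j, hj⟩ := Fin.exists_succ_eq.mpr h
  have h1 : w = Equiv.swap 0 j.succ * up (dn w) := by rw [hj]; exact dn_spec w
  have h2 := tr_sq1 (a := a) ω j false false
  simp only [qq, pw_false, mul_one] at h2
  have h3 : Equiv.swap 0 (w 0) * w = up (dn w) := by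
    rw [← hj]; conv_lhs => rw [h1]
    rw [← mul_assoc, Equiv.swap_mul_self, one_mul]
  rw [h3]
  conv_lhs => rw [h1]
  rw [map_mul, ← inc_σ, tr_right, h2, one_mul]

namespace HRep
variable {a κ ω : ℂ} {B : Type} [Ring B] [Algebra ℂ B] {T R : ℕ} {d : Idx a κ ω B (R+1) (T+1)}
    {ρ : B →ₐ[ℂ] Module.End ℂ (HH a (T+R+1+1))} (H : HRep d ρ)

lemma ε_σ (H : HRep d ρ) (i j) (w : Equiv.Perm _) (h : w (labb T R j) ≠ lab T R i) :
    ρ (d.ε i j) ((D a _).σ w) = (D a _).σ (Equiv.swap (lab T R i) (w (labb T R j)) * w) := by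
  rw [H.ε, ← map_mul, ← map_mul, HH.incE_σ, ← map_mul, ← map_mul]
  · congr 1
    have := Equiv.mul_swap_eq_swap_mul (Equiv.swap 0 (lab T R i)) 0 ((Equiv.swap 0 (lab T R i)) (w (labb T R j)))
    simp only [Equiv.swap_apply_left, Equiv.swap_apply_right, Equiv.swap_apply_self] at this
    simp only [Equiv.Perm.mul_apply, Equiv.swap_apply_left]
    rw [← mul_assoc, this]
    simp [mul_assoc]
  · simp only [Equiv.Perm.mul_apply, Equiv.swap_apply_left]
    intro h'
    apply h
    have := congrArg (Equiv.swap 0 (lab T R i)) h'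
    simpa using this

lemma εL_σ (H : HRep d ρ) (L) (hL : Idx.OK L) : ρ (d.εL L) ((D a _).σ (kap T R)) = (D a _).σ (Idx.tau (lab T R) (labc T R) L * kap T R) := by
  induction L with
  | nil => simp
  | cons q L ih =>
    rw [Idx.OK_cons] at hL
    have h0 : (Idx.tau (lab T R) (labc T R) L * kap T R) (labb T R q.2) = labc T R q.2 := by
      rw [Equiv.Perm.mul_apply, ← labc_apply]
      apply Idx.tau_not
      · intro i _; exact (lab_labc _ _).symm
      · intro i hi h
        rw [(labc T R).injective h] at hL
        exact hL.1.2 hi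
    rw [Idx.εL_cons, map_mul, Module.End.mul_apply, ih hL.2, H.ε_σ, h0, Idx.tau_cons, mul_assoc]
    rw [h0]; exact (lab_labc _ _).symm

lemma kap_via {T R : ℕ} (v) : kap T R * via (labb T R) v = via (labc T R) v * kap T R := by
  refine Equiv.ext fun x => ?_
  simp only [Equiv.Perm.mul_apply]
  by_cases h : ∃ y, labb T R y = x
  · obtain ⟨y, rfl⟩ := h
    rw [via_apply, ← labc_apply, ← labc_apply, via_apply]
  · push Not at h
    rw [via_not _ _ _ h, via_not]
    intro y hy
    exact h y ((kap T R).injective hy)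

lemma br_σ (H : HRep d ρ) (u v L) (hL : Idx.OK L) : ρ (d.σ u * (d.σb v * d.εL L)) ((D a _).σ (kap T R)) =
    (D a _).σ (Idx.WW (lab T R) (labc T R) u v L * kap T R) := by
  rw [map_mul, map_mul, Module.End.mul_apply, Module.End.mul_apply, H.εL_σ L hL, H.σ, H.σb, ← map_mul, ← map_mul, mul_assoc, kap_via]
  simp [Idx.WW, mul_assoc]

/-- right factors with labels above `j` -/
def Y (a : ℂ) (n j : ℕ) : Submonoid (HH a n) := Submonoid.closure {y | ∃ l : Fin n, j < l ∧ (y = (D a n).ξ l ∨ y = (D a n).c l)}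

/-- right commutant -/
def RC {n : ℕ} (f : Module.End ℂ (HH a n)) : Submonoid (HH a n) where
  carrier := {y | ∀ h, f (h * y) = f h * y}
  one_mem' := by simp
  mul_mem' {x y} hx hy h := by rw [← mul_assoc, hy, hx, mul_assoc]

lemma sw_y {n : ℕ} (l : Fin n) (x y : Fin n) (hx : l ≠ x) (hy : l ≠ y) (z) (hz : (z = (D a n).ξ l ∨ z = (D a n).c l)) :
    z * (D a n).σ (Equiv.swap x y) = (D a n).σ (Equiv.swap x y) * z := by
  rcases hz with rfl | rfl
  · rw [HData.σ_ξ, Equiv.swap_apply_of_ne_of_ne hx hy]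
  · rw [HData.σ_c, Equiv.swap_apply_of_ne_of_ne hx hy]

lemma y_inc {n : ℕ} (l : Fin (n+1)) (hl : l ≠ 0) (z) (hz : (z = (D a (n+1)).ξ l ∨ z = (D a (n+1)).c l)) : ∃ z', z = inc z' := by
  obtain ⟨l, rfl⟩ := Fin.exists_succ_eq.mpr hl
  rcases hz with rfl | rfl
  · exact ⟨_, (inc_ξ _).symm⟩
  · exact ⟨_, (inc_c _).symm⟩

lemma ξb_Y (H : HRep d ρ) (j : Fin (T+1)) : Y a _ (j : ℕ) ≤ RC (ρ (d.ξb j)) := by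
  refine Submonoid.closure_le.mpr ?_
  rintro z ⟨l, hl, hz⟩ h
  have h1 : l ≠ 0 := by rintro rfl; simp at hl
  have h2 : l ≠ labb T R j := fun h => by have := congrArg Fin.val h; rw [labb_val] at this; omega
  have h3 := sw_y l 0 (labb T R j) h1 h2 z hz
  rw [H.ξb, H.ξb, mul_assoc, h3]
  obtain ⟨z', rfl⟩ := y_inc l h1 z hz
  rw [← mul_assoc, xB_inc, mul_assoc, h3, mul_assoc]

lemma ε_Y (H : HRep d ρ) (i j) : Y a _ T ≤ RC (ρ (d.ε i j)) := by
  refine Submonoid.closure_le.mpr ?_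
  rintro z ⟨l, hl, hz⟩ h
  have h1 : l ≠ 0 := by rintro rfl; simp at hl
  have h2 : l ≠ labb T R j := fun h => by have := congrArg Fin.val h; rw [labb_val] at this; omega
  have h3 := sw_y l 0 (labb T R j) h1 h2 z hz
  rw [H.ε, H.ε, mul_assoc h, h3]
  obtain ⟨z', rfl⟩ := y_inc l h1 z hz
  rw [← mul_assoc h, ← mul_assoc _ _ (inc z'), tr_right, map_mul]
  simp only [mul_assoc, h3]

lemma σb_Y (H : HRep d ρ) (v) : Y a _ T ≤ RC (ρ (d.σb v)) := by
  refine Submonoid.closure_le.mpr ?_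
  rintro z ⟨l, hl, hz⟩ h
  rw [H.σb, H.σb]
  have hv : via (labb T R) v⁻¹ l = l := via_not _ _ _ fun y hy => by
    have := congrArg Fin.val hy; rw [labb_val] at this; omega
  rcases hz with rfl | rfl
  · have := (D a _).σ_ξ (via (labb T R) v⁻¹) l
    rw [hv] at this
    rw [mul_assoc, ← this, mul_assoc]
  · have := (D a _).σ_c (via (labb T R) v⁻¹) l
    rw [hv] at this
    rw [mul_assoc, ← this, mul_assoc]

lemma br_Y (H : HRep d ρ) (u v L) {y} (hy : y ∈ Y a _ T) (h) : ρ (d.σ u * (d.σb v * d.εL L)) (h * y) =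
    ρ (d.σ u * (d.σb v * d.εL L)) h * y := by
  have hL : ∀ L h, ρ (d.εL L) (h * y) = ρ (d.εL L) h * y := by
    intro L
    induction L with
    | nil => simp
    | cons q L ih =>
      intro h
      rw [Idx.εL_cons, map_mul ρ, Module.End.mul_apply, Module.End.mul_apply, ih]
      exact H.ε_Y _ _ hy _
  rw [map_mul ρ, map_mul ρ]
  simp only [Module.End.mul_apply]
  rw [hL, show ρ (d.σb v) (ρ (d.εL L) h * y) = _ from H.σb_Y v hy _, H.σ, H.σ, mul_assoc]

lemma γ_Y {n : ℕ} (j : Fin n) {y} (hy : y ∈ Y a n j) : γ y * (D a n).c j = (D a n).c j * y := by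
  unfold Y at hy
  induction hy using Submonoid.closure_induction with
  | one => simp
  | mul x y _ _ hx hy => rw [map_mul, mul_assoc, hy, ← mul_assoc, hx, mul_assoc]
  | mem y hy =>
    obtain ⟨l, hl, rfl | rfl⟩ := hy
    · rw [γ_ξ, HData.ξ_c']; rintro rfl; omega
    · rw [γ_c, (D a n).c_anti j l, neg_mul]; rintro rfl; omega

end HRep
end

section
open HH

/-- tail products -/
def dp {M : Type} [Monoid M] {n : ℕ} (g : Fin n → M) (j : ℕ) : M := ((List.ofFn g).drop j).prod
lemma dp_zero {M : Type} [Monoid M] {n : ℕ} (g : Fin n → M) : dp g 0 = (List.ofFn g).prod := by simp [dp]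
lemma dp_ge {M : Type} [Monoid M] {n : ℕ} (g : Fin n → M) (j : ℕ) (h : n ≤ j) : dp g j = 1 := by
  rw [dp, List.drop_eq_nil_of_le (by simpa using h), List.prod_nil]
lemma dp_lt {M : Type} [Monoid M] {n : ℕ} (g : Fin n → M) (j : ℕ) (h : j < n) : dp g j = g ⟨j, h⟩ * dp g (j+1) := by
  rw [dp, List.drop_eq_getElem_cons (by simpa using h), List.prod_cons, dp]; simp

/-- concatenation -/
def app2 (T R : ℕ) (x : Fin (T+1) → Bool) (y : Fin (R+1) → Bool) : Fin (T+R+1+1) → Bool := fun i =>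
  if h : (i : ℕ) < T+1 then x ⟨i, h⟩ else y ⟨i - (T+1), by omega⟩
lemma app2_l {T R x y} (j : Fin (T+1)) : app2 T R x y (labb T R j) = x j := by
  have : ((labb T R j : Fin _) : ℕ) < T+1 := j.2
  simp only [app2, this, dif_pos]; rfl
lemma app2_r {T R x y} (j : Fin (R+1)) : app2 T R x y ⟨T+1+j, by omega⟩ = y j := by
  have : ¬ (T+1+(j:ℕ) < T+1) := by omega
  simp only [app2, this, dif_neg, not_false_eq_true]; congr 1; ext; simp
lemma app2_inj {T R x y x' y'} (h : app2 T R x y = app2 T R x' y') : x = x' ∧ y = y' := by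
  constructor
  · funext j; rw [← app2_l (T := T) (R := R) (x := x) (y := y), h, app2_l]
  · funext j; rw [← app2_r (T := T) (R := R) (x := x) (y := y), h, app2_r]

namespace HRep
variable {a κ ω : ℂ} {B : Type} [Ring B] [Algebra ℂ B] {T R : ℕ} {d : Idx a κ ω B (R+1) (T+1)}
    {ρ : B →ₐ[ℂ] Module.End ℂ (HH a (T+R+1+1))}

lemma qq_Y {n : ℕ} (l : Fin n) (j : ℕ) (h : j < l) (b b') : pw ((D a n).ξ l) b * pw ((D a n).c l) b' ∈ Y a n j := by
  apply Submonoid.mul_mem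
  · cases b
    · simp
    · rw [pw_true]; exact Submonoid.subset_closure ⟨l, h, Or.inl rfl⟩
  · cases b'
    · simp
    · rw [pw_true]; exact Submonoid.subset_closure ⟨l, h, Or.inr rfl⟩

lemma dp_Y {n : ℕ} (α β : Fin n → Bool) (j i : ℕ) (hj : i < j) :
    dp (fun i => pw ((D a n).ξ i) (α i) * pw ((D a n).c i) (β i)) j ∈ Y a n i := by
  by_cases h : n ≤ j
  · rw [dp_ge _ _ h]; exact Submonoid.one_mem _
  · rw [dp_lt _ j (by omega : j < n)]
    refine Submonoid.mul_mem _ (qq_Y _ _ hj _ _) (dp_Y α β (j+1) i (by omega))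
termination_by n - j

lemma mon_aux (H : HRep d ρ) (α β : Fin (R+1) → Bool) (α'' β'' : Fin (T+R+1+1) → Bool)
    (hα : ∀ i : Fin (R+1), α'' ⟨T+1+i, by omega⟩ = α i) (hβ : ∀ i : Fin (R+1), β'' ⟨T+1+i, by omega⟩ = β i) (i : ℕ) :
    ρ (dp (fun i => pw (d.hd.ξ i) (α i) * pw (d.hd.c i) (β i)) i) ((D a _).σ (kap T R)) =
      (D a _).σ (kap T R) * dp (fun i => pw ((D a _).ξ i) (α'' i) * pw ((D a _).c i) (β'' i)) (T+1+i) := by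
  by_cases h : R+1 ≤ i
  · rw [dp_ge _ _ h, dp_ge (n := T+R+1+1) _ (T+1+i) (by omega)]; simp
  · rw [dp_lt (n := R+1) _ i (by omega), dp_lt (n := T+R+1+1) _ (T+1+i) (by omega), map_mul ρ, Module.End.mul_apply, mon_aux H α β α'' β'' hα hβ (i+1)]
    have e : (⟨T+1+i, by omega⟩ : Fin (T+R+1+1)) = kap T R (lab T R ⟨i, by omega⟩) := Fin.ext (by rw [kap_lab])
    have h1 := hα ⟨i, by omega⟩
    have h2 := hβ ⟨i, by omega⟩
    simp only at h1 h2
    rw [h1, h2, e, ← add_assoc]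
    generalize dp (fun i => pw ((D a _).ξ i) (α'' i) * pw ((D a _).c i) (β'' i)) (T+1+i+1) = y
    have h3 : ∀ y, ρ (pw (d.hd.c ⟨i, by omega⟩) (β ⟨i, by omega⟩)) ((D a _).σ (kap T R) * y) =
      (D a _).σ (kap T R) * (pw ((D a _).c (kap T R (lab T R ⟨i, by omega⟩))) (β ⟨i, by omega⟩) * y) := by
      intro y
      cases β ⟨i, by omega⟩
      · simp
      · simp only [pw_true, Idx.hd_c, H.c]
        rw [← mul_assoc, HData.c_σ, mul_assoc]; simp [kap]
    have h4 : ∀ y, ρ (pw (d.hd.ξ ⟨i, by omega⟩) (α ⟨i, by omega⟩)) ((D a _).σ (kap T R) * y) =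
      (D a _).σ (kap T R) * (pw ((D a _).ξ (kap T R (lab T R ⟨i, by omega⟩))) (α ⟨i, by omega⟩) * y) := by
      intro y
      cases α ⟨i, by omega⟩
      · simp
      · simp only [pw_true, Idx.hd_ξ, H.ξ]
        rw [← mul_assoc, HData.ξ_σ, mul_assoc]; simp [kap]
    rw [map_mul ρ, Module.End.mul_apply, h3, h4, mul_assoc]
termination_by R + 1 - i

lemma ξb_σ (H : HRep d ρ) (j) (W) : ρ (d.ξb j) ((D a _).σ W) = - ((D a _).σ W * (D a _).ξ (labb T R j)) := by
  rw [H.ξb, ← map_mul]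
  have := xB_σ κ (W * Equiv.swap 0 (labb T R j)) (1 : HH a (T+R+1+1))
  rw [mul_one, xB_1] at this
  rw [this, mul_assoc, neg_mul, HData.ξ_σ, map_mul, mul_neg, mul_assoc, ← mul_assoc ((D a _).σ (Equiv.swap _ _)), ← map_mul (D a _).σ (Equiv.swap _ _)]
  simp

lemma bar_aux (H : HRep d ρ) (α β : Fin (T+1) → Bool) (α'' β'' : Fin (T+R+1+1) → Bool)
    (hα : ∀ i : Fin (T+1), α'' (labb T R i) = α i) (hβ : ∀ i : Fin (T+1), β'' (labb T R i) = β i) (W) (j : ℕ) (hj : j ≤ T+1) :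
    ∃ s : ℂ, s ≠ 0 ∧ ρ (dp (fun i => pw (d.swap.hd.c i) (β i) * pw (d.swap.hd.ξ i) (α i)) j) ((D a _).σ W *
      dp (fun i => pw ((D a _).ξ i) (α'' i) * pw ((D a _).c i) (β'' i)) (T+1)) =
      s • ((D a _).σ W * dp (fun i => pw ((D a _).ξ i) (α'' i) * pw ((D a _).c i) (β'' i)) j) := by
  by_cases h : T+1 ≤ j
  · obtain rfl : j = T+1 := by omega
    exact ⟨1, one_ne_zero, by rw [dp_ge _ _ h]; simp⟩
  · obtain ⟨s, hs, ih⟩ := bar_aux H α β α'' β'' hα hβ W (j+1) (by omega)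
    rw [dp_lt (n := T+1) _ j (by omega), dp_lt (n := T+R+1+1) _ j (by omega), map_mul ρ, Module.End.mul_apply, ih]
    have e : (⟨j, by omega⟩ : Fin (T+R+1+1)) = labb T R ⟨j, by omega⟩ := rfl
    rw [e, hα, hβ]
    have hy := dp_Y (a := a) α'' β'' (j+1) j (by omega)
    generalize dp (fun i => pw ((D a _).ξ i) (α'' i) * pw ((D a _).c i) (β'' i)) (j+1) = y at hy ⊢
    generalize hl : (⟨j, by omega⟩ : Fin (T+1)) = l
    have hlj : (l : ℕ) = j := by rw [← hl]
    subst hlj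
    have h4 : ∃ s : ℂ, s ≠ 0 ∧ ρ (pw (d.swap.hd.ξ l) (α l)) ((D a _).σ W * y) =
      s • ((D a _).σ W * (pw ((D a _).ξ (labb T R l)) (α l) * y)) := by
      cases α l
      · exact ⟨1, one_ne_zero, by simp⟩
      · refine ⟨-1, by simp, ?_⟩
        have e : d.swap.hd.ξ l = d.ξb l := rfl
        have := H.ξb_Y l hy ((D a _).σ W)
        rw [pw_true, e, this, H.ξb_σ, pw_true]
        simp [mul_assoc]
    obtain ⟨s4, hs4, h4⟩ := h4
    have h3 : ∃ s : ℂ, s ≠ 0 ∧ ρ (pw (d.swap.hd.c l) (β l)) ((D a _).σ W * (pw ((D a _).ξ (labb T R l)) (α l) * y)) =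
      s • ((D a _).σ W * (pw ((D a _).ξ (labb T R l)) (α l) * (pw ((D a _).c (labb T R l)) (β l) * y))) := by
      cases β l
      · exact ⟨1, one_ne_zero, by simp⟩
      · refine ⟨Complex.I, by simp, ?_⟩
        have e : d.swap.hd.c l = Complex.I • d.cb l := rfl
        have g : γ (pw ((D a _).ξ (labb T R l)) (α l)) = pw ((D a _).ξ (labb T R l)) (α l) := by
          cases α l <;> simp [γ_ξ]
        rw [pw_true, e, map_smul, LinearMap.smul_apply, H.cb, map_mul, map_mul, γ_σ, g, mul_assoc, mul_assoc, γ_Y (labb T R l) hy, pw_true]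
    obtain ⟨s3, hs3, h3⟩ := h3
    refine ⟨s * (s4 * s3), by simp [hs, hs4, hs3], ?_⟩
    rw [map_smul, map_mul ρ, Module.End.mul_apply, h4, map_smul, h3]
    simp [smul_smul, mul_assoc]
termination_by T + 1 - j

/-- index type of the spanning set -/
structure QI (r t : ℕ) where
  α' : Fin t → Bool
  β' : Fin t → Bool
  α : Fin r → Bool
  β : Fin r → Bool
  u : Equiv.Perm (Fin r)
  v : Equiv.Perm (Fin t)
  L : List (Fin r × Fin t)
  ok : Idx.OK L

lemma FF_act (H : HRep d ρ) (x : QI (R+1) (T+1)) :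
   ∃ s : ℂ, s ≠ 0 ∧ ρ (d.swap.hd.monr x.α' x.β' * (d.σ x.u * (d.σb x.v * d.εL x.L) * d.hd.mon x.α x.β)) ((D a _).σ (kap T R)) =
      s • ((D a _).σ (Idx.WW (lab T R) (labc T R) x.u x.v x.L * kap T R) * (D a _).mon (app2 T R x.α' x.α) (app2 T R x.β' x.β)) := by
  have h1 := H.mon_aux x.α x.β (app2 T R x.α' x.α) (app2 T R x.β' x.β) (fun _ => app2_r _) (fun _ => app2_r _) 0
  obtain ⟨s, hs, h2⟩ := H.bar_aux x.α' x.β' (app2 T R x.α' x.α) (app2 T R x.β' x.β) (fun _ => app2_l _) (fun _ => app2_l _)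
    (Idx.WW (lab T R) (labc T R) x.u x.v x.L * kap T R) 0 (by omega)
  refine ⟨s, hs, ?_⟩
  have hy := dp_Y (a := a) (app2 T R x.α' x.α) (app2 T R x.β' x.β) (T+1) T (by omega)
  rw [dp_zero, dp_zero] at h2
  rw [dp_zero] at h1
  rw [map_mul ρ, map_mul ρ _ (d.hd.mon _ _), Module.End.mul_apply, Module.End.mul_apply]
  rw [show ρ (d.hd.mon x.α x.β) _ = _ from h1, H.br_Y _ _ _ hy, H.br_σ _ _ _ x.ok]
  exact h2

theorem inj_span (H : HRep d ρ) (b : B) (hb : b ∈ Submodule.span ℂ d.FF) (h0 : ρ b ((D a _).σ (kap T R)) = 0) : b = 0 := by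
  choose s hs h using H.FF_act
  refine inj_of_basis ((LinearMap.applyₗ ((D a _).σ (kap T R))).comp ρ.toLinearMap) d.FF _ (pbw_indep (a := a) (T+R+1+1))
    (fun x : QI (R+1) (T+1) => d.swap.hd.monr x.α' x.β' * (d.σ x.u * (d.σb x.v * d.εL x.L) * d.hd.mon x.α x.β)) ?_
    (fun x => (Idx.WW (lab T R) (labc T R) x.u x.v x.L * kap T R, app2 T R x.α' x.α, app2 T R x.β' x.β)) s hs ?_ ?_ b hb h0
  · rintro f ⟨α', β', α, β, x, ⟨u, v, L, hL, rfl⟩, rfl⟩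
    exact ⟨⟨α', β', α, β, u, v, L, hL⟩, rfl⟩
  · intro x; exact h x
  · intro x y hxy
    simp only [Prod.mk.injEq] at hxy
    obtain ⟨h1, h2, h3⟩ := hxy
    obtain ⟨e1, e2⟩ := app2_inj h2
    obtain ⟨e3, e4⟩ := app2_inj h3
    have := d.WW_inj lab_labc x.ok y.ok (mul_right_cancel h1)
    simp only [e1, e2, e3, e4, this]

theorem inj_adjoin (H : HRep d ρ) (b : B) (hb : b ∈ Algebra.adjoin ℂ d.allg) (h0 : ρ b ((D a _).σ (kap T R)) = 0) : b = 0 :=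
  H.inj_span b (d.Z_FF _ (Idx.all_Z _ hb)) h0
end HRep
end

section
open HH

/-- generators of the small subalgebra -/
def Idx.low {a κ ω : ℂ} {B : Type} [Ring B] [Algebra ℂ B] {r t : ℕ} (d : Idx a κ ω B r t) (k : ℕ) : Set B :=
  {x | (∃ w, (∀ i : Fin r, k ≤ i → w i = i) ∧ x = d.σ w) ∨ (∃ w, (∀ i : Fin t, k ≤ i → w i = i) ∧ x = d.σb w) ∨
    (∃ i : Fin r, (i : ℕ) < k ∧ (x = d.c i ∨ x = d.ξ i)) ∨ (∃ i : Fin t, (i : ℕ) < k ∧ (x = d.cb i ∨ x = d.ξb i)) ∨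
    (∃ (i : Fin r) (j : Fin t), (i : ℕ) < k ∧ (j : ℕ) < k ∧ x = d.ε i j)}

namespace HRep
variable {a κ ω : ℂ} {B : Type} [Ring B] [Algebra ℂ B] {T R : ℕ} {d : Idx a κ ω B (R+1) (T+1)}
    {ρ : B →ₐ[ℂ] Module.End ℂ (HH a (T+R+1+1))}

/-- operators commuting with a right multiplication -/
def CR (ρ : B →ₐ[ℂ] Module.End ℂ (HH a (T+R+1+1))) (y : HH a (T+R+1+1)) : Subalgebra ℂ B :=
  Subalgebra.comap ρ (Subalgebra.centralizer ℂ {LinearMap.mulRight ℂ y})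
lemma mem_CR {y : HH a (T+R+1+1)} {b : B} : b ∈ CR ρ y ↔ ∀ h, ρ b (h * y) = ρ b h * y := by
  simp only [CR, Subalgebra.mem_comap, Subalgebra.mem_centralizer_iff, Set.mem_singleton_iff, forall_eq]
  constructor
  · intro h x; exact (LinearMap.congr_fun h x).symm
  · intro h; exact LinearMap.ext fun x => (h x).symm

lemma low_CR (H : HRep d ρ) (k : ℕ) (hk : 1 ≤ k) (hR : k < R+1) (hT : k < T+1) :
    ∀ x ∈ d.low k, x ∈ CR ρ ((D a _).σ (Equiv.swap ⟨k, by omega⟩ ⟨T+1+k, by omega⟩)) := by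
  have hinc : (D a (T+R+1+1)).σ (Equiv.swap ⟨k, by omega⟩ ⟨T+1+k, by omega⟩) =
      inc ((D a (T+R+1)).σ (Equiv.swap ⟨k-1, by omega⟩ ⟨T+k, by omega⟩)) := by
    rw [inc_σ, HH.up_swap]
    congr 2
    · ext; simp; omega
    · ext; simp; omega
  have hc : ∀ j : Fin (T+1), (j : ℕ) < k → (D a (T+R+1+1)).σ (Equiv.swap ⟨k, by omega⟩ ⟨T+1+k, by omega⟩) * (D a (T+R+1+1)).σ (Equiv.swap 0 (labb T R j)) =
      (D a (T+R+1+1)).σ (Equiv.swap 0 (labb T R j)) * (D a (T+R+1+1)).σ (Equiv.swap ⟨k, by omega⟩ ⟨T+1+k, by omega⟩) := by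
    intro j hj
    rw [← map_mul, ← map_mul, Equiv.mul_swap_eq_swap_mul, Equiv.swap_apply_of_ne_of_ne, Equiv.swap_apply_of_ne_of_ne]
    all_goals
      intro h
      have := congrArg Fin.val h
      simp only [labb_val, Fin.val_zero] at this
      omega
  rintro x (⟨w, hw, rfl⟩ | ⟨w, hw, rfl⟩ | ⟨i, hi, rfl | rfl⟩ | ⟨i, hi, rfl | rfl⟩ | ⟨i, j, hi, hj, rfl⟩) <;> rw [mem_CR] <;> intro h
  · simp only [H.σ, mul_assoc]
  · simp only [H.σb, mul_assoc]
    congr 1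
    rw [← map_mul, ← map_mul]
    congr 1
    rw [Equiv.mul_swap_eq_swap_mul]
    have h1 : (⟨k, by omega⟩ : Fin (T+R+1+1)) = labb T R ⟨k, by omega⟩ := rfl
    have h2 : w⁻¹ ⟨k, by omega⟩ = ⟨k, by omega⟩ := by
      rw [Equiv.Perm.inv_eq_iff_eq]; exact (hw ⟨k, by omega⟩ le_rfl).symm
    congr 2
    · rw [h1, via_apply, h2]
    · refine (via_not _ _ _ fun y hy => ?_).symm
      have := congrArg Fin.val hy; simp only [labb_val] at this; omega
  · simp only [H.c, mul_assoc]
  · simp only [H.ξ, mul_assoc]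
  · simp only [H.cb, mul_assoc, map_mul, γ_σ]
    rw [HData.σ_c, Equiv.swap_apply_of_ne_of_ne]
    all_goals
      intro h
      have := congrArg Fin.val h
      simp only [labb_val] at this
      omega
  · simp only [H.ξb, mul_assoc]
    rw [hc i hi, ← hc i hi, hinc, ← hinc, hc i hi, hinc, ← mul_assoc, xB_inc, mul_assoc, ← hinc, hc i hi]
  · simp only [H.ε, mul_assoc]
    rw [← hc j hj, ← mul_assoc h, hc j hj, ← hc j hj]
    rw [mul_assoc h, hc j hj, hinc, ← mul_assoc h, ← mul_assoc _ _ (inc _), tr_right, map_mul, ← hinc]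
    simp only [mul_assoc, hc j hj]

lemma low_allg (k : ℕ) : d.low k ⊆ Algebra.adjoin ℂ d.allg := by
  have h1 : ∀ x ∈ d.hd.alg, x ∈ Algebra.adjoin ℂ d.allg := fun x hx => Algebra.adjoin_mono Set.subset_union_left hx
  have h2 : ∀ x ∈ d.swap.hd.alg, x ∈ Algebra.adjoin ℂ d.allg := fun x hx => Algebra.adjoin_mono (Set.subset_union_left.trans Set.subset_union_right) hx
  rintro x (⟨w, hw, rfl⟩ | ⟨w, hw, rfl⟩ | ⟨i, hi, rfl | rfl⟩ | ⟨i, hi, rfl | rfl⟩ | ⟨i, j, hi, hj, rfl⟩)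
  · exact h1 _ (d.hd.σ_mem w)
  · exact h2 _ (d.swap.hd.σ_mem w)
  · exact h1 _ (d.hd.c_mem i)
  · exact h1 _ (d.hd.ξ_mem i)
  · rw [d.cb_eq]; exact Subalgebra.smul_mem _ (h2 _ (d.swap.hd.c_mem i)) _
  · exact h2 _ (d.swap.hd.ξ_mem i)
  · exact Algebra.subset_adjoin (Or.inr (Or.inr ⟨(i, j), rfl⟩))

theorem cancel (H : HRep d ρ) (k : ℕ) (hk : 1 ≤ k) (hR : k < R+1) (hT : k < T+1) (b : B)
    (hb : b ∈ Algebra.adjoin ℂ (d.low k)) (h : b * d.ε ⟨k, hR⟩ ⟨k, hT⟩ = 0) : b = 0 := by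
  apply H.inj_adjoin
  · exact Algebra.adjoin_le (low_allg k) hb
  have h1 := mem_CR.mp (Algebra.adjoin_le (H.low_CR k hk hR hT) hb) ((D a _).σ (kap T R))
  have e1 : kap T R (labb T R ⟨k, hT⟩) = ⟨k, by omega⟩ := Fin.ext (by
    rw [kap_val, labb_val, if_neg (by simp only; omega), if_neg (by simp only; omega)])
  have e2 : lab T R ⟨k, hR⟩ = ⟨T+1+k, by omega⟩ := Fin.ext (by
    rw [lab_val]; simp only; split_ifs <;> omega)
  have h2 : ρ (d.ε ⟨k, hR⟩ ⟨k, hT⟩) ((D a _).σ (kap T R)) = (D a _).σ (kap T R) * (D a _).σ (Equiv.swap ⟨k, by omega⟩ ⟨T+1+k, by omega⟩) := by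
    rw [H.ε_σ, ← map_mul, Equiv.mul_swap_eq_swap_mul, e1, e2, Equiv.swap_comm]
    · congr 3
      · refine Fin.ext ?_
        rw [kap_val]; simp only; split_ifs <;> omega
      · refine Fin.ext ?_
        rw [kap_val]; simp only; split_ifs <;> omega
    · rw [e1, e2]; intro h; have := congrArg Fin.val h; simp only at this; omega
  have h3 : ρ (b * d.ε ⟨k, hR⟩ ⟨k, hT⟩) ((D a _).σ (kap T R)) = 0 := by rw [h]; simp
  rw [map_mul ρ, Module.End.mul_apply, h2, h1] at h3
  have h4 := congrArg (· * (D a (T+R+1+1)).σ (Equiv.swap ⟨k, by omega⟩ ⟨T+1+k, by omega⟩)) h3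
  simpa [mul_assoc, ← map_mul (D a (T+R+1+1)).σ] using h4
end HRep
end

section
open HH

lemma omSeq_even (m : ℕ) (p : ℂ) (k : ℕ) : omSeq m p (2*k) = 0 := by
  induction k with
  | zero => rfl
  | succ k ih => rw [show 2*(k+1) = 2*k+2 by ring, omSeq, ih, mul_zero]
lemma omSeq_odd (m : ℕ) (p : ℂ) (k : ℕ) : omSeq m p (2*k+1) = (p*(p+1))^k * omSeq m p 1 := by
  induction k with
  | zero => simp
  | succ k ih =>
    have h : omSeq m p (2*k+1+2) = p*(p+1) * omSeq m p (2*k+1) := rfl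
    rw [show 2*(k+1)+1 = (2*k+1)+2 by ring, h, ih]; ring
lemma obar_even (ω : ℕ → ℂ) (k : ℕ) : obar ω (2*k) = 0 := by simp [obar]
lemma obar_odd (m : ℕ) (p : ℂ) (k : ℕ) : obar (omSeq m p) (2*k+1) = -((p*(p+1) + omSeq m p 1)^k * omSeq m p 1) := by
  have h : ∀ k, obar (omSeq m p) (2*k+1) = ∑ j ∈ Finset.range (k + 1), acoef (omSeq m p) k j * omSeq m p (2 * j + 1) := by
    intro k
    rw [obar, if_neg (by omega), show (2*k+1)/2 = k by omega]
  rw [h]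
  induction k with
  | zero => simp [acoef]
  | succ k ih =>
    rw [Finset.sum_range_succ']
    simp only [acoef]
    rw [ih]
    have : ∀ j, acoef (omSeq m p) k j * omSeq m p (2*(j+1)+1) = (p*(p+1)) * (acoef (omSeq m p) k j * omSeq m p (2*j+1)) := by
      intro j; rw [omSeq_odd, omSeq_odd m p j]; ring
    simp only [this, ← Finset.mul_sum, ih]
    ring
lemma kappa_eq (m : ℕ) (p : ℂ) : (p - 2 * (m : ℂ) + 1) * (p - 2 * (m : ℂ)) = p*(p+1) + omSeq m p 1 := by
  simp only [omSeq]; ring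

theorem HRep.of_hom {a ω : ℂ} {B : Type} [Ring B] [Algebra ℂ B] {T R : ℕ} {f g : ℕ → ℂ} {hf0 hf1 hg0 hg1} (d : AWBC ℂ B (R+1) (T+1) ω)
    (hx : d.x1 * d.x1 = algebraMap ℂ B a) (hxb : d.xb1 * d.xb1 = algebraMap ℂ B (a+ω))
    (ρ : B →ₐ[ℂ] Module.End ℂ (HH a (T+R+1+1))) (h : AWBCHom d (awbc a ω T R f g hf0 hf1 hg0 hg1) ρ) : HRep (d.idx hx hxb) ρ where
  σ w y := by
    have := h.map_σ w
    show ρ (d.σ w) y = _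
    rw [this]; rfl
  σb w y := by
    have := h.map_σb w
    show ρ (d.σb w) y = _
    rw [this]; rfl
  c w y := by
    have := h.map_c w
    show ρ (d.c w) y = _
    rw [this]; rfl
  cb w y := by
    have := h.map_cb w
    show ρ (d.cb w) y = _
    rw [this]; rfl
  ξ i y := by
    show ρ (d.σ (Equiv.swap 0 i) * d.x1 * d.σ (Equiv.swap 0 i)) y = _
    rw [map_mul ρ, map_mul ρ, h.map_σ, h.map_x1]
    show opσ a T R _ (opx a _ (opσ a T R _ y)) = _
    rw [opσ_apply, opσ_apply, opx_apply, via_swap, show lab T R 0 = 0 from lab_zero _, ← mul_assoc, ← mul_assoc, HData.σ_ξ, Equiv.swap_apply_left, mul_assoc ((D a _).ξ _), ← map_mul]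
    simp
  ξb i y := by
    show ρ (d.σb (Equiv.swap 0 i) * d.xb1 * d.σb (Equiv.swap 0 i)) y = _
    rw [map_mul ρ, map_mul ρ, h.map_σb, h.map_xb1]
    show opσb a T R _ (opxB a _ _ (opσb a T R _ y)) = _
    rw [opσb_apply, opσb_apply, opxB_apply, Equiv.swap_inv, via_swap, show labb T R 0 = 0 from labb_zero _]
  ε i j y := by
    show ρ (d.σb (Equiv.swap 0 j) * (d.σ (Equiv.swap 0 i) * d.e * d.σ (Equiv.swap 0 i)) * d.σb (Equiv.swap 0 j)) y = _
    rw [map_mul ρ, map_mul ρ, map_mul ρ, map_mul ρ, h.map_σb, h.map_σ, h.map_e]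
    show opσb a T R _ (opσ a T R _ (opE ω (opσ a T R _ (opσb a T R _ y)))) = _
    rw [opσb_apply, opσb_apply, opσ_apply, opσ_apply, opE_apply, Equiv.swap_inv, via_swap, via_swap, show labb T R 0 = 0 from labb_zero _, show lab T R 0 = 0 from lab_zero _]

lemma aeval_quad {B : Type} [Ring B] [Algebra ℂ B] (x : B) (z : ℂ) : Polynomial.aeval x (Polynomial.X^2 - Polynomial.C z) = 0 ↔ x * x = algebraMap ℂ B z := by
  simp [sub_eq_zero, sq]

/-- everything we need about the cyclotomic algebra -/
theorem main_cancel {B : Type} [Ring B] [Algebra ℂ B] {T R m : ℕ} {p : ℂ} (d' : AWBC ℂ B (R+1) (T+1) (omSeq m p 1))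
    (hx : d'.x1 * d'.x1 = algebraMap ℂ B (p*(p+1))) (hxb : d'.xb1 * d'.xb1 = algebraMap ℂ B (p*(p+1) + omSeq m p 1))
    (hu' : d'.IsCycUniversal (omSeq m p)
      (Polynomial.X ^ 2 - Polynomial.C (p * (p + 1)))
      (Polynomial.X ^ 2 - Polynomial.C ((p - 2 * (m : ℂ) + 1) * (p - 2 * (m : ℂ)))))
    (k : ℕ) (hk : 1 ≤ k) (hR : k < R+1) (hT : k < T+1) (b : B)
    (hb : b ∈ Algebra.adjoin ℂ ((d'.idx hx hxb).low k)) (h : b * d'.EE ⟨k, hR⟩ ⟨k, hT⟩ = 0) : b = 0 := by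
  obtain ⟨ρ, hρ, -⟩ := hu'.2.2 _ (awbc (p*(p+1)) (omSeq m p 1) T R (omSeq m p) (obar (omSeq m p)) (omSeq_even m p) (omSeq_odd m p)
    (obar_even _) (obar_odd m p)) ⟨fun _ => rfl, fun _ _ => rfl⟩ ⟨by
      rw [aeval_quad, ← sq]; exact opx_sq, by rw [aeval_quad, ← sq, kappa_eq]; exact xB_sq' _⟩
  exact (HRep.of_hom d' hx hxb ρ hρ).cancel k hk hR hT b hb h
end

section
namespace Idx
variable {a κ ω : ℂ} {B : Type} [Ring B] [Algebra ℂ B] {r t : ℕ} (d : Idx a κ ω B r t)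

/-- summand of the Jucys-Murphy element -/
def P (i l : Fin r) : B := (1 - d.c l * d.c i) * d.σ (Equiv.swap l i)
/-- summand on the other side of the wall -/
def Q (i : Fin r) (j : Fin t) : B := d.ε i j + d.c i * d.ε i j * d.c i
/-- the element `z` attached to a pair of finite sets -/
def zz (S : Finset (Fin r)) (S' : Finset (Fin t)) (i : Fin r) : B := d.ξ i + ∑ j ∈ S', d.Q i j - ∑ l ∈ S, d.P i l

lemma c_P (i l m) (h : m ≠ i) (hl : l ≠ i) : Commute (d.c m) (d.P i l) := by
  unfold Commute SemiconjBy P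
  by_cases hm : m = l
  · subst hm
    have h1 := d.σ_c (Equiv.swap m i) m
    rw [Equiv.swap_apply_left] at h1
    have h2 := d.c_sq m
    have h3 := d.c_sq i
    have h4 := d.c_anti m i h
    generalize d.σ (Equiv.swap m i) = s at *
    generalize d.c m = x at *
    generalize d.c i = y at *
    linear_combination (norm := noncomm_ring) -h2 * y * s - h1 + x * y * h1 + x * h3 * s
  · have h1 := d.σ_c (Equiv.swap l i) m
    rw [Equiv.swap_apply_of_ne_of_ne hm h] at h1
    have h2 := d.c_anti m l hm
    have h4 := d.c_anti m i h
    generalize d.σ (Equiv.swap l i) = s at *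
    generalize d.c m = x at *
    generalize d.c i = y at *
    generalize d.c l = z at *
    linear_combination (norm := noncomm_ring) -h2 * y * s - h1 + z * y * h1 + z * h4 * s
lemma c_Q (i j m) (h : m ≠ i) : Commute (d.c m) (d.Q i j) := by
  unfold Commute SemiconjBy Q
  have h1 := d.ε_c' i j m h
  have h2 := d.c_anti m i h
  generalize d.ε i j = e at *
  generalize d.c m = x at *
  generalize d.c i = y at *
  linear_combination (norm := noncomm_ring) h1 + h2 * e * y - y * h1 * y - y * e * h2
lemma ci_P (i l) (hl : l ≠ i) : d.c i * d.P i l = - (d.P i l * d.c i) := by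
  unfold P
  have h1 := d.σ_c (Equiv.swap l i) i
  rw [Equiv.swap_apply_right] at h1
  have h2 := d.c_sq i
  have h3 := d.c_sq l
  have h4 := d.c_anti l i hl
  generalize d.σ (Equiv.swap l i) = s at *
  generalize d.c i = x at *
  generalize d.c l = y at *
  linear_combination (norm := noncomm_ring) h1 - y * x * h1 - x * h4 * s + h2 * y * s - h4 * y * s + x * h3 * s
lemma ci_Q (i j) : d.c i * d.Q i j = - (d.Q i j * d.c i) := by
  unfold Q
  have h2 := d.c_sq i
  generalize d.ε i j = e at *
  generalize d.c i = x at *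
  linear_combination (norm := noncomm_ring) h2 * e * x + x * e * h2
lemma cb_P (i l j) : Commute (d.cb j) (d.P i l) := by
  unfold Commute SemiconjBy P
  have h1 := d.σcb (Equiv.swap l i) j
  have h2 := d.ccb l j
  have h4 := d.ccb i j
  generalize d.σ (Equiv.swap l i) = s at *
  generalize d.cb j = x at *
  generalize d.c i = y at *
  generalize d.c l = z at *
  linear_combination (norm := noncomm_ring) -h1 + z * y * h1 + z * h4 * s - h2 * y * s
lemma cb_Q (i j m) : Commute (d.cb m) (d.Q i j) := by
  unfold Commute SemiconjBy Q
  have h2 := d.ccb i m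
  by_cases hm : m = j
  · subst hm
    have h1 := d.ε_c i m
    have h3 := d.c_ε i m
    have h4 := d.c_sq i
    generalize d.ε i m = e at *
    generalize d.cb m = x at *
    generalize d.c i = y at *
    linear_combination (norm := noncomm_ring) -h3 + h2 * e * y + y * h3 * y - h4 * e * y + h1 - y * e * h2 - y * h1 * y + y * e * h4
  · have h1 := d.ε_cb' i j m hm
    generalize d.ε i j = e at *
    generalize d.cb m = x at *
    generalize d.c i = y at *
    linear_combination (norm := noncomm_ring) h1 + h2 * e * y - y * h1 * y - y * e * h2
lemma ξ_P (i l m) (h : m ≠ i) (hl : m ≠ l) : Commute (d.ξ m) (d.P i l) := by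
  unfold Commute SemiconjBy P
  have h1 := d.σ_ξ (Equiv.swap l i) m
  rw [Equiv.swap_apply_of_ne_of_ne hl h] at h1
  have h2 := d.ξ_c' m i h
  have h3 := d.ξ_c' m l hl
  generalize d.σ (Equiv.swap l i) = s at *
  generalize d.ξ m = x at *
  generalize d.c i = y at *
  generalize d.c l = z at *
  linear_combination (norm := noncomm_ring) -h1 + z * y * h1 - h3 * y * s - z * h2 * s
lemma ξ_Q (i j m) (h : m ≠ i) : Commute (d.ξ m) (d.Q i j) := by
  unfold Commute SemiconjBy Q
  have h1 := d.ε_ξ' i j m h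
  have h2 := d.ξ_c' m i h
  generalize d.ε i j = e at *
  generalize d.ξ m = x at *
  generalize d.c i = y at *
  linear_combination (norm := noncomm_ring) h1 + h2 * e * y + y * h1 * y + y * e * h2
lemma ξ_zP (i l) (h : l ≠ i) : Commute (d.ξ l) (d.ξ i - d.P i l) := by
  unfold Commute SemiconjBy P
  have h1 := d.ξ_ξ l i h
  linear_combination (norm := noncomm_ring) h1
lemma ξb_P (i l j) : Commute (d.ξb j) (d.P i l) := by
  unfold Commute SemiconjBy P
  have h1 := d.σξb (Equiv.swap l i) j
  have h2 := d.ξbc i j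
  have h3 := d.ξbc l j
  generalize d.σ (Equiv.swap l i) = s at *
  generalize d.ξb j = x at *
  generalize d.c i = y at *
  generalize d.c l = z at *
  linear_combination (norm := noncomm_ring) -h1 + z * y * h1 - h3 * y * s - z * h2 * s
lemma ξb_Q (i j m) (h : m ≠ j) : Commute (d.ξb m) (d.Q i j) := by
  unfold Commute SemiconjBy Q
  have h1 := d.ε_ξb' i j m h
  have h2 := d.ξbc i m
  generalize d.ε i j = e at *
  generalize d.ξb m = x at *
  generalize d.c i = y at *
  linear_combination (norm := noncomm_ring) h1 + h2 * e * y + y * h1 * y + y * e * h2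
lemma ξb_zQ (i j) : Commute (d.ξb j) (d.ξ i + d.Q i j) := by
  unfold Commute SemiconjBy Q
  have h1 := d.mixed i j
  have h2 := d.ξbc i j
  have h3 := d.ε_ξ i j
  have h4 := d.ξ_ε i j
  have h5 := d.ξ_c i
  generalize d.ε i j = e at *
  generalize d.ξb j = x at *
  generalize d.c i = y at *
  generalize d.ξ i = z at *
  linear_combination (norm := noncomm_ring) -h1 + h4 - h3 - h5 * e * y + y * h4 * y + y * e * h5 - y * h3 * y + h2 * e * y + y * e * h2
lemma ε_P (i l m j) (h : m ≠ i) (hl : m ≠ l) : Commute (d.ε m j) (d.P i l) := by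
  unfold Commute SemiconjBy P
  have h1 := d.σ_ε (Equiv.swap l i) m j
  rw [Equiv.swap_apply_of_ne_of_ne hl h] at h1
  have h2 := d.ε_c' m j i h.symm
  have h3 := d.ε_c' m j l hl.symm
  generalize d.σ (Equiv.swap l i) = s at *
  generalize d.ε m j = x at *
  generalize d.c i = y at *
  generalize d.c l = z at *
  linear_combination (norm := noncomm_ring) -h1 + z * y * h1 + h3 * y * s + z * h2 * s
lemma ε_Q (i j m l) (h : m ≠ i) (hj : l ≠ j) : Commute (d.ε m l) (d.Q i j) := by
  unfold Commute SemiconjBy Q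
  have h1 := d.εε_comm m i l j h hj
  have h2 := d.ε_c' m l i h.symm
  generalize d.ε i j = e at *
  generalize d.ε m l = x at *
  generalize d.c i = y at *
  linear_combination (norm := noncomm_ring) h1 - h2 * e * y + y * h1 * y - y * e * h2
lemma ε_Q_P (i l j) (h : l ≠ i) : d.ε l j * d.Q i j = d.ε l j * d.P i l := by
  unfold Q P
  have h1 := d.ε_col l i j h
  have h2 := d.σ_ε (Equiv.swap l i) i j
  rw [Equiv.swap_apply_right] at h2
  have h3 := d.ε_c' l j i h.symm
  have h4 := d.σ_c (Equiv.swap l i) i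
  rw [Equiv.swap_apply_right] at h4
  have h5 := d.c_anti l i h
  generalize d.σ (Equiv.swap l i) = s at *
  generalize d.ε i j = e at *
  generalize d.ε l j = f at *
  generalize d.c i = y at *
  generalize d.c l = z at *
  linear_combination (norm := noncomm_ring) h1 + h2 - h3 * e * y + y * h1 * y + y * h2 * y + y * f * h4 + h3 * z * s + f * h5 * s
lemma Q_P_ε (i l j) (h : l ≠ i) : d.Q i j * d.ε l j = d.P i l * d.ε l j := by
  unfold Q P
  have h1 := d.ε_col i l j h.symm
  rw [Equiv.swap_comm] at h1
  have h3 := d.ε_c' l j i h.symm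
  have h4 := d.σ_c (Equiv.swap l i) i
  rw [Equiv.swap_apply_right] at h4
  have h5 := d.c_anti l i h
  generalize d.σ (Equiv.swap l i) = s at *
  generalize d.ε i j = e at *
  generalize d.ε l j = f at *
  generalize d.c i = y at *
  generalize d.c l = z at *
  linear_combination (norm := noncomm_ring) h1 + y * e * h3 + y * h1 * y - y * s * h3 + y * h4 * f + h5 * s * f
end Idx
end

section
namespace Idx
variable {a κ ω : ℂ} {B : Type} [Ring B] [Algebra ℂ B] {r t : ℕ} (d : Idx a κ ω B r t)

lemma commute_zz (y : B) (S : Finset (Fin r)) (S' : Finset (Fin t)) (i : Fin r)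
    (hξ : Commute y (d.ξ i)) (hc : Commute y (d.c i)) (hc' : ∀ l ∈ S, Commute y (d.c l))
    (hσ : ∀ l ∈ S, Commute y (d.σ (Equiv.swap l i))) (hε : ∀ j ∈ S', Commute y (d.ε i j)) :
    Commute y (d.zz S S' i) := by
  unfold zz
  refine ((hξ.add_right (Commute.sum_right _ _ _ fun j hj => ?_)).sub_right (Commute.sum_right _ _ _ fun l hl => ?_))
  · exact (hε j hj).add_right ((hc.mul_right (hε j hj)).mul_right hc)
  · exact ((Commute.one_right _).sub_right ((hc' l hl).mul_right hc)).mul_right (hσ l hl)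
lemma zz_c (S : Finset (Fin r)) (S' : Finset (Fin t)) (i m : Fin r) (hi : i ∉ S) (h : m ≠ i) :
    Commute (d.c m) (d.zz S S' i) := by
  have h0 : Commute (d.c m) (d.ξ i) := (d.ξ_c' i m h.symm).symm
  refine (h0.add_right (Commute.sum_right _ _ _ fun j hj => ?_)).sub_right (Commute.sum_right _ _ _ fun l hl => ?_)
  · exact d.c_Q i j m h
  · exact d.c_P i l m h (by rintro rfl; exact hi hl)
lemma zz_ci (S : Finset (Fin r)) (S' : Finset (Fin t)) (i : Fin r) (hi : i ∉ S) :
    d.c i * d.zz S S' i = - (d.zz S S' i * d.c i) := by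
  have h0 := d.ξ_c i
  have h1 : d.c i * (∑ j ∈ S', d.Q i j) = - ((∑ j ∈ S', d.Q i j) * d.c i) := by
    rw [Finset.mul_sum, Finset.sum_mul, ← Finset.sum_neg_distrib]
    exact Finset.sum_congr rfl fun j _ => d.ci_Q i j
  have h2 : d.c i * (∑ l ∈ S, d.P i l) = - ((∑ l ∈ S, d.P i l) * d.c i) := by
    rw [Finset.mul_sum, Finset.sum_mul, ← Finset.sum_neg_distrib]
    exact Finset.sum_congr rfl fun l hl => d.ci_P i l (by rintro rfl; exact hi hl)
  unfold zz
  linear_combination (norm := noncomm_ring) h0 + h1 - h2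
lemma zz_cb (S : Finset (Fin r)) (S' : Finset (Fin t)) (i : Fin r) (j : Fin t) :
    Commute (d.cb j) (d.zz S S' i) := by
  have h0 : Commute (d.cb j) (d.ξ i) := (d.ξcb i j).symm
  exact (h0.add_right (Commute.sum_right _ _ _ fun l hl => d.cb_Q _ _ _)).sub_right (Commute.sum_right _ _ _ fun l hl => d.cb_P _ _ _)
lemma zz_ξ (S : Finset (Fin r)) (S' : Finset (Fin t)) (i m : Fin r) (hi : i ∉ S) (h : m ∈ S) :
    Commute (d.ξ m) (d.zz S S' i) := by
  have hm : m ≠ i := by rintro rfl; exact hi h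
  have : d.zz S S' i = (d.ξ i - d.P i m) + ∑ j ∈ S', d.Q i j - ∑ l ∈ S.erase m, d.P i l := by
    unfold zz; rw [← Finset.add_sum_erase _ _ h]; abel
  rw [this]
  refine ((d.ξ_zP i m hm).add_right (Commute.sum_right _ _ _ fun l hl => d.ξ_Q _ _ _ hm)).sub_right (Commute.sum_right _ _ _ fun l hl => ?_)
  exact d.ξ_P i l m hm (Finset.ne_of_mem_erase hl).symm
lemma zz_ξb (S : Finset (Fin r)) (S' : Finset (Fin t)) (i : Fin r) (j : Fin t) (h : j ∈ S') :
    Commute (d.ξb j) (d.zz S S' i) := by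
  have : d.zz S S' i = (d.ξ i + d.Q i j) + ∑ j ∈ S'.erase j, d.Q i j - ∑ l ∈ S, d.P i l := by
    unfold zz; rw [← Finset.add_sum_erase _ _ h]; abel
  rw [this]
  refine ((d.ξb_zQ i j).add_right (Commute.sum_right _ _ _ fun l hl => ?_)).sub_right (Commute.sum_right _ _ _ fun l hl => d.ξb_P _ _ _)
  exact d.ξb_Q _ _ _ (Finset.ne_of_mem_erase hl).symm
lemma zz_ε (S : Finset (Fin r)) (S' : Finset (Fin t)) (i m : Fin r) (j : Fin t) (hi : i ∉ S) (h : m ∈ S) (hj : j ∈ S') :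
    Commute (d.ε m j) (d.zz S S' i) := by
  have hm : m ≠ i := by rintro rfl; exact hi h
  have : d.zz S S' i = d.ξ i + (d.Q i j - d.P i m) + ∑ j ∈ S'.erase j, d.Q i j - ∑ l ∈ S.erase m, d.P i l := by
    unfold zz; rw [← Finset.add_sum_erase _ _ h, ← Finset.add_sum_erase _ _ hj]; abel
  rw [this]
  have h0 : Commute (d.ε m j) (d.ξ i) := (d.ε_ξ' m j i hm.symm).symm
  have h1 : Commute (d.ε m j) (d.Q i j - d.P i m) := by
    unfold Commute SemiconjBy
    rw [mul_sub, sub_mul, d.ε_Q_P i m j hm, d.Q_P_ε i m j hm, sub_self, sub_self]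
  refine ((h0.add_right h1).add_right (Commute.sum_right _ _ _ fun l hl => ?_)).sub_right (Commute.sum_right _ _ _ fun l hl => ?_)
  · exact d.ε_Q _ _ _ _ hm (Finset.ne_of_mem_erase hl).symm
  · exact d.ε_P _ _ _ _ hm (Finset.ne_of_mem_erase hl).symm
lemma zz_ε_out (S : Finset (Fin r)) (S' : Finset (Fin t)) (i m : Fin r) (j : Fin t) (hm : m ≠ i) (h : m ∉ S) (hj : j ∉ S') :
    Commute (d.ε m j) (d.zz S S' i) := by
  have h0 : Commute (d.ε m j) (d.ξ i) := (d.ε_ξ' m j i hm.symm).symm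
  refine (h0.add_right (Commute.sum_right _ _ _ fun l hl => ?_)).sub_right (Commute.sum_right _ _ _ fun l hl => ?_)
  · exact d.ε_Q _ _ _ _ hm (by rintro rfl; exact hj hl)
  · exact d.ε_P _ _ _ _ hm (by rintro rfl; exact h hl)
lemma σ_P (w : Equiv.Perm (Fin r)) (i l) : d.σ w * d.P i l = d.P (w i) (w l) * d.σ w := by
  unfold P
  have h1 := d.σ_c w i
  have h2 := d.σ_c w l
  have h3 : d.σ w * d.σ (Equiv.swap l i) = d.σ (Equiv.swap (w l) (w i)) * d.σ w := by
    rw [← map_mul, ← map_mul, Equiv.mul_swap_eq_swap_mul]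
  generalize d.σ (Equiv.swap l i) = s at *
  generalize d.σ (Equiv.swap (w l) (w i)) = s' at *
  generalize d.σ w = W at *
  linear_combination (norm := noncomm_ring) h3 - h2 * d.c i * s - d.c (w l) * h1 * s - d.c (w l) * d.c (w i) * h3
lemma σ_Q (w : Equiv.Perm (Fin r)) (i j) : d.σ w * d.Q i j = d.Q (w i) j * d.σ w := by
  unfold Q
  have h1 := d.σ_c w i
  have h2 := d.σ_ε w i j
  linear_combination (norm := noncomm_ring) h2 + h1 * d.ε i j * d.c i + d.c (w i) * h2 * d.c i + d.c (w i) * d.ε (w i) j * h1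
lemma σb_P (w : Equiv.Perm (Fin t)) (i l) : d.σb w * d.P i l = d.P i l * d.σb w := by
  unfold P
  have h1 := d.σbc w i
  have h2 := d.σbc w l
  have h3 := d.σσb (Equiv.swap l i) w
  generalize d.σ (Equiv.swap l i) = s at *
  generalize d.σb w = W at *
  linear_combination (norm := noncomm_ring) -h3 - h2 * d.c i * s - d.c l * h1 * s + d.c l * d.c i * h3
lemma σb_Q (w : Equiv.Perm (Fin t)) (i j) : d.σb w * d.Q i j = d.Q i (w j) * d.σb w := by
  unfold Q
  have h1 := d.σbc w i
  have h2 := d.σb_ε w i j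
  linear_combination (norm := noncomm_ring) h2 + h1 * d.ε i j * d.c i + d.c i * h2 * d.c i + d.c i * d.ε i (w j) * h1
lemma σ_zz (w : Equiv.Perm (Fin r)) (S : Finset (Fin r)) (S' : Finset (Fin t)) (i : Fin r) (hS : S.map w.toEmbedding = S) :
    d.σ w * d.zz S S' i = d.zz S S' (w i) * d.σ w := by
  unfold zz
  have h1 := d.σ_ξ w i
  have h2 : d.σ w * (∑ j ∈ S', d.Q i j) = (∑ j ∈ S', d.Q (w i) j) * d.σ w := by
    rw [Finset.mul_sum, Finset.sum_mul]
    exact Finset.sum_congr rfl fun j _ => d.σ_Q w i j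
  have h3 : d.σ w * (∑ l ∈ S, d.P i l) = (∑ l ∈ S, d.P (w i) l) * d.σ w := by
    rw [Finset.mul_sum, Finset.sum_mul]
    conv_rhs => rw [← hS]
    rw [Finset.sum_map]
    exact Finset.sum_congr rfl fun j _ => d.σ_P w i j
  linear_combination (norm := noncomm_ring) h1 + h2 - h3
lemma σb_zz (w : Equiv.Perm (Fin t)) (S : Finset (Fin r)) (S' : Finset (Fin t)) (i : Fin r) (hS : S'.map w.toEmbedding = S') :
    Commute (d.σb w) (d.zz S S' i) := by
  unfold zz Commute SemiconjBy
  have h1 := d.σbξ w i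
  have h3 : d.σb w * (∑ l ∈ S, d.P i l) = (∑ l ∈ S, d.P i l) * d.σb w := by
    rw [Finset.mul_sum, Finset.sum_mul]
    exact Finset.sum_congr rfl fun j _ => d.σb_P w i j
  have h2 : d.σb w * (∑ l ∈ S', d.Q i l) = (∑ l ∈ S', d.Q i l) * d.σb w := by
    rw [Finset.mul_sum, Finset.sum_mul]
    conv_rhs => rw [← hS]
    rw [Finset.sum_map]
    exact Finset.sum_congr rfl fun j _ => d.σb_Q w i j
  linear_combination (norm := noncomm_ring) h1 + h2 - h3

lemma map_eq_of_mem {α : Type} (w : Equiv.Perm α) (S : Finset α) (h : ∀ x ∈ S, w x ∈ S) : S.map w.toEmbedding = S := by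
  apply Finset.eq_of_subset_of_card_le
  · intro x hx
    obtain ⟨y, hy, rfl⟩ := Finset.mem_map.1 hx
    exact h y hy
  · rw [Finset.card_map]

/-- commuting of successive `z`s -/
lemma zz_zz (S : Finset (Fin r)) (S' : Finset (Fin t)) (i i' : Fin r) (hi' : i' ∉ insert i S) :
    Commute (d.zz S S' i) (d.zz (insert i S) S' i') := by
  have hne : i' ≠ i := by rintro rfl; exact hi' (Finset.mem_insert_self _ _)
  have hn : ∀ l ∈ S, l ≠ i' := by rintro l hl rfl; exact hi' (Finset.mem_insert_of_mem hl)
  symm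
  refine d.commute_zz _ S S' i (d.zz_ξ _ _ _ _ hi' (Finset.mem_insert_self _ _)).symm (d.zz_c _ _ _ _ hi' hne.symm).symm
    (fun l hl => (d.zz_c _ _ _ _ hi' (hn l hl)).symm) (fun l hl => ?_) (fun j hj => (d.zz_ε _ _ _ _ _ hi' (Finset.mem_insert_self _ _) hj).symm)
  have := d.σ_zz (Equiv.swap l i) (insert i S) S' i' (map_eq_of_mem _ _ fun x hx => ?_)
  · rw [Equiv.swap_apply_of_ne_of_ne (hn l hl).symm hne] at this
    exact this.symm
  · rcases Equiv.swap_apply_eq_iff.1 (rfl : Equiv.swap l i x = _) with _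
    by_cases h1 : x = l
    · subst h1; rw [Equiv.swap_apply_left]; exact Finset.mem_insert_self _ _
    by_cases h2 : x = i
    · subst h2; rw [Equiv.swap_apply_right]; exact Finset.mem_insert_of_mem hl
    rwa [Equiv.swap_apply_of_ne_of_ne h1 h2]

lemma of_I_smul {x y : B} (h : Commute (Complex.I • x) y) : Commute x y := by
  have := h.smul_left (-Complex.I)
  simpa [smul_smul] using this

lemma swap_c (S : Finset (Fin r)) (S' : Finset (Fin t)) (j : Fin t) (i) : Commute (d.c i) (d.swap.zz S' S j) :=
  of_I_smul (d.swap.zz_cb S' S j i)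

/-- mixed commuting -/
lemma zz_mixed (S : Finset (Fin r)) (S' : Finset (Fin t)) (i : Fin r) (j : Fin t) (hj : j ∉ S') :
    Commute (d.zz S S' i) (d.swap.zz S' (insert i S) j) := by
  symm
  refine d.commute_zz _ S S' i (d.swap.zz_ξb _ _ _ _ (Finset.mem_insert_self _ _)).symm (d.swap_c _ _ _ _).symm
    (fun l hl => (d.swap_c _ _ _ _).symm) (fun l hl => ?_) (fun j' hj' => (d.swap.zz_ε _ _ _ _ _ hj hj' (Finset.mem_insert_self _ _)).symm)
  refine (d.swap.σb_zz (Equiv.swap l i) _ _ _ (map_eq_of_mem _ _ fun x hx => ?_)).symm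
  by_cases h1 : x = l
  · subst h1; rw [Equiv.swap_apply_left]; exact Finset.mem_insert_self _ _
  by_cases h2 : x = i
  · subst h2; rw [Equiv.swap_apply_right]; exact Finset.mem_insert_of_mem hl
  rwa [Equiv.swap_apply_of_ne_of_ne h1 h2]
lemma zz_insert (S : Finset (Fin r)) (S' : Finset (Fin t)) (i l : Fin r) (hl : l ∉ S) :
    d.zz (insert l S) S' i = d.zz S S' i - d.P i l := by
  unfold zz; rw [Finset.sum_insert hl]; abel
lemma zz_insert' (S : Finset (Fin r)) (S' : Finset (Fin t)) (i : Fin r) (j : Fin t) (hj : j ∉ S') :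
    d.zz S (insert j S') i = d.zz S S' i + d.Q i j := by
  unfold zz; rw [Finset.sum_insert hj]; abel
lemma swap_P (j l) : d.swap.P j l = (1 + d.cb l * d.cb j) * d.σb (Equiv.swap l j) := by
  show (1 - (Complex.I • d.cb l) * (Complex.I • d.cb j)) * d.σb (Equiv.swap l j) = _
  simp [smul_smul]
lemma swap_Q (i j) : d.swap.Q j i = d.ε i j - d.cb j * d.ε i j * d.cb j := by
  show d.ε i j + (Complex.I • d.cb j) * d.ε i j * (Complex.I • d.cb j) = _
  simp [smul_smul, sub_eq_add_neg]
lemma swap_Q' (i j) : d.swap.Q j i = d.ε i j - d.c i * d.ε i j * d.c i := by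
  rw [swap_Q, mul_assoc, ← d.ε_c, ← mul_assoc, ← d.c_ε]
lemma swap_swap_P (i l) : d.swap.swap.P i l = d.P i l := by
  rw [swap_P]
  show (1 + (Complex.I • d.c l) * (Complex.I • d.c i)) * d.σ (Equiv.swap l i) = _
  simp [smul_smul, P, sub_eq_add_neg]
lemma ε_Q_Pb (i j j') (h : j' ≠ j) : d.ε i j * d.Q i j' = d.ε i j * d.swap.P j j' := by
  rw [swap_P]; unfold Q
  have h1 := d.ε_row i j j' h.symm
  have h2 := d.σb_ε (Equiv.swap j' j) i j'
  rw [Equiv.swap_apply_left] at h2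
  rw [Equiv.swap_comm] at h1
  have h3 := d.ε_c i j
  have h4 := d.ε_cb' i j' j h.symm
  have h5 := d.ccb i j
  have h6 := d.ε_c i j'
  have h7 := d.σb_cb (Equiv.swap j' j) j
  have h8 := d.σb_cb (Equiv.swap j' j) j'
  rw [Equiv.swap_apply_right] at h7
  rw [Equiv.swap_apply_left] at h8
  generalize d.σb (Equiv.swap j' j) = s at *
  have e : d.ε i j * d.ε i j' = d.ε i j * s := h1.trans h2
  have k1 : d.ε i j * (d.c i * d.ε i j' * d.c i) = d.ε i j * d.cb j' * d.cb j * s := by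
    calc d.ε i j * (d.c i * d.ε i j' * d.c i) = (d.ε i j * d.c i) * d.ε i j' * d.c i := by noncomm_ring
      _ = d.ε i j * (d.cb j * d.ε i j') * d.c i := by rw [h3]; noncomm_ring
      _ = d.ε i j * d.ε i j' * (d.cb j * d.c i) := by rw [h4]; noncomm_ring
      _ = - (d.ε i j * (d.ε i j' * d.c i) * d.cb j) := by rw [← neg_eq_iff_eq_neg.2 h5]; noncomm_ring
      _ = - ((d.ε i j * d.ε i j') * d.cb j' * d.cb j) := by rw [h6]; noncomm_ring
      _ = - (d.ε i j * (s * d.cb j') * d.cb j) := by rw [e]; noncomm_ring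
      _ = - (d.ε i j * d.cb j * (s * d.cb j)) := by rw [h8]; noncomm_ring
      _ = - (d.ε i j * (d.cb j * d.cb j') * s) := by rw [h7]; noncomm_ring
      _ = _ := by rw [d.cb_anti j j' h.symm]; noncomm_ring
  rw [mul_add, e, k1]; noncomm_ring
lemma Q_Pb_ε (i j j') (h : j' ≠ j) : d.Q i j' * d.ε i j = d.swap.P j j' * d.ε i j := by
  rw [swap_P]; unfold Q
  have h1 := d.ε_row i j' j h
  have h3 := d.c_ε i j
  have h4 := d.ε_cb' i j' j h.symm
  have h5 := d.ccb i j
  have h6 := d.c_ε i j'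
  have h7 := d.σb_cb (Equiv.swap j' j) j
  have h8 := d.σb_cb (Equiv.swap j' j) j'
  rw [Equiv.swap_apply_right] at h7
  rw [Equiv.swap_apply_left] at h8
  generalize d.σb (Equiv.swap j' j) = s at *
  have k1 : (d.c i * d.ε i j' * d.c i) * d.ε i j = d.cb j' * d.cb j * s * d.ε i j := by
    calc (d.c i * d.ε i j' * d.c i) * d.ε i j = d.c i * d.ε i j' * (d.c i * d.ε i j) := by noncomm_ring
      _ = d.c i * (d.ε i j' * d.cb j) * d.ε i j := by rw [h3]; noncomm_ring
      _ = (d.c i * d.cb j) * (d.ε i j' * d.ε i j) := by rw [← h4]; noncomm_ring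
      _ = - (d.cb j * (d.c i * d.ε i j') * d.ε i j) := by rw [h5]; noncomm_ring
      _ = - (d.cb j * d.cb j' * (d.ε i j' * d.ε i j)) := by rw [h6]; noncomm_ring
      _ = (d.cb j' * d.cb j) * (d.ε i j' * d.ε i j) := by rw [d.cb_anti j j' h.symm]; noncomm_ring
      _ = _ := by rw [h1]; noncomm_ring
  rw [add_mul, h1, k1]; noncomm_ring
lemma ε_zsum (S : Finset (Fin r)) (S' : Finset (Fin t)) (i : Fin r) (j : Fin t) (hi : i ∉ S) (hj : j ∉ S') :
    d.ε i j * (d.zz S S' i + d.swap.zz S' S j) = 0 := by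
  have h1 : d.ε i j * (∑ j' ∈ S', d.Q i j') = d.ε i j * ∑ j' ∈ S', d.swap.P j j' := by
    rw [Finset.mul_sum, Finset.mul_sum]
    exact Finset.sum_congr rfl fun l hl => d.ε_Q_Pb _ _ _ (by rintro rfl; exact hj hl)
  have h2 : d.ε i j * (∑ l ∈ S, d.swap.Q j l) = d.ε i j * ∑ l ∈ S, d.P i l := by
    rw [Finset.mul_sum, Finset.mul_sum]
    exact Finset.sum_congr rfl fun l hl => by
      rw [← swap_swap_P]; exact d.swap.ε_Q_Pb _ _ _ (by rintro rfl; exact hi hl)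
  have h3 := d.ε_ξ i j
  have h4 : d.swap.ξ j = d.ξb j := rfl
  unfold zz
  rw [h4]
  linear_combination (norm := noncomm_ring) h1 + h2 + h3
lemma zsum_ε (S : Finset (Fin r)) (S' : Finset (Fin t)) (i : Fin r) (j : Fin t) (hi : i ∉ S) (hj : j ∉ S') :
    (d.zz S S' i + d.swap.zz S' S j) * d.ε i j = 0 := by
  have h1 : (∑ j' ∈ S', d.Q i j') * d.ε i j = (∑ j' ∈ S', d.swap.P j j') * d.ε i j := by
    rw [Finset.sum_mul, Finset.sum_mul]
    exact Finset.sum_congr rfl fun l hl => d.Q_Pb_ε _ _ _ (by rintro rfl; exact hj hl)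
  have h2 : (∑ l ∈ S, d.swap.Q j l) * d.ε i j = (∑ l ∈ S, d.P i l) * d.ε i j := by
    rw [Finset.sum_mul, Finset.sum_mul]
    exact Finset.sum_congr rfl fun l hl => by
      rw [← swap_swap_P]; exact d.swap.Q_Pb_ε _ _ _ (by rintro rfl; exact hi hl)
  have h3 := d.ξ_ε i j
  have h4 : d.swap.ξ j = d.ξb j := rfl
  unfold zz
  rw [h4]
  linear_combination (norm := noncomm_ring) h1 + h2 + h3
lemma εPε (i j l) (h : l ≠ i) : d.ε i j * d.P i l * d.ε i j = 2 * d.ε i j := by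
  unfold P
  have h1 := d.ε_col i l j h.symm
  have h2 := d.σ_ε (Equiv.swap l i) l j
  have h2' := d.σ_ε (Equiv.swap l i) i j
  rw [Equiv.swap_apply_left] at h2
  rw [Equiv.swap_apply_right] at h2'
  rw [Equiv.swap_comm] at h1
  have h3 := d.ε_c i j
  have h3' := d.c_ε i j
  have h4 := d.ε_c' i j l h
  have h7 := d.σ_c (Equiv.swap l i) i
  rw [Equiv.swap_apply_right] at h7
  have h8 := d.σcb (Equiv.swap l i) j
  have h9 : d.σ (Equiv.swap l i) * d.σ (Equiv.swap l i) = 1 := by rw [← map_mul]; simp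
  generalize d.σ (Equiv.swap l i) = s at *
  have e : d.ε i j * s * d.ε i j = d.ε i j := by
    calc d.ε i j * s * d.ε i j = (d.ε i j * d.ε l j) * s := by rw [mul_assoc, h2']; noncomm_ring
      _ = d.ε i j * (s * s) := by rw [h1, h2]; noncomm_ring
      _ = _ := by rw [h9, mul_one]
  have k : d.ε i j * (d.c l * d.c i * s) * d.ε i j = - d.ε i j := by
    calc d.ε i j * (d.c l * d.c i * s) * d.ε i j = d.c l * (d.ε i j * d.c i) * s * d.ε i j := by rw [← mul_assoc (d.c l), h4]; noncomm_ring
      _ = d.c l * d.ε i j * (s * d.cb j) * d.ε i j := by rw [h3, h8]; noncomm_ring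
      _ = d.c l * d.ε i j * s * (d.c i * d.ε i j) := by rw [h3']; noncomm_ring
      _ = d.c l * (d.ε i j * d.c l) * s * d.ε i j := by
        rw [show d.c l * d.ε i j * s * (d.c i * d.ε i j) = d.c l * d.ε i j * (s * d.c i) * d.ε i j by noncomm_ring, h7]; noncomm_ring
      _ = (d.c l * d.c l) * (d.ε i j * s * d.ε i j) := by rw [← h4]; noncomm_ring
      _ = _ := by rw [d.c_sq, e]; noncomm_ring
  linear_combination (norm := noncomm_ring) e - k
lemma ε_zz_ε (S : Finset (Fin r)) (S' : Finset (Fin t)) (i : Fin r) (j : Fin t) (hi : i ∉ S) (hj : j ∉ S') (hc : S.card = S'.card) :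
    d.ε i j * d.zz S S' i * d.ε i j = algebraMap ℂ B ω * d.ε i j := by
  have h1 : d.ε i j * (∑ j' ∈ S', d.Q i j') * d.ε i j = S'.card • (2 * d.ε i j) := by
    rw [Finset.mul_sum, Finset.sum_mul]
    refine Finset.sum_eq_card_nsmul fun l hl => ?_
    have : l ≠ j := by rintro rfl; exact hj hl
    rw [d.ε_Q_Pb _ _ _ this]
    exact d.swap.εPε j i l this
  have h2 : d.ε i j * (∑ l ∈ S, d.P i l) * d.ε i j = S.card • (2 * d.ε i j) := by
    rw [Finset.mul_sum, Finset.sum_mul]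
    exact Finset.sum_eq_card_nsmul fun l hl => d.εPε _ _ _ (by rintro rfl; exact hi hl)
  rw [hc] at h2
  have h3 := d.εξε i j
  unfold zz
  generalize S'.card • (2 * d.ε i j) = q at *
  linear_combination (norm := noncomm_ring) h1 - h2 + h3
lemma c_pow_even (S : Finset (Fin r)) (S' : Finset (Fin t)) (i : Fin r) (hi : i ∉ S) (n : ℕ) : Commute (d.c i) (d.zz S S' i ^ (2*n)) := by
  rw [pow_mul]
  apply Commute.pow_right
  have := d.zz_ci S S' i hi
  unfold Commute SemiconjBy
  rw [sq]
  linear_combination (norm := noncomm_ring) this * d.zz S S' i - d.zz S S' i * this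
lemma ε_even (S : Finset (Fin r)) (S' : Finset (Fin t)) (i : Fin r) (j : Fin t) (hi : i ∉ S) (n : ℕ) : d.ε i j * d.zz S S' i ^ (2*n) * d.ε i j = 0 := by
  have h1 := (d.c_pow_even S S' i hi n).eq
  have h2 := ((d.zz_cb S S' i j).pow_right (2*n)).eq
  generalize d.zz S S' i ^ (2*n) = z at *
  have key : d.ε i j * z * d.ε i j = - (d.ε i j * z * d.ε i j) := by
    calc d.ε i j * z * d.ε i j = d.ε i j * z * (d.cb j * d.cb j) * d.ε i j := by rw [d.cb_sq, mul_one]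
      _ = d.ε i j * (z * d.cb j) * (d.cb j * d.ε i j) := by noncomm_ring
      _ = (d.ε i j * d.cb j) * z * (d.c i * d.ε i j) := by rw [← h2, d.c_ε]; noncomm_ring
      _ = d.ε i j * d.c i * (z * d.c i) * d.ε i j := by rw [← d.ε_c]; noncomm_ring
      _ = d.ε i j * (d.c i * d.c i) * z * d.ε i j := by rw [← h1]; noncomm_ring
      _ = _ := by rw [d.c_sq]; noncomm_ring
  have h2 : (2:ℂ) • (d.ε i j * z * d.ε i j) = 0 := by
    rw [two_smul]; nth_rewrite 2 [key]; exact add_neg_cancel _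
  exact (smul_eq_zero_iff_right (two_ne_zero)).1 h2
end Idx
end

section
/-- the parity automorphism -/
structure Gam {a κ ω : ℂ} {B : Type} [Ring B] [Algebra ℂ B] {r t : ℕ} (d : Idx a κ ω B r t) (γ : B →ₐ[ℂ] B) : Prop where
  σ : ∀ w, γ (d.σ w) = d.σ w
  σb : ∀ w, γ (d.σb w) = d.σb w
  c : ∀ i, γ (d.c i) = - d.c i
  cb : ∀ i, γ (d.cb i) = - d.cb i
  ξ : ∀ i, γ (d.ξ i) = d.ξ i
  ξb : ∀ i, γ (d.ξb i) = d.ξb i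
  ε : ∀ i j, γ (d.ε i j) = d.ε i j

namespace Idx
variable {a κ ω : ℂ} {B : Type} [Ring B] [Algebra ℂ B] {r t : ℕ} (d : Idx a κ ω B r t)

lemma commute_low (y : B) (k : ℕ) (hσ : ∀ w, (∀ i : Fin r, k ≤ i → w i = i) → Commute y (d.σ w))
    (hσb : ∀ w, (∀ i : Fin t, k ≤ i → w i = i) → Commute y (d.σb w))
    (hc : ∀ i : Fin r, (i : ℕ) < k → Commute y (d.c i)) (hξ : ∀ i : Fin r, (i : ℕ) < k → Commute y (d.ξ i))
    (hcb : ∀ i : Fin t, (i : ℕ) < k → Commute y (d.cb i)) (hξb : ∀ i : Fin t, (i : ℕ) < k → Commute y (d.ξb i))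
    (hε : ∀ (i : Fin r) (j : Fin t), (i : ℕ) < k → (j : ℕ) < k → Commute y (d.ε i j)) {u : B}
    (hu : u ∈ Algebra.adjoin ℂ (d.low k)) : Commute y u := by
  have : Algebra.adjoin ℂ (d.low k) ≤ Subalgebra.centralizer ℂ {y} := by
    rw [Algebra.adjoin_le_iff]
    intro x hx
    rw [SetLike.mem_coe, Subalgebra.mem_centralizer_iff]
    intro g hg
    rw [Set.mem_singleton_iff] at hg
    subst hg
    rcases hx with ⟨w, hw, rfl⟩ | ⟨w, hw, rfl⟩ | ⟨i, hi, rfl | rfl⟩ | ⟨i, hi, rfl | rfl⟩ | ⟨i, j, hi, hj, rfl⟩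
    · exact hσ w hw
    · exact hσb w hw
    · exact hc i hi
    · exact hξ i hi
    · exact hcb i hi
    · exact hξb i hi
    · exact hε i j hi hj
  exact (Subalgebra.mem_centralizer_iff ℂ).1 (this hu) y rfl

/-- indices below `k` -/
def lo (n k : ℕ) : Finset (Fin n) := Finset.univ.filter fun i => (i : ℕ) < k
lemma mem_lo {n k : ℕ} {i : Fin n} : i ∈ lo n k ↔ (i : ℕ) < k := by simp [lo]
lemma lo_card {n k : ℕ} (h : k ≤ n) : (lo n k).card = k := by
  have : lo n k = (Finset.univ : Finset (Fin k)).map (Fin.castLEEmb h) := by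
    ext i
    simp only [mem_lo, Finset.mem_map, Finset.mem_univ, true_and]
    exact ⟨fun hi => ⟨⟨i, hi⟩, rfl⟩, by rintro ⟨j, rfl⟩; exact j.2⟩
  rw [this]; simp
lemma lo_map {n k : ℕ} (w : Equiv.Perm (Fin n)) (hw : ∀ i : Fin n, k ≤ i → w i = i) : (lo n k).map w.toEmbedding = lo n k := by
  refine map_eq_of_mem _ _ fun x hx => ?_
  rw [mem_lo] at *
  by_contra h
  have := hw (w x) (by omega)
  rw [w.injective this] at h
  exact h hx
lemma lo_map' {n k : ℕ} (w : Equiv.Perm (Fin n)) (hw : ∀ i : Fin n, (i : ℕ) < k → w i = i) : (lo n k).map w.toEmbedding = lo n k := by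
  refine map_eq_of_mem _ _ fun x hx => ?_
  rwa [hw x (mem_lo.1 hx)]
lemma perm_comm {n k : ℕ} (w w' : Equiv.Perm (Fin n)) (hw : ∀ i : Fin n, (i : ℕ) < k → w i = i) (hw' : ∀ i : Fin n, k ≤ i → w' i = i) :
    Commute w w' := by
  apply Equiv.Perm.Disjoint.commute
  intro x
  rcases lt_or_ge (x : ℕ) k with h | h
  · exact Or.inl (hw x h)
  · exact Or.inr (hw' x h)

variable {k : ℕ} {u : B}
lemma low_σ (hu : u ∈ Algebra.adjoin ℂ (d.low k)) (w) (hw : ∀ i : Fin r, (i : ℕ) < k → w i = i) : Commute (d.σ w) u := by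
  refine d.commute_low _ k (fun w' hw' => ?_) (fun w' hw' => d.σσb _ _) (fun i hi => ?_) (fun i hi => ?_) (fun i hi => d.σcb _ _)
    (fun i hi => d.σξb _ _) (fun i j hi hj => ?_) hu
  · exact (perm_comm w w' hw hw').map d.σ
  · have := d.σ_c w i; rwa [hw i hi] at this
  · have := d.σ_ξ w i; rwa [hw i hi] at this
  · have := d.σ_ε w i j; rwa [hw i hi] at this
lemma low_σb (hu : u ∈ Algebra.adjoin ℂ (d.low k)) (w) (hw : ∀ i : Fin t, (i : ℕ) < k → w i = i) : Commute (d.σb w) u := by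
  refine d.commute_low _ k (fun w' hw' => (d.σσb _ _).symm) (fun w' hw' => ?_) (fun i hi => d.σbc _ _) (fun i hi => d.σbξ _ _) (fun i hi => ?_)
    (fun i hi => ?_) (fun i j hi hj => ?_) hu
  · exact (perm_comm w w' hw hw').map d.σb
  · have := d.σb_cb w i; rwa [hw i hi] at this
  · have := d.σb_ξb w i; rwa [hw i hi] at this
  · have := d.σb_ε w i j; rwa [hw j hj] at this
lemma ne_of_lt_ge {n : ℕ} {i j : Fin n} (h : (i : ℕ) < k) (h' : k ≤ j) : i ≠ j := by
  rintro rfl; omega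
lemma low_ε (hu : u ∈ Algebra.adjoin ℂ (d.low k)) (i : Fin r) (j : Fin t) (hi : k ≤ i) (hj : k ≤ j) : Commute (d.ε i j) u := by
  refine d.commute_low _ k (fun w' hw' => ?_) (fun w' hw' => ?_) (fun l hl => (d.ε_c' i j l (ne_of_lt_ge hl hi)).symm) (fun l hl => (d.ε_ξ' i j l (ne_of_lt_ge hl hi)).symm)
    (fun l hl => (d.ε_cb' i j l (ne_of_lt_ge hl hj)).symm)
    (fun l hl => (d.ε_ξb' i j l (ne_of_lt_ge hl hj)).symm) (fun l m hl hm => d.εε_comm _ _ _ _ (ne_of_lt_ge hl hi).symm (ne_of_lt_ge hm hj).symm) hu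
  · have := d.σ_ε w' i j; rw [hw' i hi] at this; exact this.symm
  · have := d.σb_ε w' i j; rw [hw' j hj] at this; exact this.symm
lemma not_lo {n : ℕ} {i : Fin n} (h : k ≤ i) : i ∉ lo n k := by rw [mem_lo]; omega
lemma low_zz (hu : u ∈ Algebra.adjoin ℂ (d.low k)) (i : Fin r) (hi : k ≤ i) : Commute (d.zz (lo r k) (lo t k) i) u := by
  refine d.commute_low _ k (fun w' hw' => ?_) (fun w' hw' => (d.σb_zz w' _ _ _ (lo_map w' hw')).symm) (fun l hl => (d.zz_c _ _ _ _ (not_lo hi) (ne_of_lt_ge hl hi)).symm)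
    (fun l hl => (d.zz_ξ _ _ _ _ (not_lo hi) (mem_lo.2 hl)).symm) (fun l hl => (d.zz_cb _ _ _ _).symm)
    (fun l hl => (d.zz_ξb _ _ _ _ (mem_lo.2 hl)).symm) (fun l m hl hm => (d.zz_ε _ _ _ _ _ (not_lo hi) (mem_lo.2 hl) (mem_lo.2 hm)).symm) hu
  have := d.σ_zz w' (lo r k) (lo t k) i (lo_map w' hw')
  rw [hw' i hi] at this
  exact this.symm
lemma low_zzb (hu : u ∈ Algebra.adjoin ℂ (d.low k)) (i : Fin t) (hi : k ≤ i) : Commute (d.swap.zz (lo t k) (lo r k) i) u := by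
  refine d.commute_low _ k (fun w' hw' => (d.swap.σb_zz w' _ _ _ (lo_map w' hw')).symm) (fun w' hw' => ?_) (fun l hl => (d.swap_c _ _ _ _).symm)
    (fun l hl => (d.swap.zz_ξb _ _ _ _ (mem_lo.2 hl)).symm)
    (fun l hl => (of_I_smul (d.swap.zz_c _ _ _ _ (not_lo hi) (ne_of_lt_ge hl hi))).symm)
    (fun l hl => (d.swap.zz_ξ _ _ _ _ (not_lo hi) (mem_lo.2 hl)).symm) (fun l m hl hm => (d.swap.zz_ε _ _ _ _ _ (not_lo hi) (mem_lo.2 hm) (mem_lo.2 hl)).symm) hu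
  have := d.swap.σ_zz w' (lo t k) (lo r k) i (lo_map w' hw')
  rw [hw' i hi] at this
  exact this.symm

variable {d} {γ : B →ₐ[ℂ] B}
lemma gam_zz (G : Gam d γ) (S S' i) : γ (d.zz S S' i) = d.zz S S' i := by
  simp [zz, P, Q, G.σ, G.c, G.ξ, G.ε]
lemma gam_zzb (G : Gam d γ) (S S' i) : γ (d.swap.zz S S' i) = d.swap.zz S S' i := by
  unfold zz
  simp only [swap_P, swap_Q]
  show γ (d.ξb i + _ - _) = d.ξb i + _ - _
  simp [G.σb, G.cb, G.ξb, G.ε]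
lemma gam_mem (G : Gam d γ) (hu : u ∈ Algebra.adjoin ℂ (d.low k)) : γ u ∈ Algebra.adjoin ℂ (d.low k) := by
  have : Algebra.adjoin ℂ (d.low k) ≤ (Algebra.adjoin ℂ (d.low k)).comap γ := by
    rw [Algebra.adjoin_le_iff]
    intro x hx
    have hx' := Algebra.subset_adjoin (R := ℂ) hx
    rw [SetLike.mem_coe, Subalgebra.mem_comap]
    rcases hx with ⟨w, hw, rfl⟩ | ⟨w, hw, rfl⟩ | ⟨i, hi, rfl | rfl⟩ | ⟨i, hi, rfl | rfl⟩ | ⟨i, j, hi, hj, rfl⟩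
    · rwa [G.σ]
    · rwa [G.σb]
    · rw [G.c]; exact neg_mem hx'
    · rwa [G.ξ]
    · rw [G.cb]; exact neg_mem hx'
    · rwa [G.ξb]
    · rwa [G.ε]
  exact this hu
/-- elements commuting up to parity -/
lemma gam_of (y : B) (s : Set B) (h : ∀ x ∈ s, y * x = γ x * y) (hu : u ∈ Algebra.adjoin ℂ s) : y * u = γ u * y := by
  induction hu using Algebra.adjoin_induction with
  | mem x hx => exact h x hx
  | algebraMap z => rw [AlgHom.commutes, Algebra.commutes]
  | add x z _ _ hx hz => rw [map_add, mul_add, add_mul, hx, hz]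
  | mul x z _ _ hx hz => rw [map_mul, ← mul_assoc, hx, mul_assoc, hz, mul_assoc]
lemma gam_c (G : Gam d γ) (hu : u ∈ Algebra.adjoin ℂ (d.low k)) (m : Fin r) (hm : k ≤ m) : d.c m * u = γ u * d.c m := by
  refine gam_of _ _ (fun x hx => ?_) hu
  rcases hx with ⟨w, hw, rfl⟩ | ⟨w, hw, rfl⟩ | ⟨i, hi, rfl | rfl⟩ | ⟨i, hi, rfl | rfl⟩ | ⟨i, j, hi, hj, rfl⟩
  · rw [G.σ, d.σ_c, hw m hm]
  · rw [G.σb, d.σbc]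
  · rw [G.c, d.c_anti _ _ (ne_of_lt_ge hi hm).symm, neg_mul]
  · rw [G.ξ, d.ξ_c' _ _ (ne_of_lt_ge hi hm)]
  · rw [G.cb, d.ccb, neg_mul]
  · rw [G.ξb, d.ξbc]
  · rw [G.ε, d.ε_c' _ _ _ (ne_of_lt_ge hi hm).symm]
lemma gam_cb (G : Gam d γ) (hu : u ∈ Algebra.adjoin ℂ (d.low k)) (m : Fin t) (hm : k ≤ m) : d.cb m * u = γ u * d.cb m := by
  refine gam_of _ _ (fun x hx => ?_) hu
  rcases hx with ⟨w, hw, rfl⟩ | ⟨w, hw, rfl⟩ | ⟨i, hi, rfl | rfl⟩ | ⟨i, hi, rfl | rfl⟩ | ⟨i, j, hi, hj, rfl⟩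
  · rw [G.σ, d.σcb]
  · rw [G.σb, d.σb_cb, hw m hm]
  · rw [G.c, neg_mul, d.ccb, neg_neg]
  · rw [G.ξ, d.ξcb]
  · rw [G.cb, d.cb_anti _ _ (ne_of_lt_ge hi hm).symm, neg_mul]
  · rw [G.ξb, d.ξb_cb' _ _ (ne_of_lt_ge hi hm)]
  · rw [G.ε, d.ε_cb' _ _ _ (ne_of_lt_ge hj hm).symm]

/-- two elements of the small algebra commute -/
lemma low_comm (hc : ∀ b ∈ Algebra.adjoin ℂ (d.low k), ∀ (i : Fin r) (j : Fin t), (i : ℕ) = k → (j : ℕ) = k → b * d.ε i j = 0 → b = 0)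
    (i : Fin r) (j : Fin t) (hi : (i : ℕ) = k) (hj : (j : ℕ) = k) {v Z Z' : B}
    (hu : u ∈ Algebra.adjoin ℂ (d.low k)) (hv : v ∈ Algebra.adjoin ℂ (d.low k))
    (h1 : d.ε i j * Z * d.ε i j = u * d.ε i j) (h2 : d.ε i j * Z' * d.ε i j = v * d.ε i j)
    (hZ : Commute Z v) (hZ' : Commute Z' u) : u * v = v * u := by
  rw [← sub_eq_zero]
  refine hc _ (sub_mem (mul_mem hu hv) (mul_mem hv hu)) i j hi hj ?_
  have e1 : d.ε i j * v = v * d.ε i j := d.low_ε hv i j hi.ge hj.ge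
  have e2 : d.ε i j * u = u * d.ε i j := d.low_ε hu i j hi.ge hj.ge
  have k1 : u * v * d.ε i j = d.ε i j * Z * d.ε i j * Z' * d.ε i j := by
    calc u * v * d.ε i j = u * (d.ε i j * Z' * d.ε i j) := by rw [h2, mul_assoc]
      _ = (u * d.ε i j) * Z' * d.ε i j := by noncomm_ring
      _ = _ := by rw [← h1]
  have k2 : v * u * d.ε i j = d.ε i j * Z * d.ε i j * Z' * d.ε i j := by
    calc v * u * d.ε i j = v * (d.ε i j * Z * d.ε i j) := by rw [h1, mul_assoc]
      _ = (v * d.ε i j) * Z * d.ε i j := by noncomm_ring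
      _ = d.ε i j * (v * Z) * d.ε i j := by rw [← e1]; noncomm_ring
      _ = d.ε i j * Z * (v * d.ε i j) := by rw [← hZ.eq]; noncomm_ring
      _ = _ := by rw [← h2]; noncomm_ring
  rw [sub_mul, k1, k2, sub_self]
lemma gam_fix (G : Gam d γ) (hc : ∀ b ∈ Algebra.adjoin ℂ (d.low k), ∀ (i : Fin r) (j : Fin t), (i : ℕ) = k → (j : ℕ) = k → b * d.ε i j = 0 → b = 0)
    (i : Fin r) (j : Fin t) (hi : (i : ℕ) = k) (hj : (j : ℕ) = k) {Z : B}
    (hu : u ∈ Algebra.adjoin ℂ (d.low k)) (h1 : d.ε i j * Z * d.ε i j = u * d.ε i j) (hZ : γ Z = Z) : γ u = u := by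
  rw [← sub_eq_zero]
  refine hc _ (sub_mem (gam_mem G hu) hu) i j hi hj ?_
  have := congrArg γ h1
  rw [map_mul, map_mul, map_mul, G.ε, hZ, h1] at this
  rw [sub_mul, ← this, sub_self]
end Idx

/-- data with all Clifford generators negated -/
def AWBC.neg {B : Type} [Ring B] [Algebra ℂ B] {r t : ℕ} {ω : ℂ} (d : AWBC ℂ B r t ω) : AWBC ℂ B r t ω where
  σ := d.σ
  σb := d.σb
  c i := - d.c i
  cb i := - d.cb i
  e := d.e
  c_sq i := by simp [d.c_sq]
  c_anti i j h := by simp [d.c_anti i j h]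
  c_conj w i := by simp [d.c_conj]
  cb_sq i := by simp [d.cb_sq]
  cb_anti i j h := by simp [d.cb_anti i j h]
  cb_conj w i := by simp [d.cb_conj]
  comm_σσb := d.comm_σσb
  comm_σcb w j := by simp [d.comm_σcb]
  comm_σbc w j := by simp [d.comm_σbc]
  anti_ccb i j := by simp [d.anti_ccb]
  e_c1 h1 h2 := by simp [d.e_c1 h1 h2]
  c1_e h1 h2 := by simp [d.c1_e h1 h2]
  e_sq := d.e_sq
  e_s_e := d.e_s_e
  e_sb_e := d.e_sb_e
  s_e_comm := d.s_e_comm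
  sb_e_comm := d.sb_e_comm
  braid1 := d.braid1
  braid2 := d.braid2
  c_e_comm i h := by simp [d.c_e_comm i h]
  cb_e_comm i h := by simp [d.cb_e_comm i h]
  e_c_e h := by simp [d.e_c_e h]
  e_cb_e h := by simp [d.e_cb_e h]
  x1 := d.x1
  xb1 := d.xb1
  om := d.om
  omb := d.omb
  om_one := d.om_one
  om_even := d.om_even
  omb_zero := d.omb_zero
  om_comm k := by
    obtain ⟨h1, h2, h3, h4, h5⟩ := d.om_comm k
    exact ⟨h1, h2, fun i => by simp [h3], fun i => by simp [h4], h5⟩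
  omb_comm k := by
    obtain ⟨h1, h2, h3, h4, h5⟩ := d.omb_comm k
    exact ⟨h1, h2, fun i => by simp [h3], fun i => by simp [h4], h5⟩
  x_comm h := by simpa using d.x_comm h
  x1_c1 h := by simp [d.x1_c1 h]
  x1_c i h := by simp [d.x1_c i h]
  s_x1 := d.s_x1
  xb_comm h := by simpa using d.xb_comm h
  xb1_cb1 h := by simp [d.xb1_cb1 h]
  xb1_cb i h := by simp [d.xb1_cb i h]
  sb_xb1 := d.sb_xb1
  e_xsum := d.e_xsum
  xsum_e := d.xsum_e
  e_sxs := d.e_sxs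
  x_mixed h := by simpa using d.x_mixed h
  e_sbxbsb := d.e_sbxbsb
  e_xodd := d.e_xodd
  e_xeven := d.e_xeven
  e_xb := d.e_xb
  x1_cb_comm j := by simp [d.x1_cb_comm]
  xb1_c_comm j := by simp [d.xb1_c_comm]
  x1_σb := d.x1_σb
  xb1_σ := d.xb1_σ

lemma exists_gam {B : Type} [Ring B] [Algebra ℂ B] {T R m : ℕ} {p : ℂ} (d' : AWBC ℂ B (R+1) (T+1) (omSeq m p 1))
    (hx : d'.x1 * d'.x1 = algebraMap ℂ B (p*(p+1))) (hxb : d'.xb1 * d'.xb1 = algebraMap ℂ B (p*(p+1) + omSeq m p 1))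
    {f g : Polynomial ℂ} {o : ℕ → ℂ} (hu' : d'.IsCycUniversal o f g) : ∃ γ, Gam (d'.idx hx hxb) γ := by
  obtain ⟨γ, h, -⟩ := hu'.2.2 B d'.neg hu'.1 hu'.2.1
  have hσ : ∀ w, γ (d'.σ w) = d'.σ w := h.map_σ
  have hσb : ∀ w, γ (d'.σb w) = d'.σb w := h.map_σb
  have he : γ d'.e = d'.e := h.map_e
  have h1 : γ d'.x1 = d'.x1 := h.map_x1
  have h2 : γ d'.xb1 = d'.xb1 := h.map_xb1
  refine ⟨γ, hσ, hσb, h.map_c, h.map_cb, fun i => ?_, fun i => ?_, fun i j => ?_⟩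
  · show γ (d'.X i) = d'.X i
    simp [AWBC.X, hσ, h1]
  · show γ (d'.Xb i) = d'.Xb i
    simp [AWBC.Xb, hσb, h2]
  · show γ (d'.EE i j) = d'.EE i j
    simp [AWBC.EE, hσ, hσb, he]
end

section
/-- shifting the indices -/
def shf {n N k : ℕ} (h : N = n + k) : Fin n ↪ Fin N where
  toFun i := ⟨k + i, by omega⟩
  inj' i j h := by simpa [Fin.ext_iff] using h
lemma shf_val {n N k : ℕ} (h : N = n + k) (i : Fin n) : ((shf h i : Fin N) : ℕ) = k + i := rfl
lemma shf_ge {n N k : ℕ} (h : N = n + k) (i : Fin n) : k ≤ ((shf h i : Fin N) : ℕ) := by rw [shf_val]; omega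
lemma shf_ne {n N k : ℕ} (h : N = n + k) {i j : Fin n} (hij : i ≠ j) : shf h i ≠ shf h j := fun h' => hij ((shf h).injective h')
lemma via_lo {n N k : ℕ} (h : N = n + k) (w : Equiv.Perm (Fin n)) (i : Fin N) (hi : (i : ℕ) < k) : via (shf h) w i = i :=
  via_not _ _ _ fun y hy => by have := shf_ge h y; rw [hy] at this; omega
lemma via_sw {n N k a b : ℕ} (h : N = n + k) (ha : a < n) (hb : b < n) : via (shf h) (sw n a b) = Equiv.swap (shf h ⟨a, ha⟩) (shf h ⟨b, hb⟩) := by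
  rw [sw_eq ha hb, via_swap]

namespace Idx
variable {a κ ω : ℂ} {B : Type} [Ring B] [Algebra ℂ B] {r t : ℕ} (d : Idx a κ ω B r t)

lemma ss1 (i j) : d.σ (Equiv.swap i j) * d.σ (Equiv.swap i j) = 1 := by rw [← map_mul]; simp
lemma ss1b (i j) : d.σb (Equiv.swap i j) * d.σb (Equiv.swap i j) = 1 := by rw [← map_mul]; simp
lemma εσε (i j l) (h : i ≠ l) : d.ε i j * d.σ (Equiv.swap i l) * d.ε i j = d.ε i j := by
  have h1 := d.ε_col i l j h
  have h2 := d.σ_ε (Equiv.swap i l) l j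
  have h2' := d.σ_ε (Equiv.swap i l) i j
  rw [Equiv.swap_apply_right] at h2
  rw [Equiv.swap_apply_left] at h2'
  have h9 := d.ss1 i l
  generalize d.σ (Equiv.swap i l) = s at *
  calc d.ε i j * s * d.ε i j = (d.ε i j * d.ε l j) * s := by rw [mul_assoc, h2']; noncomm_ring
    _ = d.ε i j * (s * s) := by rw [h1, h2]; noncomm_ring
    _ = _ := by rw [h9, mul_one]
lemma εε_sw' (i l j m) (h : i ≠ l) (h' : j ≠ m) :
    d.ε i j * d.ε l m * (d.σ (Equiv.swap i l) * d.σb (Equiv.swap j m)) = d.ε i j * d.ε l m := by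
  have h1 := d.σ_ε (Equiv.swap i l) l j
  have h2 := d.σ_ε (Equiv.swap i l) i m
  have h3 := d.σb_ε (Equiv.swap j m) i j
  have h4 := d.σb_ε (Equiv.swap j m) l m
  have h5 := d.εε_sw i l j m h h'
  have h6 := d.εε_comm i l j m h h'
  rw [Equiv.swap_apply_right] at h1 h4
  rw [Equiv.swap_apply_left] at h2 h3
  have h7 := d.σσb (Equiv.swap i l) (Equiv.swap j m)
  have h8 := d.σ_ε (Equiv.swap i l) l j
  rw [Equiv.swap_apply_right] at h8
  generalize d.σ (Equiv.swap i l) = s at *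
  generalize d.σb (Equiv.swap j m) = s' at *
  calc _ = d.ε i j * d.ε l m * (s * s') := rfl
    _ = d.ε l m * (d.ε i j * s) * s' := by rw [h6]; noncomm_ring
    _ = d.ε l m * s * (d.ε l j * s') := by rw [← h1]; noncomm_ring
    _ = (d.ε l m * s) * s' * d.ε l m := by rw [← h4]; noncomm_ring
    _ = s * (d.ε i m * s') * d.ε l m := by rw [← h2]; noncomm_ring
    _ = _ := by rw [← h3, ← h5]; noncomm_ring
lemma εssε (i l j m) (h : i ≠ l) (h' : j ≠ m) :
    d.ε i j * d.σ (Equiv.swap i l) * d.σb (Equiv.swap j m) * d.ε i j = d.ε i j * d.ε l m := by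
  have h2 := d.σ_ε (Equiv.swap i l) i m
  have h3 := d.σb_ε (Equiv.swap j m) i j
  rw [Equiv.swap_apply_left] at h2 h3
  rw [← d.εε_sw' i l j m h h', mul_assoc, h3, mul_assoc, ← mul_assoc (d.σ _), h2]
  noncomm_ring
lemma σzσ (S : Finset (Fin r)) (S' : Finset (Fin t)) (i l : Fin r) (hi : i ∉ S) (hl : l ∉ S) :
    d.σ (Equiv.swap i l) * d.zz S S' i * d.σ (Equiv.swap i l) = d.zz S S' l := by
  rw [d.σ_zz, Equiv.swap_apply_left, mul_assoc, d.ss1, mul_one]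
  refine map_eq_of_mem _ _ fun x hx => ?_
  rwa [Equiv.swap_apply_of_ne_of_ne (by rintro rfl; exact hi hx) (by rintro rfl; exact hl hx)]
lemma braid1' (i l j m) (h : i ≠ l) (h' : j ≠ m) :
    d.ε i j * d.σ (Equiv.swap i l) * d.σb (Equiv.swap j m) * d.ε i j * d.σ (Equiv.swap i l)
    = d.ε i j * d.σ (Equiv.swap i l) * d.σb (Equiv.swap j m) * d.ε i j * d.σb (Equiv.swap j m) := by
  rw [d.εssε i l j m h h']
  have h1 := d.εε_sw' i l j m h h'
  have h2 := d.ss1b j m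
  generalize d.σ (Equiv.swap i l) = s at *
  generalize d.σb (Equiv.swap j m) = s' at *
  linear_combination (norm := noncomm_ring) h1 * s' - d.ε i j * d.ε l m * s * h2
lemma braid2' (i l j m) (h : i ≠ l) (h' : j ≠ m) :
    d.σ (Equiv.swap i l) * d.ε i j * d.σ (Equiv.swap i l) * d.σb (Equiv.swap j m) * d.ε i j
    = d.σb (Equiv.swap j m) * d.ε i j * d.σ (Equiv.swap i l) * d.σb (Equiv.swap j m) * d.ε i j := by
  have h0 := d.εssε i l j m h h'
  have h1 := d.εε_sw i l j m h h'
  have h2 := d.ss1 i l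
  generalize d.σ (Equiv.swap i l) = s at *
  generalize d.σb (Equiv.swap j m) = s' at *
  linear_combination (norm := noncomm_ring) s * h0 - s' * h0 - s * h1 + h2 * s' * d.ε i j * d.ε l m
lemma zzb_ci (S : Finset (Fin r)) (S' : Finset (Fin t)) (j : Fin t) (hj : j ∉ S') :
    d.swap.zz S' S j * d.cb j = - (d.cb j * d.swap.zz S' S j) := by
  have : (Complex.I • d.cb j) * d.swap.zz S' S j = - (d.swap.zz S' S j * (Complex.I • d.cb j)) := d.swap.zz_ci S' S j hj
  rw [smul_mul_assoc, mul_smul_comm, ← smul_neg] at this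
  rw [smul_right_injective B Complex.I_ne_zero this, neg_neg]
lemma zzb_cb (S : Finset (Fin r)) (S' : Finset (Fin t)) (j m : Fin t) (hj : j ∉ S') (h : m ≠ j) :
    Commute (d.cb m) (d.swap.zz S' S j) := of_I_smul (d.swap.zz_c S' S j m hj h)

variable {k : ℕ} {d} {γ : B →ₐ[ℂ] B}
lemma cent (G : Gam d γ) {u : B} (hu : u ∈ Algebra.adjoin ℂ (d.low k)) (hγ : γ u = u) {n n' : ℕ} (hn : r = n + k) (hn' : t = n' + k)
    (i0 : Fin r) (j0 : Fin t) (hi0 : k ≤ i0) (hj0 : k ≤ j0) :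
    (∀ w, u * d.σ (via (shf hn) w) = d.σ (via (shf hn) w) * u) ∧
    (∀ w, u * d.σb (via (shf hn') w) = d.σb (via (shf hn') w) * u) ∧
    (∀ i, u * d.c (shf hn i) = d.c (shf hn i) * u) ∧ (∀ i, u * d.cb (shf hn' i) = d.cb (shf hn' i) * u) ∧
    u * d.ε i0 j0 = d.ε i0 j0 * u ∧ u * d.zz (lo r k) (lo t k) i0 = d.zz (lo r k) (lo t k) i0 * u ∧
    u * d.swap.zz (lo t k) (lo r k) j0 = d.swap.zz (lo t k) (lo r k) j0 * u := by
  refine ⟨fun w => (d.low_σ hu _ (via_lo hn w)).symm, fun w => (d.low_σb hu _ (via_lo hn' w)).symm, fun i => ?_, fun i => ?_,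
    (d.low_ε hu _ _ hi0 hj0).symm, (d.low_zz hu _ hi0).symm, (d.low_zzb hu _ hj0).symm⟩
  · rw [gam_c G hu _ (shf_ge hn i), hγ]
  · rw [gam_cb G hu _ (shf_ge hn' i), hγ]

variable {n n' : ℕ}
/-- the shifted data -/
def shiftA (G : Gam d γ) (hc : ∀ b ∈ Algebra.adjoin ℂ (d.low k), ∀ (i : Fin r) (j : Fin t), (i : ℕ) = k → (j : ℕ) = k → b * d.ε i j = 0 → b = 0)
    (hn : r = n + k) (hn' : t = n' + k) (h0 : 0 < n) (h0' : 0 < n') (Ξ Ξb : ℕ → B)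
    (hΞ : ∀ b, Ξ b ∈ Algebra.adjoin ℂ (d.low k) ∧
      d.ε (shf hn ⟨0, h0⟩) (shf hn' ⟨0, h0'⟩) * d.zz (lo r k) (lo t k) (shf hn ⟨0, h0⟩) ^ b * d.ε (shf hn ⟨0, h0⟩) (shf hn' ⟨0, h0'⟩)
        = Ξ b * d.ε (shf hn ⟨0, h0⟩) (shf hn' ⟨0, h0'⟩))
    (hΞb : ∀ b, Ξb b ∈ Algebra.adjoin ℂ (d.low k) ∧
      d.ε (shf hn ⟨0, h0⟩) (shf hn' ⟨0, h0'⟩) * d.swap.zz (lo t k) (lo r k) (shf hn' ⟨0, h0'⟩) ^ b * d.ε (shf hn ⟨0, h0⟩) (shf hn' ⟨0, h0'⟩)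
        = Ξb b * d.ε (shf hn ⟨0, h0⟩) (shf hn' ⟨0, h0'⟩)) : AWBC ℂ B n n' ω where
  σ := d.σ.comp (via (shf hn))
  σb := d.σb.comp (via (shf hn'))
  c i := d.c (shf hn i)
  cb i := d.cb (shf hn' i)
  e := d.ε (shf hn ⟨0, h0⟩) (shf hn' ⟨0, h0'⟩)
  x1 := d.zz (lo r k) (lo t k) (shf hn ⟨0, h0⟩)
  xb1 := d.swap.zz (lo t k) (lo r k) (shf hn' ⟨0, h0'⟩)
  om b := if Even b then 0 else Ξ b
  omb b := if Even b then 0 else Ξb b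
  c_sq i := d.c_sq _
  c_anti i j h := d.c_anti _ _ (shf_ne hn h)
  c_conj w i := by
    show d.σ (via _ w) * _ * d.σ (via _ w⁻¹) = _
    rw [d.σ_c, via_apply, mul_assoc, ← map_mul, ← map_mul, mul_inv_cancel, map_one, map_one, mul_one]
  cb_sq i := d.cb_sq _
  cb_anti i j h := d.cb_anti _ _ (shf_ne hn' h)
  cb_conj w i := by
    show d.σb (via _ w) * _ * d.σb (via _ w⁻¹) = _
    rw [d.σb_cb, via_apply, mul_assoc, ← map_mul, ← map_mul, mul_inv_cancel, map_one, map_one, mul_one]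
  comm_σσb w v := d.σσb _ _
  comm_σcb w j := d.σcb _ _
  comm_σbc w j := d.σbc _ _
  anti_ccb i j := d.ccb _ _
  e_c1 h1 h2 := d.ε_c _ _
  c1_e h1 h2 := d.c_ε _ _
  e_sq := d.ε_sq _ _
  e_s_e h := by
    show _ * d.σ (via _ _) * _ = _
    rw [via_sw hn h0 h]
    exact d.εσε _ _ _ (shf_ne hn (by simp))
  e_sb_e h := by
    show _ * d.σb (via _ _) * _ = _
    rw [via_sw hn' h0' h]
    exact d.swap.εσε _ _ _ (shf_ne hn' (by simp))
  s_e_comm i hi h := by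
    show d.σ (via _ _) * _ = _ * d.σ (via _ _)
    rw [via_sw hn (by omega) h, d.σ_ε, Equiv.swap_apply_of_ne_of_ne (shf_ne hn fun h => by have := congrArg Fin.val h; simp at this; omega)
      (shf_ne hn fun h => by have := congrArg Fin.val h; simp at this)]
  sb_e_comm i hi h := by
    show d.σb (via _ _) * _ = _ * d.σb (via _ _)
    rw [via_sw hn' (by omega) h, d.σb_ε, Equiv.swap_apply_of_ne_of_ne (shf_ne hn' fun h => by have := congrArg Fin.val h; simp at this; omega)
      (shf_ne hn' fun h => by have := congrArg Fin.val h; simp at this)]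
  braid1 h h' := by
    show _ * d.σ (via _ _) * d.σb (via _ _) * _ * d.σ (via _ _) = _ * d.σ (via _ _) * d.σb (via _ _) * _ * d.σb (via _ _)
    rw [via_sw hn h0 h, via_sw hn' h0' h']
    exact d.braid1' _ _ _ _ (shf_ne hn (by simp)) (shf_ne hn' (by simp))
  braid2 h h' := by
    show d.σ (via _ _) * _ * d.σ (via _ _) * d.σb (via _ _) * _ = d.σb (via _ _) * _ * d.σ (via _ _) * d.σb (via _ _) * _
    rw [via_sw hn h0 h, via_sw hn' h0' h']
    exact d.braid2' _ _ _ _ (shf_ne hn (by simp)) (shf_ne hn' (by simp))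
  c_e_comm i h := d.ε_c' _ _ _ (shf_ne hn fun h' => h (congrArg Fin.val h'))
  cb_e_comm i h := d.ε_cb' _ _ _ (shf_ne hn' fun h' => h (congrArg Fin.val h'))
  e_c_e h := d.εcε _ _
  e_cb_e h := by rw [← d.ε_c]; exact d.εcε _ _
  om_one := by
    rw [if_neg (by decide), ← sub_eq_zero]
    refine hc _ (sub_mem (hΞ 1).1 (Subalgebra.algebraMap_mem _ _)) (shf hn ⟨0, h0⟩) (shf hn' ⟨0, h0'⟩) rfl rfl ?_
    rw [sub_mul, ← (hΞ 1).2, pow_one, d.ε_zz_ε _ _ _ _ (not_lo (shf_ge _ _)) (not_lo (shf_ge _ _)), sub_self]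
    rw [lo_card (by omega), lo_card (by omega)]
  om_even b := if_pos (even_two_mul b)
  omb_zero := if_pos (by decide)
  om_comm b := by
    by_cases hb : Even b
    · simp [if_pos hb]
    have hγ : γ (Ξ b) = Ξ b := gam_fix G hc _ _ rfl rfl (hΞ b).1 (hΞ b).2 (by rw [map_pow, gam_zz G])
    obtain ⟨h1, h2, h3, h4, h5, h6, h7⟩ := cent G (hΞ b).1 hγ hn hn' (shf hn ⟨0, h0⟩) (shf hn' ⟨0, h0'⟩) (shf_ge _ _) (shf_ge _ _)
    rw [if_neg hb]
    refine ⟨h1, h2, h3, h4, h5, h6, h7, fun l => ?_, fun l => ?_⟩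
    · by_cases hl : Even l
      · simp [if_pos hl]
      rw [if_neg hl]
      exact low_comm hc _ _ rfl rfl (hΞ b).1 (hΞ l).1 (hΞ b).2 (hΞ l).2 ((d.low_zz (hΞ l).1 _ (shf_ge _ _)).pow_left _)
        ((d.low_zz (hΞ b).1 _ (shf_ge _ _)).pow_left _)
    · by_cases hl : Even l
      · simp [if_pos hl]
      rw [if_neg hl]
      exact low_comm hc _ _ rfl rfl (hΞ b).1 (hΞb l).1 (hΞ b).2 (hΞb l).2 ((d.low_zz (hΞb l).1 _ (shf_ge _ _)).pow_left _)
        ((d.low_zzb (hΞ b).1 _ (shf_ge _ _)).pow_left _)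
  omb_comm b := by
    by_cases hb : Even b
    · simp [if_pos hb]
    have hγ : γ (Ξb b) = Ξb b := gam_fix G hc _ _ rfl rfl (hΞb b).1 (hΞb b).2 (by rw [map_pow, gam_zzb G])
    obtain ⟨h1, h2, h3, h4, h5, h6, h7⟩ := cent G (hΞb b).1 hγ hn hn' (shf hn ⟨0, h0⟩) (shf hn' ⟨0, h0'⟩) (shf_ge _ _) (shf_ge _ _)
    rw [if_neg hb]
    refine ⟨h1, h2, h3, h4, h5, h6, h7, fun l => ?_⟩
    by_cases hl : Even l
    · simp [if_pos hl]
    rw [if_neg hl]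
    exact low_comm hc _ _ rfl rfl (hΞb b).1 (hΞb l).1 (hΞb b).2 (hΞb l).2 ((d.low_zzb (hΞb l).1 _ (shf_ge _ _)).pow_left _)
        ((d.low_zzb (hΞb b).1 _ (shf_ge _ _)).pow_left _)
  x_comm h := by
    show _ * (d.σ (via _ _) * _ * d.σ (via _ _) - _ * d.σ (via _ _)) = (d.σ (via _ _) * _ * d.σ (via _ _) - _ * d.σ (via _ _)) * _
    rw [via_sw hn h0 h, d.σzσ _ _ _ _ (not_lo (shf_ge _ _)) (not_lo (shf_ge _ _))]
    have := d.zz_zz (lo r k) (lo t k) (shf hn ⟨0, h0⟩) (shf hn ⟨1, h⟩) (by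
      rw [Finset.mem_insert, not_or]
      exact ⟨shf_ne hn (by simp), not_lo (shf_ge _ _)⟩)
    rw [d.zz_insert _ _ _ _ (not_lo (shf_ge _ _))] at this
    exact this
  x1_c1 h := by rw [d.zz_ci _ _ _ (not_lo (shf_ge _ _)), neg_neg]
  x1_c i h := (d.zz_c _ _ _ _ (not_lo (shf_ge _ _)) (shf_ne hn fun h' => h (congrArg Fin.val h'))).symm
  s_x1 i hi h := by
    show d.σ (via _ _) * _ = _ * d.σ (via _ _)
    have := d.σ_zz (via (shf hn) (sw n i (i+1))) (lo r k) (lo t k) (shf hn ⟨0, h0⟩) (lo_map' _ (via_lo hn _))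
    rw [this, via_sw hn (by omega) h, Equiv.swap_apply_of_ne_of_ne (shf_ne hn fun h => by have := congrArg Fin.val h; simp at this; omega)
      (shf_ne hn fun h => by have := congrArg Fin.val h; simp at this)]
  xb_comm h := by
    show _ * (d.σb (via _ _) * _ * d.σb (via _ _) - _ * d.σb (via _ _)) = (d.σb (via _ _) * _ * d.σb (via _ _) - _ * d.σb (via _ _)) * _
    have h1 := d.swap.σzσ (lo t k) (lo r k) (shf hn' ⟨0, h0'⟩) (shf hn' ⟨1, h⟩) (not_lo (shf_ge _ _)) (not_lo (shf_ge _ _))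
    change d.σb _ * _ * d.σb _ = _ at h1
    rw [via_sw hn' h0' h, h1]
    have := d.swap.zz_zz (lo t k) (lo r k) (shf hn' ⟨0, h0'⟩) (shf hn' ⟨1, h⟩) (by
      rw [Finset.mem_insert, not_or]
      exact ⟨shf_ne hn' (by simp), not_lo (shf_ge _ _)⟩)
    rw [d.swap.zz_insert _ _ _ _ (not_lo (shf_ge _ _)), d.swap_P] at this
    exact this
  xb1_cb1 h := d.zzb_ci _ _ _ (not_lo (shf_ge _ _))
  xb1_cb i h := (d.zzb_cb _ _ _ _ (not_lo (shf_ge _ _)) (shf_ne hn' fun h' => h (congrArg Fin.val h'))).symm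
  sb_xb1 i hi h := by
    show d.σb (via _ _) * _ = _ * d.σb (via _ _)
    have := d.swap.σ_zz (via (shf hn') (sw n' i (i+1))) (lo t k) (lo r k) (shf hn' ⟨0, h0'⟩) (lo_map' _ (via_lo hn' _))
    change d.σb _ * _ = _ * d.σb _ at this
    rw [this, via_sw hn' (by omega) h, Equiv.swap_apply_of_ne_of_ne (shf_ne hn' fun h => by have := congrArg Fin.val h; simp at this; omega)
      (shf_ne hn' fun h => by have := congrArg Fin.val h; simp at this)]
  e_xsum := d.ε_zsum _ _ _ _ (not_lo (shf_ge _ _)) (not_lo (shf_ge _ _))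
  xsum_e := d.zsum_ε _ _ _ _ (not_lo (shf_ge _ _)) (not_lo (shf_ge _ _))
  e_sxs h := by
    show _ * (d.σ (via _ _) * _ * d.σ (via _ _)) = (d.σ (via _ _) * _ * d.σ (via _ _)) * _
    rw [via_sw hn h0 h, d.σzσ _ _ _ _ (not_lo (shf_ge _ _)) (not_lo (shf_ge _ _))]
    exact d.zz_ε_out _ _ _ _ _ (shf_ne hn (by simp)) (not_lo (shf_ge _ _)) (not_lo (shf_ge _ _))
  x_mixed h := by
    have := (d.zz_mixed (lo r k) (lo t k) (shf hn ⟨0, h0⟩) (shf hn' ⟨0, h0'⟩) (not_lo (shf_ge _ _))).eq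
    rw [d.swap.zz_insert' _ _ _ _ (not_lo (shf_ge _ _)), d.swap_Q'] at this
    linear_combination (norm := noncomm_ring) this
  e_sbxbsb h := by
    show _ * (d.σb (via _ _) * _ * d.σb (via _ _)) = (d.σb (via _ _) * _ * d.σb (via _ _)) * _
    have h1 := d.swap.σzσ (lo t k) (lo r k) (shf hn' ⟨0, h0'⟩) (shf hn' ⟨1, h⟩) (not_lo (shf_ge _ _)) (not_lo (shf_ge _ _))
    change d.σb _ * _ * d.σb _ = _ at h1
    rw [via_sw hn' h0' h, h1]
    exact d.swap.zz_ε_out _ _ _ _ _ (shf_ne hn' (by simp)) (not_lo (shf_ge _ _)) (not_lo (shf_ge _ _))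
  e_xodd b := by rw [if_neg (by simp), (hΞ _).2]
  e_xeven b _ := d.ε_even _ _ _ _ (not_lo (shf_ge _ _)) b
  e_xb b _ := by
    by_cases hb : Even b
    · obtain ⟨q, rfl⟩ := hb
      rw [if_pos ⟨q, rfl⟩, zero_mul, ← two_mul]
      exact d.swap.ε_even _ _ _ _ (not_lo (shf_ge _ _)) q
    · rw [if_neg hb, (hΞb _).2]
  x1_cb_comm j := (d.zz_cb _ _ _ _).symm
  xb1_c_comm j := (d.swap_c _ _ _ _).symm
  x1_σb w := (d.σb_zz _ _ _ _ (lo_map' _ (via_lo hn' _)))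
  xb1_σ w := (d.swap.σb_zz _ _ _ _ (lo_map' _ (via_lo hn _)))
end Idx
end

section
lemma sum_lo {M : Type} [AddCommMonoid M] {n k : ℕ} (h : k ≤ n) (f : ℕ → M) :
    ∑ j ∈ Finset.Ico 1 (k+1), f j = ∑ j ∈ Idx.lo n k, f ((j : ℕ) + 1) := by
  symm
  refine Finset.sum_bij (fun (j : Fin n) _ => (j : ℕ) + 1) (fun j hj => ?_) (fun i _ j _ hij => ?_) (fun b hb => ?_) (fun _ _ => rfl)
  · rw [Idx.mem_lo] at hj; simp; omega
  · exact Fin.ext (by simpa using hij)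
  · rw [Finset.mem_Ico] at hb
    exact ⟨⟨b - 1, by omega⟩, Idx.mem_lo.2 (by simp; omega), by simp; omega⟩

namespace AWBC
variable {B : Type} [Ring B] [Algebra ℂ B] {R T : ℕ} {ω a κ : ℂ} (d : AWBC ℂ B (R+1) (T+1) ω)

lemma tr_eq (i j : Fin (R+1)) : d.toWBC.tr (i+1) (j+1) = d.σ (Equiv.swap i j) := by
  show d.σ (sw (R+1) _ _) = _
  rw [sw_eq (by omega) (by omega)]; rfl
lemma trb_eq (i j : Fin (T+1)) : d.toWBC.trb (i+1) (j+1) = d.σb (Equiv.swap i j) := by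
  show d.σb (sw (T+1) _ _) = _
  rw [sw_eq (by omega) (by omega)]; rfl
lemma cn_eq (i : Fin (R+1)) : d.toWBC.cn (i+1) = d.c i := dif_pos i.2
lemma cbn_eq (i : Fin (T+1)) : d.toWBC.cbn (i+1) = d.cb i := dif_pos i.2
lemma E_eq (i : Fin (R+1)) (j : Fin (T+1)) : d.toWBC.E (i+1) (j+1) = d.EE i j := by
  have h1 := d.tr_eq 0 i
  have h2 := d.trb_eq 0 j
  have h3 : d.toWBC.tr 1 (i+1) = d.σ (Equiv.swap 0 i) := h1
  have h4 : d.toWBC.trb 1 (j+1) = d.σb (Equiv.swap 0 j) := h2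
  unfold WBC.E AWBC.EE
  rw [h3, h4]; noncomm_ring
lemma xp_eq (i : ℕ) (h : i < R+1) : d.xp (i+1) = d.X ⟨i, h⟩ := by
  induction i with
  | zero => rw [show (⟨0, h⟩ : Fin (R+1)) = 0 from rfl, X_zero]; simp [xp]
  | succ i ih =>
    have hi : i < R+1 := by omega
    have e : d.xp (i+1+1) = d.toWBC.s (i+1) * d.xp (i+1) * d.toWBC.s (i+1) := by
      unfold xp
      simp only [Nat.add_sub_cancel, List.range_succ, List.reverse_append, List.map_append, List.prod_append]
      simp [mul_assoc]
    have hs : d.toWBC.s (i+1) = d.σ (Equiv.swap ⟨i, hi⟩ ⟨i+1, h⟩) := by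
      show d.σ (sw (R+1) i (i+1)) = _
      rw [sw_eq hi h]
    rw [e, ih hi, hs, d.σ_X, Equiv.swap_apply_left, mul_assoc, ss, mul_one]
lemma xbp_eq (i : ℕ) (h : i < T+1) : d.xbp (i+1) = d.Xb ⟨i, h⟩ := by
  induction i with
  | zero => rw [show (⟨0, h⟩ : Fin (T+1)) = 0 from rfl, Xb_zero]; simp [xbp]
  | succ i ih =>
    have hi : i < T+1 := by omega
    have e : d.xbp (i+1+1) = d.toWBC.sb (i+1) * d.xbp (i+1) * d.toWBC.sb (i+1) := by
      unfold xbp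
      simp only [Nat.add_sub_cancel, List.range_succ, List.reverse_append, List.map_append, List.prod_append]
      simp [mul_assoc]
    have hs : d.toWBC.sb (i+1) = d.σb (Equiv.swap ⟨i, hi⟩ ⟨i+1, h⟩) := by
      show d.σb (sw (T+1) i (i+1)) = _
      rw [sw_eq hi h]
    rw [e, ih hi, hs, d.σb_Xb, Equiv.swap_apply_left, mul_assoc, ssb, mul_one]
variable (hx : d.x1 * d.x1 = algebraMap ℂ B a) (hxb : d.xb1 * d.xb1 = algebraMap ℂ B κ)
lemma z_eq (k : ℕ) (hR : k < R+1) (hT : k < T+1) :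
    d.z (k+1) = (d.idx hx hxb).zz (Idx.lo _ k) (Idx.lo _ k) ⟨k, hR⟩ := by
  have hc : d.toWBC.cn (k+1) = d.c ⟨k, hR⟩ := d.cn_eq ⟨k, hR⟩
  have h1 : ∑ j ∈ Finset.Ico 1 (k+1), (d.toWBC.E (k+1) j + d.toWBC.Eb (k+1) j) = ∑ j ∈ Idx.lo (T+1) k, (d.idx hx hxb).Q ⟨k, hR⟩ j := by
    rw [sum_lo hT.le]
    refine Finset.sum_congr rfl fun j _ => ?_
    have : d.toWBC.E (k+1) (j+1) = d.EE ⟨k, hR⟩ j := d.E_eq ⟨k, hR⟩ j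
    unfold WBC.Eb
    rw [this, hc]; rfl
  have h2 : d.toWBC.L (k+1) = ∑ l ∈ Idx.lo (R+1) k, (d.idx hx hxb).P ⟨k, hR⟩ l := by
    unfold WBC.L WBC.LL
    rw [sum_lo hR.le, hc, Finset.mul_sum, Finset.sum_mul, ← Finset.sum_add_distrib]
    refine Finset.sum_congr rfl fun l hl => ?_
    have h3 : d.toWBC.tr (l+1) (k+1) = d.σ (Equiv.swap l ⟨k, hR⟩) := d.tr_eq l ⟨k, hR⟩
    have hne : l ≠ ⟨k, hR⟩ := Idx.ne_of_lt_ge (k := k) (Idx.mem_lo.1 hl) le_rfl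
    rw [h3, mul_assoc, d.σ_c, Equiv.swap_apply_right, ← mul_assoc, d.c_anti _ _ hne.symm]
    show _ = (1 - d.c l * d.c ⟨k, hR⟩) * d.σ (Equiv.swap l ⟨k, hR⟩)
    noncomm_ring
  unfold z WBC.y Idx.zz
  rw [h1, h2, d.xp_eq k hR, add_sub_assoc]; rfl
lemma zb_eq (k : ℕ) (hR : k < R+1) (hT : k < T+1) :
    d.zb (k+1) = (d.idx hx hxb).swap.zz (Idx.lo _ k) (Idx.lo _ k) ⟨k, hT⟩ := by
  have hc : d.toWBC.cbn (k+1) = d.cb ⟨k, hT⟩ := d.cbn_eq ⟨k, hT⟩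
  have h1 : ∑ j ∈ Finset.Ico 1 (k+1), (d.toWBC.E j (k+1) - d.toWBC.Eb j (k+1)) = ∑ j ∈ Idx.lo (R+1) k, (d.idx hx hxb).swap.Q ⟨k, hT⟩ j := by
    rw [sum_lo hR.le]
    refine Finset.sum_congr rfl fun j _ => ?_
    have : d.toWBC.E (j+1) (k+1) = d.EE j ⟨k, hT⟩ := d.E_eq j ⟨k, hT⟩
    unfold WBC.Eb
    rw [this, cn_eq, Idx.swap_Q']; rfl
  have h2 : d.toWBC.Lb (k+1) = ∑ l ∈ Idx.lo (T+1) k, (d.idx hx hxb).swap.P ⟨k, hT⟩ l := by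
    unfold WBC.Lb WBC.LLb
    rw [sum_lo hT.le, hc, Finset.mul_sum, Finset.sum_mul, ← Finset.sum_sub_distrib]
    refine Finset.sum_congr rfl fun l hl => ?_
    have h3 : d.toWBC.trb (l+1) (k+1) = d.σb (Equiv.swap l ⟨k, hT⟩) := d.trb_eq l ⟨k, hT⟩
    have hne : l ≠ ⟨k, hT⟩ := Idx.ne_of_lt_ge (k := k) (Idx.mem_lo.1 hl) le_rfl
    rw [h3, mul_assoc, d.σb_cb, Equiv.swap_apply_right, ← mul_assoc, d.cb_anti _ _ hne.symm, Idx.swap_P]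
    show _ = (1 + d.cb l * d.cb ⟨k, hT⟩) * d.σb (Equiv.swap l ⟨k, hT⟩)
    noncomm_ring
  unfold zb WBC.yb Idx.zz
  rw [h1, h2, d.xbp_eq k hT, add_sub_assoc]; rfl
lemma lower_sub (k : ℕ) (hR : k < R+1) (hT : k < T+1) : d.lowerGensA k ⊆ (d.idx hx hxb).low k := by
  intro x hx'
  rcases hx' with (⟨h1, rfl⟩ | ⟨j, h1, h2, rfl⟩ | ⟨j, h1, h2, rfl⟩ | ⟨h1, rfl⟩ | ⟨h1, rfl⟩) | ⟨h1, rfl | rfl⟩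
  · refine Or.inr (Or.inr (Or.inr (Or.inr ⟨0, 0, h1, h1, ?_⟩)))
    exact d.EE_zero.symm
  · refine Or.inl ⟨Equiv.swap ⟨j-1, by omega⟩ ⟨j, by omega⟩, fun i hi => ?_, ?_⟩
    · exact Equiv.swap_apply_of_ne_of_ne (fun h => by have := congrArg Fin.val h; simp at this; omega) (fun h => by have := congrArg Fin.val h; simp at this; omega)
    · show d.σ (sw (R+1) (j-1) j) = d.σ _
      rw [sw_eq]
  · refine Or.inr (Or.inl ⟨Equiv.swap ⟨j-1, by omega⟩ ⟨j, by omega⟩, fun i hi => ?_, ?_⟩)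
    · exact Equiv.swap_apply_of_ne_of_ne (fun h => by have := congrArg Fin.val h; simp at this; omega) (fun h => by have := congrArg Fin.val h; simp at this; omega)
    · show d.σb (sw (T+1) (j-1) j) = d.σb _
      rw [sw_eq]
  · exact Or.inr (Or.inr (Or.inl ⟨0, h1, Or.inl (d.cn_eq 0)⟩))
  · exact Or.inr (Or.inr (Or.inr (Or.inl ⟨0, h1, Or.inl (d.cbn_eq 0)⟩)))
  · exact Or.inr (Or.inr (Or.inl ⟨0, h1, Or.inr d.X_zero.symm⟩))
  · exact Or.inr (Or.inr (Or.inr (Or.inl ⟨0, h1, Or.inr d.Xb_zero.symm⟩)))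
end AWBC

/-- the main theorem, with the shapes of the indices made explicit -/
theorem shift_main (A B : Type) [Ring A] [Algebra ℂ A] [Ring B] [Algebra ℂ B]
    (r t k m R T : ℕ) (hr : 1 ≤ r) (ht : 1 ≤ t) (hk : 1 ≤ k) (hR : R + 1 = r + k) (hT : T + 1 = t + k) (p : ℂ)
    (d : AWBC ℂ A r t (omSeq m p 1)) (hu : d.IsUniversal)
    (d' : AWBC ℂ B (R + 1) (T + 1) (omSeq m p 1))
    (hu' : d'.IsCycUniversal (omSeq m p)
      (Polynomial.X ^ 2 - Polynomial.C (p * (p + 1)))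
      (Polynomial.X ^ 2 - Polynomial.C ((p - 2 * (m : ℂ) + 1) * (p - 2 * (m : ℂ)))))
    (Ξ Ξb : ℕ → B)
    (hΞ : ∀ a : ℕ, Ξ a ∈ Algebra.adjoin ℂ (d'.lowerGensA k) ∧
      d'.toWBC.E (k + 1) (k + 1) * d'.z (k + 1) ^ a * d'.toWBC.E (k + 1) (k + 1)
        = Ξ a * d'.toWBC.E (k + 1) (k + 1))
    (hΞb : ∀ a : ℕ, Ξb a ∈ Algebra.adjoin ℂ (d'.lowerGensA k) ∧
      d'.toWBC.E (k + 1) (k + 1) * d'.zb (k + 1) ^ a * d'.toWBC.E (k + 1) (k + 1)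
        = Ξb a * d'.toWBC.E (k + 1) (k + 1)) :
    ∃ φ : A →ₐ[ℂ] B,
      (∀ n : ℕ, 1 ≤ n → φ (d.om (2 * n + 1)) = Ξ (2 * n + 1)) ∧
      (∀ n : ℕ, 1 ≤ n → φ (d.omb (2 * n + 1)) = Ξb (2 * n + 1)) ∧
      (∀ n : ℕ, 1 ≤ n → φ (d.omb (2 * n)) = 0) ∧
      φ d.e = d'.toWBC.E (k + 1) (k + 1) ∧
      (∀ i : ℕ, 1 ≤ i → i + 1 ≤ r → φ (d.toWBC.s i) = d'.toWBC.s (k + i)) ∧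
      (∀ j : ℕ, 1 ≤ j → j + 1 ≤ t → φ (d.toWBC.sb j) = d'.toWBC.sb (k + j)) ∧
      (∀ l : ℕ, 1 ≤ l → l ≤ r → φ (d.toWBC.cn l) = d'.toWBC.cn (k + l)) ∧
      (∀ l : ℕ, 1 ≤ l → l ≤ t → φ (d.toWBC.cbn l) = d'.toWBC.cbn (k + l)) ∧
      φ d.x1 = d'.z (k + 1) ∧
      φ d.xb1 = d'.zb (k + 1) := by
  have hx : d'.x1 * d'.x1 = algebraMap ℂ B (p*(p+1)) := (aeval_quad _ _).1 hu'.2.1.1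
  have hxb : d'.xb1 * d'.xb1 = algebraMap ℂ B (p*(p+1) + omSeq m p 1) := by
    rw [← kappa_eq]; exact (aeval_quad _ _).1 hu'.2.1.2
  have hkR : k < R + 1 := by omega
  have hkT : k < T + 1 := by omega
  obtain ⟨γ, G⟩ := exists_gam d' hx hxb hu'
  have hE : d'.toWBC.E (k+1) (k+1) = d'.EE ⟨k, hkR⟩ ⟨k, hkT⟩ := d'.E_eq ⟨k, hkR⟩ ⟨k, hkT⟩
  have hz := d'.z_eq hx hxb k hkR hkT
  have hzb := d'.zb_eq hx hxb k hkR hkT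
  have hsub := Algebra.adjoin_mono (R := ℂ) (d'.lower_sub hx hxb k hkR hkT)
  rw [hE, hz] at hΞ
  rw [hE, hzb] at hΞb
  rw [hE, hz, hzb]
  obtain ⟨φ, h, -⟩ := hu B (Idx.shiftA (k := k) G (fun b hb i j hi hj h => main_cancel d' hx hxb hu' k hk hkR hkT b hb (by
    obtain rfl : i = ⟨k, hkR⟩ := Fin.ext hi
    obtain rfl : j = ⟨k, hkT⟩ := Fin.ext hj
    exact h)) hR hT hr ht Ξ Ξb (fun b => ⟨hsub (hΞ b).1, (hΞ b).2⟩) (fun b => ⟨hsub (hΞb b).1, (hΞb b).2⟩))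
  refine ⟨φ, fun n _ => ?_, fun n _ => ?_, fun n _ => ?_, h.map_e, fun i h1 h2 => ?_, fun i h1 h2 => ?_, fun i h1 h2 => ?_, fun i h1 h2 => ?_, h.map_x1, h.map_xb1⟩
  · exact (h.map_om _).trans (if_neg (by simp))
  · exact (h.map_omb _).trans (if_neg (by simp))
  · exact (h.map_omb _).trans (if_pos (by simp))
  · refine (h.map_σ _).trans ?_
    show d'.σ (via (shf hR) (sw r (i-1) i)) = d'.σ (sw (R+1) (k+i-1) (k+i))
    rw [via_sw hR (by omega) (by omega), sw_eq (by omega) (by omega)]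
    congr 2
    exact Fin.ext (by simp only [shf_val]; omega)
  · refine (h.map_σb _).trans ?_
    show d'.σb (via (shf hT) (sw t (i-1) i)) = d'.σb (sw (T+1) (k+i-1) (k+i))
    rw [via_sw hT (by omega) (by omega), sw_eq (by omega) (by omega)]
    congr 2
    exact Fin.ext (by simp only [shf_val]; omega)
  · unfold WBC.cn
    rw [dif_pos (by omega), dif_pos (by omega), h.map_c]
    show d'.c _ = d'.c _
    congr 1
    exact Fin.ext (by simp only [shf_val]; omega)
  · unfold WBC.cbn
    rw [dif_pos (by omega), dif_pos (by omega), h.map_cb]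
    show d'.cb _ = d'.cb _
    congr 1
    exact Fin.ext (by simp only [shf_val]; omega)

/-- the main theorem -/
theorem shift_main' (A B : Type) [Ring A] [Algebra ℂ A] [Ring B] [Algebra ℂ B]
    (r t k m N N' : ℕ) (hr : 1 ≤ r) (ht : 1 ≤ t) (hk : 1 ≤ k) (hR : N = r + k) (hT : N' = t + k) (p : ℂ)
    (d : AWBC ℂ A r t (omSeq m p 1)) (hu : d.IsUniversal)
    (d' : AWBC ℂ B N N' (omSeq m p 1))
    (hu' : d'.IsCycUniversal (omSeq m p)
      (Polynomial.X ^ 2 - Polynomial.C (p * (p + 1)))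
      (Polynomial.X ^ 2 - Polynomial.C ((p - 2 * (m : ℂ) + 1) * (p - 2 * (m : ℂ)))))
    (Ξ Ξb : ℕ → B)
    (hΞ : ∀ a : ℕ, Ξ a ∈ Algebra.adjoin ℂ (d'.lowerGensA k) ∧
      d'.toWBC.E (k + 1) (k + 1) * d'.z (k + 1) ^ a * d'.toWBC.E (k + 1) (k + 1)
        = Ξ a * d'.toWBC.E (k + 1) (k + 1))
    (hΞb : ∀ a : ℕ, Ξb a ∈ Algebra.adjoin ℂ (d'.lowerGensA k) ∧
      d'.toWBC.E (k + 1) (k + 1) * d'.zb (k + 1) ^ a * d'.toWBC.E (k + 1) (k + 1)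
        = Ξb a * d'.toWBC.E (k + 1) (k + 1)) :
    ∃ φ : A →ₐ[ℂ] B,
      (∀ n : ℕ, 1 ≤ n → φ (d.om (2 * n + 1)) = Ξ (2 * n + 1)) ∧
      (∀ n : ℕ, 1 ≤ n → φ (d.omb (2 * n + 1)) = Ξb (2 * n + 1)) ∧
      (∀ n : ℕ, 1 ≤ n → φ (d.omb (2 * n)) = 0) ∧
      φ d.e = d'.toWBC.E (k + 1) (k + 1) ∧
      (∀ i : ℕ, 1 ≤ i → i + 1 ≤ r → φ (d.toWBC.s i) = d'.toWBC.s (k + i)) ∧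
      (∀ j : ℕ, 1 ≤ j → j + 1 ≤ t → φ (d.toWBC.sb j) = d'.toWBC.sb (k + j)) ∧
      (∀ l : ℕ, 1 ≤ l → l ≤ r → φ (d.toWBC.cn l) = d'.toWBC.cn (k + l)) ∧
      (∀ l : ℕ, 1 ≤ l → l ≤ t → φ (d.toWBC.cbn l) = d'.toWBC.cbn (k + l)) ∧
      φ d.x1 = d'.z (k + 1) ∧
      φ d.xb1 = d'.zb (k + 1) := by
  obtain ⟨R, rfl⟩ : ∃ R, N = R + 1 := ⟨N - 1, by omega⟩
  obtain ⟨T, rfl⟩ : ∃ T, N' = T + 1 := ⟨N' - 1, by omega⟩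
  exact shift_main A B r t k m R T hr ht hk hR hT p d hu d' hu' Ξ Ξb hΞ hΞb
end

/-- Theorem 5.13: for any `k ≥ 1` there is a superalgebra homomorphism
`φ_k : BC^aff_{r,t} → BC_{2,r+k,t+k}` sending `ω_{2n+1} ↦ ξ_{2n+1,k+1}`,
`ω̄_{2n+1} ↦ ξ̄_{2n+1,k+1}`, `ω̄_{2n} ↦ 0`, `e_1 ↦ e_{k+1}`, `s_i ↦ s_{k+i}`,
`s̄_j ↦ s̄_{k+j}`, `c_l ↦ c_{k+l}`, `c̄_m ↦ c̄_{k+m}`, `x_1 ↦ z_{k+1}`, `x̄_1 ↦ z̄_{k+1}`. -/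
theorem statement14 (A B : Type) [Ring A] [Algebra ℂ A] [Ring B] [Algebra ℂ B]
    (r t k m : ℕ) (hr : 1 ≤ r) (ht : 1 ≤ t) (hk : 1 ≤ k) (hm : 2 * (r + t + 2 * k) ≤ m)
    (p : ℂ)
    (hp : (∀ z : ℤ, p ≠ (z : ℂ)) ∨ (∃ z : ℤ, p = (z : ℂ) ∧ ((2 * (m : ℤ) < z) ∨ z < 0)))
    (d : AWBC ℂ A r t (omSeq m p 1)) (hu : d.IsUniversal)
    (d' : AWBC ℂ B (r + k) (t + k) (omSeq m p 1))
    (hu' : d'.IsCycUniversal (omSeq m p)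
      (Polynomial.X ^ 2 - Polynomial.C (p * (p + 1)))
      (Polynomial.X ^ 2 - Polynomial.C ((p - 2 * (m : ℂ) + 1) * (p - 2 * (m : ℂ)))))
    (Ξ Ξb : ℕ → B)
    (hΞ : ∀ a : ℕ, Ξ a ∈ Algebra.adjoin ℂ (d'.lowerGensA k) ∧
      d'.toWBC.E (k + 1) (k + 1) * d'.z (k + 1) ^ a * d'.toWBC.E (k + 1) (k + 1)
        = Ξ a * d'.toWBC.E (k + 1) (k + 1))
    (hΞb : ∀ a : ℕ, Ξb a ∈ Algebra.adjoin ℂ (d'.lowerGensA k) ∧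
      d'.toWBC.E (k + 1) (k + 1) * d'.zb (k + 1) ^ a * d'.toWBC.E (k + 1) (k + 1)
        = Ξb a * d'.toWBC.E (k + 1) (k + 1)) :
    ∃ φ : A →ₐ[ℂ] B,
      (∀ n : ℕ, 1 ≤ n → φ (d.om (2 * n + 1)) = Ξ (2 * n + 1)) ∧
      (∀ n : ℕ, 1 ≤ n → φ (d.omb (2 * n + 1)) = Ξb (2 * n + 1)) ∧
      (∀ n : ℕ, 1 ≤ n → φ (d.omb (2 * n)) = 0) ∧
      φ d.e = d'.toWBC.E (k + 1) (k + 1) ∧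
      (∀ i : ℕ, 1 ≤ i → i + 1 ≤ r → φ (d.toWBC.s i) = d'.toWBC.s (k + i)) ∧
      (∀ j : ℕ, 1 ≤ j → j + 1 ≤ t → φ (d.toWBC.sb j) = d'.toWBC.sb (k + j)) ∧
      (∀ l : ℕ, 1 ≤ l → l ≤ r → φ (d.toWBC.cn l) = d'.toWBC.cn (k + l)) ∧
      (∀ l : ℕ, 1 ≤ l → l ≤ t → φ (d.toWBC.cbn l) = d'.toWBC.cbn (k + l)) ∧
      φ d.x1 = d'.z (k + 1) ∧
      φ d.xb1 = d'.zb (k + 1) := by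
  exact shift_main' A B r t k m (r + k) (t + k) hr ht hk rfl rfl p d hu d' hu' Ξ Ξb hΞ hΞb
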